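/- Let n ≥ 2. The homotopy groups of SU(n), based at the identity matrix, satisfy: π_k(SU(n)) is trivial for k = 0, 1, 2; π_{2i−1}(SU(n)) is isomorphic to ℤ for every i with 2 ≤ i ≤ n; π_{2i}(SU(n)) is trivial for every i with 2 ≤ i ≤ n−1; and π_{2n}(SU(n)) is isomorphic to ℤ/n!ℤ. -/

import Mathlib

/-- The special unitary group `SU(n)`: the subgroup of the unitary group
`U(n) = Matrix.unitaryGroup (Fin n) ℂ` consisting of matrices of determinant `1`. -/
def SU (n : ℕ) : Subgroup (Matrix.unitaryGroup (Fin n) ℂ) where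
  carrier := {A | (A : Matrix (Fin n) (Fin n) ℂ).det = 1}
  mul_mem' := by
    intro a b ha hb
    simp only [Set.mem_setOf_eq] at *
    simp [Matrix.UnitaryGroup.mul_val, Matrix.det_mul, ha, hb]
  one_mem' := by simp
  inv_mem' := by
    intro a ha
    simp only [Set.mem_setOf_eq] at *
    show ((a⁻¹ : Matrix.unitaryGroup (Fin n) ℂ) : Matrix (Fin n) (Fin n) ℂ).det = 1
    rw [Matrix.UnitaryGroup.inv_val, Matrix.star_eq_conjTranspose, Matrix.det_conjTranspose, ha]
    simp

set_option linter.all false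

open scoped unitInterval Topology.Homotopy Matrix

namespace BottSU

open Function (update Embedding Injective)
open Cube (boundary)
open Fintype (card)
open Real (pi sin cos)
open Finset (univ range)
open Matrix (fromBlocks fromBlocks_multiply diagonal GeneralLinearGroup of_apply mulVec_mulVec det_diagonal diagonal_apply)
open Units (val_mul val_one continuous_val)
open Set (projIcc)
open Complex (normSq)
open ContinuousLinearMap (proj)

local notation "Mat(" ι ")" => Matrix ι ι ℂ

/-! ## Homotopies with pointwise constraints -/

/-- Homotopy between raw functions, through maps satisfying a pointwise constraint. -/
def Hty {Z M : Type*} [TopologicalSpace Z] [TopologicalSpace M] (S : Z → Set M)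
    (f g : Z → M) : Prop :=
  ∃ H : I × Z → M, Continuous H ∧ (∀ z, H (0, z) = f z) ∧ (∀ z, H (1, z) = g z) ∧
    ∀ t z, H (t, z) ∈ S z

section Hty

variable {Z Z' M M' : Type*} [TopologicalSpace Z] [TopologicalSpace M] [TopologicalSpace Z']
  [TopologicalSpace M'] {S : Z → Set M} {f g h : Z → M}

theorem Hty.refl (hf : Continuous f) (hS : ∀ z, f z ∈ S z) : Hty S f f :=
  ⟨fun p => f p.2, by fun_prop, fun _ => rfl, fun _ => rfl, fun _ z => hS z⟩

theorem Hty.symm (H : Hty S f g) : Hty S g f := by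
  obtain ⟨H, hc, h0, h1, hS⟩ := H
  exact ⟨fun p => H (σ p.1, p.2), by fun_prop, by simpa using h1, by simpa using h0,
    fun t z => hS _ z⟩

theorem Hty.cont_left (H : Hty S f g) : Continuous f := by
  obtain ⟨H, hc, h0, h1, hS⟩ := H
  have : f = fun z => H (0, z) := funext fun z => (h0 z).symm
  rw [this]; fun_prop

theorem Hty.cont_right (H : Hty S f g) : Continuous g := H.symm.cont_left

theorem Hty.mem_left (H : Hty S f g) (z : Z) : f z ∈ S z := by
  obtain ⟨H, hc, h0, h1, hS⟩ := H
  rw [← h0]; exact hS 0 z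

theorem Hty.mem_right (H : Hty S f g) (z : Z) : g z ∈ S z := H.symm.mem_left z

theorem Hty.trans (H : Hty S f g) (K : Hty S g h) : Hty S f h := by
  have hf := H.cont_left
  have hg := H.cont_right
  have hh := K.cont_right
  obtain ⟨H, hc, h0, h1, hS⟩ := H
  obtain ⟨K, kc, k0, k1, kS⟩ := K
  let P : C(Z, M) → Prop := fun φ => ∀ z, φ z ∈ S z
  have A : ContinuousMap.HomotopicWith (⟨f, hf⟩ : C(Z, M)) ⟨g, hg⟩ P :=
    ⟨⟨⟨⟨H, hc⟩, h0, h1⟩, fun t z => hS t z⟩⟩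
  have B : ContinuousMap.HomotopicWith (⟨g, hg⟩ : C(Z, M)) ⟨h, hh⟩ P :=
    ⟨⟨⟨⟨K, kc⟩, k0, k1⟩, fun t z => kS t z⟩⟩
  obtain ⟨L⟩ := A.trans B
  exact ⟨fun p => L p, by fun_prop, fun z => L.apply_zero z, fun z => L.apply_one z,
    fun t z => L.prop t z⟩

theorem Hty.mono {S' : Z → Set M} (H : Hty S f g) (hs : ∀ z, S z ⊆ S' z) : Hty S' f g := by
  obtain ⟨H, hc, h0, h1, hS⟩ := H
  exact ⟨H, hc, h0, h1, fun t z => hs z (hS t z)⟩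

/-- Precomposition. -/
theorem Hty.comp {S' : Z' → Set M} (H : Hty S f g) (φ : Z' → Z) (hφ : Continuous φ)
    (hs : ∀ z, S (φ z) ⊆ S' z) : Hty S' (fun z => f (φ z)) (fun z => g (φ z)) := by
  obtain ⟨H, hc, h0, h1, hS⟩ := H
  exact ⟨fun p => H (p.1, φ p.2), by fun_prop, fun z => h0 _, fun z => h1 _,
    fun t z => hs z (hS t _)⟩

/-- Postcomposition with a parametrised map. -/
theorem Hty.post {S' : Z → Set M'} (H : Hty S f g) (Φ : Z → M → M')
    (hΦ : Continuous fun p : Z × M => Φ p.1 p.2)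
    (hs : ∀ z, ∀ m ∈ S z, Φ z m ∈ S' z) : Hty S' (fun z => Φ z (f z)) (fun z => Φ z (g z)) := by
  obtain ⟨H, hc, h0, h1, hS⟩ := H
  refine ⟨fun p => Φ p.2 (H p), ?_, fun z => by simp [h0], fun z => by simp [h1],
    fun t z => hs z _ (hS t z)⟩
  exact hΦ.comp (continuous_snd.prodMk hc)

/-- Postcomposition on an arbitrary pair. -/
theorem Hty.map₂ {M'' : Type*} [TopologicalSpace M''] {T : Z → Set M'} {R : Z → Set M''}
    {f' g' : Z → M'} (H : Hty S f g) (K : Hty T f' g') (Φ : Z → M → M' → M'')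
    (hΦ : Continuous fun p : Z × M × M' => Φ p.1 p.2.1 p.2.2)
    (hs : ∀ z, ∀ m ∈ S z, ∀ m' ∈ T z, Φ z m m' ∈ R z) :
    Hty R (fun z => Φ z (f z) (f' z)) (fun z => Φ z (g z) (g' z)) := by
  obtain ⟨H, hc, h0, h1, hS⟩ := H
  obtain ⟨K, kc, k0, k1, kS⟩ := K
  refine ⟨fun p => Φ p.2 (H p) (K p), ?_, fun z => by simp [h0, k0], fun z => by simp [h1, k1],
    fun t z => hs z _ (hS t z) _ (kS t z)⟩
  exact hΦ.comp (continuous_snd.prodMk (hc.prodMk kc))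

theorem Hty.mul {G : Type*} [TopologicalSpace G] [Group G] [IsTopologicalGroup G]
    {S : Z → Subgroup G} {f g f' g' : Z → G} (H : Hty (fun z => (S z : Set G)) f g)
    (K : Hty (fun z => (S z : Set G)) f' g') : Hty (fun z => (S z : Set G)) (f * f') (g * g') :=
  H.map₂ K (fun _ a b => a * b) (by fun_prop) (fun z _ ha _ hb => (S z).mul_mem ha hb)

theorem Hty.inv {G : Type*} [TopologicalSpace G] [Group G] [IsTopologicalGroup G]
    {S : Z → Subgroup G} {f g : Z → G} (H : Hty (fun z => (S z : Set G)) f g) :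
    Hty (fun z => (S z : Set G)) f⁻¹ g⁻¹ :=
  H.post (fun _ a => a⁻¹) (by fun_prop) (fun z _ ha => (S z).inv_mem ha)

theorem Hty.zpow {G : Type*} [TopologicalSpace G] [Group G] [IsTopologicalGroup G]
    {S : Z → Subgroup G} {f g : Z → G} (H : Hty (fun z => (S z : Set G)) f g) (m : ℤ) :
    Hty (fun z => (S z : Set G)) (f ^ m) (g ^ m) :=
  H.post (fun _ a => a ^ m) (by fun_prop) (fun z _ ha => (S z).zpow_mem ha m)

end Hty

/-- Linear interpolation in the unit interval. -/
def lerp (s a b : I) : I :=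
  ⟨(1 - s) * a + s * b, by
    have := s.2; have := a.2; have := b.2
    simp only [Set.mem_Icc] at *
    constructor
    · have : (0:ℝ) ≤ (1 - s) * a := mul_nonneg (by linarith) (by linarith)
      have : (0:ℝ) ≤ s * b := mul_nonneg (by linarith) (by linarith)
      linarith
    · nlinarith⟩

theorem lerp_continuous {Z : Type*} [TopologicalSpace Z] {s a b : Z → I} (hs : Continuous s)
    (ha : Continuous a) (hb : Continuous b) : Continuous fun z => lerp (s z) (a z) (b z) := by
  unfold lerp
  fun_prop

@[simp] theorem lerp_zero (a b : I) : lerp 0 a b = a := by ext; simp [lerp]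
@[simp] theorem lerp_one (a b : I) : lerp 1 a b = b := by ext; simp [lerp]
@[simp] theorem lerp_self (s a : I) : lerp s a a = a := by
  ext; simp only [lerp]; ring
theorem coe_lerp (s a b : I) : ((lerp s a b : I) : ℝ) = (1 - s) * a + s * b := rfl

section cube

variable {N : Type*}

/-- The constraint for loops based at `x`. -/
def LS (N : Type*) {M : Type*} (x : M) : (N → I) → Set M :=
  fun y => {m | y ∈ boundary N → m = x}

/-- Constraint subgroup for loops in groups. -/
def LG (N : Type*) (G : Type*) [Group G] : (N → I) → Subgroup G := fun y =>
  { carrier := {m | y ∈ boundary N → m = 1}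
    mul_mem' := by intro a b ha hb hy; rw [ha hy, hb hy, one_mul]
    one_mem' := fun _ => rfl
    inv_mem' := by intro a ha hy; rw [ha hy, inv_one] }

theorem LG_eq (N : Type*) (G : Type*) [Group G] :
    (fun y => (LG N G y : Set G)) = LS N (1 : G) := rfl

variable [DecidableEq N]

theorem reparam {M : Type*} [TopologicalSpace M] {S : (N → I) → Set M} {f : (N → I) → M}
    (hf : Continuous f) (i : N)
    (hS : ∀ y, f y ∈ S y) (hS' : ∀ y c, y i ≠ 0 → y i ≠ 1 → f (update y i c) ∈ S y)
    (r : I → I) (hr : Continuous r) (r0 : r 0 = 0) (r1 : r 1 = 1) :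
    Hty S f (fun y => f (update y i (r (y i)))) := by
  refine ⟨fun p => f (update p.2 i (lerp p.1 (p.2 i) (r (p.2 i)))), ?_, ?_, ?_, ?_⟩
  · apply hf.comp
    apply Continuous.update continuous_snd
    apply lerp_continuous <;> fun_prop
  · simp
  · simp
  · intro t y
    by_cases h0 : y i = 0
    · have : update y i (lerp t (y i) (r (y i))) = y := by rw [h0, r0, lerp_self, ← h0, Function.update_eq_self]
      simp only [this]; exact hS y
    by_cases h1 : y i = 1
    · have : update y i (lerp t (y i) (r (y i))) = y := by rw [h1, r1, lerp_self, ← h1, Function.update_eq_self]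
      simp only [this]; exact hS y
    exact hS' y _ h0 h1

/-- First half reparametrisation. -/
noncomputable def ra (t : I) : I := projIcc 0 1 zero_le_one (2 * (t : ℝ))
/-- Second half reparametrisation. -/
noncomputable def rb (t : I) : I := projIcc 0 1 zero_le_one (2 * (t : ℝ) - 1)

theorem ra_cont : Continuous ra := continuous_projIcc.comp (by fun_prop)
theorem rb_cont : Continuous rb := continuous_projIcc.comp (by fun_prop)
@[simp] theorem ra_zero : ra 0 = 0 := by simp [ra]
theorem ra_one' (t : I) (h : 1 / 2 ≤ (t : ℝ)) : ra t = 1 :=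
  Set.projIcc_of_right_le _ (by linarith)
@[simp] theorem ra_one : ra 1 = 1 := ra_one' _ (by norm_num)
theorem rb_zero' (t : I) (h : (t : ℝ) ≤ 1 / 2) : rb t = 0 :=
  Set.projIcc_of_le_left _ (by linarith)
@[simp] theorem rb_zero : rb 0 = 0 := rb_zero' _ (by norm_num)
@[simp] theorem rb_one : rb 1 = 1 := Set.projIcc_of_right_le _ (by norm_num)
/-- Concatenation of raw functions. -/
noncomputable def conc {M : Type*} (i : N) (f g : (N → I) → M) : (N → I) → M := fun y =>
  if (y i : ℝ) ≤ 1 / 2 then f (update y i (ra (y i)))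
    else g (update y i (rb (y i)))

theorem conc_cont {M : Type*} [TopologicalSpace M] {i : N} {f g : (N → I) → M}
    (hf : Continuous f) (hg : Continuous g)
    (h : ∀ y, f (update y i 1) = g (update y i 0)) : Continuous (conc i f g) := by
  apply Continuous.if_le
  · exact hf.comp (Continuous.update continuous_id _ (ra_cont.comp (continuous_apply i)))
  · exact hg.comp (Continuous.update continuous_id _ (rb_cont.comp (continuous_apply i)))
  · fun_prop
  · fun_prop
  · intro y hy
    rw [ra_one' _ hy.ge, rb_zero' _ hy.le, h]

theorem conc_eq_mul {G : Type*} [Group G] {i : N} {f g : (N → I) → G}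
    (hf : ∀ y, y i = 1 → f y = 1) (hg : ∀ y, y i = 0 → g y = 1) (y : N → I) :
    conc i f g y = f (update y i (ra (y i))) * g (update y i (rb (y i))) := by
  unfold conc
  split_ifs with h
  · rw [hg (update y i (rb (y i))) (by simp [rb_zero' _ h]), mul_one]
  · rw [hf (update y i (ra (y i))) (by simp [ra_one' _ (not_le.1 h).le]), one_mul]

theorem conc_eq_mul' {G : Type*} [Group G] {i : N} {f g : (N → I) → G}
    (hf : ∀ y, y i = 1 → f y = 1) (hg : ∀ y, y i = 0 → g y = 1) (y : N → I) :
    conc i f g y = g (update y i (rb (y i))) * f (update y i (ra (y i))) := by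
  unfold conc
  split_ifs with h
  · rw [hg (update y i (rb (y i))) (by simp [rb_zero' _ h]), one_mul]
  · rw [hf (update y i (ra (y i))) (by simp [ra_one' _ (not_le.1 h).le]), mul_one]

/-- Eckmann-Hilton with general constraints. -/
theorem eckmann_hilton {G : Type*} [TopologicalSpace G] [Group G] [IsTopologicalGroup G]
    {S : (N → I) → Subgroup G} {f g : (N → I) → G} (i : N)
    (hS : ∀ y, y i ≠ 0 → y i ≠ 1 → ∀ c, S (update y i c) ≤ S y)
    (hS0 : ∀ y, y i = 0 ∨ y i = 1 → S y = ⊥)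
    (hf : Continuous f) (hfS : ∀ y, f y ∈ S y) (hg : Continuous g) (hgS : ∀ y, g y ∈ S y) :
    Hty (fun y => (S y : Set G)) (f * g) (conc i f g) ∧
    Hty (fun y => (S y : Set G)) (f * g) (conc i g f) := by
  have key : ∀ f : (N → I) → G, Continuous f → (∀ y, f y ∈ S y) →
      (∀ y, y i = 0 → f y = 1) ∧ (∀ y, y i = 1 → f y = 1) ∧
      Hty (fun y => (S y : Set G)) f (fun y => f (update y i (ra (y i)))) ∧
      Hty (fun y => (S y : Set G)) f (fun y => f (update y i (rb (y i)))) := by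
    intro f hf hfS
    refine ⟨fun y hy => ?_, fun y hy => ?_, ?_, ?_⟩
    · have := hfS y; rwa [hS0 y (Or.inl hy), Subgroup.mem_bot] at this
    · have := hfS y; rwa [hS0 y (Or.inr hy), Subgroup.mem_bot] at this
    · exact reparam hf i hfS (fun y c h0 h1 => hS y h0 h1 c (hfS _)) _ ra_cont ra_zero ra_one
    · exact reparam hf i hfS (fun y c h0 h1 => hS y h0 h1 c (hfS _)) _ rb_cont rb_zero rb_one
  obtain ⟨f0, f1, fa, fb⟩ := key f hf hfS
  obtain ⟨g0, g1, ga, gb⟩ := key g hg hgS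
  constructor
  · have := fa.mul gb
    convert this using 1
    ext y; exact conc_eq_mul f1 g0 y
  · have := fb.mul ga
    convert this using 1
    ext y; exact conc_eq_mul' g1 f0 y

/-! ### Relation to Mathlib homotopy groups -/

/-- The class of a raw loop. -/
def hg {X : Type*} [TopologicalSpace X] {x : X} (f : (N → I) → X) (hc : Continuous f)
    (hb : ∀ y ∈ boundary N, f y = x) : HomotopyGroup N X x :=
  Quotient.mk (GenLoop.Homotopic.setoid N x) ⟨⟨f, hc⟩, hb⟩

variable {X : Type*} [TopologicalSpace X] {x : X}

theorem hg_congr {f g : (N → I) → X} (h : f = g) (hf : Continuous f)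
    (hfb : ∀ y ∈ boundary N, f y = x) (hg' : Continuous g)
    (hgb : ∀ y ∈ boundary N, g y = x) : hg f hf hfb = hg g hg' hgb := by
  subst h; rfl

theorem hg_one [Nonempty N] {f : (N → I) → X} (hf : Continuous f)
    (hfb : ∀ y ∈ boundary N, f y = x) (h : ∀ y, f y = x) : hg f hf hfb = 1 := by
  rw [HomotopyGroup.one_def]
  have : f = fun _ => x := funext h
  subst this; rfl

theorem genHomotopic_iff (p q : Ω^ N X x) : GenLoop.Homotopic p q ↔ Hty (LS N x) p q := by
  constructor
  · rintro ⟨H⟩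
    refine ⟨fun p => H p, by fun_prop, fun z => H.apply_zero z, fun z => H.apply_one z,
      fun t z hz => ?_⟩
    have := H.eq_fst t hz
    exact this.trans (p.2 z hz)
  · rintro ⟨H, hc, h0, h1, hS⟩
    refine ⟨⟨⟨⟨H, hc⟩, h0, h1⟩, fun t z hz => ?_⟩⟩
    exact (hS t z hz).trans (p.2 z hz).symm

theorem hg_eq_iff {f g : (N → I) → X} (hf : Continuous f) (hfb : ∀ y ∈ boundary N, f y = x)
    (hg' : Continuous g) (hgb : ∀ y ∈ boundary N, g y = x) :
    hg f hf hfb = hg g hg' hgb ↔ Hty (LS N x) f g := by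
  exact Quotient.eq.trans (genHomotopic_iff _ _)

theorem hg_surj (a : HomotopyGroup N X x) : ∃ f hf hb, a = hg (N := N) (x := x) f hf hb := by
  induction a using Quotient.inductionOn with
  | h p => exact ⟨p.1, p.1.2, p.2, rfl⟩

theorem hg_mul [Nonempty N] (i : N) {f g : (N → I) → X} (hf : Continuous f)
    (hfb : ∀ y ∈ boundary N, f y = x)
    (hg' : Continuous g) (hgb : ∀ y ∈ boundary N, g y = x)
    (hc : Continuous (conc i g f)) (hb : ∀ y ∈ boundary N, conc i g f y = x) :
    hg f hf hfb * hg g hg' hgb = hg (conc i g f) hc hb := by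
  have := HomotopyGroup.mul_spec (N := N) (X := X) (x := x) (i := i)
    (p := ⟨⟨f, hf⟩, hfb⟩) (q := ⟨⟨g, hg'⟩, hgb⟩)
  refine this.trans ?_
  rfl

theorem conc_boundary {i : N} {f g : (N → I) → X} (hfb : ∀ y ∈ boundary N, f y = x)
    (hgb : ∀ y ∈ boundary N, g y = x) : ∀ y ∈ boundary N, conc i f g y = x := by
  rintro y ⟨j, hj⟩
  unfold conc
  by_cases hji : j = i
  · subst hji
    rcases hj with hj | hj
    · rw [if_pos (by rw [hj]; norm_num)]
      exact hfb _ ⟨j, by simp [hj]⟩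
    · rw [if_neg (by rw [hj]; norm_num)]
      exact hgb _ ⟨j, by simp [hj]⟩
  · split_ifs
    · exact hfb _ ⟨j, by simpa [hji] using hj⟩
    · exact hgb _ ⟨j, by simpa [hji] using hj⟩

theorem conc_cont_loop {i : N} {f g : (N → I) → X} (hf : Continuous f) (hg : Continuous g)
    (hfb : ∀ y ∈ boundary N, f y = x)
    (hgb : ∀ y ∈ boundary N, g y = x) : Continuous (conc i f g) :=
  conc_cont hf hg fun y => by rw [hfb _ ⟨i, by simp⟩, hgb _ ⟨i, by simp⟩]

theorem hg_mul' [Nonempty N] (i : N) {f g : (N → I) → X} (hf : Continuous f)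
    (hfb : ∀ y ∈ boundary N, f y = x)
    (hg' : Continuous g) (hgb : ∀ y ∈ boundary N, g y = x) :
    hg f hf hfb * hg g hg' hgb =
      hg (conc i g f) (conc_cont_loop hg' hf hgb hfb) (conc_boundary hgb hfb) :=
  hg_mul i hf hfb hg' hgb _ _

theorem LG_update {G : Type*} [Group G] (i : N) (y : N → I) (h0 : y i ≠ 0) (h1 : y i ≠ 1) (c : I) :
    LG N G (update y i c) ≤ LG N G y := by
  intro a ha hy
  obtain ⟨j, hj⟩ := hy
  have hji : j ≠ i := by rintro rfl; tauto
  exact ha ⟨j, by simpa [hji] using hj⟩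

theorem LG_bot {G : Type*} [Group G] (y : N → I) (hy : y ∈ boundary N) : LG N G y = ⊥ := by
  ext a
  constructor
  · intro h; exact h hy
  · intro h hy; exact h

/-- In a topological group the product of classes is the class of the pointwise product. -/
theorem hg_mul_group [Nonempty N] {G : Type*} [TopologicalSpace G] [Group G]
    [IsTopologicalGroup G]
    {f g : (N → I) → G} (hf : Continuous f) (hfb : ∀ y ∈ boundary N, f y = 1)
    (hg' : Continuous g) (hgb : ∀ y ∈ boundary N, g y = 1) :
    hg f hf hfb * hg g hg' hgb =
      hg (x := 1) (f * g) (hf.mul hg') (fun y hy => by simp [hfb y hy, hgb y hy]) := by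
  obtain ⟨i⟩ := ‹Nonempty N›
  haveI : Nonempty N := ⟨i⟩
  rw [hg_mul' i, hg_eq_iff]
  exact (eckmann_hilton (S := LG N G) i (fun y h0 h1 c => LG_update i y h0 h1 c)
    (fun y hy => LG_bot y ⟨i, hy⟩) hf hfb hg' hgb).2.symm

/-- Criterion for a homotopy group of a topological group to be cyclic of order `d`. -/
theorem mulEquiv_zmod [Nonempty N] {G : Type*} [TopologicalSpace G] [Group G]
    [IsTopologicalGroup G] (d : ℕ) (g : (N → I) → G) (hg' : Continuous g)
    (hgb : ∀ y ∈ boundary N, g y = 1)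
    (h1 : ∀ f : (N → I) → G, Continuous f → (∀ y ∈ boundary N, f y = 1) →
      ∃ m : ℤ, Hty (LS N (1 : G)) f (g ^ m))
    (h2 : ∀ m : ℤ, Hty (LS N (1 : G)) (g ^ m) 1 ↔ (d : ℤ) ∣ m) :
    Nonempty (HomotopyGroup N G 1 ≃* Multiplicative (ZMod d)) := by
  have hpn : ∀ m : ℕ, (hg g hg' hgb : HomotopyGroup N G 1) ^ m =
      hg (x := 1) (g ^ m) (hg'.pow m) (fun y hy => by simp [hgb y hy]) := by
    intro m
    induction m with
    | zero =>
      rw [pow_zero, hg_one]; simp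
    | succ m ih =>
      rw [pow_succ, ih, hg_mul_group]
      exact hg_congr (pow_succ _ _).symm _ _ _ _
  have hpz : ∀ m : ℤ, (hg g hg' hgb : HomotopyGroup N G 1) ^ m =
      hg (x := 1) (g ^ m) (hg'.zpow m) (fun y hy => by simp [hgb y hy]) := by
    intro m
    rcases Int.eq_nat_or_neg m with ⟨k, rfl | rfl⟩
    · rw [zpow_natCast, hpn]
      exact hg_congr (zpow_natCast _ _).symm _ _ _ _
    · rw [zpow_neg, inv_eq_iff_mul_eq_one, zpow_natCast, hpn, hg_mul_group]
      have : g ^ k * g ^ (-(k : ℤ)) = 1 := by simp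
      exact hg_one _ _ (fun y => congrFun this y)
  have hcyc : ∀ a : HomotopyGroup N G 1, a ∈ Subgroup.zpowers (hg g hg' hgb) := by
    intro a
    obtain ⟨f, hf, hb, rfl⟩ := hg_surj a
    obtain ⟨m, hm⟩ := h1 f hf hb
    refine ⟨m, ?_⟩
    simp only [hpz]
    rw [hg_eq_iff]
    exact hm.symm
  have hord : orderOf (hg g hg' hgb : HomotopyGroup N G 1) = d := by
    apply Nat.dvd_antisymm
    · rw [orderOf_dvd_iff_pow_eq_one, hpn]
      have := (h2 d).2 dvd_rfl
      rw [zpow_natCast] at this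
      have h3 := (hg_eq_iff (x := (1 : G)) (hg'.pow d) (fun y hy => by simp [hgb y hy])
        continuous_one (fun y hy => rfl)).2 this
      rw [h3]; exact hg_one _ _ (fun y => rfl)
    · have h4 := pow_orderOf_eq_one (hg g hg' hgb : HomotopyGroup N G 1)
      rw [hpn, ← hg_one (x := (1 : G)) (f := fun _ => 1) continuous_const (fun y hy => rfl)
        (fun y => rfl)] at h4
      have h3 := (hg_eq_iff (x := (1 : G)) (hg'.pow _) (fun y hy => by simp [hgb y hy])
        continuous_one (fun y hy => rfl)).1 h4
      rw [← zpow_natCast] at h3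
      have := (h2 _).1 h3
      exact_mod_cast this
  have hC : IsCyclic (HomotopyGroup N G 1) := ⟨⟨_, hcyc⟩⟩
  have hcard : Nat.card (HomotopyGroup N G 1) = d := by
    rw [← hord, orderOf_eq_card_of_forall_mem_zpowers hcyc]
  have e := zmodCyclicMulEquiv hC
  rw [hcard] at e
  exact ⟨e.symm⟩

theorem subsingleton_hg {G : Type*} [TopologicalSpace G] {x : G}
    (h1 : ∀ f : (N → I) → G, Continuous f → (∀ y ∈ boundary N, f y = x) →
      Hty (LS N x) f (fun _ => x)) : Subsingleton (HomotopyGroup N G x) := by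
  constructor
  intro a b
  obtain ⟨f, hf, hb, rfl⟩ := hg_surj a
  obtain ⟨f', hf', hb', rfl⟩ := hg_surj b
  rw [hg_eq_iff]
  exact (h1 f hf hb).trans (h1 f' hf' hb').symm

end cube

/-! ## General linear groups -/

/-- Invertible complex matrices. -/
abbrev GLn (ι : Type*) [Fintype ι] [DecidableEq ι] := (Mat(ι))ˣ

section GLbasic

variable {ι κ μ : Type*} [Fintype ι] [DecidableEq ι] [Fintype κ] [DecidableEq κ]
  [Fintype μ] [DecidableEq μ] {Z : Type*} [TopologicalSpace Z]

theorem GLn_cont {F : Z → GLn ι} (h : Continuous fun z => (F z : Mat(ι))) :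
    Continuous F := by
  rw [Units.continuous_iff]
  refine ⟨h, ?_⟩
  have hd : ∀ z, (F z : Mat(ι)).det ≠ 0 := fun z =>
    ((Matrix.isUnit_iff_isUnit_det _).1 (F z).isUnit).ne_zero
  have : (fun z => ((F z)⁻¹ : GLn ι).val) =
      fun z => ((F z : Mat(ι)).det)⁻¹ • (F z : Mat(ι)).adjugate := by
    ext1 z
    rw [Matrix.coe_units_inv, Matrix.inv_def, Ring.inverse_eq_inv']
  rw [this]
  exact (h.matrix_det.inv₀ hd).smul h.matrix_adjugate

theorem GLn_det_ne (A : GLn ι) : (A : Mat(ι)).det ≠ 0 :=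
    ((Matrix.isUnit_iff_isUnit_det _).1 A.isUnit).ne_zero

/-- Lift of an invertible matrix. -/
noncomputable def toGL (A : Mat(ι)) : GLn ι :=
  open Classical in
  if h : A.det ≠ 0 then GeneralLinearGroup.mkOfDetNeZero A h else 1

theorem coe_toGL {A : Mat(ι)} (h : A.det ≠ 0) : (toGL A : Mat(ι)) = A := by
  rw [toGL, dif_pos h]; rfl

@[simp] theorem toGL_coe (A : GLn ι) : toGL (A : Mat(ι)) = A :=
  Units.ext (coe_toGL (GLn_det_ne A))

theorem toGL_cont {F : Z → Mat(ι)} (h : Continuous F) (hd : ∀ z, (F z).det ≠ 0) :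
    Continuous fun z => toGL (F z) := by
  apply GLn_cont
  simpa only [coe_toGL (hd _)] using h

/-- Indicator matrix of a map. -/
def ind (e : ι → κ) : Matrix κ ι ℂ := Matrix.of fun k i => if k = e i then 1 else 0

theorem ind_tr_mul {e : ι → κ} (he : Injective e) : (ind e)ᵀ * ind e = 1 := by
  ext i j
  simp [Matrix.mul_apply, ind, Matrix.one_apply, he.eq_iff, eq_comm]

theorem ind_comp (e : ι → κ) (e' : κ → μ) : ind e' * ind e = ind (e' ∘ e) := by
  ext i j
  simp [Matrix.mul_apply, ind]

/-- Extension of matrices along an injection. -/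
noncomputable def extM (e : ι ↪ κ) : Mat(ι) →* Mat(κ) where
  toFun A := 1 + ind e * (A - 1) * (ind e)ᵀ
  map_one' := by simp
  map_mul' A B := by
    have h : (ind e * (A - 1) * (ind e)ᵀ) * (ind e * (B - 1) * (ind e)ᵀ) =
        ind e * ((A - 1) * (B - 1)) * (ind e)ᵀ := by
      calc _ = ind e * (A - 1) * ((ind e)ᵀ * ind e) * (B - 1) * (ind e)ᵀ := by
            simp only [Matrix.mul_assoc]
        _ = _ := by rw [ind_tr_mul e.injective]; simp only [Matrix.mul_assoc, Matrix.mul_one]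
    rw [mul_add, add_mul, add_mul, h]
    simp only [mul_sub, sub_mul, Matrix.mul_sub, Matrix.sub_mul, mul_one, one_mul, Matrix.mul_one,
      Matrix.one_mul]
    abel

theorem extM_apply (e : ι ↪ κ) (A : Mat(ι)) :
    extM e A = 1 + ind e * (A - 1) * (ind e)ᵀ := rfl

theorem extM_cont (e : ι ↪ κ) : Continuous (extM e) := by
  simp only [extM, MonoidHom.coe_mk, OneHom.coe_mk]
  fun_prop

theorem extM_det (e : ι ↪ κ) (A : Mat(ι)) : (extM e A).det = A.det := by
  rw [extM_apply, Matrix.mul_assoc, Matrix.det_one_add_mul_comm, Matrix.mul_assoc,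
    ind_tr_mul e.injective]
  simp

theorem extM_trans (e : ι ↪ κ) (e' : κ ↪ μ) (A : Mat(ι)) :
    extM e' (extM e A) = extM (e.trans e') A := by
  simp only [extM_apply, add_sub_cancel_left, Embedding.coe_trans, ← ind_comp,
    Matrix.transpose_mul, Matrix.mul_assoc]

theorem extM_entry (e : ι ↪ κ) (A : Mat(ι)) (i j : ι) : extM e A (e i) (e j) = A i j := by
  have : (ind e * (A - 1) * (ind e)ᵀ : Mat(κ)) (e i) (e j) = (A - 1) i j := by
    simp [Matrix.mul_apply, ind]
  rw [extM_apply, Matrix.add_apply, this]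
  simp [Matrix.one_apply]

theorem extM_col (e : ι ↪ κ) (A : Mat(ι)) (i k : κ) (hk : ∀ j, k ≠ e j) :
    extM e A i k = (1 : Mat(κ)) i k := by
  have : (ind e * (A - 1) * (ind e)ᵀ : Mat(κ)) i k = 0 := by
    simp [Matrix.mul_apply, ind, hk]
  rw [extM_apply, Matrix.add_apply, this, add_zero]

theorem extM_row (e : ι ↪ κ) (A : Mat(ι)) (i k : κ) (hk : ∀ j, k ≠ e j) :
    extM e A k i = (1 : Mat(κ)) k i := by
  have : (ind e * (A - 1) * (ind e)ᵀ : Mat(κ)) k i = 0 := by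
    simp [Matrix.mul_apply, ind, hk]
  rw [extM_apply, Matrix.add_apply, this, add_zero]

/-- Extension of invertible matrices along an injection. -/
noncomputable def ext (e : ι ↪ κ) : GLn ι →* GLn κ := Units.map (extM e)

@[simp] theorem coe_ext (e : ι ↪ κ) (A : GLn ι) : (ext e A : Mat(κ)) = extM e A := rfl

@[fun_prop] theorem ext_cont (e : ι ↪ κ) : Continuous (ext e) :=
  GLn_cont ((extM_cont e).comp continuous_val)

theorem ext_trans (e : ι ↪ κ) (e' : κ ↪ μ) (A : GLn ι) :
    ext e' (ext e A) = ext (e.trans e') A := Units.ext (extM_trans e e' A)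

theorem ext_inj (e : ι ↪ κ) : Injective (ext e) := by
  intro A B h
  apply Units.ext
  ext i j
  rw [← extM_entry e A.val, ← coe_ext, h, coe_ext, extM_entry]

theorem ext_refl (A : GLn ι) : ext (Embedding.refl ι) A = A := by
  ext i j
  exact extM_entry (Embedding.refl ι) A i j

theorem extM_inl (A : Mat(ι)) :
    extM (Embedding.inl : ι ↪ ι ⊕ κ) A = fromBlocks A 0 0 1 := by
  ext i j
  rcases i with i | i <;> rcases j with j | j
  · exact extM_entry (Embedding.inl : ι ↪ ι ⊕ κ) A i j
  · rw [extM_col]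
    · simp
    · simp
  · rw [extM_row]
    · simp
    · simp
  · rw [extM_col]
    · simp [Matrix.one_apply]
    · simp

theorem extM_inr (A : Mat(κ)) :
    extM (Embedding.inr : κ ↪ ι ⊕ κ) A = fromBlocks 1 0 0 A := by
  ext i j
  rcases i with i | i <;> rcases j with j | j
  · rw [extM_col]
    · simp [Matrix.one_apply]
    · simp
  · rw [extM_row]
    · simp
    · simp
  · rw [extM_col]
    · simp
    · simp
  · exact extM_entry (Embedding.inr : κ ↪ ι ⊕ κ) A i j

theorem extM_some (A : Mat(ι)) (i j : ι) :
    extM (Embedding.some : ι ↪ Option ι) A (some i) (some j) = A i j :=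
  extM_entry _ A i j

/-! ### Path connectedness -/

theorem GLn_path (A : GLn ι) : ∃ γ : I → GLn ι, Continuous γ ∧ γ 0 = 1 ∧ γ 1 = A := by
  let M : Matrix ι ι (Polynomial ℂ) := Matrix.of fun i j =>
    Polynomial.C ((1 : Mat(ι)) i j) + Polynomial.X * Polynomial.C ((A.val - 1) i j)
  have hM : ∀ z : ℂ, (M.det).eval z = (1 + z • (A.val - 1)).det := by
    intro z
    rw [← Polynomial.coe_evalRingHom, RingHom.map_det]
    congr 1
    ext i j
    simp [M]
  have h0 : M.det ≠ 0 := by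
    intro h
    have := hM 0
    simp [h] at this
  have hc : (M.det.rootSet ℂ : Set ℂ).Countable := (Polynomial.rootSet_finite _ _).countable
  have hp : IsPathConnected ((M.det.rootSet ℂ : Set ℂ)ᶜ) := by
    apply hc.isPathConnected_compl_of_one_lt_rank
    rw [Complex.rank_real_complex]
    norm_num
  have hmem : ∀ z : ℂ, z ∈ (M.det.rootSet ℂ : Set ℂ)ᶜ ↔ (1 + z • (A.val - 1)).det ≠ 0 := by
    intro z
    rw [← hM, Set.mem_compl_iff, Polynomial.mem_rootSet]
    simp [h0]
  obtain ⟨γ, hγ⟩ := hp.joinedIn 0 (by rw [hmem]; simp) 1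
    (by rw [hmem]; simpa using GLn_det_ne A)
  refine ⟨fun t => toGL (1 + (γ t) • (A.val - 1)), ?_, ?_, ?_⟩
  · apply toGL_cont
    · have := γ.continuous
      fun_prop
    · intro t; rw [← hmem]; exact hγ t
  · simp only [γ.source, zero_smul, add_zero]
    exact toGL_coe 1
  · simp only [γ.target, one_smul, add_sub_cancel]
    exact toGL_coe A

/-- Conjugation by a constant element is homotopic to the identity. -/
theorem Hty_conj {G : Type*} [TopologicalSpace G] [Group G] [IsTopologicalGroup G]
    {S : Z → Subgroup G} {f : Z → G} (hf : Continuous f) (hS : ∀ z, f z ∈ S z)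
    (γ : I → G) (hγ : Continuous γ) (h0 : γ 0 = 1)
    (hn : ∀ t z, ∀ a ∈ S z, γ t * a * (γ t)⁻¹ ∈ S z) :
    Hty (fun z => (S z : Set G)) f (fun z => γ 1 * f z * (γ 1)⁻¹) := by
  refine ⟨fun p => γ p.1 * f p.2 * (γ p.1)⁻¹, by fun_prop, by simp [h0], by simp, ?_⟩
  intro t z
  exact hn t z _ (hS z)

theorem Hty_conj_GL {N : Type*} {f : (N → I) → GLn ι} (hf : Continuous f)
    (hS : ∀ y ∈ boundary N, f y = 1) (u : GLn ι) :
    Hty (LS N (1 : GLn ι)) f (fun z => u * f z * u⁻¹) := by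
  obtain ⟨γ, hγ, h0, h1⟩ := GLn_path u
  have := Hty_conj (S := LG N (GLn ι)) hf hS γ hγ h0 (by
    intro t z a ha hz
    rw [ha hz]; simp)
  rw [h1] at this
  exact this

/-- Permutation matrix. -/
noncomputable def permGL (e : κ ≃ κ) : GLn κ where
  val := ind e
  inv := (ind e)ᵀ
  val_inv := by
    ext i j
    simp only [Matrix.mul_apply, ind, of_apply, Matrix.transpose_apply, Matrix.one_apply]
    rw [Finset.sum_eq_single (e.symm i)]
    · by_cases h : i = j <;> simp [h, eq_comm]
    · intro k _ hk
      have : i ≠ e k := by rintro rfl; simp at hk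
      simp [this]
    · simp
  inv_val := ind_tr_mul e.injective

theorem ext_equiv_conj (e : ι ↪ κ) (s : κ ≃ κ) (A : GLn ι) :
    ext (e.trans s.toEmbedding) A = permGL s * ext e A * (permGL s)⁻¹ := by
  rw [← ext_trans]
  apply Units.ext
  have h : (ind s : Mat(κ)) * (ind s)ᵀ = 1 := (permGL s).val_inv
  change 1 + ind s * (extM e A.val - 1) * (ind s)ᵀ = ind s * extM e A.val * (ind s)ᵀ
  rw [mul_sub, sub_mul, mul_one, h]
  abel

theorem exists_perm (e e' : ι ↪ κ) : ∃ s : κ ≃ κ, e' = e.trans s.toEmbedding := by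
  classical
  let r : Set.range e ≃ Set.range e' :=
    (Equiv.ofInjective e e.injective).symm.trans (Equiv.ofInjective e' e'.injective)
  refine ⟨r.extendSubtype, ?_⟩
  ext i
  simp only [Embedding.trans_apply, Equiv.coe_toEmbedding]
  rw [Equiv.extendSubtype_apply_of_mem _ _ (Set.mem_range_self i)]
  have : (Equiv.ofInjective e e.injective).symm ⟨e i, Set.mem_range_self i⟩ = i :=
    Equiv.ofInjective_symm_apply e.injective i
  simp [r, this]

theorem ext_any {N : Type*} {f : (N → I) → GLn ι} (hf : Continuous f)
    (hS : ∀ y ∈ boundary N, f y = 1) (e e' : ι ↪ κ) :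
    Hty (LS N (1 : GLn κ)) (fun y => ext e (f y)) (fun y => ext e' (f y)) := by
  obtain ⟨s, rfl⟩ := exists_perm e e'
  simp only [ext_equiv_conj]
  apply Hty_conj_GL
  · fun_prop
  · intro y hy; rw [hS y hy, map_one]

/-- An invertible diagonal matrix with a single nontrivial entry. -/
noncomputable def dlM (i : ι) (v : ℂ) : Mat(ι) := 1 + (v - 1) • Matrix.single i i 1

theorem dlM_det (i : ι) (v : ℂ) : (dlM i v).det = v := by
  have : dlM i v = diagonal (update 1 i v) := by
    ext a b
    simp only [dlM, Matrix.add_apply, Matrix.one_apply, Matrix.smul_apply, Matrix.single_apply,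
      diagonal_apply, Function.update_apply]
    by_cases hab : a = b
    · subst hab; by_cases h : i = a
      · subst h; simp
      · simp [h, Ne.symm h]
    · have : ¬ (i = a ∧ i = b) := by rintro ⟨rfl, rfl⟩; exact hab rfl
      simp [hab, this]
  rw [this, det_diagonal, Finset.prod_update_of_mem (Finset.mem_univ i)]
  simp

/-- An invertible diagonal matrix with a single nontrivial entry. -/
noncomputable def dl (i : ι) : ℂˣ →* GLn ι where
  toFun v := toGL (dlM i v)
  map_one' := by simp only [dlM, val_one, sub_self, zero_smul, add_zero]; exact toGL_coe 1
  map_mul' v w := by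
    apply Units.ext
    rw [coe_toGL (by rw [dlM_det]; exact (v * w).ne_zero), val_mul (toGL _),
      coe_toGL (by rw [dlM_det]; exact v.ne_zero), coe_toGL (by rw [dlM_det]; exact w.ne_zero)]
    simp only [dlM, mul_add, add_mul, one_mul, mul_one, val_mul, smul_mul_smul_comm,
      Matrix.single_mul_single_same, add_assoc, ← add_smul]
    congr 2
    ring

theorem coe_dl (i : ι) (v : ℂˣ) :
    (dl i v : Mat(ι)) = 1 + ((v : ℂ) - 1) • Matrix.single i i 1 :=
  coe_toGL (by rw [dlM_det]; exact v.ne_zero)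

@[fun_prop] theorem dl_cont (i : ι) : Continuous (dl (ι := ι) i) := by
  apply GLn_cont
  simp only [coe_dl]
  have := continuous_val (M := ℂ)
  fun_prop

@[fun_prop] theorem detGL_cont : Continuous (GeneralLinearGroup.det : GLn ι →* ℂˣ) := by
  rw [Units.continuous_iff]
  have h : Continuous fun A : GLn ι => (A : Mat(ι)).det :=
    (continuous_val).matrix_det
  refine ⟨h, ?_⟩
  have : (Units.val ∘ fun A : GLn ι => (GeneralLinearGroup.det A)⁻¹) =
      fun A : GLn ι => ((A : Mat(ι)).det)⁻¹ := by
    ext A; simp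
  exact (h.inv₀ (fun A => GLn_det_ne A)).congr (fun A => by simp)

theorem ext_dl (e : ι ↪ κ) (i : ι) (v : ℂˣ) : ext e (dl i v) = dl (e i) v := by
  apply Units.ext
  rw [coe_ext, coe_dl, coe_dl, extM_apply, add_sub_cancel_left]
  congr 1
  rw [Matrix.mul_smul, Matrix.smul_mul]
  congr 1
  ext a b
  rw [Matrix.mul_apply]
  simp only [Matrix.mul_apply, ind, Matrix.single_apply, of_apply, Matrix.transpose_apply]
  rw [Finset.sum_eq_single i, Finset.sum_eq_single i]
  · by_cases h1 : a = e i <;> by_cases h2 : b = e i <;> simp [h1, h2, eq_comm]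
  · intro j _ hj; simp [hj.symm]
  · simp
  · intro j _ hj
    rw [Finset.sum_eq_zero, zero_mul]
    intro k _; simp [hj.symm]
  · simp

theorem det_ext (e : ι ↪ κ) (A : GLn ι) : GeneralLinearGroup.det (ext e A) =
    GeneralLinearGroup.det A := by
  apply Units.ext; exact extM_det e A

end GLbasic

/-! ### Higher homotopy of `ℂˣ` -/

/-- Straight line contraction in the cube. -/
theorem exists_log {N : Type*} [Fintype N] {d : (N → I) → ℂˣ} (hd : Continuous d) (h0 : d 0 = 1) :
    ∃ L : (N → I) → ℂ, Continuous L ∧ (∀ y, Complex.exp (L y) = d y) ∧ L 0 = 0 := by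
  have hd' : Continuous fun y => (d y : ℂ) := continuous_val.comp hd
  -- the homotopy `F (s, y) = d (s y)`
  let F : I × (N → I) → ℂ := fun p => d (fun i => p.1 * p.2 i)
  have hF : Continuous F := hd'.comp (by fun_prop)
  have hF0 : ∀ p, F p ≠ 0 := fun p => (d _).ne_zero
  let R : I × I × (N → I) → ℂ := fun p => F (p.1, p.2.2) / F (p.2.1, p.2.2)
  have hR : Continuous R := by
    apply Continuous.div
    · fun_prop
    · fun_prop
    · intro p; exact hF0 _
  have hU := CompactSpace.uniformContinuous_of_continuous hR
  rw [Metric.uniformContinuous_iff] at hU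
  obtain ⟨δ, hδ, hU⟩ := hU 1 one_pos
  obtain ⟨m, hm⟩ := exists_nat_one_div_lt hδ
  have hmpos : (0:ℝ) < m + 1 := by positivity
  let τ : ℕ → I := fun j => projIcc 0 1 zero_le_one (j / (m + 1 : ℝ))
  have hτ : ∀ j, dist (τ (j+1)) (τ j) < δ := by
    intro j
    have h1 : dist (τ (j+1)) (τ j) ≤ |((j+1 : ℕ) / (m + 1 : ℝ)) - (j / (m+1:ℝ))| := by
      rw [Subtype.dist_eq, Real.dist_eq, Set.coe_projIcc, Set.coe_projIcc]
      have h2 := abs_max_sub_max_le_abs (min 1 (((j+1 : ℕ) : ℝ)/ (m + 1 : ℝ))) (min 1 (j / (m + 1 : ℝ))) 0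
      have h3 := abs_min_sub_min_le_max 1 (((j+1 : ℕ) : ℝ)/ (m + 1 : ℝ)) 1 (j / (m + 1 : ℝ))
      simp only [sub_self, abs_zero] at h3
      rw [max_comm 0, max_comm 0]
      refine h2.trans (h3.trans ?_)
      simp
    refine h1.trans_lt ?_
    have : ((j+1 : ℕ) / (m + 1 : ℝ)) - (j / (m+1:ℝ)) = 1 / (m+1 : ℝ) := by
      push_cast; field_simp; ring
    rw [this, abs_of_pos (by positivity)]
    exact hm
  let L : (N → I) → ℂ := fun y => ∑ j ∈ range (m+1), Complex.log (R (τ (j+1), τ j, y))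
  have hclose : ∀ j y, R (τ (j+1), τ j, y) ∈ Complex.slitPlane := by
    intro j y
    have h1 : dist (R (τ (j+1), τ j, y)) (R (τ j, τ j, y)) < 1 := by
      apply hU
      rw [Prod.dist_eq, Prod.dist_eq]
      simp only [dist_self]
      simpa [hδ] using hτ j
    have h2 : R (τ j, τ j, y) = 1 := div_self (hF0 _)
    rw [h2] at h1
    apply Complex.ball_one_subset_slitPlane
    exact h1
  have hcomp : ∀ k y, Complex.exp (∑ j ∈ range k, Complex.log (R (τ (j+1), τ j, y))) =
      F (τ k, y) := by
    intro k y
    induction k with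
    | zero =>
      have : τ 0 = 0 := by simp [τ]
      simp only [Finset.range_zero, Finset.sum_empty, Complex.exp_zero, this, F, zero_mul]
      change (1:ℂ) = (d 0 : ℂ)
      rw [h0]; simp
    | succ k ih =>
      rw [Finset.sum_range_succ, Complex.exp_add, ih, Complex.exp_log
        (Complex.slitPlane_ne_zero (hclose k y))]
      exact mul_div_cancel₀ _ (hF0 _)
  refine ⟨L, ?_, ?_, ?_⟩
  · apply continuous_finsetSum
    intro j _
    apply Continuous.clog
    · fun_prop
    · exact hclose j
  · intro y
    rw [hcomp (m+1) y]
    have : τ (m+1) = 1 := by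
      simp only [τ]
      push_cast
      rw [div_self hmpos.ne']
      simp
    simp [F, this]
  · apply Finset.sum_eq_zero
    intro j _
    have : R (τ (j+1), τ j, 0) = 1 := by
      simp [R, F]
    rw [this, Complex.log_one]

theorem isPreconnected_boundary {N : Type*} [Fintype N] [DecidableEq N] [Nontrivial N] :
    IsPreconnected (boundary N) := by
  -- connect every boundary point to `0`
  apply isPreconnected_of_forall (0 : N → I)
  rintro y ⟨i, hi⟩
  obtain ⟨j, hj⟩ := exists_ne i
  -- move inside the face `y i = const` to the vertex edge, then along the edge
  let c : I → (N → I) := fun s => fun k => if k = i then y i else s * y k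
  let c' : I → (N → I) := fun s => fun k => if k = i then s * y i else 0
  have hc : Continuous c := by
    apply continuous_pi; intro k
    by_cases hk : k = i <;> simp only [c, hk, if_true, if_false] <;> fun_prop
  have hc' : Continuous c' := by
    apply continuous_pi; intro k
    by_cases hk : k = i <;> simp only [c', hk, if_true, if_false] <;> fun_prop
  refine ⟨Set.range c ∪ Set.range c', ?_, Or.inr ⟨0, ?_⟩, Or.inl ⟨1, ?_⟩, ?_⟩
  · rintro z (⟨s, rfl⟩ | ⟨s, rfl⟩)
    · exact ⟨i, by simpa [c] using hi⟩
    · exact ⟨j, by simp [c', hj]⟩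
  · ext k; simp [c']
  · ext k; by_cases hk : k = i
    · subst hk; simp [c]
    · simp [c, hk]
  · apply IsPreconnected.union (c 0)
    · exact ⟨0, rfl⟩
    · refine ⟨1, ?_⟩
      ext k; simp [c, c']
    · exact isPreconnected_range hc
    · exact isPreconnected_range hc'

theorem pi_units_C {N : Type*} [Fintype N] [DecidableEq N] [Nontrivial N] {d : (N → I) → ℂˣ}
    (hd : Continuous d) (hb : ∀ y ∈ boundary N, d y = 1) :
    Hty (LS N (1 : ℂˣ)) d 1 := by
  obtain ⟨i⟩ : Nonempty N := inferInstance
  have hz : (0 : N → I) ∈ boundary N := ⟨i, Or.inl rfl⟩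
  obtain ⟨L, hL, hexp, hL0⟩ := exists_log hd (hb 0 hz)
  have hLb : ∀ y ∈ boundary N, L y = 0 := by
    intro y hy
    -- the imaginary part over 2 pi is integral
    have hInt : ∀ y ∈ boundary N, ∃ n : ℤ, L y = n * (2 * pi * Complex.I) := by
      intro y hy
      have := hexp y
      rw [hb y hy, val_one, Complex.exp_eq_one_iff] at this
      exact this
    have hpre : IsPreconnected ((fun y => (L y).im / (2 * pi)) '' boundary N) := by
      apply isPreconnected_boundary.image
      have := Complex.continuous_im.comp hL
      apply Continuous.continuousOn
      fun_prop
    have hsub : ((fun y => (L y).im / (2 * pi)) '' boundary N) ⊆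
        Set.range ((↑) : ℤ → ℝ) := by
      rintro _ ⟨y, hy, rfl⟩
      obtain ⟨n, hn⟩ := hInt y hy
      refine ⟨n, ?_⟩
      have := Real.pi_pos.ne'
      simp [hn]
    have hlt : ∀ a ∈ ((fun y => (L y).im / (2 * pi)) '' boundary N),
        ∀ b ∈ ((fun y => (L y).im / (2 * pi)) '' boundary N), ¬ a < b := by
      intro a ha b hb' hab
      obtain ⟨k, hk⟩ := hsub ha
      obtain ⟨l, hl⟩ := hsub hb'
      have hkl : (k : ℝ) + 1 ≤ l := by
        have : k < l := by rw [← hk, ← hl] at hab; exact_mod_cast hab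
        exact_mod_cast this
      obtain ⟨q, hq⟩ := hsub (hpre.ordConnected.out ha hb'
        (show a + 1 / 2 ∈ Set.Icc a b from ⟨by linarith, by linarith⟩))
      have h1 : k < q := by have : (k : ℝ) < q := by linarith
                            exact_mod_cast this
      have h2 : q < k + 1 := by have : (q : ℝ) < k + 1 := by linarith
                                exact_mod_cast this
      omega
    have hsing : ∀ a ∈ ((fun y => (L y).im / (2 * pi)) '' boundary N),
        ∀ b ∈ ((fun y => (L y).im / (2 * pi)) '' boundary N), a = b := fun a ha b hb' =>
      le_antisymm (not_lt.1 (hlt b hb' a ha)) (not_lt.1 (hlt a ha b hb'))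
    have := hsing _ ⟨y, hy, rfl⟩ _ ⟨0, hz, rfl⟩
    obtain ⟨n, hn⟩ := hInt y hy
    simp only [hL0, hn] at this
    have hpi := Real.pi_pos.ne'
    simp [hpi] at this
    simp [hn, this]
  refine ⟨fun p => Units.mk0 (Complex.exp ((1 - (p.1 : ℝ) : ℝ) * L p.2)) (Complex.exp_ne_zero _),
    ?_, ?_, ?_, ?_⟩
  · rw [Units.continuous_iff]
    constructor
    · simp only [Function.comp_def, Units.val_mk0]
      fun_prop
    · simp only [Units.val_inv_eq_inv_val, Units.val_mk0]
      apply Continuous.inv₀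
      · fun_prop
      · intro p; exact Complex.exp_ne_zero _
  · intro y; apply Units.ext; simp [hexp]
  · intro y; apply Units.ext; simp
  · intro t y hy
    apply Units.ext
    simp [hLb y hy]

theorem polar_cstar {A : Type*} [CStarAlgebra A] : ∃ P : Aˣ → A, Continuous P ∧
    (∀ u : Aˣ, star ((u : A) * P u) * (u * P u) = 1) ∧
    (∀ u : Aˣ, star (u : A) * u = 1 → P u = 1) ∧
    ∀ (u : Aˣ) (s : ℝ), 0 ≤ s → s ≤ 1 → IsUnit ((1 - s) • (1 : A) + s • P u) := by
  let f : ℝ → ℝ := fun x => 1 / √x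
  have hsa : ∀ u : Aˣ, IsSelfAdjoint (star (u : A) * u) := fun u => IsSelfAdjoint.star_mul_self _
  have hpos : ∀ u : Aˣ, ∀ x ∈ spectrum ℝ (star (u : A) * u), 0 < x := by
    intro u x hx
    have h1 := spectrum_star_mul_self_nonneg x hx
    refine lt_of_le_of_ne h1 ?_
    rintro rfl
    have : IsUnit (star (u : A) * u) := u.isUnit.star.mul u.isUnit
    exact (spectrum.zero_notMem_iff ℝ).2 this hx
  have hfc : ContinuousOn f (Set.Ioi 0) := by
    apply ContinuousOn.div continuousOn_const (Real.continuous_sqrt.continuousOn)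
    intro x hx
    exact (Real.sqrt_pos.2 hx).ne'
  have hc : ∀ u : Aˣ, ContinuousOn f (spectrum ℝ (star (u : A) * u)) := fun u =>
    hfc.mono (fun x hx => hpos u x hx)
  refine ⟨fun u => cfc f (star (u : A) * u), ?_, ?_, ?_, ?_⟩
  · apply Continuous.cfc_of_mem_nhdsSet (s := Set.Ioi 0) f
    · rw [isOpen_Ioi.mem_nhdsSet]
      intro x hx
      obtain ⟨u, hu⟩ := Set.mem_iUnion.1 hx
      exact hpos u x hu
    · have := continuous_val (M := A)
      exact (this.star).mul this
  · intro u
    have hPs : star (cfc f (star (u : A) * u)) = cfc f (star (u : A) * u) :=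
      (cfc_predicate f (star (u : A) * u) : IsSelfAdjoint _)
    rw [star_mul, hPs]
    calc _ = cfc f (star (u : A) * u) * (star (u : A) * u) * cfc f (star (u : A) * u) := by
          noncomm_ring
      _ = cfc f (star (u : A) * u) * cfc (fun x : ℝ => x) (star (u : A) * u) *
          cfc f (star (u : A) * u) := by
          rw [cfc_id' ℝ (star (u : A) * u)]
      _ = 1 := by
          rw [← cfc_mul f _ _ (hc u) (by fun_prop),
            ← cfc_mul (fun x => f x * x) f _ ((hc u).mul (by fun_prop)) (hc u)]
          rw [← cfc_one ℝ (star (u : A) * u)]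
          apply cfc_congr
          intro x hx
          have := hpos u x hx
          have h2 := Real.mul_self_sqrt this.le
          have h3 := Real.sqrt_pos.2 this
          simp only [f, Pi.one_apply]
          field_simp
          nlinarith
  · intro u hu
    simp only [hu]
    rw [cfc_apply_one]; simp [f]
  · intro u s h0 h1
    have : (1 - s) • (1 : A) + s • cfc f (star (u : A) * u) =
        cfc (fun x => (1 - s) + s * f x) (star (u : A) * u) := by
      rw [cfc_const_add (1 - s) (fun x => s * f x) _ ((hc u).const_smul s), cfc_const_mul s f _ (hc u),
        Algebra.algebraMap_eq_smul_one]
    rw [this, isUnit_cfc_iff (fun x => (1 - s) + s * f x) _ (continuousOn_const.add ((hc u).const_smul s))]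
    intro x hx
    have h3 : 0 < f x := by
      have := Real.sqrt_pos.2 (hpos u x hx)
      simp only [f]; positivity
    have : 0 ≤ s * f x := by positivity
    rcases eq_or_lt_of_le h0 with h | h
    · subst h; norm_num
    · have : 0 < s * f x := by positivity
      have : 0 ≤ 1 - s := by linarith
      positivity

section
open scoped Matrix.Norms.L2Operator

theorem polar_matrix (ι : Type*) [Fintype ι] [DecidableEq ι] : ∃ P : GLn ι → Mat(ι),
    Continuous P ∧
    (∀ u : GLn ι, star ((u : Mat(ι)) * P u) * (u * P u) = 1) ∧
    (∀ u : GLn ι, star (u : Mat(ι)) * u = 1 → P u = 1) ∧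
    ∀ (u : GLn ι) (s : ℝ), 0 ≤ s → s ≤ 1 →
      IsUnit ((1 - s) • (1 : Mat(ι)) + s • P u) := polar_cstar

end

/-- The inclusion of `SU(n)` in `GL(n)`. -/
noncomputable def inclSU (n : ℕ) : SU n →* GLn (Fin n) :=
  Unitary.toUnits.comp (SU n).subtype

theorem coe_inclSU {n : ℕ} (A : SU n) :
    (inclSU n A : Mat(Fin n)) = (A : Matrix.unitaryGroup (Fin n) ℂ) := rfl

@[fun_prop] theorem inclSU_cont (n : ℕ) : Continuous (inclSU n) := by
  apply GLn_cont
  simp only [coe_inclSU]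
  fun_prop

theorem inclSU_det {n : ℕ} (A : SU n) : (inclSU n A : Mat(Fin n)).det = 1 := A.2

theorem dlM_unitary {ι : Type*} [Fintype ι] [DecidableEq ι] (i : ι) (c : ℂ) (hc : star c * c = 1) :
    star (dlM i c) * dlM i c = 1 := by
  have h : star (dlM i c) = dlM i (star c) := by
    simp [dlM, Matrix.star_eq_conjTranspose, Matrix.conjTranspose_single]
  rw [h, dlM, dlM]
  have : (Matrix.single i i (1 : ℂ)) * Matrix.single i i 1 = Matrix.single i i 1 := by simp
  simp only [add_mul, mul_add, one_mul, mul_one, Matrix.smul_mul, Matrix.mul_smul, this]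
  have e : (c - 1) * (star c - 1) = 2 - star c - c := by linear_combination hc
  rw [smul_smul, add_assoc, ← add_smul, ← add_smul, e]
  ring_nf; simp

theorem polar_SU (n : ℕ) [NeZero n] : ∃ ρ : GLn (Fin n) → SU n, Continuous ρ ∧
    (∀ A, ρ (inclSU n A) = A) ∧
    ∃ H : I × GLn (Fin n) → GLn (Fin n), Continuous H ∧ (∀ A, H (0, A) =
      A * dl 0 (GeneralLinearGroup.det A)⁻¹) ∧ (∀ A, H (1, A) = inclSU n (ρ A)) ∧
      ∀ s, H (s, 1) = 1 := by
  obtain ⟨P, hP, hU, h1, hunit⟩ := polar_matrix (Fin n)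
  have hdet : ∀ A : GLn (Fin n), star (A.val * P A).det * (A.val * P A).det = 1 := by
    intro A
    have := congrArg Matrix.det (hU A)
    rwa [Matrix.det_mul, Matrix.star_eq_conjTranspose, Matrix.det_conjTranspose,
      Matrix.det_one] at this
  let R : GLn (Fin n) → Mat(Fin n) := fun A =>
    (A.val * P A) * dlM 0 (star (A.val * P A).det)
  have hR1 : ∀ A, R A ∈ Matrix.unitaryGroup (Fin n) ℂ := by
    intro A
    rw [Matrix.mem_unitaryGroup_iff']
    simp only [R]
    rw [star_mul, mul_assoc, ← mul_assoc _ (A.val * P A), hU, one_mul]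
    apply dlM_unitary
    rw [star_star, mul_comm]; exact hdet A
  have hR2 : ∀ A, (R A).det = 1 := by
    intro A
    simp only [R]
    rw [Matrix.det_mul, dlM_det, mul_comm]
    exact hdet A
  have hRc : Continuous R := by
    have := continuous_val (M := Mat(Fin n))
    simp only [R, dlM]
    fun_prop
  have hRs : ∀ A : SU n, R (inclSU n A) = (A : Matrix.unitaryGroup (Fin n) ℂ) := by
    intro A
    have hu : star (inclSU n A).val * (inclSU n A).val = 1 := A.1.2.1
    simp only [R]
    rw [h1 _ hu, mul_one, inclSU_det]
    simp [dlM, coe_inclSU]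
  refine ⟨fun A => ⟨⟨R A, hR1 A⟩, hR2 A⟩, ?_, ?_, ?_⟩
  · apply Continuous.subtype_mk
    apply Continuous.subtype_mk
    exact hRc
  · intro A
    apply Subtype.ext; apply Subtype.ext
    exact hRs A
  · let Q : I × GLn (Fin n) → Mat(Fin n) := fun p =>
      p.2.val * ((1 - (p.1 : ℝ)) • (1 : Mat(Fin n)) + (p.1 : ℝ) • P p.2)
    have hQc : Continuous Q := by
      have := continuous_val (M := Mat(Fin n))
      simp only [Q]
      fun_prop
    have hQd : ∀ p, (Q p).det ≠ 0 := by
      intro p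
      apply IsUnit.ne_zero
      rw [← Matrix.isUnit_iff_isUnit_det]
      exact p.2.isUnit.mul (hunit _ _ p.1.2.1 p.1.2.2)
    refine ⟨fun p => toGL (Q p) * dl 0 (GeneralLinearGroup.det (toGL (Q p)))⁻¹, ?_, ?_, ?_, ?_⟩
    · have h1 := toGL_cont hQc hQd
      have h2 := detGL_cont (ι := Fin n)
      fun_prop
    · intro A
      simp [Q]
    · intro A
      have hq : Q (1, A) = A.val * P A := by simp [Q]
      have hd := hQd (1, A)
      rw [hq] at hd
      apply Units.ext
      rw [val_mul, coe_inclSU]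
      simp only [hq]
      rw [coe_toGL hd, coe_dl]
      simp only [R, dlM]
      have : ((GeneralLinearGroup.det (toGL (A.val * P A)))⁻¹ : ℂˣ).val =
          star (A.val * P A).det := by
        rw [Units.val_inv_eq_inv_val]
        have : (GeneralLinearGroup.det (toGL (A.val * P A))).val = (A.val * P A).det := by
          change (toGL (A.val * P A)).val.det = _
          rw [coe_toGL hd]
        rw [this, inv_eq_iff_eq_inv]
        exact eq_inv_of_mul_eq_one_right (hdet A)
      rw [this]
    · intro s
      have : Q (s, 1) = 1 := by
        simp only [Q]
        rw [h1 1 (by simp), val_one, one_mul, ← add_smul]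
        simp
      have h2 : toGL (1 : Mat(Fin n)) = 1 := toGL_coe 1
      simp only [this, h2]; simp

theorem SU_hty {N : Type*} {n : ℕ} [NeZero n] {f g : (N → I) → SU n}
    (h : Hty (LS N (1 : GLn (Fin n))) (fun y => inclSU n (f y)) (fun y => inclSU n (g y))) :
    Hty (LS N (1 : SU n)) f g := by
  obtain ⟨ρ, hc, hr, -⟩ := polar_SU n
  have := h.post (S' := LS N (1 : SU n)) (fun _ a => ρ a) (by fun_prop) (by
    intro z m hm hz
    rw [hm hz, ← map_one (inclSU n), hr])
  simpa only [hr] using this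

/-- A loop in `GL` whose determinant loop is null is homotopic to a loop in `SU`. -/
theorem SU_lift {N : Type*} {n : ℕ} [NeZero n] {f : (N → I) → GLn (Fin n)} (hf : Continuous f)
    (hb : ∀ y ∈ boundary N, f y = 1)
    (hd : Hty (LS N (1 : ℂˣ)) (fun y => GeneralLinearGroup.det (f y)) 1) :
    ∃ g : (N → I) → SU n, Continuous g ∧ (∀ y ∈ boundary N, g y = 1) ∧
      Hty (LS N (1 : GLn (Fin n))) f (fun y => inclSU n (g y)) := by
  obtain ⟨ρ, hc, hr, H, hHc, hH0, hH1, hHb⟩ := polar_SU n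
  refine ⟨fun y => ρ (f y), by fun_prop, ?_, ?_⟩
  · intro y hy
    simp only
    rw [hb y hy, ← map_one (inclSU n), hr]
  · have h1 : Hty (LS N (1 : GLn (Fin n)))
        (fun y => f y * dl 0 (GeneralLinearGroup.det (f y))⁻¹)
        (fun y => inclSU n (ρ (f y))) := by
      refine ⟨fun p => H (p.1, f p.2), by fun_prop, fun y => hH0 _, fun y => hH1 _, ?_⟩
      intro t z hz
      simp only
      rw [hb z hz, hHb]
    have h2 := hd.post (S' := LS N (1 : GLn (Fin n))) (fun y v => f y * dl 0 v⁻¹) (by fun_prop) (by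
      intro z m hm hz
      rw [hm hz, hb z hz]; simp)
    simp only [Pi.one_apply, inv_one, map_one, mul_one] at h2
    exact h2.symm.trans h1

/-! ## Spheres -/

section sphere

variable {E : Type*} [NormedAddCommGroup E] [NormedSpace ℝ E]

/-- The punctured space. -/
abbrev YE (E : Type*) [NormedAddCommGroup E] := {v : E × ℝ // v ≠ 0}

/-- The base point. -/
def y0 : YE E := ⟨(0, 1), by simp⟩

notation "HG[" N ";" E "]" => HomotopyGroup N (YE E) y0

/-- The negative ray. -/
def NR (v : E × ℝ) : Prop := v.1 = 0 ∧ v.2 ≤ 0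

theorem isClosed_NR : IsClosed {v : E × ℝ | NR v} := by
  unfold NR
  exact (isClosed_eq continuous_fst continuous_const).inter
    (isClosed_le continuous_snd continuous_const)

theorem NR_zero : NR (0 : E × ℝ) := ⟨rfl, le_rfl⟩

theorem isClosed_boundary {N : Type*} [Finite N] : IsClosed (boundary N) := by
  have : boundary N = ⋃ i, {y | y i = 0 ∨ y i = 1} := by
    ext y; simp [boundary]
  rw [this]
  apply isClosed_iUnion_of_finite
  intro i
  exact (isClosed_eq (continuous_apply i) continuous_const).union
    (isClosed_eq (continuous_apply i) continuous_const)

/-- Admissible maps. -/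
def Adm (N : Type*) (E : Type*) [NormedAddCommGroup E] (y : N → I) : Set (E × ℝ) :=
  {v | v ≠ 0 ∧ (y ∈ boundary N → ¬ NR v)}

/-- Raw loops. -/
def RL (N : Type*) (E : Type*) [NormedAddCommGroup E] (y : N → I) : Set (E × ℝ) :=
  {v | v ≠ 0 ∧ (y ∈ boundary N → v = (0, 1))}

theorem not_NR_base : ¬ NR ((0, 1) : E × ℝ) := fun h => absurd h.2 (by norm_num)

theorem RL_sub_Adm {N : Type*} (y : N → I) : RL N E y ⊆ Adm N E y := by
  rintro v ⟨h1, h2⟩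
  exact ⟨h1, fun hy => by rw [h2 hy]; exact not_NR_base⟩

/-- Shear. -/
noncomputable def shear (R : ℝ) (v : E × ℝ) : E × ℝ := (v.1, v.2 + R * ‖v.1‖)

/-- Collapse. -/
noncomputable def col (v : E × ℝ) : E × ℝ :=
  ((max 0 (‖v.1‖ - v.2) / (‖v.1‖ + |v.2|)) • v.1,
    1 - 3 * (max 0 (‖v.1‖ - v.2) / (‖v.1‖ + |v.2|)))

theorem shear_ne {R : ℝ} {v : E × ℝ} (h : v ≠ 0) : shear R v ≠ 0 := by
  intro h'
  apply h
  simp only [shear, Prod.mk_eq_zero] at h'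
  obtain ⟨h1, h2⟩ := h'
  rw [h1] at h2
  simp at h2
  exact Prod.ext h1 h2

theorem size_pos {v : E × ℝ} (h : v ≠ 0) : 0 < ‖v.1‖ + |v.2| := by
  rcases eq_or_ne v.1 0 with h1 | h1
  · have : v.2 ≠ 0 := fun h2 => h (Prod.ext h1 h2)
    have := abs_pos.2 this
    positivity
  · have := norm_pos_iff.2 h1
    positivity

theorem col_base {v : E × ℝ} (h : ‖v.1‖ ≤ v.2) : col v = (0, 1) := by
  have : max 0 (‖v.1‖ - v.2) = 0 := max_eq_left (by linarith)
  simp [col, this]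

/-- The collapse is homotopic to the identity, respecting everything. -/
theorem col_hty (R : ℝ) : Hty (fun z : YE E => {w : E × ℝ | w ≠ 0 ∧ (NR w → NR z.1) ∧
    (z.1 = (0, 1) → w = (0, 1))}) (fun z => z.1) (fun z => col (shear R z.1)) := by
  have h1 : Hty (fun z : YE E => {w : E × ℝ | w ≠ 0 ∧ (NR w → NR z.1) ∧
      (z.1 = (0, 1) → w = (0, 1))}) (fun z => z.1) (fun z => shear R z.1) := by
    refine ⟨fun p => shear (p.1 * R) p.2.1, ?_, ?_, ?_, ?_⟩
    · unfold shear; fun_prop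
    · intro z; simp [shear]
    · intro z; simp [shear]
    · intro t z
      refine ⟨shear_ne z.2, ?_, ?_⟩
      · rintro ⟨h1, h2⟩
        simp only [shear] at h1 h2
        rw [h1] at h2
        simp at h2
        exact ⟨h1, h2⟩
      · intro h; simp [h, shear]
  refine h1.trans ?_
  let a : E × ℝ → ℝ := fun v => max 0 (‖v.1‖ - v.2) / (‖v.1‖ + |v.2|)
  have key : ∀ (s : ℝ) (v : E × ℝ), 0 ≤ s → s ≤ 1 → v ≠ 0 →
      NR (((1 - s) • v + s • col v : E × ℝ)) → NR v ∧ ((1 - s) • v + s • col v : E × ℝ) ≠ 0 := by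
    intro s v h0 h1 hv hN
    have hn := size_pos hv
    have ha0 : 0 ≤ a v := by simp only [a]; positivity
    obtain ⟨hN1, hN2⟩ := hN
    have e1 : ((1 - s) + s * a v) • v.1 = 0 := by
      rw [← hN1]; simp [col, a, add_smul, smul_smul]
    have e2 : (1 - s) * v.2 + s * (1 - 3 * a v) ≤ 0 := by
      simpa [col, a] using hN2
    have hsa : 0 ≤ s * a v := by positivity
    by_cases hv1 : v.1 = 0
    · have hv2 : v.2 ≠ 0 := fun h2 => hv (Prod.ext hv1 h2)
      rcases lt_or_gt_of_ne hv2 with h | h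
      · have : a v = 1 := by
          simp only [a]
          rw [hv1, norm_zero, abs_of_neg h, max_eq_right (by linarith)]
          simp only [zero_add, zero_sub]
          exact div_self (neg_ne_zero.2 hv2)
        refine ⟨⟨hv1, h.le⟩, ?_⟩
        intro hz
        have : ((1 - s) * v.2 + s * (1 - 3 * a v)) = 0 := by
          have := congrArg Prod.snd hz
          simpa [col, a] using this
        have h4 : (1 - s) * v.2 ≤ 0 := mul_nonpos_of_nonneg_of_nonpos (by linarith) h.le
        rcases eq_or_lt_of_le h0 with h5 | h5
        · subst h5; simp at this; linarith
        · nlinarith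
      · have : a v = 0 := by
          simp only [a]
          rw [hv1, norm_zero, max_eq_left (by linarith)]
          simp
        rw [this] at e2
        have h4 : 0 ≤ (1 - s) * v.2 := mul_nonneg (by linarith) h.le
        rcases eq_or_lt_of_le h0 with h5 | h5
        · subst h5; simp at e2; linarith
        · nlinarith
    · rw [smul_eq_zero] at e1
      have e3 := e1.resolve_right hv1
      have hs : s = 1 := by linarith
      subst hs
      have : a v = 0 := by linarith
      rw [this] at e2
      norm_num at e2
  refine ⟨fun p => (1 - (p.1 : ℝ)) • shear R p.2.1 + (p.1 : ℝ) • col (shear R p.2.1), ?_, ?_, ?_, ?_⟩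
  · have hs : Continuous fun p : I × YE E => shear R p.2.1 := by unfold shear; fun_prop
    have hcol : Continuous fun p : I × YE E => col (shear R p.2.1) := by
      have : Continuous fun p : I × YE E => a (shear R p.2.1) := by
        simp only [a]
        apply Continuous.div
        · fun_prop
        · fun_prop
        · intro p; exact (size_pos (shear_ne p.2.2)).ne'
      have : Continuous fun p : I × YE E => ((a (shear R p.2.1)) • (shear R p.2.1).1,
          1 - 3 * a (shear R p.2.1)) :=
        (this.smul (continuous_fst.comp hs)).prodMk (continuous_const.sub (continuous_const.mul this))
      exact this
    fun_prop
  · intro z; simp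
  · intro z; simp
  · intro t z
    have k := key t (shear R z.1) t.2.1 t.2.2 (shear_ne z.2)
    refine ⟨?_, ?_, ?_⟩
    · intro hz
      exact (k (by simp only at hz; rw [hz]; exact NR_zero)).2 hz
    · intro h
      have := (k h).1
      obtain ⟨h1, h2⟩ := this
      simp only [shear] at h1 h2
      rw [h1] at h2
      simp at h2
      exact ⟨h1, h2⟩
    · intro h
      have hb : shear R z.1 = (0, 1) := by simp [h, shear]
      simp only
      rw [hb, col_base (by simp)]
      ext <;> simp

theorem exists_R {K : Set (E × ℝ)} (hK : IsCompact K) (h : ∀ v ∈ K, ¬ NR v) :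
    ∃ R : ℝ, ∀ v ∈ K, col (shear R v) = (0, 1) := by
  have := hK.elim_directed_cover (fun n : ℕ => {v : E × ℝ | ‖v.1‖ < v.2 + n * ‖v.1‖}) ?_ ?_ ?_
  · obtain ⟨n, hn⟩ := this
    refine ⟨n, fun v hv => col_base ?_⟩
    exact (hn hv).le
  · intro n
    exact isOpen_lt (by fun_prop) (by fun_prop)
  · intro v hv
    have hv' := h v hv
    simp only [Set.mem_iUnion, Set.mem_setOf_eq]
    by_cases h1 : v.1 = 0
    · refine ⟨0, ?_⟩
      have : ¬ v.2 ≤ 0 := fun h2 => hv' ⟨h1, h2⟩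
      simp only [h1, norm_zero]; simpa using this
    · have := norm_pos_iff.2 h1
      obtain ⟨n, hn⟩ := exists_nat_gt ((‖v.1‖ - v.2) / ‖v.1‖)
      refine ⟨n, ?_⟩
      rw [div_lt_iff₀ this] at hn
      linarith
  · intro n m
    refine ⟨max n m, ?_, ?_⟩ <;> intro v hv <;> simp only [Set.mem_setOf_eq] at * <;>
    refine hv.trans_le ?_ <;> gcongr <;> simp

section cl

variable {N : Type*} [DecidableEq N] [Finite N]

/-- Class of a raw loop. -/
def rhg (f : (N → I) → E × ℝ) (hf : Continuous f) (hS : ∀ y, f y ∈ RL N E y) :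
    HG[N; E] :=
  hg (fun y => ⟨f y, (hS y).1⟩) (by fun_prop) (fun y hy => Subtype.ext ((hS y).2 hy))

theorem rhg_eq_iff {f g : (N → I) → E × ℝ} (hf : Continuous f) (hS : ∀ y, f y ∈ RL N E y)
    (hg' : Continuous g) (hS' : ∀ y, g y ∈ RL N E y) :
    rhg f hf hS = rhg g hg' hS' ↔ Hty (RL N E) f g := by
  rw [rhg, rhg, hg_eq_iff]
  constructor
  · rintro ⟨H, hc, h0, h1, h2⟩
    refine ⟨fun p => (H p).1, by fun_prop, fun z => by simp [h0], fun z => by simp [h1], ?_⟩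
    intro t z
    exact ⟨(H (t, z)).2, fun hz => congrArg Subtype.val (h2 t z hz)⟩
  · rintro ⟨H, hc, h0, h1, h2⟩
    refine ⟨fun p => ⟨H p, (h2 p.1 p.2).1⟩, by fun_prop, fun z => Subtype.ext (h0 z),
      fun z => Subtype.ext (h1 z), ?_⟩
    intro t z hz
    exact Subtype.ext ((h2 t z).2 hz)

theorem rhg_surj (a : HG[N; E]) : ∃ f hf hS, a = rhg (N := N) (E := E) f hf hS := by
  obtain ⟨f, hf, hb, rfl⟩ := hg_surj a
  exact ⟨fun y => (f y).1, by fun_prop, fun y => ⟨(f y).2, fun hy => congrArg Subtype.val (hb y hy)⟩, rfl⟩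

/-- `f` is an admissible map of class `a`. -/
def Cl (f : (N → I) → E × ℝ) (a : HG[N; E]) : Prop :=
  ∃ g hg hS, Hty (Adm N E) f g ∧ rhg g hg hS = a

theorem Cl.of_loop {f : (N → I) → E × ℝ} (hf : Continuous f) (hS : ∀ y, f y ∈ RL N E y) :
    Cl f (rhg f hf hS) :=
  ⟨f, hf, hS, Hty.refl hf (fun y => RL_sub_Adm y (hS y)), rfl⟩

theorem Cl.hty {f f' : (N → I) → E × ℝ} {a : HG[N; E]} (h : Cl f a)
    (H : Hty (Adm N E) f f') : Cl f' a := by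
  obtain ⟨g, hg, hS, K, rfl⟩ := h
  exact ⟨g, hg, hS, H.symm.trans K, rfl⟩

theorem Cl.cont {f : (N → I) → E × ℝ} {a : HG[N; E]} (h : Cl f a) :
    Continuous f := by
  obtain ⟨g, hg, hS, K, rfl⟩ := h
  exact K.cont_left

theorem Cl.mem {f : (N → I) → E × ℝ} {a : HG[N; E]} (h : Cl f a) (y : N → I) :
    f y ∈ Adm N E y := by
  obtain ⟨g, hg, hS, K, rfl⟩ := h
  exact K.mem_left y

theorem col_adm {f : (N → I) → E × ℝ} (hf : Continuous f) (hS : ∀ y, f y ∈ Adm N E y) (R : ℝ) :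
    Hty (Adm N E) f (fun y => col (shear R (f y))) := by
  have := (col_hty (E := E) R).comp (S' := Adm N E) (fun y => ⟨f y, (hS y).1⟩) (by fun_prop) (by
    rintro y w ⟨h1, h2, h3⟩
    exact ⟨h1, fun hy hw => (hS y).2 hy (h2 hw)⟩)
  exact this

theorem col_RL {f : (N → I) → E × ℝ} (hf : Continuous f) (hS : ∀ y, f y ∈ RL N E y) (R : ℝ) :
    Hty (RL N E) f (fun y => col (shear R (f y))) := by
  have := (col_hty (E := E) R).comp (S' := RL N E) (fun y => ⟨f y, (hS y).1⟩) (by fun_prop) (by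
    rintro y w ⟨h1, h2, h3⟩
    exact ⟨h1, fun hy => h3 ((hS y).2 hy)⟩)
  exact this

theorem col_shear_ne {v : E × ℝ} (hv : v ≠ 0) (R : ℝ) : col (shear R v) ≠ 0 :=
  ((col_hty (E := E) R).mem_right ⟨v, hv⟩).1

/-- A class computed by collapsing. -/
theorem Cl.of_col {f : (N → I) → E × ℝ} (hf : Continuous f) (hS : ∀ y, f y ∈ Adm N E y) (R : ℝ)
    (hR : ∀ y ∈ boundary N, col (shear R (f y)) = (0, 1)) :
    Cl f (rhg (fun y => col (shear R (f y))) (col_adm hf hS R).cont_right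
      (fun y => ⟨col_shear_ne (hS y).1 R, hR y⟩)) :=
  ⟨_, _, _, col_adm hf hS R, rfl⟩

theorem Cl.exists {f : (N → I) → E × ℝ} (hf : Continuous f) (hS : ∀ y, f y ∈ Adm N E y) :
    ∃ a, Cl f a := by
  obtain ⟨R, hR⟩ := exists_R (K := f '' boundary N) (isClosed_boundary.isCompact.image hf) (by
    rintro _ ⟨y, hy, rfl⟩
    exact (hS y).2 hy)
  exact ⟨_, Cl.of_col hf hS R (fun y hy => hR _ ⟨y, hy, rfl⟩)⟩

theorem RL_of_Adm {f g : (N → I) → E × ℝ} (hf : ∀ y, f y ∈ RL N E y) (hg : ∀ y, g y ∈ RL N E y)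
    (h : Hty (Adm N E) f g) : Hty (RL N E) f g := by
  have fc := h.cont_left
  have gc := h.cont_right
  obtain ⟨H, hc, h0, h1, h2⟩ := h
  obtain ⟨R, hR⟩ := exists_R (K := H '' (Set.univ ×ˢ boundary N))
    ((isCompact_univ.prod isClosed_boundary.isCompact).image hc) (by
    rintro _ ⟨y, hy, rfl⟩
    exact (h2 y.1 y.2).2 hy.2)
  refine (col_RL fc hf R).trans (Hty.trans ?_ (col_RL gc hg R).symm)
  refine ⟨fun p => col (shear R (H p)), ?_, fun z => by simp [h0], fun z => by simp [h1], ?_⟩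
  · exact (col_hty (E := E) R).cont_right.comp
      (Continuous.subtype_mk hc (fun p => (h2 p.1 p.2).1))
  · intro t z
    exact ⟨col_shear_ne (h2 t z).1 R, fun hz => hR _ ⟨(t, z), ⟨trivial, hz⟩, rfl⟩⟩

theorem Cl.unique {f : (N → I) → E × ℝ} {a b : HG[N; E]} (h : Cl f a)
    (h' : Cl f b) : a = b := by
  obtain ⟨g, hg, hS, K, rfl⟩ := h
  obtain ⟨g', hg', hS', K', rfl⟩ := h'
  rw [rhg_eq_iff]
  exact RL_of_Adm hS hS' (K.symm.trans K')

theorem Cl.congr {f f' : (N → I) → E × ℝ} {a : HG[N; E]} (h : Cl f a)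
    (H : ∀ y, f y = f' y) : Cl f' a := (funext H : f = f') ▸ h

/-- Maps that miss the negative ray are trivial. -/
theorem Cl.one [Nonempty N] {f : (N → I) → E × ℝ} (hf : Continuous f) (hS : ∀ y, ¬ NR (f y)) :
    Cl f 1 := by
  obtain ⟨R, hR⟩ := exists_R (K := Set.range f) (isCompact_range hf) (by
    rintro _ ⟨y, rfl⟩
    exact hS y)
  have hA : ∀ y, f y ∈ Adm N E y := fun y =>
    ⟨fun h => hS y (by rw [h]; exact NR_zero), fun _ => hS y⟩
  have := Cl.of_col hf hA R (fun y hy => hR _ ⟨y, rfl⟩)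
  convert this using 1
  symm
  apply hg_one
  intro y
  exact Subtype.ext (hR _ ⟨y, rfl⟩)

/-- Concatenation. -/
theorem Cl.conc [Nonempty N] (i : N) {f g : (N → I) → E × ℝ} {a b : HG[N; E]}
    (hf : Cl f a) (hg : Cl g b) (h : ∀ y, f (update y i 1) = g (update y i 0)) :
    Cl (conc i f g) (b * a) := by
  have fc := hf.cont
  have gc := hg.cont
  obtain ⟨R, hR⟩ := exists_R (K := f '' boundary N ∪ g '' boundary N)
    ((isClosed_boundary.isCompact.image fc).union (isClosed_boundary.isCompact.image gc)) (by
    rintro _ (⟨y, hy, rfl⟩ | ⟨y, hy, rfl⟩)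
    · exact (hf.mem y).2 hy
    · exact (hg.mem y).2 hy)
  have Rf : ∀ y ∈ boundary N, col (shear R (f y)) = (0, 1) :=
    fun y hy => hR _ (Or.inl ⟨y, hy, rfl⟩)
  have Rg : ∀ y ∈ boundary N, col (shear R (g y)) = (0, 1) :=
    fun y hy => hR _ (Or.inr ⟨y, hy, rfl⟩)
  have f1 := Cl.of_col fc hf.mem R Rf
  have g1 := Cl.of_col gc hg.mem R Rg
  rw [hf.unique f1, hg.unique g1]
  have hcc : Continuous (BottSU.conc i f g) := conc_cont fc gc h
  have hcA : ∀ y, BottSU.conc i f g y ∈ Adm N E y := by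
    intro y
    unfold BottSU.conc
    split_ifs with hy
    · refine ⟨(hf.mem _).1, ?_⟩
      rintro ⟨j, hj⟩
      apply (hf.mem _).2
      by_cases hji : j = i
      · subst hji
        refine ⟨j, ?_⟩
        rcases hj with hj | hj
        · left; simp [hj]
        · right; simp [hj]
      · exact ⟨j, by simpa [hji] using hj⟩
    · refine ⟨(hg.mem _).1, ?_⟩
      rintro ⟨j, hj⟩
      apply (hg.mem _).2
      by_cases hji : j = i
      · subst hji
        refine ⟨j, ?_⟩
        rcases hj with hj | hj
        · left; simp [hj]
        · right; simp [hj]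
      · exact ⟨j, by simpa [hji] using hj⟩
  have hcol : ∀ y, col (shear R (BottSU.conc i f g y)) =
      BottSU.conc i (fun y => col (shear R (f y))) (fun y => col (shear R (g y))) y := by
    intro y
    unfold BottSU.conc
    split_ifs <;> rfl
  have := Cl.of_col hcc hcA R (by
    intro y hy
    rw [hcol]
    exact conc_boundary Rf Rg y hy)
  convert this using 1
  refine (hg_mul' i _ _ _ _).trans ?_
  apply hg_congr
  ext1 y
  apply Subtype.ext
  refine Eq.trans ?_ (hcol y).symm
  unfold BottSU.conc
  split_ifs <;> rfl

/-- Reversal of one coordinate. -/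
theorem Cl.flip [Nonempty N] (i : N) {f : (N → I) → E × ℝ} {a : HG[N; E]}
    (hf : Cl f a) : Cl (fun y => f (update y i (σ (y i)))) a⁻¹ := by
  obtain ⟨g, hg, hS, K, rfl⟩ := hf
  have hb : ∀ y : N → I, y ∈ boundary N → update y i (σ (y i)) ∈ boundary N := by
    rintro y ⟨j, hj⟩
    by_cases hji : j = i
    · subst hji
      refine ⟨j, ?_⟩
      rcases hj with hj | hj
      · right; simp [hj]
      · left; simp [hj]
    · exact ⟨j, by simpa [hji] using hj⟩
  have hu : Continuous fun y : N → I => update y i (σ (y i)) :=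
    Continuous.update continuous_id _ (by fun_prop)
  refine ⟨fun y => g (update y i (σ (y i))), by fun_prop, ?_, ?_, ?_⟩
  · intro y
    exact ⟨(hS _).1, fun hy => (hS _).2 (hb y hy)⟩
  · exact K.comp _ hu (fun y w hw => ⟨hw.1, fun hy => hw.2 (hb y hy)⟩)
  · symm
    refine (HomotopyGroup.inv_spec (i := i)).trans ?_
    apply congrArg (Quotient.mk _)
    apply Subtype.ext
    ext1 y
    change (⟨g _, _⟩ : YE E) = ⟨g _, _⟩
    apply Subtype.ext
    simp only
    congr 1
    ext1 j
    by_cases hji : j = i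
    · subst hji; simp
    · simp [hji]

end cl

end sphere

section sphere2

variable {E : Type*} [NormedAddCommGroup E] [NormedSpace ℝ E] {N : Type*} [DecidableEq N] [Fintype N]

/-- Box parametrisation. -/
def bx (a b : N → ℝ) (y : N → I) : N → ℝ := fun i => a i + y i * (b i - a i)

@[fun_prop] theorem bx_cont (a b : N → ℝ) : Continuous (bx a b) := by unfold bx; fun_prop

theorem Adm_update {f : (N → I) → E × ℝ} (hS : ∀ y, f y ∈ Adm N E y) (i : N) (y : N → I) (c : I)
    (h0 : y i ≠ 0) (h1 : y i ≠ 1) : f (update y i c) ∈ Adm N E y := by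
  refine ⟨(hS _).1, fun hy => (hS _).2 ?_⟩
  obtain ⟨j, hj⟩ := hy
  have hji : j ≠ i := by rintro rfl; tauto
  exact ⟨j, by simpa [hji] using hj⟩

theorem Cl.cut [Nonempty N] {Φ : (N → ℝ) → E × ℝ} (hΦ : Continuous Φ) {a b : N → ℝ}
    (hA : ∀ y, Φ (bx a b y) ∈ Adm N E y) (i : N) (c : ℝ) (hac : a i < c) (hcb : c < b i)
    {α β : HG[N; E]} (h1 : Cl (fun y => Φ (bx a (update b i c) y)) α)
    (h2 : Cl (fun y => Φ (bx (update a i c) b y)) β) :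
    Cl (fun y => Φ (bx a b y)) (β * α) := by
  have hpos : 0 < b i - a i := by linarith
  let k : ℝ := (c - a i) / (b i - a i)
  have hk0 : 0 < k := div_pos (by linarith) hpos
  have hk1 : k < 1 := by rw [div_lt_one hpos]; linarith
  let r : I → I := fun t => ⟨k * ra t + (1 - k) * rb t, by
    have h1 := (ra t).2; have h2 := (rb t).2
    constructor
    · have := mul_nonneg hk0.le h1.1
      have := mul_nonneg (show 0 ≤ 1 - k by linarith) h2.1
      linarith
    · nlinarith [h1.2, h2.2]⟩
  have hr : Continuous r := by
    have := ra_cont; have := rb_cont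
    simp only [r]; fun_prop
  have hc := Cl.conc i h1 h2 (by
    intro y
    refine congrArg Φ (funext fun j => ?_)
    by_cases hj : j = i
    · subst hj; simp [bx]
    · simp [bx, hj])
  have hrep := reparam (S := Adm N E) (f := fun y => Φ (bx a b y)) (by fun_prop) i hA
    (fun y c h0 h1 => Adm_update hA i y c h0 h1) r hr (by ext; simp [r]) (by ext; simp [r])
  refine Cl.hty (hc.congr ?_) hrep.symm
  intro y
  unfold BottSU.conc
  have hk : k * (b i - a i) = c - a i := by simp only [k]; field_simp
  split_ifs with hy
  · refine congrArg Φ (funext fun j => ?_)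
    by_cases hj : j = i
    · subst hj
      simp only [bx, Function.update_self, r, rb_zero' _ hy, Set.Icc.coe_zero]
      linear_combination (-(ra (y j) : ℝ)) * hk
    · simp [bx, hj]
  · refine congrArg Φ (funext fun j => ?_)
    by_cases hj : j = i
    · subst hj
      simp only [bx, Function.update_self, r, ra_one' _ (not_le.1 hy).le, Set.Icc.coe_one]
      linear_combination (rb (y j) - 1 : ℝ) * hk
    · simp [bx, hj]

/-- Zooming in on a smaller box. -/
theorem Hty.zoom {Φ : (N → ℝ) → E × ℝ} (hΦ : Continuous Φ) {a b a' b' : N → ℝ}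
    (ha : ∀ i, a i ≤ a' i) (hb : ∀ i, b' i ≤ b i) (hab : ∀ i, a' i ≤ b' i)
    (h0 : ∀ x, (∀ i, a i ≤ x i) → (∀ i, x i ≤ b i) → Φ x ≠ 0)
    (hN : ∀ x, (∀ i, a i ≤ x i) → (∀ i, x i ≤ b i) → NR (Φ x) → ∀ i, a' i < x i ∧ x i < b' i) :
    Hty (Adm N E) (fun y => Φ (bx a b y)) (fun y => Φ (bx a' b' y)) := by
  let A : I → N → ℝ := fun s i => (1 - s) * a i + s * a' i
  let B : I → N → ℝ := fun s i => (1 - s) * b i + s * b' i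
  have hA : ∀ s i, a i ≤ A s i ∧ A s i ≤ a' i := by
    intro s i
    have h1 := s.2.1; have h2 := s.2.2
    simp only [A]
    constructor <;> nlinarith [ha i]
  have hB : ∀ s i, b' i ≤ B s i ∧ B s i ≤ b i := by
    intro s i
    have h1 := s.2.1; have h2 := s.2.2
    simp only [B]
    constructor <;> nlinarith [hb i]
  have hbx : ∀ s y i, a i ≤ bx (A s) (B s) y i ∧ bx (A s) (B s) y i ≤ b i := by
    intro s y i
    have h1 := (y i).2.1; have h2 := (y i).2.2
    have := hA s i; have := hB s i; have := hab i
    simp only [bx]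
    constructor <;> nlinarith
  refine ⟨fun p => Φ (bx (A p.1) (B p.1) p.2), ?_, ?_, ?_, ?_⟩
  · apply hΦ.comp
    refine continuous_pi fun i => ?_
    simp only [bx, A, B]; fun_prop
  · intro z; congr 2 <;> ext i <;> simp [A, B]
  · intro z; congr 2 <;> ext i <;> simp [A, B]
  · intro s y
    refine ⟨h0 _ (fun i => (hbx s y i).1) (fun i => (hbx s y i).2), ?_⟩
    rintro ⟨j, hj⟩ hNR
    have := hN _ (fun i => (hbx s y i).1) (fun i => (hbx s y i).2) hNR j
    have h1 := hA s j; have h2 := hB s j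
    rcases hj with hj | hj
    · simp only [bx, hj] at this
      simp at this; linarith
    · simp only [bx, hj] at this
      simp at this; linarith

/-- Centered coordinates. -/
noncomputable def ctr (y : N → I) : N → ℝ := fun i => (y i : ℝ) - 1 / 2

@[fun_prop] theorem ctr_cont : Continuous (ctr (N := N)) := by unfold ctr; fun_prop

theorem ctr_ne {y : N → I} (hy : y ∈ boundary N) : ctr y ≠ 0 := by
  obtain ⟨j, hj⟩ := hy
  intro h
  have := congrFun h j
  rcases hj with hj | hj <;> simp [ctr, hj] at this <;> norm_num at this

theorem ctr_norm (y : N → I) : ‖ctr y‖ ≤ 1 / 2 := by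
  rw [pi_norm_le_iff_of_nonneg (by norm_num)]
  intro i
  have h1 := (y i).2.1; have h2 := (y i).2.2
  rw [Real.norm_eq_abs, abs_le]
  simp only [ctr]
  constructor <;> linarith

/-- Linear model. -/
noncomputable def Lin (L : (N → ℝ) → E) (y : N → I) : E × ℝ := (L (ctr y), -1)

/-- Localisation at a nondegenerate zero. -/
theorem Hty.linearize {Φ : (N → ℝ) → E × ℝ} (hΦ : Continuous Φ) {a b p : N → ℝ}
    (L : (N → ℝ) ≃L[ℝ] E) (hpa : ∀ i, a i < p i) (hpb : ∀ i, p i < b i)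
    (hd : HasFDerivAt (fun x => (Φ x).1) (L : (N → ℝ) →L[ℝ] E) p) (hp : NR (Φ p))
    (h0 : ∀ x, (∀ i, a i ≤ x i) → (∀ i, x i ≤ b i) → Φ x ≠ 0)
    (hN : ∀ x, (∀ i, a i ≤ x i) → (∀ i, x i ≤ b i) → NR (Φ x) → x = p) :
    Hty (Adm N E) (fun y => Φ (bx a b y)) (Lin L) := by
  have hF : (Φ p).1 = 0 := hp.1
  have hh : (Φ p).2 < 0 := by
    refine lt_of_le_of_ne hp.2 fun h => ?_
    exact h0 p (fun i => (hpa i).le) (fun i => (hpb i).le) (Prod.ext hF h)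
  obtain ⟨κ, hκ, hLκ⟩ : ∃ κ : ℝ, 0 < κ ∧ ∀ x, κ * ‖x‖ ≤ ‖L x‖ := by
    obtain ⟨K, hK, h⟩ : ∃ K : ℝ, 0 < K ∧ ∀ x, ‖x‖ ≤ K * ‖L x‖ :=
      ⟨‖(L.symm : E →L[ℝ] (N → ℝ))‖ + 1, by positivity, fun x => by
        calc ‖x‖ = ‖(L.symm : E →L[ℝ] (N → ℝ)) (L x)‖ := by simp
          _ ≤ ‖(L.symm : E →L[ℝ] (N → ℝ))‖ * ‖L x‖ := ContinuousLinearMap.le_opNorm _ _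
          _ ≤ (‖(L.symm : E →L[ℝ] (N → ℝ))‖ + 1) * ‖L x‖ := by gcongr; linarith⟩
    exact ⟨K⁻¹, by positivity, fun x => by rw [inv_mul_le_iff₀ hK]; exact h x⟩
  have hlo := hd.isLittleO
  have hev := hlo.def (show 0 < κ / 2 by positivity)
  have hev2 : ∀ᶠ x in nhds p, (Φ x).2 < 0 :=
    (hΦ.snd.tendsto p).eventually (gt_mem_nhds hh)
  obtain ⟨δ, hδ, hball⟩ := Metric.eventually_nhds_iff.1 (hev.and hev2)
  obtain ⟨ε, hε, hεδ, hεa, hεb⟩ : ∃ ε : ℝ, 0 < ε ∧ ε < δ ∧ (∀ i, ε ≤ p i - a i) ∧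
      ∀ i, ε ≤ b i - p i := by
    have h1 : ∀ᶠ ε : ℝ in nhdsWithin 0 (Set.Ioi 0), ∀ i, ε ≤ p i - a i :=
      Filter.eventually_all.2 fun i => nhdsWithin_le_nhds
        ((ge_mem_nhds (sub_pos.2 (hpa i))))
    have h2 : ∀ᶠ ε : ℝ in nhdsWithin 0 (Set.Ioi 0), ∀ i, ε ≤ b i - p i :=
      Filter.eventually_all.2 fun i => nhdsWithin_le_nhds
        ((ge_mem_nhds (sub_pos.2 (hpb i))))
    have h3 : ∀ᶠ ε : ℝ in nhdsWithin 0 (Set.Ioi 0), ε < δ := nhdsWithin_le_nhds (gt_mem_nhds hδ)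
    have h4 : ∀ᶠ ε : ℝ in nhdsWithin 0 (Set.Ioi 0), 0 < ε := self_mem_nhdsWithin
    obtain ⟨ε, h⟩ := (h4.and (h3.and (h1.and h2))).exists
    exact ⟨ε, h.1, h.2.1, h.2.2.1, h.2.2.2⟩
  have hz := Hty.zoom hΦ (a := a) (b := b) (a' := fun i => p i - ε) (b' := fun i => p i + ε)
    (fun i => by linarith [hεa i]) (fun i => by linarith [hεb i]) (fun i => by linarith) h0 (by
      intro x h1 h2 h3 i
      rw [hN x h1 h2 h3]; constructor <;> linarith)
  have hbx : ∀ y : N → I, bx (fun i => p i - ε) (fun i => p i + ε) y = p + (2 * ε) • ctr y := by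
    intro y; ext i; simp [bx, ctr]; ring
  refine hz.trans ?_
  have hin : ∀ y : N → I, ‖(Φ (p + (2 * ε) • ctr y)).1 - L ((2 * ε) • ctr y)‖ ≤
      κ / 2 * ‖(2 * ε) • ctr y‖ ∧ (Φ (p + (2 * ε) • ctr y)).2 < 0 := by
    intro y
    have := @hball (p + (2 * ε) • ctr y) (by
      rw [dist_eq_norm, add_sub_cancel_left, norm_smul, Real.norm_eq_abs, abs_of_pos (by positivity)]
      have := ctr_norm y
      nlinarith)
    simpa [hF] using this
  have m1 : Hty (Adm N E) (fun y => Φ (bx (fun i => p i - ε) (fun i => p i + ε) y))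
      (fun y => (L ((2 * ε) • ctr y), (Φ (p + (2 * ε) • ctr y)).2)) := by
    refine ⟨fun q => ((1 - (q.1 : ℝ)) • (Φ (p + (2 * ε) • ctr q.2)).1 +
      (q.1 : ℝ) • L ((2 * ε) • ctr q.2), (Φ (p + (2 * ε) • ctr q.2)).2), by fun_prop, ?_, ?_, ?_⟩
    · intro y; simp only [hbx]; simp
    · intro y; simp
    · intro s y
      refine ⟨fun h => (hin y).2.ne (congrArg Prod.snd h), ?_⟩
      rintro hy ⟨h1, -⟩
      have hc := ctr_ne hy
      have hx : 0 < ‖(2 * ε) • ctr y‖ := norm_pos_iff.2 (smul_ne_zero (by positivity) hc)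
      have e1 := (hin y).1
      have e2 := hLκ ((2 * ε) • ctr y)
      simp only at h1
      generalize (2 * ε) • ctr y = w at *
      generalize (Φ (p + w)).1 = u at *
      have e3 : L w = (1 - (s : ℝ)) • (L w - u) := by
        have : L w - (1 - (s : ℝ)) • (L w - u) = (1 - (s : ℝ)) • u + (s : ℝ) • L w := by module
        rw [h1] at this
        exact sub_eq_zero.1 this
      have e4 : ‖L w‖ ≤ ‖u - L w‖ := by
        rw [e3, norm_smul, norm_sub_rev u]
        have hs1 : ‖1 - (s : ℝ)‖ ≤ 1 := by
          rw [Real.norm_eq_abs, abs_le]; constructor <;> linarith [s.2.1, s.2.2]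
        rw [← e3]
        exact mul_le_of_le_one_left (norm_nonneg _) hs1
      nlinarith
  refine m1.trans ?_
  refine ⟨fun q => (((1 - (q.1 : ℝ)) * (2 * ε) + q.1) • L (ctr q.2),
    (1 - (q.1 : ℝ)) * (Φ (p + (2 * ε) • ctr q.2)).2 - q.1), by fun_prop, ?_, ?_, ?_⟩
  · intro y; simp
  · intro y; simp [Lin]
  · intro s y
    have hs0 := s.2.1; have hs1 := s.2.2
    have : (1 - (s : ℝ)) * (Φ (p + (2 * ε) • ctr y)).2 - s < 0 := by
      have := (hin y).2
      rcases eq_or_lt_of_le hs0 with h | h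
      · rw [← h]; simpa using this
      · nlinarith
    refine ⟨fun h => this.ne (congrArg Prod.snd h), ?_⟩
    rintro hy ⟨h1, -⟩
    simp only [smul_eq_zero] at h1
    rcases h1 with h1 | h1
    · rcases eq_or_lt_of_le hs0 with h | h
      · rw [← h] at h1; simp at h1; linarith
      · have : 0 ≤ (1 - (s : ℝ)) * (2 * ε) := mul_nonneg (by linarith) (by positivity)
        linarith
    · exact ctr_ne hy (by simpa using h1)

theorem Lin_adm (L : (N → ℝ) → E) (hL : Continuous L) (h : ∀ x, L x = 0 → x = 0) (y : N → I) :
    Lin L y ∈ Adm N E y :=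
  ⟨fun h => absurd (congrArg Prod.snd h) (by simp [Lin]),
    fun hy hN => ctr_ne hy (h _ hN.1)⟩

/-- All linear models agree up to inversion. -/
theorem Lin_class [Nonempty N] (e L : (N → ℝ) ≃L[ℝ] E) {g α : HG[N; E]}
    (hg : Cl (Lin e) g) (hα : Cl (Lin L) α) : α = g ∨ α = g⁻¹ := by
  let LM : Matrix N N ℝ → (N → I) → E × ℝ := fun M => Lin fun x => e (M *ᵥ x)
  have hinj : ∀ M : Matrix N N ℝ, M.det ≠ 0 → ∀ x, e (M *ᵥ x) = 0 → x = 0 := by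
    intro M hM x hx
    have h1 : M *ᵥ x = 0 := by simpa using hx
    exact Matrix.eq_zero_of_mulVec_eq_zero hM h1
  have path : ∀ M : I → Matrix N N ℝ, Continuous M → (∀ s, (M s).det ≠ 0) →
      Hty (Adm N E) (LM (M 0)) (LM (M 1)) := by
    intro M hM hd
    refine ⟨fun q => LM (M q.1) q.2, ?_, fun z => rfl, fun z => rfl, ?_⟩
    · simp only [LM, Lin]; fun_prop
    · intro s y
      exact Lin_adm _ (by fun_prop) (hinj _ (hd s)) y
  let Q : Matrix N N ℝ → Prop := fun M => ∀ M' : Matrix N N ℝ, M'.det ≠ 0 → ∀ β, Cl (LM M') β →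
    Cl (LM (M' * M)) β ∨ Cl (LM (M' * M)) β⁻¹
  have hmul : ∀ A B : Matrix N N ℝ, A.det ≠ 0 → Q A → Q B → Q (A * B) := by
    intro A B hA' hA hB M' hM' β hβ
    rw [← mul_assoc]
    have hd : (M' * A).det ≠ 0 := by rw [Matrix.det_mul]; exact mul_ne_zero hM' hA'
    rcases hA M' hM' β hβ with h | h
    · exact hB _ hd _ h
    · rcases hB _ hd _ h with h | h
      · right; exact h
      · left; simpa using h
  -- one diagonal entry
  have hone : ∀ (i : N) (d : ℝ), d ≠ 0 → Q (diagonal (update 1 i d)) := by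
    intro i d hd M' hM' β hβ
    have hdet : ∀ c : ℝ, (diagonal (update (1 : N → ℝ) i c)).det = c := by
      intro c
      rw [det_diagonal, Finset.prod_update_of_mem (Finset.mem_univ i)]
      simp
    have hpath : ∀ c c' : ℝ, (0 < c * c') →
        Hty (Adm N E) (LM (M' * diagonal (update 1 i c)))
          (LM (M' * diagonal (update 1 i c'))) := by
      intro c c' hcc
      have := path (fun s => M' * diagonal (update 1 i ((1 - (s : ℝ)) * c + s * c')))
        (by
          refine continuous_const.matrix_mul (Continuous.matrix_diagonal ?_)
          exact Continuous.update continuous_const i (by fun_prop)) (by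
          intro s
          rw [Matrix.det_mul, hdet]
          refine mul_ne_zero hM' ?_
          have hs0 := s.2.1; have hs1 := s.2.2
          intro h
          have h1 : (1 - (s : ℝ)) * c ^ 2 + s * (c * c') = 0 := by linear_combination c * h
          have h2 : c ≠ 0 := by rintro rfl; simp at hcc
          have h3 : 0 < c ^ 2 := by positivity
          rcases eq_or_lt_of_le hs0 with h | h
          · rw [← h] at h1; simp at h1; exact h2 h1
          · nlinarith [mul_pos h hcc, mul_nonneg (show 0 ≤ 1 - (s : ℝ) by linarith) h3.le])
      simpa using this
    rcases lt_or_gt_of_ne hd with h | h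
    · right
      have h1 := hβ.flip i
      refine Cl.hty (h1.congr (f' := LM (M' * diagonal (update 1 i (-1)))) ?_)
        (hpath _ _ (by linarith))
      intro y
      simp only [LM, Lin]
      congr 2
      rw [← mulVec_mulVec]
      congr 1
      ext j
      rw [Matrix.mulVec_diagonal]
      by_cases hj : j = i
      · subst hj; simp [ctr]; ring
      · simp [ctr, hj]
    · left
      refine Cl.hty (hβ.congr (f' := LM (M' * diagonal (update 1 i 1))) ?_)
        (hpath _ _ (by linarith))
      intro y
      have : update (1 : N → ℝ) i 1 = fun _ => 1 := by
        ext j; by_cases hj : j = i <;> simp [Function.update_apply]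
      rw [this, Matrix.diagonal_one, mul_one]
  have hdiag : ∀ D : N → ℝ, (∀ i, D i ≠ 0) → Q (diagonal D) := by
    intro D hD
    have : ∀ S : Finset N, Q (diagonal fun i => if i ∈ S then D i else 1) := by
      intro S
      induction S using Finset.induction_on with
      | empty =>
        intro M' hM' β hβ
        left
        simpa using hβ
      | insert i S hi ih =>
        have e : (diagonal fun j => if j ∈ insert i S then D j else 1) =
            (diagonal fun j => if j ∈ S then D j else 1) *
              diagonal (update 1 i (D i)) := by
          rw [Matrix.diagonal_mul_diagonal]
          congr 1
          ext j
          by_cases hj : j = i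
          · subst hj; simp [hi]
          · simp [hj]
        rw [e]
        refine hmul _ _ ?_ ih (hone i _ (hD i))
        rw [det_diagonal, Finset.prod_ne_zero_iff]
        intro j _
        split_ifs
        · exact hD j
        · exact one_ne_zero
    simpa using this univ
  have hall : ∀ M : Matrix N N ℝ, M.det ≠ 0 → Q M := by
    intro M hM
    refine Matrix.diagonal_transvection_induction_of_det_ne_zero Q M hM ?_ ?_ ?_
    · intro D hD
      apply hdiag
      intro i hi
      apply hD
      rw [det_diagonal]
      exact Finset.prod_eq_zero (Finset.mem_univ i) hi
    · intro t M' hM' β hβ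
      left
      refine hβ.hty ?_
      have := path (fun s => M' * Matrix.transvection t.i t.j ((s : ℝ) * t.c)) (by
        simp only [Matrix.transvection]
        refine continuous_const.matrix_mul (continuous_const.add ?_)
        have : ∀ s : I, Matrix.single t.i t.j ((s : ℝ) * t.c) =
            (s : ℝ) • Matrix.single t.i t.j t.c := by
          intro s; rw [Matrix.smul_single]; rfl
        simp only [this]
        fun_prop) (by
        intro s
        rw [Matrix.det_mul, Matrix.det_transvection_of_ne _ _ t.hij, mul_one]
        exact hM')
      simpa [Matrix.TransvectionStruct.toMatrix] using this
    · intro A B hA hB h1 h2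
      exact hmul A B hA h1 h2
  -- conclusion
  let M : Matrix N N ℝ := LinearMap.toMatrix' ((L.trans e.symm).toLinearEquiv : (N → ℝ) →ₗ[ℝ] (N → ℝ))
  have hMv : ∀ x, M *ᵥ x = e.symm (L x) := by
    intro x
    simp only [M]
    rw [LinearMap.toMatrix'_mulVec]
    rfl
  have hM : M.det ≠ 0 := by
    have := LinearEquiv.isUnit_det' (L.trans e.symm).toLinearEquiv
    rw [← LinearMap.det_toMatrix'] at this
    exact this.ne_zero
  have h1 : Cl (LM 1) g := hg.congr (fun y => by simp [LM, Lin])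
  have h2 : Cl (LM (1 * M)) α := hα.congr (fun y => by simp [LM, Lin, hMv])
  rcases hall M hM 1 (by simp) g h1 with h | h
  · left; exact h2.unique h
  · right; exact h2.unique h

end sphere2

section sphere3

variable {E : Type*} [NormedAddCommGroup E] [NormedSpace ℝ E] {N : Type*} [DecidableEq N] [Fintype N]

theorem bx_mem {a b : N → ℝ} (hab : ∀ i, a i ≤ b i) (y : N → I) :
    (∀ i, a i ≤ bx a b y i) ∧ ∀ i, bx a b y i ≤ b i := by
  have : ∀ i, a i ≤ bx a b y i ∧ bx a b y i ≤ b i := by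
    intro i
    have h1 := (y i).2.1; have h2 := (y i).2.2; have := hab i
    simp only [bx]
    constructor <;> nlinarith
  exact ⟨fun i => (this i).1, fun i => (this i).2⟩

theorem bx_bdry {a b : N → ℝ} {y : N → I} (hy : y ∈ boundary N) :
    ∃ i, bx a b y i = a i ∨ bx a b y i = b i := by
  obtain ⟨i, hi | hi⟩ := hy
  · exact ⟨i, Or.inl (by simp [bx, hi])⟩
  · exact ⟨i, Or.inr (by simp [bx, hi])⟩

/-- Counting nondegenerate zeros. -/
theorem Cl.count [Nonempty N] (e : (N → ℝ) ≃L[ℝ] E) {g : HG[N; E]}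
    (hg : Cl (Lin e) g) {Φ : (N → ℝ) → E × ℝ} (hΦ : Continuous Φ) (Z : Finset (N → ℝ)) :
    ∀ a b : N → ℝ, (∀ i, a i ≤ b i) →
    (∀ x, (∀ i, a i ≤ x i) → (∀ i, x i ≤ b i) → Φ x ≠ 0) →
    (∀ x, (∀ i, a i ≤ x i) → (∀ i, x i ≤ b i) → NR (Φ x) → x ∈ Z) →
    (∀ x ∈ Z, NR (Φ x) ∧ (∃ L : (N → ℝ) ≃L[ℝ] E,
      HasFDerivAt (fun x => (Φ x).1) (L : (N → ℝ) →L[ℝ] E) x) ∧ ∀ i, a i < x i ∧ x i < b i) →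
    ∃ m : ℤ, Cl (fun y => Φ (bx a b y)) (g ^ m) := by
  induction Z using Finset.strongInduction with
  | H Z ih =>
    intro a b hab h0 hNZ hZ
    by_cases hcard : ∃ p ∈ Z, ∃ q ∈ Z, p ≠ q
    · obtain ⟨p, hp, q, hq, hpq⟩ := hcard
      obtain ⟨i, p, hp, q, hq, hi⟩ : ∃ i, ∃ p ∈ Z, ∃ q ∈ Z, p i < q i := by
        obtain ⟨i, hi⟩ := Function.ne_iff.1 hpq
        rcases lt_or_gt_of_ne hi with h | h
        · exact ⟨i, p, hp, q, hq, h⟩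
        · exact ⟨i, q, hq, p, hp, h⟩
      obtain ⟨c, hc, hcZ⟩ : ∃ c ∈ Set.Ioo (p i) (q i), c ∉ Z.image (fun x => x i) :=
        (Set.Ioo_infinite hi).exists_notMem_finset _
      have hcZ' : ∀ x ∈ Z, x i ≠ c := fun x hx h => hcZ (Finset.mem_image.2 ⟨x, hx, h⟩)
      have hac : a i < c := ((hZ p hp).2.2 i).1.trans hc.1
      have hcb : c < b i := hc.2.trans ((hZ q hq).2.2 i).2
      have hu1 : ∀ j, update b i c j ≤ b j := by
        intro j; by_cases hj : j = i
        · subst hj; simpa using hcb.le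
        · simp [hj]
      have hu2 : ∀ j, a j ≤ update a i c j := by
        intro j; by_cases hj : j = i
        · subst hj; simpa using hac.le
        · simp [hj]
      obtain ⟨m1, h1⟩ := ih (Z.filter fun x => x i < c)
        (Finset.filter_ssubset.2 ⟨q, hq, not_lt.2 hc.2.le⟩) a (update b i c) (by
          intro j; by_cases hj : j = i
          · subst hj; simpa using hac.le
          · simpa [hj] using hab j)
        (fun x hx hx' => h0 x hx fun j => (hx' j).trans (hu1 j))
        (fun x hx hx' hN => by
          have hz := hNZ x hx (fun j => (hx' j).trans (hu1 j)) hN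
          rw [Finset.mem_filter]
          refine ⟨hz, lt_of_le_of_ne ?_ (hcZ' x hz)⟩
          simpa using hx' i)
        (fun x hx => by
          rw [Finset.mem_filter] at hx
          obtain ⟨k1, k2, k3⟩ := hZ x hx.1
          refine ⟨k1, k2, fun j => ⟨(k3 j).1, ?_⟩⟩
          by_cases hj : j = i
          · subst hj; simpa using hx.2
          · simpa [hj] using (k3 j).2)
      obtain ⟨m2, h2⟩ := ih (Z.filter fun x => c < x i)
        (Finset.filter_ssubset.2 ⟨p, hp, not_lt.2 hc.1.le⟩) (update a i c) b (by
          intro j; by_cases hj : j = i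
          · subst hj; simpa using hcb.le
          · simpa [hj] using hab j)
        (fun x hx hx' => h0 x (fun j => (hu2 j).trans (hx j)) hx')
        (fun x hx hx' hN => by
          have hz := hNZ x (fun j => (hu2 j).trans (hx j)) hx' hN
          rw [Finset.mem_filter]
          refine ⟨hz, lt_of_le_of_ne ?_ (hcZ' x hz).symm⟩
          simpa using hx i)
        (fun x hx => by
          rw [Finset.mem_filter] at hx
          obtain ⟨k1, k2, k3⟩ := hZ x hx.1
          refine ⟨k1, k2, fun j => ⟨?_, (k3 j).2⟩⟩
          by_cases hj : j = i
          · subst hj; simpa using hx.2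
          · simpa [hj] using (k3 j).1)
      refine ⟨m2 + m1, ?_⟩
      rw [zpow_add]
      refine Cl.cut hΦ (fun y => ⟨?_, ?_⟩) i c hac hcb h1 h2
      · exact h0 _ (bx_mem hab y).1 (bx_mem hab y).2
      · intro hy hN
        have hz := hNZ _ (bx_mem hab y).1 (bx_mem hab y).2 hN
        obtain ⟨j, hj⟩ := bx_bdry (a := a) (b := b) hy
        have := (hZ _ hz).2.2 j
        rcases hj with hj | hj <;> rw [hj] at this
        · exact lt_irrefl _ this.1
        · exact lt_irrefl _ this.2
    · simp only [not_exists, not_and, not_not] at hcard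
      rcases Z.eq_empty_or_nonempty with rfl | ⟨p, hp⟩
      · refine ⟨0, ?_⟩
        rw [zpow_zero]
        exact Cl.one (by fun_prop) fun y hN =>
          absurd (hNZ _ (bx_mem hab y).1 (bx_mem hab y).2 hN) (Finset.notMem_empty _)
      · obtain ⟨k1, ⟨L, hL⟩, k3⟩ := hZ p hp
        have hl := Hty.linearize hΦ L (fun i => (k3 i).1) (fun i => (k3 i).2) hL k1 h0
          (fun x h1 h2 h3 => hcard _ (hNZ x h1 h2 h3) _ hp)
        obtain ⟨α, hα⟩ := Cl.exists hl.cont_right hl.mem_right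
        have h2 := hα.hty hl.symm
        rcases Lin_class e L hg hα with rfl | rfl
        · exact ⟨1, by simpa using h2⟩
        · exact ⟨-1, by simpa using h2⟩

/-- Smooth approximation. -/
theorem approx [CompleteSpace E] {f : (N → I) → E × ℝ} (hf : Continuous f)
    (hS : ∀ y, f y ∈ RL N E y) :
    ∃ δ > 0, ∃ (F : (N → ℝ) → E) (h : (N → ℝ) → ℝ), ContDiff ℝ (⊤ : ℕ∞) F ∧ Continuous h ∧
      (∀ y : N → I, h (fun i => y i) = (f y).2) ∧ ∀ v, ‖v‖ < δ →
      Hty (Adm N E) f (fun y => (F (fun i => y i) - v, h (fun i => y i))) := by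
  let π : (N → ℝ) → (N → I) := fun x i => projIcc 0 1 zero_le_one (x i)
  have hπ : UniformContinuous π := by
    refine uniformContinuous_pi.2 fun i => ?_
    exact (LipschitzWith.projIcc zero_le_one).uniformContinuous.comp
      (Pi.uniformContinuous_proj _ i)
  have hπ' : ∀ y : N → I, π (fun i => y i) = y := by
    intro y; ext i; simp [π]
  have hu : UniformContinuous fun x => (f (π x)).1 :=
    (uniformContinuous_fst.comp (CompactSpace.uniformContinuous_of_continuous hf)).comp hπ
  obtain ⟨y₁, -, hmin⟩ := isCompact_univ.exists_isMinOn (Set.univ_nonempty)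
    (show ContinuousOn (fun y => ‖(f y).1‖ + |(f y).2|) Set.univ by fun_prop)
  set c := ‖(f y₁).1‖ + |(f y₁).2| with hc
  have hcpos : 0 < c := size_pos (hS y₁).1
  obtain ⟨F, hF, hFd⟩ := hu.exists_contDiff_dist_le (half_pos hcpos)
  refine ⟨c / 2, half_pos hcpos, F, fun x => (f (π x)).2, hF, ?_, ?_, ?_⟩
  · have := hπ.continuous
    fun_prop
  · intro y; simp only [hπ']
  · intro v hv
    have hFc := hF.continuous
    refine ⟨fun q => ((1 - (q.1 : ℝ)) • (f q.2).1 + (q.1 : ℝ) • (F (fun i => q.2 i) - v), (f q.2).2),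
      by fun_prop, ?_, ?_, ?_⟩
    · intro y; simp
    · intro y; simp [hπ']
    · intro s y
      refine ⟨?_, ?_⟩
      · intro h
        have h1 := congrArg Prod.fst h
        have h2 := congrArg Prod.snd h
        simp only [Prod.fst_zero, Prod.snd_zero] at h1 h2
        have h3 : c ≤ ‖(f y).1‖ + |(f y).2| := hmin (Set.mem_univ y)
        rw [h2, abs_zero, add_zero] at h3
        have h4 := hFd (fun i => y i)
        rw [hπ', dist_eq_norm] at h4
        have h5 : (f y).1 = -((s : ℝ) • (F (fun i => y i) - (f y).1 - v)) := by
          rw [eq_neg_iff_add_eq_zero, ← h1]; module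
        have h6 : ‖(s : ℝ) • (F (fun i => y i) - (f y).1 - v)‖ ≤ ‖F (fun i => y i) - (f y).1 - v‖ := by
          rw [norm_smul]
          refine mul_le_of_le_one_left (norm_nonneg _) ?_
          rw [Real.norm_eq_abs, abs_le]; constructor <;> linarith [s.2.1, s.2.2]
        have h7 := norm_sub_le (F (fun i => y i) - (f y).1) v
        rw [h5, norm_neg] at h3
        linarith
      · rintro hy ⟨-, h⟩
        have := (hS y).2 hy
        simp only [this] at h
        norm_num at h

/-- Low dimensional vanishing. -/
theorem low_dim [FiniteDimensional ℝ E] (hd : card N < Module.finrank ℝ E)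
    {f : (N → I) → E × ℝ} (hf : Continuous f) (hS : ∀ y, f y ∈ RL N E y) :
    Hty (RL N E) f (fun _ => (0, 1)) := by
  have : CompleteSpace E := FiniteDimensional.complete ℝ E
  obtain ⟨δ, hδ, F, h, hF, hh, hfh, H⟩ := approx hf hS
  have hden := (hF.of_le (by exact_mod_cast le_top)).dense_compl_range_of_finrank_lt_finrank
    (by simpa using hd)
  obtain ⟨v, hv, hvF⟩ := hden.exists_dist_lt 0 hδ
  rw [dist_comm, dist_zero_right] at hvF
  have hne : ∀ x, F x - v ≠ 0 := fun x h => hv ⟨x, sub_eq_zero.1 h⟩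
  have hFc := hF.continuous
  refine RL_of_Adm hS (fun y => ⟨by simp, fun _ => rfl⟩) ((H v hvF).trans ?_)
  refine Hty.trans (g := fun y => (F (fun i => y i) - v, 1)) ?_ ?_
  · refine ⟨fun q => (F (fun i => q.2 i) - v, (1 - (q.1 : ℝ)) * h (fun i => q.2 i) + q.1),
      by fun_prop, fun y => by simp, fun y => by simp, fun s y => ⟨?_, ?_⟩⟩
    · exact fun h => hne _ (congrArg Prod.fst h)
    · exact fun _ h => hne _ h.1
  · refine ⟨fun q => ((1 - (q.1 : ℝ)) • (F (fun i => q.2 i) - v), 1),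
      by fun_prop, fun y => by simp, fun y => by simp, fun s y => ⟨?_, ?_⟩⟩
    · exact fun h => absurd (congrArg Prod.snd h) one_ne_zero
    · exact fun _ h => absurd h.2 (by norm_num)

/-- Generation of the top homotopy group. -/
theorem gen_class [Nonempty N] (e : (N → ℝ) ≃L[ℝ] E) {g : HG[N; E]}
    (hg : Cl (Lin e) g) (a : HG[N; E]) : ∃ m : ℤ, a = g ^ m := by
  obtain ⟨f, hf, hS, rfl⟩ := rhg_surj a
  have : FiniteDimensional ℝ E := e.toLinearEquiv.finiteDimensional
  have : CompleteSpace E := FiniteDimensional.complete ℝ E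
  obtain ⟨δ, hδ, F, h, hF, hh, hfh, H⟩ := approx hf hS
  have hFc := hF.continuous
  have hFd : Differentiable ℝ F := hF.differentiable (by simp)
  let K : (N → ℝ) → (N → ℝ) := fun x => e.symm (F x)
  let K' : (N → ℝ) → (N → ℝ) →L[ℝ] (N → ℝ) := fun x =>
    (e.symm : E →L[ℝ] (N → ℝ)).comp (fderiv ℝ F x)
  have hK : ∀ x, HasFDerivAt K (K' x) x := fun x =>
    (e.symm : E →L[ℝ] (N → ℝ)).hasFDerivAt.comp x (hFd x).hasFDerivAt
  have hsard := MeasureTheory.addHaar_image_eq_zero_of_det_fderivWithin_eq_zero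
    (s := {x | (K' x).det = 0}) (MeasureTheory.volume : MeasureTheory.Measure (N → ℝ))
    (fun x _ => (hK x).hasFDerivWithinAt) (fun x hx => hx)
  obtain ⟨v, hv, hreg⟩ : ∃ v : E, ‖v‖ < δ ∧ ∀ x, F x = v → (K' x).det ≠ 0 := by
    let U : Set (N → ℝ) := {w | ‖e w‖ < δ}
    have hU : IsOpen U := isOpen_lt (by fun_prop) continuous_const
    have hU0 : U.Nonempty := ⟨0, by simpa [U] using hδ⟩
    have hpos := hU.measure_pos MeasureTheory.volume hU0
    obtain ⟨w, hw, hw'⟩ : ∃ w ∈ U, w ∉ K '' {x | (K' x).det = 0} := by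
      by_contra hcon
      simp only [not_exists, not_and, not_not] at hcon
      exact hpos.ne' (MeasureTheory.measure_mono_null hcon hsard)
    refine ⟨e w, hw, fun x hx hdet => hw' ⟨x, hdet, ?_⟩⟩
    simp [K, hx]
  have H := H v hv
  let Φ : (N → ℝ) → E × ℝ := fun x => (F x - v, h x)
  have hΦ : Continuous Φ := by simp only [Φ]; fun_prop
  have hbx : ∀ y : N → I, bx 0 1 y = fun i => (y i : ℝ) := by intro y; ext i; simp [bx]
  have hsur : ∀ x : N → ℝ, (∀ i, 0 ≤ x i) → (∀ i, x i ≤ 1) → ∃ y : N → I, x = fun i => (y i : ℝ) :=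
    fun x h1 h2 => ⟨fun i => ⟨x i, h1 i, h2 i⟩, rfl⟩
  have hder : ∀ x, F x - v = 0 → ∃ L : (N → ℝ) ≃L[ℝ] E,
      HasFDerivAt (fun x => (Φ x).1) (L : (N → ℝ) →L[ℝ] E) x := by
    intro x hx
    have hdet := hreg x (sub_eq_zero.1 hx)
    refine ⟨((K' x).toContinuousLinearEquivOfDetNeZero hdet).trans e, ?_⟩
    have : ((((K' x).toContinuousLinearEquivOfDetNeZero hdet).trans e : (N → ℝ) ≃L[ℝ] E) :
        (N → ℝ) →L[ℝ] E) = fderiv ℝ F x := by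
      ext y; simp [K']
    rw [this]
    exact (hFd x).hasFDerivAt.sub_const v
  let Zs : Set (N → ℝ) := Set.Icc 0 1 ∩ {x | NR (Φ x)}
  have hZc : IsCompact Zs := isCompact_Icc.inter_right (isClosed_NR.preimage hΦ)
  have hZf : Zs.Finite := by
    refine hZc.finite ⟨discreteTopology_subtype_iff.2 fun x hx => ?_⟩
    obtain ⟨L, hL⟩ := hder x hx.2.1
    have h1 := hL.eventually_ne (c := (0 : E)) ⟨_, L.antilipschitz⟩
    rw [← Filter.empty_mem_iff_bot, Filter.mem_inf_principal]
    filter_upwards [h1] with z hz hzZ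
    exact hz hzZ.2.1
  obtain ⟨m, hm⟩ := Cl.count e hg hΦ hZf.toFinset 0 1 (fun i => zero_le_one) (by
      intro x h1 h2
      obtain ⟨y, rfl⟩ := hsur x h1 h2
      exact (H.mem_right y).1) (by
      intro x h1 h2 h3
      rw [Set.Finite.mem_toFinset]
      exact ⟨⟨h1, h2⟩, h3⟩) (by
      intro x hx
      rw [Set.Finite.mem_toFinset] at hx
      refine ⟨hx.2, hder x hx.2.1, fun i => ?_⟩
      obtain ⟨y, rfl⟩ := hsur x hx.1.1 hx.1.2
      have hy : y ∉ boundary N := fun hy => (H.mem_right y).2 hy hx.2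
      have hy' : y i ≠ 0 ∧ y i ≠ 1 := by
        constructor
        · exact fun h => hy ⟨i, Or.inl h⟩
        · exact fun h => hy ⟨i, Or.inr h⟩
      exact ⟨unitInterval.pos_iff_ne_zero.2 hy'.1, unitInterval.lt_one_iff_ne_one.2 hy'.2⟩)
  refine ⟨m, (Cl.of_loop hf hS).unique ?_⟩
  refine Cl.hty (hm.congr fun y => ?_) H.symm
  simp only [hbx, Φ]

end sphere3

section SmoothPart
open scoped ContDiff

section degree

variable {D : Type*} [DecidableEq D] [Fintype D]

/-- Partial derivative. -/
noncomputable def pd (j : D) (f : (D → ℝ) → ℝ) (x : D → ℝ) : ℝ := fderiv ℝ f x (Pi.single j 1)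

theorem pd_smooth {f : (D → ℝ) → ℝ} (hf : ContDiff ℝ ∞ f) (j : D) : ContDiff ℝ ∞ (pd j f) := by
  have := hf.fderiv_right (m := ∞) (by simp)
  exact this.clm_apply contDiff_const

theorem pd_symm {f : (D → ℝ) → ℝ} (hf : ContDiff ℝ ∞ f) (j k : D) (x : D → ℝ) :
    pd j (pd k f) x = pd k (pd j f) x := by
  have hs : IsSymmSndFDerivAt ℝ f x := hf.contDiffAt.isSymmSndFDerivAt (by
    simp only [minSmoothness_of_isRCLikeNormedField]; exact WithTop.coe_le_coe.2 (le_top : (2 : ℕ∞) ≤ ⊤))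
  have hd : DifferentiableAt ℝ (fderiv ℝ f) x :=
    ((hf.fderiv_right (m := ∞) (by simp)).differentiable (by simp)) x
  have key : ∀ u v : D → ℝ, fderiv ℝ (fun y => fderiv ℝ f y v) x u = fderiv ℝ (fderiv ℝ f) x u v := by
    intro u v
    have := hd.hasFDerivAt.clm_apply (hasFDerivAt_const v x)
    rw [this.fderiv]; simp
  simp only [pd]
  unfold pd
  rw [key, key]
  exact hs _ _

/-- Jacobian matrix of a family of functions. -/
noncomputable def jac (g : D → (D → ℝ) → ℝ) (x : D → ℝ) : Matrix D D ℝ := Matrix.of fun k j => pd j (g k) x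

theorem det_jac (g : D → (D → ℝ) → ℝ) (x : D → ℝ) :
    (jac g x).det = ∑ ρ : Equiv.Perm D, (Equiv.Perm.sign ρ : ℤ) * ∏ k, pd (ρ k) (g k) x := by
  rw [← Matrix.det_transpose, Matrix.det_apply']
  rfl

theorem jac_det_cont {g : D → (D → ℝ) → ℝ} (hg : ∀ k, ContDiff ℝ ∞ (g k)) :
    Continuous fun x => (jac g x).det := by
  refine Continuous.matrix_det ?_
  refine continuous_pi fun k => continuous_pi fun j => ?_
  exact (pd_smooth (hg k) j).continuous

theorem jac_int_zero {g : D → (D → ℝ) → ℝ} (hg : ∀ k, ContDiff ℝ ∞ (g k)) (i : D)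
    (hi : HasCompactSupport (g i)) : ∫ x, (jac g x).det = 0 := by
  let R : Equiv.Perm D → (D → ℝ) → ℝ := fun ρ x => ∏ k ∈ univ.erase i, pd (ρ k) (g k) x
  have hR : ∀ ρ, ContDiff ℝ ∞ (R ρ) := fun ρ => contDiff_prod fun k _ => pd_smooth (hg k) _
  have hsplit : ∀ ρ x, ∏ k, pd (ρ k) (g k) x = R ρ x * pd (ρ i) (g i) x := by
    intro ρ x
    exact (Finset.prod_erase_mul _ _ (Finset.mem_univ i)).symm
  have hpc : ∀ j, HasCompactSupport (pd j (g i)) := fun j => hi.fderiv_apply ℝ _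
  have hI1 : ∀ ρ, MeasureTheory.Integrable fun x => R ρ x * pd (ρ i) (g i) x := fun ρ =>
    ((hR ρ).continuous.mul (pd_smooth (hg i) _).continuous).integrable_of_hasCompactSupport
      (hpc _).mul_left
  have hI2 : ∀ ρ, MeasureTheory.Integrable fun x => pd (ρ i) (R ρ) x * g i x := fun ρ =>
    ((pd_smooth (hR ρ) _).continuous.mul (hg i).continuous).integrable_of_hasCompactSupport
      hi.mul_left
  have hparts : ∀ ρ, ∫ x, R ρ x * pd (ρ i) (g i) x = - ∫ x, pd (ρ i) (R ρ) x * g i x := by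
    intro ρ
    exact integral_mul_fderiv_eq_neg_fderiv_mul_of_integrable (hI2 ρ) (hI1 ρ)
      (((hR ρ).continuous.mul (hg i).continuous).integrable_of_hasCompactSupport hi.mul_left)
      (fun x _ => (hR ρ).differentiable (by simp) x) (fun x _ => (hg i).differentiable (by simp) x)
  have hder : ∀ (ρ : Equiv.Perm D) (j : D) x, pd j (R ρ) x = ∑ k ∈ univ.erase i,
      (∏ l ∈ (univ.erase i).erase k, pd (ρ l) (g l) x) * pd j (pd (ρ k) (g k)) x := by
    intro ρ j x
    have := HasFDerivAt.finset_prod (u := univ.erase i) (g := fun k => pd (ρ k) (g k))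
      (g' := fun k => fderiv ℝ (pd (ρ k) (g k)) x) (x := x)
      (fun k _ => ((pd_smooth (hg k) _).differentiable (by simp) x).hasFDerivAt)
    simp only [pd] at this ⊢
    rw [show (fderiv ℝ (R ρ) x) = _ from this.fderiv]
    simp
  have hzero : ∀ x, ∑ ρ : Equiv.Perm D, ((Equiv.Perm.sign ρ : ℤ) : ℝ) * pd (ρ i) (R ρ) x = 0 := by
    intro x
    simp only [hder, Finset.mul_sum]
    rw [Finset.sum_comm]
    refine Finset.sum_eq_zero fun k hk => ?_
    have hki : k ≠ i := (Finset.mem_erase.1 hk).1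
    set T : Equiv.Perm D → ℝ := fun ρ => ((Equiv.Perm.sign ρ : ℤ) : ℝ) *
      ((∏ l ∈ (univ.erase i).erase k, pd (ρ l) (g l) x) * pd (ρ i) (pd (ρ k) (g k)) x) with hT
    have h1 : ∑ ρ, T (ρ * Equiv.swap i k) = ∑ ρ, T ρ :=
      Equiv.sum_comp (Equiv.mulRight (Equiv.swap i k)) T
    have h2 : ∀ ρ, T (ρ * Equiv.swap i k) = - T ρ := by
      intro ρ
      simp only [hT, Equiv.Perm.sign_mul, Equiv.Perm.sign_swap hki.symm, Equiv.Perm.mul_apply,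
        Equiv.swap_apply_left, Equiv.swap_apply_right]
      rw [pd_symm (hg k)]
      have : ∏ l ∈ (univ.erase i).erase k, pd (ρ (Equiv.swap i k l)) (g l) x =
          ∏ l ∈ (univ.erase i).erase k, pd (ρ l) (g l) x := by
        refine Finset.prod_congr rfl fun l hl => ?_
        simp only [Finset.mem_erase] at hl
        rw [Equiv.swap_apply_of_ne_of_ne hl.2.1 hl.1]
      rw [this]
      push_cast
      ring
    simp only [h2, Finset.sum_neg_distrib] at h1
    show ∑ ρ, T ρ = 0
    linarith
  simp only [det_jac, hsplit]
  rw [MeasureTheory.integral_finsetSum _ (fun ρ _ => (hI1 ρ).const_mul _)]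
  simp only [MeasureTheory.integral_const_mul, hparts]
  have : ∫ x, (∑ ρ : Equiv.Perm D, ((Equiv.Perm.sign ρ : ℤ) : ℝ) * pd (ρ i) (R ρ) x) * g i x = 0 := by
    simp [hzero]
  simp only [Finset.sum_mul, mul_assoc] at this
  rw [MeasureTheory.integral_finsetSum _ (fun ρ _ => (hI2 ρ).const_mul _)] at this
  simp only [MeasureTheory.integral_const_mul] at this
  simp only [mul_neg, Finset.sum_neg_distrib, this, neg_zero]

theorem jac_int_eq {g h : D → (D → ℝ) → ℝ} (hg : ∀ k, ContDiff ℝ ∞ (g k))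
    (hh : ∀ k, ContDiff ℝ ∞ (h k)) (hs : ∀ k, HasCompactSupport (g k - h k)) :
    ∫ x, ((jac g x).det - (jac h x).det) = 0 := by
  let m : Finset D → D → (D → ℝ) → ℝ := fun S k => if k ∈ S then g k else h k
  have hm : ∀ S k, ContDiff ℝ ∞ (m S k) := by
    intro S k; simp only [m]; split_ifs
    · exact hg k
    · exact hh k
  have step : ∀ (S : Finset D) (i : D), i ∉ S → ∀ x, (jac (m (insert i S)) x).det -
      (jac (m S) x).det = (jac (update (m S) i (g i - h i)) x).det := by
    intro S i hi x
    have e1 : jac (update (m S) i (g i - h i)) x =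
        (jac (m S) x).updateRow i (fun j => pd j (g i) x - pd j (h i) x) := by
      ext k j
      by_cases hk : k = i
      · subst hk
        simp only [jac, of_apply, Function.update_self, Matrix.updateRow_self, pd]
        rw [fderiv_sub ((hg k).differentiable (by simp) x) ((hh k).differentiable (by simp) x)]
        simp
      · simp [jac, hk, Matrix.updateRow_ne]
    have e2 : jac (m (insert i S)) x = (jac (m S) x).updateRow i (fun j => pd j (g i) x) := by
      ext k j
      by_cases hk : k = i
      · subst hk; simp [jac, m]
      · simp [jac, hk, Matrix.updateRow_ne, m]
    have e3 : jac (m S) x = (jac (m S) x).updateRow i (fun j => pd j (h i) x) := by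
      ext k j
      by_cases hk : k = i
      · subst hk; simp [jac, m, hi]
      · simp [jac, hk, Matrix.updateRow_ne, m]
    have := Matrix.det_updateRow_add (jac (m S) x) i (fun j => pd j (g i) x - pd j (h i) x)
      (fun j => pd j (h i) x)
    rw [e1, e2]
    conv_lhs => rw [e3]
    rw [sub_eq_iff_eq_add]
    simp only [Matrix.updateRow_idem]
    rw [← this]
    congr 2
    ext j; simp
  have main : ∀ S : Finset D, MeasureTheory.Integrable (fun x => (jac (m S) x).det - (jac h x).det) ∧
      ∫ x, ((jac (m S) x).det - (jac h x).det) = 0 := by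
    intro S
    induction S using Finset.induction_on with
    | empty => simp [m]
    | insert i S hi ih =>
      have hu : ∀ k, ContDiff ℝ ∞ (update (m S) i (g i - h i) k) := by
        intro k
        by_cases hk : k = i
        · subst hk; simp only [Function.update_self]; exact (hg k).sub (hh k)
        · simpa [hk] using hm S k
      have hc : HasCompactSupport (fun x => (jac (update (m S) i (g i - h i)) x).det) := by
        refine (hs i).mono' ?_
        intro x hx
        by_contra hxt
        apply hx
        refine Matrix.det_eq_zero_of_row_eq_zero i fun j => ?_
        simp only [jac, of_apply, Function.update_self, pd]
        rw [image_eq_zero_of_notMem_tsupport (fun h => hxt (tsupport_fderiv_subset ℝ h))]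
        rfl
      have e : ∀ x, (jac (m (insert i S)) x).det - (jac h x).det =
          (jac (update (m S) i (g i - h i)) x).det + ((jac (m S) x).det - (jac h x).det) := by
        intro x; rw [← step S i hi x]; ring
      simp only [e]
      have hI := (jac_det_cont hu).integrable_of_hasCompactSupport (μ := MeasureTheory.volume) hc
      refine ⟨hI.add ih.1, ?_⟩
      rw [MeasureTheory.integral_add hI ih.1, ih.2, jac_int_zero hu i (by simpa using hs i), add_zero]
  have := (main univ).2
  simpa [m] using this

theorem exists_bump (c : ℝ) (hc : 0 < c) : ∃ β : ℝ → ℝ, ContDiff ℝ ∞ β ∧ (∀ x, 0 ≤ deriv β x) ∧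
    0 < deriv β 0 ∧ ∀ x, c ≤ |x| → deriv β x = 0 := by
  let φ : ContDiffBump (0 : ℝ) := ⟨c / 2, c, by positivity, by linarith⟩
  have hd : ∀ x, HasDerivAt (fun u => ∫ t in (0:ℝ)..u, φ t) (φ x) x := fun x =>
    intervalIntegral.integral_hasDerivAt_right (φ.continuous.intervalIntegrable _ _)
      φ.continuous.stronglyMeasurable.stronglyMeasurableAtFilter φ.continuous.continuousAt
  have hd' : deriv (fun u => ∫ t in (0:ℝ)..u, φ t) = φ := funext fun x => (hd x).deriv
  refine ⟨fun u => ∫ t in (0:ℝ)..u, φ t, ?_, ?_, ?_, ?_⟩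
  · rw [contDiff_infty_iff_deriv, hd']
    exact ⟨fun x => (hd x).differentiableAt, φ.contDiff⟩
  · intro x; rw [hd']; exact φ.nonneg
  · rw [hd', φ.one_of_mem_closedBall (Metric.mem_closedBall_self (by positivity))]; exact one_pos
  · intro x hx
    rw [hd']
    exact φ.zero_of_le_dist (by simpa using hx)

theorem jac_comp {g : D → (D → ℝ) → ℝ} (hg : ∀ k, ContDiff ℝ ∞ (g k)) {β : ℝ → ℝ}
    (hβ : ContDiff ℝ ∞ β) (x : D → ℝ) :
    (jac (fun k x => β (g k x)) x).det = (∏ k, deriv β (g k x)) * (jac g x).det := by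
  rw [← Matrix.det_mul_column]
  congr 1
  ext k j
  simp only [jac, of_apply, pd]
  have h1 := ((hβ.differentiable (by simp)) (g k x)).hasDerivAt
  have h2 := ((hg k).differentiable (by simp) x).hasFDerivAt
  rw [show fderiv ℝ (fun x => β (g k x)) x = _ from (h1.comp_hasFDerivAt x h2).fderiv]
  simp

/-- The smooth core of the degree argument. -/
theorem no_smooth {G Φ : D → (D → ℝ) → ℝ} (hG : ∀ k, ContDiff ℝ ∞ (G k))
    (hΦ : ∀ k, ContDiff ℝ ∞ (Φ k)) {K : Set (D → ℝ)} (hK : IsCompact K)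
    (hoff : ∀ x ∉ K, ∀ k, Φ k x = G k x) {c : ℝ} (hc : 0 < c)
    (havoid : ∀ x ∈ K, ∃ k, c ≤ |Φ k x|) (ε : ℝ)
    (hpos : ∀ x ∈ K, (∀ k, |G k x| < c) → 0 < ε * (jac G x).det)
    (x₀ : D → ℝ) (hx₀ : x₀ ∈ interior K) (h0 : ∀ k, G k x₀ = 0) : False := by
  obtain ⟨β, hβ, hβ0, hβ1, hβc⟩ := exists_bump c hc
  have hGβ : ∀ k, ContDiff ℝ ∞ (fun x => β (G k x)) := fun k => hβ.comp (hG k)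
  have hΦβ : ∀ k, ContDiff ℝ ∞ (fun x => β (Φ k x)) := fun k => hβ.comp (hΦ k)
  have key := jac_int_eq (g := fun k x => β (G k x)) (h := fun k x => β (Φ k x)) hGβ hΦβ (by
    intro k
    refine HasCompactSupport.intro hK fun x hx => ?_
    simp [hoff x hx k])
  set J : (D → ℝ) → ℝ := fun x => (jac (fun k x => β (G k x)) x).det -
    (jac (fun k x => β (Φ k x)) x).det with hJ
  have hJc : Continuous J := (jac_det_cont hGβ).sub (jac_det_cont hΦβ)
  have hJK : ∀ x ∈ K, J x = (∏ k, deriv β (G k x)) * (jac G x).det := by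
    intro x hx
    obtain ⟨k, hk⟩ := havoid x hx
    simp only [hJ]
    rw [jac_comp hG hβ, jac_comp hΦ hβ, Finset.prod_eq_zero (f := fun k => deriv β (Φ k x))
      (Finset.mem_univ k) (hβc _ hk)]
    ring
  have hJoff : ∀ x ∉ K, J x = 0 := by
    intro x hx
    have : ∀ k, (fun x => β (G k x)) =ᶠ[nhds x] fun x => β (Φ k x) := by
      intro k
      filter_upwards [hK.isClosed.isOpen_compl.mem_nhds hx] with z hz
      rw [hoff z hz k]
    simp only [hJ, sub_eq_zero]
    congr 1
    ext k j
    simp only [jac, of_apply, pd]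
    rw [(this k).fderiv_eq]
  have hnn : ∀ x, 0 ≤ ε * J x := by
    intro x
    by_cases hx : x ∈ K
    · rw [hJK x hx]
      by_cases hcc : ∀ k, |G k x| < c
      · have := hpos x hx hcc
        have h2 : 0 ≤ ∏ k, deriv β (G k x) := Finset.prod_nonneg fun k _ => hβ0 _
        have := mul_nonneg h2 this.le
        linarith
      · simp only [not_forall, not_lt] at hcc
        obtain ⟨k, hk⟩ := hcc
        rw [Finset.prod_eq_zero (f := fun k => deriv β (G k x)) (Finset.mem_univ k) (hβc _ hk)]
        simp
    · rw [hJoff x hx, mul_zero]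
  have hx0 : 0 < ε * J x₀ := by
    rw [hJK x₀ (interior_subset hx₀)]
    have := hpos x₀ (interior_subset hx₀) (by simp [h0, hc])
    have h2 : 0 < ∏ k, deriv β (G k x₀) := Finset.prod_pos fun k _ => by rw [h0]; exact hβ1
    have := mul_pos h2 this
    linarith
  have hJs : HasCompactSupport fun x => ε * J x := by
    refine HasCompactSupport.intro hK fun x hx => ?_
    rw [hJoff x hx, mul_zero]
  have h3 := (continuous_const.mul hJc).integral_pos_of_hasCompactSupport_nonneg_nonzero
    (μ := MeasureTheory.volume) (f := fun x => ε * J x) hJs hnn hx0.ne'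
  rw [MeasureTheory.integral_const_mul, key, mul_zero] at h3
  exact lt_irrefl _ h3

/-- No nonvanishing extension with the boundary behaviour of a map of nonzero degree. -/
theorem no_ext {G : (D → ℝ) → (D → ℝ)} (hG : ContDiff ℝ ∞ G) {H : (D → I) → (D → ℝ)}
    (hH : Continuous H) (hH0 : ∀ y, H y ≠ 0)
    (hbd : ∀ y ∈ boundary D, ∀ s : I,
      (1 - (s : ℝ)) • G (fun i => y i) + (s : ℝ) • H y ≠ 0) (ε : ℝ)
    (hpos : ∀ x ∈ Set.Icc (0 : D → ℝ) 1, G x = 0 → 0 < ε * (jac (fun k x => G x k) x).det)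
    (x₀ : D → ℝ) (hx₀ : ∀ i, 0 < x₀ i ∧ x₀ i < 1) (h0 : G x₀ = 0) : False := by
  have hGk : ∀ k, ContDiff ℝ ∞ (fun x => G x k) := fun k => contDiff_pi.1 hG k
  have hGc := hG.continuous
  let π : (D → ℝ) → (D → I) := fun x i => projIcc 0 1 zero_le_one (x i)
  have hπ : UniformContinuous π := by
    refine uniformContinuous_pi.2 fun i => ?_
    exact (LipschitzWith.projIcc zero_le_one).uniformContinuous.comp
      (Pi.uniformContinuous_proj _ i)
  have hπc := hπ.continuous
  have hπ' : ∀ x ∈ Set.Icc (0 : D → ℝ) 1, (fun i => ((π x i : I) : ℝ)) = x := by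
    intro x hx; ext i
    exact congrArg Subtype.val (Set.projIcc_of_mem zero_le_one ⟨hx.1 i, hx.2 i⟩)
  let B : Set (D → ℝ) := Set.Icc 0 1
  have hB : IsCompact B := isCompact_Icc
  let B' : Set (D → ℝ) := {x | ∀ i, 0 < x i ∧ x i < 1}
  have hB'o : IsOpen B' := by
    have : B' = ⋂ i, {x : D → ℝ | 0 < x i ∧ x i < 1} := by ext x; simp [B']
    rw [this]
    exact isOpen_iInter_of_finite fun i => (isOpen_lt continuous_const (continuous_apply i)).inter
      (isOpen_lt (continuous_apply i) continuous_const)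
  have hB'B : B' ⊆ B := fun x hx => ⟨fun i => (hx i).1.le, fun i => (hx i).2.le⟩
  have hbdy : ∀ x ∈ B, x ∉ B' → π x ∈ boundary D := by
    intro x hx hx'
    simp only [B', Set.mem_setOf_eq, not_forall] at hx'
    obtain ⟨i, hi⟩ := hx'
    refine ⟨i, ?_⟩
    have h1 := hx.1 i; have h2 := hx.2 i
    simp only [Pi.zero_apply, Pi.one_apply] at h1 h2
    rcases eq_or_lt_of_le h1 with h | h
    · left; exact Set.projIcc_of_le_left _ h.symm.le
    · right; exact Set.projIcc_of_right_le _ (not_lt.1 fun h' => hi ⟨h, h'⟩)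
  -- good neighbourhood of the boundary
  let W : Set (D → ℝ) := {x | ∀ s : I, (1 - (s : ℝ)) • G x + (s : ℝ) • H (π x) ≠ 0}
  have hWo : IsOpen W := by
    have hcl : IsClosed {p : I × (D → ℝ) | (1 - (p.1 : ℝ)) • G p.2 + (p.1 : ℝ) • H (π p.2) = 0} :=
      isClosed_eq (by fun_prop) continuous_const
    have := isClosedMap_snd_of_compactSpace _ hcl
    rw [← isClosed_compl_iff]
    convert this using 1
    ext x
    simp [W, and_assoc]
  have hW : B \ B' ⊆ W := by
    intro x hx s
    have := hbd _ (hbdy x hx.1 hx.2) s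
    rwa [hπ' x hx.1] at this
  obtain ⟨τ, hτ0, hτ1, hτ⟩ := exists_contMDiffMap_zero_one_of_isClosed (n := (⊤ : ℕ∞))
    (modelWithCornersSelf ℝ (D → ℝ)) hB'o.isClosed_compl
    (hB.isClosed.sdiff hWo) (by
      rw [Set.disjoint_left]
      intro x hx hx'
      exact hx'.2 (hW ⟨hx'.1, hx⟩))
  have hτs : ContDiff ℝ ∞ τ := τ.contMDiff.contDiff
  have hτc := hτs.continuous
  let Φc : (D → ℝ) → (D → ℝ) := fun x => (1 - τ x) • G x + τ x • H (π x)
  have hΦc : Continuous Φc := by simp only [Φc]; fun_prop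
  have hΦ0 : ∀ x ∈ B, Φc x ≠ 0 := by
    intro x hx
    by_cases hxW : x ∈ W
    · exact hxW ⟨τ x, hτ x⟩
    · have : τ x = 1 := hτ1 ⟨hx, hxW⟩
      simpa [Φc, this] using hH0 (π x)
  obtain ⟨x₁, hx₁, hmin⟩ := hB.exists_isMinOn ⟨0, by simp [B]⟩ (hΦc.norm.continuousOn)
  have hm0 : 0 < ‖Φc x₁‖ := norm_pos_iff.2 (hΦ0 _ hx₁)
  -- positivity threshold
  obtain ⟨c₁, hc₁, hc₁'⟩ : ∃ c₁ > 0, ∀ x ∈ B, (∀ k, |G x k| < c₁) →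
      0 < ε * (jac (fun k x => G x k) x).det := by
    let Q : Set (D → ℝ) := B ∩ {x | ε * (jac (fun k x => G x k) x).det ≤ 0}
    have hQ : IsCompact Q := hB.inter_right
      (isClosed_le (continuous_const.mul (jac_det_cont hGk)) continuous_const)
    rcases Q.eq_empty_or_nonempty with hQe | hQn
    · refine ⟨1, one_pos, fun x hx _ => ?_⟩
      by_contra hcon
      have : x ∈ Q := ⟨hx, not_lt.1 hcon⟩
      rw [hQe] at this
      exact this
    · obtain ⟨x₂, hx₂, hmin₂⟩ := hQ.exists_isMinOn hQn (hGc.norm.continuousOn)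
      have hpos2 : 0 < ‖G x₂‖ := by
        rw [norm_pos_iff]
        intro h
        exact absurd (hpos x₂ hx₂.1 h) (not_lt.2 hx₂.2)
      refine ⟨‖G x₂‖, hpos2, fun x hx hk => ?_⟩
      by_contra hcon
      have h1 : ‖G x₂‖ ≤ ‖G x‖ := hmin₂ (show x ∈ Q from ⟨hx, not_lt.1 hcon⟩)
      have h2 : ‖G x‖ < ‖G x₂‖ := (pi_norm_lt_iff hpos2).2 hk
      linarith
  have hu : UniformContinuous fun x => H (π x) :=
    (CompactSpace.uniformContinuous_of_continuous hH).comp hπ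
  obtain ⟨F, hF, hFd⟩ := hu.exists_contDiff_dist_le (half_pos hm0)
  have hΦs : ContDiff ℝ ∞ fun x => (1 - τ x) • G x + τ x • F x :=
    ((contDiff_const.sub hτs).smul hG).add (hτs.smul hF)
  refine no_smooth (G := fun k x => G x k) (Φ := fun k x => ((1 - τ x) • G x + τ x • F x) k) hGk
    (fun k => contDiff_pi.1 hΦs k) hB ?_ (c := min c₁ (‖Φc x₁‖ / 2)) (lt_min hc₁ (half_pos hm0)) ?_ ε
    ?_ x₀ (interior_maximal hB'B hB'o hx₀) (fun k => congrFun h0 k)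
  · intro x hx k
    have : τ x = 0 := hτ0 (fun h => hx (hB'B h))
    simp [this]
  · intro x hx
    by_contra hcon
    simp only [not_exists, not_le] at hcon
    have h1 : ‖(1 - τ x) • G x + τ x • F x‖ < ‖Φc x₁‖ / 2 :=
      (pi_norm_lt_iff (half_pos hm0)).2 fun k => lt_of_lt_of_le (hcon k) (min_le_right _ _)
    have h2 : ‖Φc x₁‖ ≤ ‖Φc x‖ := hmin hx
    have h3 : Φc x = ((1 - τ x) • G x + τ x • F x) - τ x • (F x - H (π x)) := by
      simp only [Φc]; module
    have h4 : ‖τ x • (F x - H (π x))‖ ≤ ‖F x - H (π x)‖ := by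
      rw [norm_smul]
      refine mul_le_of_le_one_left (norm_nonneg _) ?_
      rw [Real.norm_eq_abs, abs_le]; constructor <;> linarith [(hτ x).1, (hτ x).2]
    have h5 := hFd x
    rw [dist_eq_norm] at h5
    have h6 := norm_sub_le ((1 - τ x) • G x + τ x • F x) (τ x • (F x - H (π x)))
    rw [← h3] at h6
    linarith
  · intro x hx hk
    exact hc₁' x hx fun k => lt_of_lt_of_le (hk k) (min_le_left _ _)

end degree

end SmoothPart

section SmoothPart
open scoped ContDiff

section order

variable {E : Type*} [NormedAddCommGroup E] [NormedSpace ℝ E] {N : Type*} [DecidableEq N] [Fintype N]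

theorem col_not_antipodal {v : E × ℝ} (hv : v ≠ 0) (R : ℝ) (s : I) :
    (1 - (s : ℝ)) • v + (s : ℝ) • col (shear R v) ≠ 0 := by
  intro h
  have h1 := congrArg Prod.fst h
  have h2 := congrArg Prod.snd h
  have hs0 := s.2.1; have hs1 := s.2.2
  by_cases hv1 : v.1 = 0
  · have hsh : shear R v = v := by ext <;> simp [shear, hv1]
    have hv2 : v.2 ≠ 0 := fun h2 => hv (Prod.ext hv1 h2)
    rw [hsh] at h2
    rcases lt_or_gt_of_ne hv2 with hn | hp
    · simp only [col, hv1, norm_zero, zero_sub, zero_add, abs_of_neg hn, Prod.snd_add, Prod.smul_snd,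
        smul_eq_mul, Prod.snd_zero] at h2
      rw [max_eq_right (by linarith), div_self (by linarith)] at h2
      rcases eq_or_lt_of_le hs0 with h0 | h0
      · rw [← h0] at h2; linarith
      · nlinarith [mul_nonneg (sub_nonneg.2 hs1) (neg_nonneg.2 hn.le)]
    · rw [col_base (by simp [hv1, hp.le])] at h2
      simp at h2
      rcases eq_or_lt_of_le hs0 with h0 | h0
      · rw [← h0] at h2; linarith
      · nlinarith [mul_nonneg (sub_nonneg.2 hs1) hp.le]
  · have hk : 0 ≤ max 0 (‖(shear R v).1‖ - (shear R v).2) / (‖(shear R v).1‖ + |(shear R v).2|) := by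
      positivity
    simp only [col, Prod.fst_add, Prod.smul_fst, Prod.fst_zero, Prod.snd_add, Prod.smul_snd,
      Prod.snd_zero, smul_eq_mul] at h1 h2
    set k := max 0 (‖(shear R v).1‖ - (shear R v).2) / (‖(shear R v).1‖ + |(shear R v).2|) with hkdef
    have e1 : (shear R v).1 = v.1 := rfl
    rw [e1, smul_smul, ← add_smul, smul_eq_zero] at h1
    have h3 := h1.resolve_right hv1
    have h4 : (s : ℝ) = 1 := by nlinarith [mul_nonneg hs0 hk]
    rw [h4] at h3 h2
    simp at h3 h2
    rw [h3] at h2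
    norm_num at h2

/-- The wrapping map. -/
noncomputable def wrapP (i₀ : N) (x : N → ℝ) : N → ℝ :=
  fun j => if j = i₀ then sin (2 * pi * x i₀) else x j - 1 / 2

theorem wrapP_cont (i₀ : N) : Continuous (wrapP i₀) := by
  refine continuous_pi fun j => ?_
  unfold wrapP
  split_ifs <;> fun_prop

theorem wrapP_i (i₀ : N) (x : N → ℝ) : wrapP i₀ x i₀ = sin (2 * pi * x i₀) := by
  simp [wrapP]

theorem wrapP_j {i₀ j : N} (h : j ≠ i₀) (x : N → ℝ) : wrapP i₀ x j = x j - 1 / 2 := by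
  simp [wrapP, h]

theorem wrap_half {x : ℝ} (h0 : 0 ≤ x) (h1 : x ≤ 1) (hs : sin (2 * pi * x) = 0)
    (hc : cos (2 * pi * x) ≤ 0) : x = 1 / 2 := by
  have e : 2 * pi * x = pi * (2 * x - 1) + pi := by ring
  rw [e, Real.sin_add_pi] at hs
  rw [e, Real.cos_add_pi] at hc
  have hpi := Real.pi_pos
  rcases eq_or_lt_of_le h0 with h | h
  · rw [← h] at hc; simp at hc
    norm_num at hc
  rcases eq_or_lt_of_le h1 with h' | h'
  · rw [h'] at hc; norm_num at hc
  have := (Real.sin_eq_zero_iff_of_lt_of_lt (x := pi * (2 * x - 1)) (by nlinarith) (by nlinarith)).1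
    (by linarith)
  rcases mul_eq_zero.1 this with h | h <;> linarith

theorem gen_order [Nonempty N] (e : (N → ℝ) ≃L[ℝ] E) {g : HG[N; E]}
    (hg : Cl (Lin e) g) {m : ℤ} (hm : g ^ m = 1) : m = 0 := by
  by_contra hm0
  obtain ⟨r, hr, hgr⟩ : ∃ r : ℕ, r ≠ 0 ∧ g ^ r = 1 := by
    refine ⟨m.natAbs, by simpa using hm0, ?_⟩
    rcases Int.natAbs_eq m with h | h
    · rw [h] at hm; simpa using hm
    · rw [h, zpow_neg, inv_eq_one] at hm; simpa using hm
  obtain ⟨i₀⟩ := ‹Nonempty N›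
  have : Nonempty N := ⟨i₀⟩
  have hPc := wrapP_cont i₀
  let Φ : (N → ℝ) → E × ℝ := fun x => (e (wrapP i₀ x), cos (2 * pi * x i₀))
  have hΦ : Continuous Φ := by simp only [Φ]; fun_prop
  have hΦ0 : ∀ x, Φ x ≠ 0 := by
    intro x h
    have h1 : wrapP i₀ x = 0 := by simpa [Φ] using congrArg Prod.fst h
    have h2 : cos (2 * pi * x i₀) = 0 := congrArg Prod.snd h
    have h3 := congrFun h1 i₀
    rw [wrapP_i] at h3
    have := Real.sin_sq_add_cos_sq (2 * pi * x i₀)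
    simp [h2, h3] at this
  have hNR : ∀ x, NR (Φ x) → sin (2 * pi * x i₀) = 0 ∧ cos (2 * pi * x i₀) = -1 ∧
      ∀ j, j ≠ i₀ → x j = 1 / 2 := by
    rintro x ⟨h1, h2⟩
    have h1 : wrapP i₀ x = 0 := by simpa [Φ] using h1
    have h3 : sin (2 * pi * x i₀) = 0 := by
      rw [← wrapP_i, h1]; rfl
    refine ⟨h3, ?_, fun j hj => ?_⟩
    · have := Real.sin_sq_add_cos_sq (2 * pi * x i₀)
      rw [h3] at this
      simp only [Φ] at h2
      nlinarith
    · have := congrFun h1 j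
      rw [wrapP_j hj] at this
      simp at this; linarith
  let top : ℕ → N → ℝ := fun k => update 1 i₀ (k : ℝ)
  have hbxi : ∀ (k : ℕ) (y : N → I), bx 0 (top k) y i₀ = k * y i₀ := by
    intro k y; simp [bx, top]; ring
  have hbxj : ∀ (k : ℕ) (y : N → I) j, j ≠ i₀ → bx 0 (top k) y j = y j := by
    intro k y j hj; simp [bx, top, hj]
  have hA : ∀ k : ℕ, ∀ y, Φ (bx 0 (top k) y) ∈ Adm N E y := by
    intro k y
    refine ⟨hΦ0 _, ?_⟩
    rintro ⟨j, hj⟩ hN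
    obtain ⟨h1, h2, h3⟩ := hNR _ hN
    by_cases hji : j = i₀
    · subst hji
      rw [hbxi] at h2
      rcases hj with hj | hj
      · rw [hj] at h2; simp at h2; norm_num at h2
      · rw [hj] at h2
        simp only [Set.Icc.coe_one, mul_one] at h2
        rw [show 2 * pi * (k : ℝ) = k * (2 * pi) by ring, Real.cos_nat_mul_two_pi] at h2
        norm_num at h2
    · have := h3 j hji
      rw [hbxj _ _ _ hji] at this
      rcases hj with hj | hj <;> rw [hj] at this <;> norm_num at this
  -- the basic class
  obtain ⟨β, hβ⟩ : ∃ β, Cl (fun y => Φ (bx 0 (top 1) y)) β := Cl.exists (by fun_prop) (hA 1)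
  have hβg : β = g ∨ β = g⁻¹ := by
    let M : Matrix N N ℝ := diagonal fun j => if j = i₀ then -(2 * pi) else 1
    have hM : IsUnit M.det := by
      rw [det_diagonal, isUnit_iff_ne_zero, Finset.prod_ne_zero_iff]
      intro j _
      split_ifs
      · have := Real.pi_pos; linarith
      · exact one_ne_zero
    let L₀ : (N → ℝ) ≃L[ℝ] (N → ℝ) :=
      (LinearEquiv.ofIsUnitDet (f := Matrix.toLin' M) (v := Pi.basisFun ℝ N) (v' := Pi.basisFun ℝ N) (by
        rw [LinearMap.toMatrix_eq_toMatrix', LinearMap.toMatrix'_toLin']; exact hM)).toContinuousLinearEquiv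
    have hL₀ : ∀ x, L₀ x = M *ᵥ x := fun x => rfl
    have hl := Hty.linearize hΦ (a := 0) (b := top 1) (p := fun _ => 1 / 2) (L₀.trans e)
      (fun i => by norm_num) (fun i => by
        by_cases hi : i = i₀
        · subst hi; norm_num [top]
        · norm_num [top, hi]) ?_ ?_ (fun x _ _ => hΦ0 x) ?_
    · obtain ⟨α, hα⟩ := Cl.exists hl.cont_right hl.mem_right
      have := (hβ.hty hl).unique hα
      rw [this]
      exact Lin_class e _ hg hα
    · have hP : HasFDerivAt (wrapP i₀) (L₀ : (N → ℝ) →L[ℝ] (N → ℝ)) (fun _ => 1 / 2) := by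
        rw [hasFDerivAt_pi']
        intro j
        by_cases hj : j = i₀
        · subst hj
          have h1 : HasFDerivAt (fun x : N → ℝ => 2 * pi * x j)
              ((2 * pi) • (proj j : (N → ℝ) →L[ℝ] ℝ)) (fun _ => 1 / 2) :=
            (proj (R := ℝ) (φ := fun _ : N => ℝ) j).hasFDerivAt.const_mul _
          have h2 := h1.sin
          have : (fun x : N → ℝ => wrapP j x j) = fun x => sin (2 * pi * x j) :=
            funext fun x => wrapP_i j x
          rw [this]
          refine h2.congr_fderiv ?_
          ext x
          simp only [ContinuousLinearMap.comp_apply, ContinuousLinearMap.proj_apply,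
            ContinuousLinearMap.smul_apply, ContinuousLinearEquiv.coe_coe, hL₀, M,
            Matrix.mulVec_diagonal]
          rw [show 2 * pi * (1 / 2) = pi by ring, Real.cos_pi]
          simp
        · have : (fun x : N → ℝ => wrapP i₀ x j) = fun x => x j - 1 / 2 :=
            funext fun x => wrapP_j hj x
          rw [this]
          refine ((proj (R := ℝ) (φ := fun _ : N => ℝ) j).hasFDerivAt.sub_const
            (1 / 2 : ℝ)).congr_fderiv ?_
          ext x
          simp only [ContinuousLinearMap.comp_apply, ContinuousLinearMap.proj_apply,
            ContinuousLinearEquiv.coe_coe, hL₀, M, Matrix.mulVec_diagonal]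
          simp [hj]
      exact (e : (N → ℝ) →L[ℝ] E).hasFDerivAt.comp _ hP
    · constructor
      · simp only [Φ]
        have : wrapP i₀ (fun _ : N => (1 / 2 : ℝ)) = 0 := by
          ext j
          by_cases hj : j = i₀
          · subst hj; rw [wrapP_i, show 2 * pi * (1 / 2) = pi by ring, Real.sin_pi]; rfl
          · rw [wrapP_j hj]; simp
        rw [this, map_zero]
      · simp only [Φ]
        rw [show 2 * pi * (1 / 2) = pi by ring, Real.cos_pi]
        norm_num
    · intro x h1 h2 h3
      obtain ⟨k1, k2, k3⟩ := hNR x h3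
      ext j
      by_cases hj : j = i₀
      · subst hj
        have := h2 j
        simp only [top, Function.update_self, Nat.cast_one] at this
        exact wrap_half (h1 j) this k1 (by rw [k2]; norm_num)
      · exact k3 j hj
  have hβr : β ^ r = 1 := by
    rcases hβg with h | h
    · rw [h, hgr]
    · rw [h, inv_pow, hgr, inv_one]
  have hpow : ∀ k : ℕ, Cl (fun y => Φ (bx 0 (top (k + 1)) y)) (β ^ (k + 1)) := by
    intro k
    induction k with
    | zero => simpa using hβ
    | succ k ih =>
      rw [pow_succ']
      refine Cl.cut hΦ (hA (k + 1 + 1)) i₀ ((k + 1 : ℕ) : ℝ) (by simp; positivity)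
        (by simp [top]) ?_ ?_
      · have : update (top (k + 1 + 1)) i₀ ((k + 1 : ℕ) : ℝ) = top (k + 1) := by
          simp [top]
        rw [this]; exact ih
      · refine hβ.congr fun y => ?_
        have e1 : bx (update 0 i₀ ((k + 1 : ℕ) : ℝ)) (top (k + 1 + 1)) y i₀ =
            y i₀ + (k + 1 : ℕ) := by simp [bx, top]; ring
        have e2 : bx 0 (top 1) y i₀ = y i₀ := by rw [hbxi]; simp
        have e3 : ∀ j, j ≠ i₀ → bx (update 0 i₀ ((k + 1 : ℕ) : ℝ)) (top (k + 1 + 1)) y j =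
            bx 0 (top 1) y j := by
          intro j hj; simp [bx, top, hj]
        have e4 : 2 * pi * ((y i₀ : ℝ) + (k + 1 : ℕ)) =
            2 * pi * y i₀ + (k + 1 : ℕ) * (2 * pi) := by ring
        simp only [Φ]
        rw [e1, e2, e4, Real.cos_add_nat_mul_two_pi]
        refine Prod.ext (congrArg e (funext fun j => ?_)) rfl
        by_cases hj : j = i₀
        · subst hj
          rw [wrapP_i, wrapP_i, e1, e2, e4, Real.sin_add_nat_mul_two_pi]
        · rw [wrapP_j hj, wrapP_j hj, e3 j hj]
  obtain ⟨k, rfl⟩ := Nat.exists_eq_succ_of_ne_zero hr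
  have hcl := hpow k
  rw [show k + 1 = k.succ from rfl, hβr] at hcl
  set f : (N → I) → E × ℝ := fun y => Φ (bx 0 (top k.succ) y) with hf
  have hfc : Continuous f := hcl.cont
  obtain ⟨R, hR⟩ := exists_R (K := f '' boundary N) (isClosed_boundary.isCompact.image hfc) (by
    rintro _ ⟨y, hy, rfl⟩
    exact (hcl.mem y).2 hy)
  have hR' := fun y hy => hR _ ⟨y, hy, rfl⟩
  have h1 := (Cl.of_col hfc hcl.mem R hR').unique hcl
  have hcS : ∀ y : N → I, ((0, 1) : E × ℝ) ∈ RL N E y := fun y => ⟨by simp, fun _ => rfl⟩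
  have h2 := (Cl.of_loop (f := fun _ : N → I => ((0, 1) : E × ℝ)) continuous_const hcS).unique
    (Cl.one continuous_const fun _ => not_NR_base)
  have h1 := (rhg_eq_iff _ _ _ _).1 (h1.trans h2.symm)
  obtain ⟨H, hc, H0, H1, HS⟩ := h1
  -- degree argument
  let sh : (Option N → I) → I × (N → I) := fun y => (y none, fun i => y (some i))
  have hsh : Continuous sh := by simp only [sh]; fun_prop
  let ov : E × ℝ → Option N → ℝ := fun v o => o.elim v.2 (e.symm v.1)
  have hovc : Continuous ov := by
    refine continuous_pi fun o => ?_
    cases o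
    · exact continuous_snd
    · exact (continuous_apply _).comp (e.symm.continuous.comp continuous_fst)
  have hovl : ∀ (a b : ℝ) (v w : E × ℝ), a • ov v + b • ov w = ov (a • v + b • w) := by
    intro a b v w
    ext o
    cases o <;> simp [ov]
  have hov0 : ∀ v, ov v = 0 → v = 0 := by
    intro v hv
    refine Prod.ext ?_ (congrFun hv none)
    have : e.symm v.1 = 0 := funext fun i => congrFun hv (some i)
    simpa using this
  let G : (Option N → ℝ) → Option N → ℝ := fun x o => o.elim
    (cos (2 * pi * (k.succ * x (some i₀))) + 3 * x none)
    (fun j => if j = i₀ then sin (2 * pi * (k.succ * x (some i₀))) else x (some j) - 1 / 2)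
  have hGf : ∀ y : Option N → I, G (fun i => y i) = ov (f (fun i => y (some i)) + (0, 3 * (y none : ℝ))) := by
    intro y
    ext o
    cases o with
    | none => simp only [G, ov, hf, Φ, Option.elim, hbxi]; rfl
    | some j =>
      simp only [G, ov, hf, Φ, Option.elim, Prod.fst_add, add_zero, ContinuousLinearEquiv.symm_apply_apply]
      by_cases hj : j = i₀
      · subst hj; rw [wrapP_i, hbxi]; simp
      · rw [wrapP_j hj, hbxj _ _ _ hj]; simp [hj]
  have hGs : ContDiff ℝ ∞ G := by
    rw [contDiff_pi]
    intro o
    cases o with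
    | none => simp only [G, Option.elim]; fun_prop
    | some j =>
      simp only [G, Option.elim]
      split_ifs <;> fun_prop
  have hGk : ∀ o, ContDiff ℝ ∞ (fun x => G x o) := contDiff_pi.1 hGs
  refine no_ext hGs (H := fun y => ov (H (sh y))) (by fun_prop) ?_ ?_
    (-1) ?_ (fun o => o.elim (1 / 3) fun j => if j = i₀ then 1 / (2 * k.succ) else 1 / 2) ?_ ?_
  · intro y h
    exact (HS _ _).1 (hov0 _ h)
  · intro y hy s h
    rw [hGf, hovl] at h
    have h := hov0 _ h
    have hs0 := s.2.1; have hs1 := s.2.2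
    have hy0 := (y none).2.1
    obtain ⟨o, ho⟩ := hy
    set z : N → I := fun i => y (some i) with hz
    have hfz := hcl.mem z
    -- the case where `H` takes the value `(0, 1)`
    have hcase : H (sh y) = (0, 1) → ¬ NR (f z + (0, 3 * (y none : ℝ))) → False := by
      intro h3 h4
      rw [h3] at h
      have k1 : (1 - (s : ℝ)) • (f z).1 = 0 := by simpa using congrArg Prod.fst h
      have k2 : (1 - (s : ℝ)) * ((f z).2 + 3 * y none) + s = 0 := by simpa [mul_add] using congrArg Prod.snd h
      apply h4
      rcases eq_or_lt_of_le hs1 with h5 | h5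
      · rw [h5] at k2; norm_num at k2
      · refine ⟨?_, ?_⟩
        · simpa using (smul_eq_zero.1 k1).resolve_left (by linarith)
        · simp only [Prod.snd_add]
          by_contra h6
          have := mul_pos (show 0 < 1 - (s : ℝ) by linarith) (not_le.1 h6)
          linarith
    cases o with
    | none =>
      rcases ho with ho | ho
      · rw [show sh y = (0, z) from Prod.ext ho rfl, H0, ho] at h
        simp only [Set.Icc.coe_zero, mul_zero] at h
        rw [show ((0, 0) : E × ℝ) = 0 from rfl, add_zero] at h
        exact col_not_antipodal hfz.1 R s h
      · refine hcase ?_ ?_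
        · rw [show sh y = (1, z) from Prod.ext ho rfl, H1]
        · rintro ⟨-, h4⟩
          rw [ho] at h4
          simp only [Prod.snd_add, Set.Icc.coe_one, mul_one, hf, Φ] at h4
          have := Real.neg_one_le_cos (2 * pi * bx 0 (top k.succ) z i₀)
          linarith
    | some j =>
      have hzb : z ∈ boundary N := ⟨j, ho⟩
      refine hcase ((HS _ _).2 hzb) ?_
      rintro ⟨h4, h5⟩
      refine hfz.2 hzb ⟨by simpa using h4, ?_⟩
      simp only [Prod.snd_add] at h5
      linarith
  · intro x hx hG0
    have g1 := congrFun hG0 none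
    have g2 := congrFun hG0 (some i₀)
    simp only [G, Option.elim, if_true, Pi.zero_apply] at g1 g2
    have hcos : cos (2 * pi * (k.succ * x (some i₀))) = -1 := by
      have := Real.sin_sq_add_cos_sq (2 * pi * (k.succ * x (some i₀)))
      rw [g2] at this
      have h0 := hx.1 none
      simp only [Pi.zero_apply] at h0
      nlinarith
    have hdiag : jac (fun o x => G x o) x = diagonal fun o : Option N =>
        o.elim (3 : ℝ) fun j => if j = i₀ then -(2 * pi * k.succ) else 1 := by
      have d1 : HasFDerivAt (fun x : Option N → ℝ => 2 * pi * (k.succ * x (some i₀)))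
          ((2 * pi) • ((k.succ : ℝ) • (proj (some i₀) : (Option N → ℝ) →L[ℝ] ℝ))) x :=
        ((proj (R := ℝ) (φ := fun _ : Option N => ℝ) (some i₀)).hasFDerivAt.const_mul _).const_mul _
      have dp : ∀ o, HasFDerivAt (fun x : Option N → ℝ => x o)
          (proj o : (Option N → ℝ) →L[ℝ] ℝ) x := fun o =>
        (proj (R := ℝ) (φ := fun _ : Option N => ℝ) o).hasFDerivAt
      ext o j
      simp only [jac, of_apply, pd]
      cases o with
      | none =>
        have d2 := d1.cos.add ((dp none).const_mul 3)
        rw [show fderiv ℝ (fun x => G x none) x = _ from d2.fderiv]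
        rw [g2]
        cases j <;> simp [diagonal_apply]
      | some l =>
        by_cases hl : l = i₀
        · subst hl
          have : (fun x => G x (some l)) = fun x => sin (2 * pi * (k.succ * x (some l))) := by
            funext x; simp [G]
          rw [this, d1.sin.fderiv, hcos]
          by_cases hj : j = some l
          · subst hj; simp [diagonal_apply]; try ring
          · simp [diagonal_apply, hj, Ne.symm hj, Pi.single_apply]
        · have : (fun x => G x (some l)) = fun x => x (some l) - 1 / 2 := by
            funext x; simp [G, hl]
          rw [this, ((dp (some l)).sub_const (1 / 2 : ℝ)).fderiv]
          by_cases hj : j = some l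
          · subst hj; simp [diagonal_apply, hl]
          · simp [diagonal_apply, hj, Ne.symm hj, Pi.single_apply]
    rw [hdiag, det_diagonal, Fintype.prod_option]
    simp only [Option.elim, Finset.prod_ite_eq', Finset.mem_univ, if_true]
    have := Real.pi_pos
    have h3 : (0 : ℝ) < k.succ := by positivity
    have := mul_pos this h3
    linarith
  · intro o
    cases o with
    | none => norm_num
    | some j =>
      simp only [Option.elim]
      split_ifs
      · have h3 : (1 : ℝ) ≤ k.succ := by simp
        constructor
        · positivity
        · rw [div_lt_one (by positivity)]; linarith
      · norm_num
  · have h3 : (k.succ : ℝ) ≠ 0 := by positivity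
    have e1 : 2 * pi * ((k.succ : ℝ) * (1 / (2 * k.succ))) = pi := by field_simp
    ext o
    cases o with
    | none => simp only [G, Option.elim, if_true]; rw [e1, Real.cos_pi]; simp
    | some j =>
      simp only [G, Option.elim, if_true]
      by_cases hj : j = i₀
      · rw [if_pos hj, e1, Real.sin_pi]; rfl
      · simp [hj]

end order

end SmoothPart

section telescope

theorem uniform_ne {X : Type*} [TopologicalSpace X] [CompactSpace X] {F : I × I × X → ℂ}
    (hF : Continuous F) (h : ∀ s x, F (s, s, x) ≠ 0) :
    ∃ n : ℕ, 0 < n ∧ ∀ s t : I, ∀ x, |(s : ℝ) - t| ≤ 1 / n → F (s, t, x) ≠ 0 := by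
  have hK : IsCompact {p | F p = 0} := (isClosed_eq hF continuous_const).isCompact
  by_cases hne : {p | F p = 0}.Nonempty
  · obtain ⟨p, hp, hmin⟩ := hK.exists_isMinOn hne
      (f := fun p : I × I × X => |(p.1 : ℝ) - p.2.1|) (by fun_prop)
    have hpos : 0 < |(p.1 : ℝ) - p.2.1| := by
      rw [abs_pos, sub_ne_zero]
      intro h1
      have h2 : p.1 = p.2.1 := Subtype.ext h1
      apply h p.1 p.2.2
      have : p = (p.1, p.1, p.2.2) := Prod.ext rfl (Prod.ext h2.symm rfl)
      rw [← this]; exact hp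
    obtain ⟨n, hn⟩ := exists_nat_one_div_lt hpos
    refine ⟨n + 1, Nat.succ_pos _, fun s t x hst h0 => ?_⟩
    have := hmin (a := (s, t, x)) h0
    simp only [Set.mem_setOf_eq] at this
    push_cast at hst
    linarith
  · exact ⟨1, one_pos, fun s t x _ h0 => hne ⟨_, h0⟩⟩

/-- Telescoping products of local transport matrices. -/
theorem telescope {X Y κ : Type*} [TopologicalSpace X] [CompactSpace X] [TopologicalSpace Y]
    [Fintype κ] [DecidableEq κ] (T : Y → Y → Mat(κ))
    (hT : Continuous fun p : Y × Y => T p.1 p.2) (hT1 : ∀ y, T y y = 1)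
    (R : GLn κ → Y → Y → Prop) (R1 : ∀ y, R 1 y y)
    (Rm : ∀ a b u v w, R a u v → R b v w → R (b * a) u w)
    (hR : ∀ u v, (T u v).det ≠ 0 → R (toGL (T u v)) u v)
    (c : I × X → Y) (hc : Continuous c) :
    ∃ Γ : I × X → GLn κ, Continuous Γ ∧ (∀ x, Γ (0, x) = 1) ∧
      (∀ t x, R (Γ (t, x)) (c (0, x)) (c (t, x))) ∧
      ∀ x, (∀ t, c (t, x) = c (0, x)) → ∀ t, Γ (t, x) = 1 := by
  obtain ⟨n, hn, hF⟩ := uniform_ne (X := X)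
    (F := fun p => (T (c (p.1, p.2.2)) (c (p.2.1, p.2.2))).det)
    (Continuous.matrix_det (hT.comp (f := fun p : I × I × X => (c (p.1, p.2.2), c (p.2.1, p.2.2)))
      (by fun_prop))) (fun s x => by simp [hT1])
  have hnr : (0 : ℝ) < n := by exact_mod_cast hn
  let k : ℕ → I → I := fun j t => min t (projIcc 0 1 zero_le_one ((j : ℝ) / n))
  have hk : ∀ j, Continuous (k j) := fun j => by simp only [k]; fun_prop
  have k0 : ∀ t, k 0 t = 0 := fun t => by
    simp only [k, Nat.cast_zero, zero_div]
    rw [Set.projIcc_of_le_left _ le_rfl]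
    exact min_eq_right t.2.1
  have kz : ∀ j, k j 0 = 0 := fun j => min_eq_left (projIcc 0 1 zero_le_one ((j : ℝ) / n)).2.1
  have kn : ∀ t, k n t = t := fun t => by
    simp only [k]
    rw [div_self hnr.ne', Set.projIcc_of_right_le _ le_rfl]
    exact min_eq_left t.2.2
  have kd : ∀ j t, |(k j t : ℝ) - k (j + 1) t| ≤ 1 / n := by
    intro j t
    simp only [k]
    have e : ∀ a b : I, ((min a b : I) : ℝ) = min (a : ℝ) b := fun a b =>
      Monotone.map_min (f := fun a : I => (a : ℝ)) (fun _ _ h => h)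
    rw [e, e]
    refine (abs_min_sub_min_le_max _ _ _ _).trans ?_
    rw [sub_self, abs_zero, max_eq_right (abs_nonneg _)]
    rw [Set.coe_projIcc, Set.coe_projIcc]
    refine (abs_max_sub_max_le_max _ _ _ _).trans ?_
    rw [sub_self, abs_zero, max_eq_right (abs_nonneg _)]
    refine (abs_min_sub_min_le_max _ _ _ _).trans ?_
    rw [sub_self, abs_zero, max_eq_right (abs_nonneg _)]
    push_cast
    rw [← sub_div, abs_div, abs_of_pos hnr]
    gcongr
    rw [abs_le]; constructor <;> linarith
  suffices H : ∀ j : ℕ, ∃ Γ : I × X → GLn κ, Continuous Γ ∧ (∀ x, Γ (0, x) = 1) ∧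
      (∀ t x, R (Γ (t, x)) (c (0, x)) (c (k j t, x))) ∧
      ∀ x, (∀ t, c (t, x) = c (0, x)) → ∀ t, Γ (t, x) = 1 by
    obtain ⟨Γ, h1, h2, h3, h4⟩ := H n
    exact ⟨Γ, h1, h2, fun t x => by have := h3 t x; rwa [kn] at this, h4⟩
  have htg1 : toGL (1 : Mat(κ)) = 1 := toGL_coe 1
  intro j
  induction j with
  | zero =>
    exact ⟨fun _ => 1, continuous_const, fun _ => rfl, fun t x => by rw [k0]; exact R1 _,
      fun _ _ _ => rfl⟩
  | succ j ih =>
    obtain ⟨Γ, h1, h2, h3, h4⟩ := ih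
    refine ⟨fun p => toGL (T (c (k j p.1, p.2)) (c (k (j + 1) p.1, p.2))) * Γ p, ?_, ?_, ?_, ?_⟩
    · refine Continuous.mul (toGL_cont (hT.comp (f := fun p : I × X =>
        (c (k j p.1, p.2), c (k (j + 1) p.1, p.2))) ?_) (fun p => hF _ _ _ (kd j p.1))) h1
      have := hk j; have := hk (j + 1)
      fun_prop
    · intro x
      simp only [kz, hT1, htg1, h2, one_mul]
    · intro t x
      exact Rm _ _ _ _ _ (h3 t x) (hR _ _ (hF _ _ _ (kd j t)))
    · intro x hx t
      simp only [hx (k j t), hx (k (j + 1) t), hT1, htg1, h4 x hx t, one_mul]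

end telescope

section fib

variable {ι : Type*} [Fintype ι] [DecidableEq ι]

/-- The real vector space `ℂ^ι × ℝ`, so that `EE ι × ℝ ≅ ℂ^(Option ι)`. -/
abbrev EE (ι : Type*) := (ι → ℂ) × ℝ

/-- Real coordinates on `ℂ^(Option ι)`. -/
def pV (w : Option ι → ℂ) : EE ι × ℝ := ((fun i => w (some i), (w none).im), (w none).re)

/-- Inverse of `pV`. -/
noncomputable def qV (v : EE ι × ℝ) : Option ι → ℂ :=
  fun o => o.elim ((v.2 : ℂ) + v.1.2 * Complex.I) v.1.1

theorem pV_qV (v : EE ι × ℝ) : pV (qV v) = v := by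
  refine Prod.ext (Prod.ext rfl ?_) ?_ <;> simp [pV, qV]

theorem qV_pV (w : Option ι → ℂ) : qV (pV w) = w := by
  ext o
  cases o with
  | none => simp [pV, qV]
  | some i => rfl

@[fun_prop] theorem pV_cont : Continuous (pV (ι := ι)) := by
  unfold pV; fun_prop

@[fun_prop] theorem qV_cont : Continuous (qV (ι := ι)) := by
  refine continuous_pi fun o => ?_
  cases o with
  | none => simp only [qV, Option.elim]; fun_prop
  | some i => simp only [qV, Option.elim]; fun_prop

/-- The base vector. -/
def e0 : Option ι → ℂ := Pi.single none 1

theorem pV_e0 : pV (e0 (ι := ι)) = (0, 1) := by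
  refine Prod.ext (Prod.ext ?_ ?_) ?_
  · ext i; simp [pV, e0]
  · simp [pV, e0]
  · simp [pV, e0]

theorem pV_zero : pV (0 : Option ι → ℂ) = 0 := by
  refine Prod.ext (Prod.ext ?_ ?_) ?_
  · ext i; simp [pV]
  · simp [pV]
  · simp [pV]

theorem pV_eq_zero {w : Option ι → ℂ} : pV w = 0 ↔ w = 0 := by
  rw [← pV_zero]
  exact ⟨fun h => by rw [← qV_pV w, h, qV_pV], fun h => by rw [h]⟩

theorem pV_inj {w w' : Option ι → ℂ} (h : pV w = pV w') : w = w' := by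
  rw [← qV_pV w, h, qV_pV]

/-- The column `A e0`. -/
def c0 (A : GLn (Option ι)) : Option ι → ℂ := (A : Mat(Option ι)) *ᵥ e0

theorem c0_apply (A : GLn (Option ι)) (i) : c0 A i = (A : Mat(Option ι)) i none := by
  simp [c0, e0]

theorem c0_mul (A B : GLn (Option ι)) :
    c0 (A * B) = (A : Mat(Option ι)) *ᵥ c0 B := by
  simp [c0]

theorem c0_one : c0 (1 : GLn (Option ι)) = e0 := by simp [c0]

@[fun_prop] theorem coe_GLn_cont : Continuous fun A : GLn ι => (A : Mat(ι)) :=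
  continuous_val

@[fun_prop] theorem c0_cont : Continuous (c0 (ι := ι)) := by
  unfold c0
  exact Continuous.matrix_mulVec coe_GLn_cont continuous_const

theorem mulVec_ne_zero (A : GLn ι) {w : ι → ℂ} (hw : w ≠ 0) : (A : Mat(ι)) *ᵥ w ≠ 0 := by
  intro h
  apply hw
  have : ((A⁻¹ : GLn ι) : Mat(ι)) *ᵥ ((A : Mat(ι)) *ᵥ w) = w := by
    rw [mulVec_mulVec, ← val_mul]; simp
  rw [← this, h, Matrix.mulVec_zero]

theorem e0_ne : (e0 : Option ι → ℂ) ≠ 0 := by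
  intro h; simpa [e0] using congrFun h none

theorem c0_ne (A : GLn (Option ι)) : c0 A ≠ 0 := mulVec_ne_zero A e0_ne

/-- The projection to the sphere. -/
def pE (A : GLn (Option ι)) : EE ι × ℝ := pV (c0 A)

@[fun_prop] theorem pE_cont : Continuous (pE (ι := ι)) := by unfold pE; fun_prop

theorem pE_ne (A : GLn (Option ι)) : pE A ≠ 0 := fun h => c0_ne A (pV_eq_zero.1 h)

theorem pE_one : pE (1 : GLn (Option ι)) = (0, 1) := by rw [pE, c0_one, pV_e0]

/-- The stabiliser of `e0`. -/
def St (ι : Type*) [Fintype ι] [DecidableEq ι] : Subgroup (GLn (Option ι)) where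
  carrier := {A | c0 A = e0}
  one_mem' := c0_one
  mul_mem' := by
    intro a b ha hb
    simp only [Set.mem_setOf_eq] at *
    rw [c0_mul, hb]; exact ha
  inv_mem' := by
    intro a ha
    simp only [Set.mem_setOf_eq] at *
    conv_rhs => rw [← c0_one, ← inv_mul_cancel a, c0_mul, ha]
    rfl

theorem mem_St {A : GLn (Option ι)} : A ∈ St ι ↔ c0 A = e0 := Iff.rfl

theorem mem_St' {A : GLn (Option ι)} : A ∈ St ι ↔ pE A = (0, 1) := by
  rw [mem_St, ← pV_e0]
  exact ⟨fun h => by rw [pE, h], fun h => pV_inj h⟩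

theorem pE_mul_St (A : GLn (Option ι)) {B} (hB : B ∈ St ι) : pE (A * B) = pE A := by
  rw [pE, c0_mul, mem_St.1 hB]; rfl

/-- The standard embedding. -/
noncomputable abbrev xs (A : GLn ι) : GLn (Option ι) := ext (Embedding.some) A

theorem coe_xs_none (A : GLn ι) (i : Option ι) :
    (xs A : Mat(Option ι)) i none = (1 : Mat(Option ι)) i none := by
  rw [xs, coe_ext]
  exact extM_col _ _ _ _ (by simp)

theorem coe_xs_none' (A : GLn ι) (i : Option ι) :
    (xs A : Mat(Option ι)) none i = (1 : Mat(Option ι)) none i := by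
  rw [xs, coe_ext]
  exact extM_row _ _ _ _ (by simp)

theorem xs_St (A : GLn ι) : xs A ∈ St ι := by
  rw [mem_St]
  ext i
  rw [c0_apply, coe_xs_none, ← c0_one, c0_apply]; rfl

@[fun_prop] theorem xs_cont : Continuous (fun A : GLn ι => xs A) := ext_cont _

/-- The lower right block. -/
noncomputable def resM (A : Mat(Option ι)) : Mat(ι) :=
  A.submatrix some some

theorem det_resM {A : Mat(Option ι)} (h : ∀ i, A (some i) none = 0)
    (h1 : A none none = 1) : A.det = (resM A).det := by
  let e : Option ι ≃ ι ⊕ Unit := Equiv.optionEquivSumPUnit ι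
  rw [← Matrix.det_submatrix_equiv_self e.symm A]
  have : A.submatrix e.symm e.symm = fromBlocks (resM A) 0
      (Matrix.of fun _ i => A none (some i)) 1 := by
    ext i j
    rcases i with i | i <;> rcases j with j | j <;> simp [e, resM, h, h1]
  rw [this, Matrix.det_fromBlocks_zero₁₂]
  simp

noncomputable def res (A : GLn (Option ι)) : GLn ι :=
  toGL (resM (A : Mat(Option ι)))

theorem St_entry {A : GLn (Option ι)} (h : A ∈ St ι) (i : Option ι) :
    (A : Mat(Option ι)) i none = (1 : Mat(Option ι)) i none := by
  rw [← c0_apply, mem_St.1 h, ← c0_one, c0_apply]; rfl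

theorem St_some {A : GLn (Option ι)} (h : A ∈ St ι) (i : ι) :
    (A : Mat(Option ι)) (some i) none = 0 := by
  rw [St_entry h]; simp

theorem St_none {A : GLn (Option ι)} (h : A ∈ St ι) :
    (A : Mat(Option ι)) none none = 1 := by
  rw [St_entry h]; simp

theorem St_det {A : GLn (Option ι)} (h : A ∈ St ι) :
    (resM (A : Mat(Option ι))).det ≠ 0 := by
  rw [← det_resM (St_some h) (St_none h)]
  exact GLn_det_ne A

theorem coe_res {A : GLn (Option ι)} (h : A ∈ St ι) :
    (res A : Mat(ι)) = resM (A : Mat(Option ι)) := coe_toGL (St_det h)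

theorem res_xs (A : GLn ι) : res (xs A) = A := by
  apply Units.ext
  rw [coe_res (xs_St A)]
  ext i j
  rw [resM, Matrix.submatrix_apply, xs, coe_ext, extM_some]

theorem res_one : res (1 : GLn (Option ι)) = 1 := by
  have := res_xs (1 : GLn ι)
  rwa [xs, map_one] at this

theorem res_cont {Z : Type*} [TopologicalSpace Z] {f : Z → GLn (Option ι)} (hf : Continuous f)
    (h : ∀ z, f z ∈ St ι) : Continuous fun z => res (f z) := by
  refine toGL_cont ?_ fun z => St_det (h z)
  exact (coe_GLn_cont.comp hf).matrix_submatrix _ _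

/-- The stabiliser retracts onto the smaller group. -/
theorem stab_hty {Z : Type*} [TopologicalSpace Z] {f : Z → GLn (Option ι)} (hf : Continuous f)
    (h : ∀ z, f z ∈ St ι) :
    Hty (fun z => {A | A ∈ St ι ∧ res A = res (f z) ∧ (f z = xs (res (f z)) → A = f z)})
      f (fun z => xs (res (f z))) := by
  let K : I × Z → Mat(Option ι) := fun p => Matrix.of fun i j =>
    if i = none ∧ j ≠ none then (1 - (p.1 : ℂ)) * (f p.2 : Mat(Option ι)) i j else
      (f p.2 : Mat(Option ι)) i j
  have hfe : ∀ i j, Continuous fun z => (f z : Mat(Option ι)) i j := fun i j =>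
    (continuous_apply_apply i j).comp (coe_GLn_cont.comp hf)
  have hK : Continuous K := by
    refine continuous_matrix fun i j => ?_
    have := hfe i j
    simp only [K, of_apply]
    split_ifs
    · have h2 : Continuous fun p : I × Z => (f p.2 : Mat(Option ι)) i j :=
        this.comp continuous_snd
      have h3 : Continuous fun p : I × Z => (1 - ((p.1 : ℝ) : ℂ)) := by fun_prop
      exact h3.mul h2
    · exact this.comp continuous_snd
  have hres : ∀ p, resM (K p) = resM (f p.2 : Mat(Option ι)) := by
    intro p; ext i j; simp [resM, K]
  have hdet : ∀ p, (K p).det ≠ 0 := by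
    intro p
    rw [det_resM (fun i => by simpa [K] using St_some (h p.2) i) (by simpa [K] using St_none (h p.2)),
      hres]
    exact St_det (h p.2)
  have hK0 : ∀ z, K (0, z) = f z := by intro z; ext i j; simp [K]
  have hSt : ∀ p, toGL (K p) ∈ St ι := by
    intro p
    rw [mem_St, ← mem_St.1 (h p.2)]
    ext i
    rw [c0_apply, c0_apply, coe_toGL (hdet p)]
    simp [K]
  refine ⟨fun p => toGL (K p), toGL_cont hK hdet, fun z => ?_, fun z => ?_, fun t z => ⟨hSt _, ?_, ?_⟩⟩
  · simp only [hK0, toGL_coe]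
  · apply Units.ext
    simp only
    rw [coe_toGL (hdet _), xs, coe_ext, coe_res (h z)]
    ext i j
    cases i with
    | none =>
      rw [extM_row _ _ _ _ (by simp)]
      cases j with
      | none => simpa [K] using St_none (h z)
      | some j => simp [K]
    | some i =>
      cases j with
      | none =>
        rw [extM_col _ _ _ _ (by simp)]
        simpa [K] using St_some (h z) i
      | some j => rw [extM_some]; simp [K, resM]
  · apply Units.ext
    rw [coe_res (hSt _), coe_res (h z), coe_toGL (hdet _), hres]
  · intro hz
    apply Units.ext
    simp only
    rw [coe_toGL (hdet _)]
    ext i j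
    simp only [K, of_apply]
    split_ifs with hij
    · rw [hz, hij.1, coe_xs_none', Matrix.one_apply_ne (Ne.symm hij.2)]; simp
    · rfl

/-- The local transport. -/
noncomputable def trV (u v : Option ι → ℂ) : Mat(Option ι) :=
  1 + (star u ⬝ᵥ u)⁻¹ • Matrix.vecMulVec (v - u) (star u)

open scoped ComplexOrder in
theorem dot_ne {κ : Type*} [Fintype κ] {u : κ → ℂ} (hu : u ≠ 0) : star u ⬝ᵥ u ≠ 0 := fun h =>
  hu (dotProduct_star_self_eq_zero.1 h)

theorem trV_apply {u : Option ι → ℂ} (hu : u ≠ 0) (v : Option ι → ℂ) : trV u v *ᵥ u = v := by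
  have h := dot_ne hu
  rw [trV, Matrix.add_mulVec, Matrix.one_mulVec, Matrix.smul_mulVec, Matrix.vecMulVec_mulVec]
  ext i
  simp
  field_simp
  ring

/-- Lifting of homotopies. -/
theorem lift_hty {Z : Type*} [TopologicalSpace Z] [CompactSpace Z] {f : Z → GLn (Option ι)}
    (hf : Continuous f) {c : I × Z → EE ι × ℝ} (hc : Continuous c) (hne : ∀ p, c p ≠ 0)
    (h0 : ∀ z, c (0, z) = pE (f z)) :
    ∃ F : I × Z → GLn (Option ι), Continuous F ∧ (∀ z, F (0, z) = f z) ∧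
      (∀ t z, pE (F (t, z)) = c (t, z)) ∧
      ∀ z, (∀ t, c (t, z) = c (0, z)) → ∀ t, F (t, z) = f z := by
  have hq : ∀ p, qV (c p) ≠ 0 := fun p h => hne p (by rw [← pV_qV (c p), h, pV_zero])
  obtain ⟨Γ, h1, h2, h3, h4⟩ := telescope (X := Z) (Y := {w : Option ι → ℂ // w ≠ 0}) (κ := Option ι)
    (fun u v => trV u.1 v.1) (by
      unfold trV
      have hs : ∀ p : {w : Option ι → ℂ // w ≠ 0} × {w : Option ι → ℂ // w ≠ 0}, star p.1.1 ⬝ᵥ p.1.1 ≠ 0 := fun p => dot_ne p.1.2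
      refine continuous_const.add (Continuous.smul (Continuous.inv₀ ?_ hs) ?_)
      · exact Continuous.dotProduct (by fun_prop) (by fun_prop)
      · exact Continuous.matrix_vecMulVec (by fun_prop) (by fun_prop))
    (fun y => by simp [trV])
    (fun A u v => (A : Mat(Option ι)) *ᵥ u.1 = v.1) (fun y => by simp)
    (fun a b u v w h h' => by rw [val_mul, ← mulVec_mulVec, h, h'])
    (fun u v h => by rw [coe_toGL h]; exact trV_apply u.2 _)
    (fun p => ⟨qV (c p), hq p⟩) (by fun_prop)
  have hp : ∀ t z, pE (Γ (t, z) * f z) = c (t, z) := by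
    intro t z
    rw [pE, c0_mul]
    have : c0 (f z) = qV (c (0, z)) := by rw [h0, pE, qV_pV]
    rw [this, h3 t z, pV_qV]
  refine ⟨fun p => Γ p * f p.2, by fun_prop, fun z => by simp [h2], hp, fun z hz t => ?_⟩
  simp only
  rw [h4 z (fun t => Subtype.ext (by simp only [hz t])) t, one_mul]

end fib

section fib2

variable {ι : Type*} [Fintype ι] [DecidableEq ι] {N : Type*} [Fintype N] [DecidableEq N]

/-- Points of the cube `Option N → I`. -/
def oc (t : I) (x : N → I) : Option N → I := fun o => o.elim t x

theorem oc_eta (y : Option N → I) : oc (y none) (fun i => y (some i)) = y := by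
  ext o; cases o <;> rfl

@[simp] theorem oc_none (t : I) (x : N → I) : oc t x none = t := rfl
@[simp] theorem oc_some (t : I) (x : N → I) (i : N) : oc t x (some i) = x i := rfl

@[fun_prop] theorem oc_cont {Z : Type*} [TopologicalSpace Z] {t : Z → I} {x : Z → N → I}
    (ht : Continuous t) (hx : Continuous x) : Continuous fun z => oc (t z) (x z) := by
  refine continuous_pi fun o => ?_
  cases o
  · exact ht
  · rename_i i
    exact (continuous_apply i).comp hx

theorem bdry_option (y : Option N → I) : y ∈ boundary (Option N) ↔
    y none = 0 ∨ y none = 1 ∨ (fun i => y (some i)) ∈ boundary N := by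
  constructor
  · rintro ⟨o, h⟩
    cases o with
    | none => exact h.elim Or.inl (fun h => Or.inr (Or.inl h))
    | some i => exact Or.inr (Or.inr ⟨i, h⟩)
  · rintro (h | h | ⟨i, h⟩)
    · exact ⟨none, Or.inl h⟩
    · exact ⟨none, Or.inr h⟩
    · exact ⟨some i, h⟩

theorem finrank_EE : Module.finrank ℝ (EE ι) = 2 * card ι + 1 := by
  rw [Module.finrank_prod, Module.finrank_pi_fintype]
  simp [Complex.finrank_real_complex, mul_comm]

theorem compress {f : (N → I) → GLn (Option ι)} (hf : Continuous f)
    (h : Hty (RL N (EE ι)) (fun y => pE (f y)) (fun _ => (0, 1))) :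
    ∃ f' : (N → I) → GLn (Option ι), (∀ y, f' y ∈ St ι) ∧
      Hty (fun y => {A | y ∈ boundary N → A = f y}) f f' := by
  obtain ⟨c, hc, h0, h1, hS⟩ := h
  obtain ⟨F, hF, F0, Fp, Fc⟩ := lift_hty hf hc (fun p => (hS p.1 p.2).1) h0
  refine ⟨fun y => F (1, y), fun y => ?_, F, hF, F0, fun _ => rfl, fun t y hy => ?_⟩
  · rw [mem_St', Fp, h1]
  · exact Fc y (fun t => by rw [(hS t y).2 hy, (hS 0 y).2 hy]) t

theorem pE_RL {f : (N → I) → GLn (Option ι)} (h : ∀ y ∈ boundary N, f y ∈ St ι) (y : N → I) :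
    pE (f y) ∈ RL N (EE ι) y := ⟨pE_ne _, fun hy => mem_St'.1 (h y hy)⟩

theorem surj_xs (hN : card N ≤ 2 * card ι) {f : (N → I) → GLn (Option ι)}
    (hf : Continuous f) (hb : ∀ y ∈ boundary N, f y = 1) :
    ∃ g : (N → I) → GLn ι, Continuous g ∧ (∀ y ∈ boundary N, g y = 1) ∧
      Hty (LS N (1 : GLn (Option ι))) f (fun y => xs (g y)) := by
  obtain ⟨f', h1, h2⟩ := compress hf (low_dim (by rw [finrank_EE]; omega) (by fun_prop)
    (pE_RL (fun y hy => by rw [hb y hy]; exact one_mem _)))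
  have hf' : ∀ y ∈ boundary N, f' y = 1 := fun y hy => by
    rw [h2.mem_right y hy, hb y hy]
  refine ⟨fun y => res (f' y), res_cont h2.cont_right h1, fun y hy => ?_, ?_⟩
  · simp only; rw [hf' y hy, res_one]
  · refine Hty.trans (g := f') (h2.mono fun y A hA hy => ?_)
      ((stab_hty h2.cont_right h1).mono fun y A hA hy => ?_)
    · rw [hA hy, hb y hy]
    · rw [hA.2.2 (by rw [hf' y hy, res_one, xs, map_one]), hf' y hy]

theorem null_of_H {g : (N → I) → GLn ι} {H : (Option N → I) → GLn (Option ι)} (hH : Continuous H)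
    (H0 : ∀ x, H (oc 0 x) = xs (g x)) (H1 : ∀ x, H (oc 1 x) = 1)
    (Hb : ∀ t, ∀ x ∈ boundary N, H (oc t x) = 1)
    (h : Hty (RL (Option N) (EE ι)) (fun y => pE (H y)) (fun _ => (0, 1))) :
    Hty (LS N (1 : GLn ι)) g (fun _ => 1) := by
  obtain ⟨K, h1, h2⟩ := compress hH h
  have hK : ∀ y ∈ boundary (Option N), K y = H y := fun y hy => h2.mem_right y hy
  refine ⟨fun p => res (K (oc p.1 p.2)), res_cont (h2.cont_right.comp (by fun_prop)) (fun p => h1 _),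
    fun x => ?_, fun x => ?_, fun t x hx => ?_⟩
  · simp only
    rw [hK _ ((bdry_option _).2 (Or.inl rfl)), H0, res_xs]
  · simp only
    rw [hK _ ((bdry_option _).2 (Or.inr (Or.inl rfl))), H1, res_one]
  · simp only
    rw [hK _ ((bdry_option _).2 (Or.inr (Or.inr hx))), Hb t x hx, res_one]

theorem H_St {g : (N → I) → GLn ι} {H : (Option N → I) → GLn (Option ι)}
    (H0 : ∀ x, H (oc 0 x) = xs (g x)) (H1 : ∀ x, H (oc 1 x) = 1)
    (Hb : ∀ t, ∀ x ∈ boundary N, H (oc t x) = 1) (y : Option N → I)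
    (hy : y ∈ boundary (Option N)) : H y ∈ St ι := by
  rw [← oc_eta y]
  rcases (bdry_option y).1 hy with h | h | h
  · rw [h, H0]; exact xs_St _
  · rw [h, H1]; exact one_mem _
  · rw [Hb _ _ h]; exact one_mem _

theorem inj_xs (hN : card N + 1 ≤ 2 * card ι) {g : (N → I) → GLn ι}
    (h : Hty (LS N (1 : GLn (Option ι))) (fun y => xs (g y)) (fun _ => 1)) :
    Hty (LS N (1 : GLn ι)) g (fun _ => 1) := by
  obtain ⟨H, hc, h0, h1, hS⟩ := h
  have H0 : ∀ x : N → I, (fun y : Option N → I => H (y none, fun i => y (some i))) (oc 0 x) =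
    xs (g x) := h0
  have H1 : ∀ x : N → I, (fun y : Option N → I => H (y none, fun i => y (some i))) (oc 1 x) =
    1 := h1
  have Hb : ∀ t, ∀ x ∈ boundary N,
      (fun y : Option N → I => H (y none, fun i => y (some i))) (oc t x) = 1 := fun t x hx => hS t x hx
  exact null_of_H (H := fun y : Option N → I => H (y none, fun i => y (some i)))
    (by fun_prop) H0 H1 Hb (low_dim (by
    rw [finrank_EE, Fintype.card_option]; omega) (by fun_prop) (pE_RL (H_St H0 H1 Hb)))

end fib2

section emb

variable {ι : Type*} [Fintype ι] [DecidableEq ι] {κ : Type*} [Fintype κ] [DecidableEq κ]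
  {N : Type*} [Fintype N] [DecidableEq N]

theorem Hty.ext (e : ι ↪ κ) {f g : (N → I) → GLn ι} (h : Hty (LS N (1 : GLn ι)) f g) :
    Hty (LS N (1 : GLn κ)) (fun y => ext e (f y)) (fun y => ext e (g y)) :=
  h.post (fun _ A => BottSU.ext e A) ((ext_cont e).comp continuous_snd) (fun y A hA hy => by
    rw [hA hy, map_one])

theorem ext_symm_apply (q : ι ≃ κ) (A : GLn κ) :
    ext q.toEmbedding (ext q.symm.toEmbedding A) = A := by
  rw [ext_trans]
  have : q.symm.toEmbedding.trans q.toEmbedding = Embedding.refl κ := by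
    ext x; simp
  rw [this, ext_refl]

theorem ext_surj (hN : card N ≤ 2 * card ι) (m : ℕ) :
    ∀ (κ : Type) [Fintype κ] [DecidableEq κ] (hm : card κ = card ι + m) (e : ι ↪ κ)
    (f : (N → I) → GLn κ) (hf : Continuous f) (hb : ∀ y ∈ boundary N, f y = 1),
    ∃ g : (N → I) → GLn ι, Continuous g ∧ (∀ y ∈ boundary N, g y = 1) ∧
      Hty (LS N (1 : GLn κ)) f (fun y => ext e (g y)) := by
  induction m with
  | zero =>
    intro κ _ _ hm e f hf hb
    have hbij : Function.Bijective e := (Fintype.bijective_iff_injective_and_card _).2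
      ⟨e.injective, by omega⟩
    let q : ι ≃ κ := Equiv.ofBijective e hbij
    have hq : q.toEmbedding = e := by ext x; rfl
    refine ⟨fun y => ext q.symm.toEmbedding (f y), (ext_cont _).comp hf, fun y hy => ?_, ?_⟩
    · simp only; rw [hb y hy, map_one]
    · rw [← hq]
      simp only [ext_symm_apply]
      exact Hty.refl hf hb
  | succ m ih =>
    intro κ _ _ hm e f hf hb
    let q : Option (Fin (card ι + m)) ≃ κ := Fintype.equivOfCardEq (by
      rw [Fintype.card_option, Fintype.card_fin]; omega)
    obtain ⟨g', hg', hgb, h1⟩ := surj_xs (ι := Fin (card ι + m)) (by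
      rw [Fintype.card_fin]; omega)
      (f := fun y => ext q.symm.toEmbedding (f y)) ((ext_cont _).comp hf) (fun y hy => by
        rw [hb y hy, map_one])
    have e' : ι ↪ Fin (card ι + m) :=
      (Fintype.equivFin ι).toEmbedding.trans (Fin.castAddEmb m)
    obtain ⟨g, hg, hb', h2⟩ := ih (Fin (card ι + m)) (Fintype.card_fin _) e' g' hg' hgb
    refine ⟨g, hg, hb', ?_⟩
    have h3 := (h1.ext q.toEmbedding).trans ((h2.ext Embedding.some).ext q.toEmbedding)
    simp only [ext_symm_apply] at h3
    refine h3.trans ?_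
    simp only [ext_trans]
    exact ext_any hg hb' _ _

theorem ext_null (hN : card N + 1 ≤ 2 * card ι) (m : ℕ) :
    ∀ (κ : Type) [Fintype κ] [DecidableEq κ] (hm : card κ = card ι + m) (e : ι ↪ κ)
    (g : (N → I) → GLn ι) (hg : Continuous g) (hb : ∀ y ∈ boundary N, g y = 1)
    (h : Hty (LS N (1 : GLn κ)) (fun y => ext e (g y)) (fun _ => 1)),
    Hty (LS N (1 : GLn ι)) g (fun _ => 1) := by
  induction m with
  | zero =>
    intro κ _ _ hm e g hg hb h
    have hbij : Function.Bijective e := (Fintype.bijective_iff_injective_and_card _).2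
      ⟨e.injective, by omega⟩
    let q : ι ≃ κ := Equiv.ofBijective e hbij
    have hq : q.toEmbedding = e := by ext x; rfl
    have h1 := h.ext q.symm.toEmbedding
    have h2 := fun A => ext_symm_apply q.symm A
    rw [Equiv.symm_symm, hq] at h2
    simpa only [h2, map_one] using h1
  | succ m ih =>
    intro κ _ _ hm e g hg hb h
    let q : Option (Fin (card ι + m)) ≃ κ := Fintype.equivOfCardEq (by
      rw [Fintype.card_option, Fintype.card_fin]; omega)
    have e' : ι ↪ Fin (card ι + m) :=
      (Fintype.equivFin ι).toEmbedding.trans (Fin.castAddEmb m)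
    refine ih (Fin (card ι + m)) (Fintype.card_fin _) e' g hg hb ?_
    refine inj_xs (by rw [Fintype.card_fin]; omega) ?_
    have h1 := (ext_any hg hb ((e'.trans Embedding.some).trans q.toEmbedding) e).trans h
    have h2 := h1.ext q.symm.toEmbedding
    have h4 : ((e'.trans Embedding.some).trans q.toEmbedding).trans q.symm.toEmbedding =
        e'.trans Embedding.some := by ext x; simp
    simpa only [ext_trans, map_one, xs, h4] using h2

end emb

section rel

variable {ι : Type*} [Fintype ι] [DecidableEq ι] {N : Type*} [Fintype N] [DecidableEq N]

theorem Cl.null {E : Type*} [NormedAddCommGroup E] [NormedSpace ℝ E] [Nonempty N]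
    {f : (N → I) → E × ℝ} (h : Cl f 1) (hS : ∀ y, f y ∈ RL N E y) :
    Hty (RL N E) f (fun _ => (0, 1)) := by
  have h1 := (Cl.of_loop h.cont hS).unique h
  have hcS : ∀ y : N → I, ((0, 1) : E × ℝ) ∈ RL N E y := fun y => ⟨by simp, fun _ => rfl⟩
  have h2 := (Cl.of_loop (f := fun _ : N → I => ((0, 1) : E × ℝ)) continuous_const hcS).unique
    (Cl.one continuous_const fun _ => not_NR_base)
  exact (rhg_eq_iff _ _ _ _).1 (h1.trans h2.symm)

/-- A nullhomotopy of `xs ∘ g`. -/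
structure IsH (g : (N → I) → GLn ι) (H : (Option N → I) → GLn (Option ι)) : Prop where
  cont : Continuous H
  H0 : ∀ x, H (oc 0 x) = xs (g x)
  H1 : ∀ x, H (oc 1 x) = 1
  Hb : ∀ t, ∀ x ∈ boundary N, H (oc t x) = 1

/-- The boundary relation. -/
def Rel (g : (N → I) → GLn ι) (a : HG[Option N; EE ι]) : Prop :=
  ∃ H, IsH g H ∧ Cl (fun y => pE (H y)) a

/-- Constraint for nullhomotopies. -/
def SG (N ι : Type*) [Fintype ι] [DecidableEq ι] (y : Option N → I) :
    Subgroup (GLn (Option ι)) where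
  carrier := {A | ((fun i => y (some i)) ∈ boundary N ∨ y none = 1 → A = 1) ∧
    (y none = 0 → A ∈ St ι)}
  one_mem' := ⟨fun _ => rfl, fun _ => one_mem _⟩
  mul_mem' := by
    rintro a b ⟨h1, h2⟩ ⟨h3, h4⟩
    exact ⟨fun h => by rw [h1 h, h3 h, one_mul], fun h => mul_mem (h2 h) (h4 h)⟩
  inv_mem' := by
    rintro a ⟨h1, h2⟩
    exact ⟨fun h => by rw [h1 h, inv_one], fun h => inv_mem (h2 h)⟩

theorem SG_pE {y : Option N → I} {A : GLn (Option ι)} (h : A ∈ SG N ι y) :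
    pE A ∈ RL (Option N) (EE ι) y := by
  refine ⟨pE_ne _, fun hy => mem_St'.1 ?_⟩
  rcases (bdry_option y).1 hy with h1 | h1 | h1
  · exact h.2 h1
  · rw [h.1 (Or.inr h1)]; exact one_mem _
  · rw [h.1 (Or.inl h1)]; exact one_mem _

theorem IsH.mem {g : (N → I) → GLn ι} {H : (Option N → I) → GLn (Option ι)} (h : IsH g H)
    (y : Option N → I) : H y ∈ SG N ι y := by
  refine ⟨?_, fun hy => ?_⟩
  · rintro (hy | hy)
    · rw [← oc_eta y]; exact h.Hb _ _ hy
    · rw [← oc_eta y, hy]; exact h.H1 _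
  · rw [← oc_eta y, hy, h.H0]; exact xs_St _

theorem SG_update (i : N) (y : Option N → I) (h0 : y (some i) ≠ 0) (h1 : y (some i) ≠ 1) (c : I) :
    SG N ι (update y (some i) c) ≤ SG N ι y := by
  rintro A ⟨h2, h3⟩
  refine ⟨fun h => h2 ?_, fun h => h3 (by simpa using h)⟩
  rcases h with ⟨j, hj⟩ | h
  · have hij : j ≠ i := by rintro rfl; exact hj.elim h0 h1
    exact Or.inl ⟨j, by simpa [Function.update_of_ne, hij] using hj⟩
  · exact Or.inr (by simpa using h)

theorem SG_bot (i : N) (y : Option N → I) (h : y (some i) = 0 ∨ y (some i) = 1) :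
    SG N ι y = ⊥ := by
  rw [eq_bot_iff]
  intro A hA
  exact hA.1 (Or.inl ⟨i, h⟩)

theorem conc_comp {M M' : Type*} (i : N) (φ : M → M') (f g : (N → I) → M) (y : N → I) :
    φ (conc i f g y) = conc i (fun y => φ (f y)) (fun y => φ (g y)) y := by
  unfold conc; split_ifs <;> rfl

/-- Products of constrained maps project to products. -/
theorem SG_mul_Cl [Nonempty N] {F G : (Option N → I) → GLn (Option ι)} (hF : Continuous F)
    (hFS : ∀ y, F y ∈ SG N ι y) (hG : Continuous G) (hGS : ∀ y, G y ∈ SG N ι y)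
    {a b : HG[Option N; EE ι]} (ha : Cl (fun y => pE (F y)) a)
    (hb : Cl (fun y => pE (G y)) b) : Cl (fun y => pE ((F * G) y)) (b * a) := by
  obtain ⟨i⟩ := ‹Nonempty N›
  have h1 := (eckmann_hilton (some i) (fun y h0 h1 c => SG_update i y h0 h1 c)
    (fun y h => SG_bot (ι := ι) i y h) hF hFS hG hGS).1
  have h2 : Hty (Adm (Option N) (EE ι)) (fun y => pE ((F * G) y))
      (fun y => pE (conc (some i) F G y)) :=
    h1.post (fun _ A => pE A) (by fun_prop) (fun y A hA => RL_sub_Adm y (SG_pE hA))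
  have h3 := Cl.conc (some i) ha hb (fun y => by
    have e1 := hFS (update y (some i) 1)
    have e2 := hGS (update y (some i) 0)
    rw [SG_bot i _ (Or.inr (by simp))] at e1
    rw [SG_bot i _ (Or.inl (by simp))] at e2
    rw [Subgroup.mem_bot] at e1 e2
    simp only [e1, e2])
  simp only [conc_comp] at h2
  exact h3.hty h2.symm

theorem IsH.mul {g g' : (N → I) → GLn ι} {H H' : (Option N → I) → GLn (Option ι)} (h : IsH g H)
    (h' : IsH g' H') : IsH (g * g') (H * H') where
  cont := h.cont.mul h'.cont
  H0 x := by simp [h.H0, h'.H0]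
  H1 x := by simp [h.H1, h'.H1]
  Hb t x hx := by simp [h.Hb t x hx, h'.Hb t x hx]

theorem IsH.inv {g : (N → I) → GLn ι} {H : (Option N → I) → GLn (Option ι)} (h : IsH g H) :
    IsH g⁻¹ H⁻¹ where
  cont := h.cont.inv
  H0 x := by simp [h.H0]
  H1 x := by simp [h.H1]
  Hb t x hx := by simp [h.Hb t x hx]

theorem Rel.mul [Nonempty N] {g g' : (N → I) → GLn ι}
    {a b : HG[Option N; EE ι]} (h : Rel g a) (h' : Rel g' b) :
    Rel (g * g') (b * a) := by
  obtain ⟨H, hH, ha⟩ := h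
  obtain ⟨H', hH', hb⟩ := h'
  exact ⟨H * H', hH.mul hH', SG_mul_Cl hH.cont hH.mem hH'.cont hH'.mem ha hb⟩

theorem SG_inv_Cl [Nonempty N] {F : (Option N → I) → GLn (Option ι)} (hF : Continuous F)
    (hFS : ∀ y, F y ∈ SG N ι y)
    {a : HG[Option N; EE ι]} (ha : Cl (fun y => pE (F y)) a) :
    Cl (fun y => pE (F⁻¹ y)) a⁻¹ := by
  obtain ⟨b, hb⟩ := Cl.exists (f := fun y => pE (F⁻¹ y)) (pE_cont.comp hF.inv)
    (fun y => RL_sub_Adm y (SG_pE (inv_mem (hFS y))))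
  have h1 := SG_mul_Cl hF hFS hF.inv (fun y => inv_mem (hFS y)) ha hb
  rw [mul_inv_cancel] at h1
  have h2 := h1.unique (Cl.one (by simp only [Pi.one_apply]; exact continuous_const)
    (fun y => by rw [Pi.one_apply, pE_one]; exact not_NR_base))
  rw [← eq_inv_of_mul_eq_one_left h2]; exact hb

theorem Rel.inv [Nonempty N] {g : (N → I) → GLn ι}
    {a : HG[Option N; EE ι]} (h : Rel g a) : Rel g⁻¹ a⁻¹ := by
  obtain ⟨H, hH, ha⟩ := h
  exact ⟨H⁻¹, hH.inv, SG_inv_Cl hH.cont hH.mem ha⟩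

theorem Rel.of_loop {L : (Option N → I) → GLn (Option ι)} (hL : Continuous L)
    (hb : ∀ y ∈ boundary (Option N), L y = 1)
    {a : HG[Option N; EE ι]} (h : Cl (fun y => pE (L y)) a) :
    Rel (1 : (N → I) → GLn ι) a := by
  refine ⟨L, ⟨hL, fun x => ?_, fun x => ?_, fun t x hx => ?_⟩, h⟩
  · rw [hb _ ((bdry_option _).2 (Or.inl rfl))]; simp [xs]
  · rw [hb _ ((bdry_option _).2 (Or.inr (Or.inl rfl)))]
  · rw [hb _ ((bdry_option _).2 (Or.inr (Or.inr hx)))]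

theorem Rel.one [Nonempty N] : Rel (1 : (N → I) → GLn ι) 1 :=
  Rel.of_loop (L := fun _ => 1) continuous_const (fun _ _ => rfl)
    (Cl.one (by fun_prop) fun y => by rw [pE_one]; exact not_NR_base)

theorem Rel.zpow [Nonempty N] {g : (N → I) → GLn ι}
    {a : HG[Option N; EE ι]} (h : Rel g a) (m : ℤ) : Rel (g ^ m) (a ^ m) := by
  have hn : ∀ k : ℕ, Rel (g ^ k) (a ^ k) := by
    intro k
    induction k with
    | zero => simpa using Rel.one
    | succ k ih => rw [pow_succ, pow_succ']; exact ih.mul h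
  cases m with
  | ofNat k => simpa using hn k
  | negSucc k => simpa [zpow_negSucc] using (hn (k + 1)).inv

theorem Rel.null_of_one [Nonempty N] {g : (N → I) → GLn ι} (h : Rel g 1) :
    Hty (LS N (1 : GLn ι)) g (fun _ => 1) := by
  obtain ⟨H, hH, ha⟩ := h
  exact null_of_H hH.cont hH.H0 hH.H1 hH.Hb (ha.null fun y => SG_pE (hH.mem y))

theorem Rel.exists_right {g : (N → I) → GLn ι}
    (h : Hty (LS N (1 : GLn (Option ι))) (fun y => xs (g y)) (fun _ => 1)) : ∃ a, Rel g a := by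
  obtain ⟨H, hc, h0, h1, hS⟩ := h
  obtain ⟨K, hK⟩ : ∃ K : (Option N → I) → GLn (Option ι), K = fun y => H (y none, fun i => y (some i)) :=
    ⟨_, rfl⟩
  have hK' : ∀ t x, K (oc t x) = H (t, x) := by rw [hK]; intro t x; rfl
  have hH : IsH g K := ⟨by rw [hK]; fun_prop, fun x => by rw [hK', h0], fun x => by rw [hK', h1],
    fun t x hx => by rw [hK']; exact hS t x hx⟩
  obtain ⟨a, ha⟩ := Cl.exists (f := fun y => pE (K y)) (pE_cont.comp hH.cont)
    (fun y => RL_sub_Adm y (SG_pE (hH.mem y)))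
  exact ⟨a, _, hH, ha⟩

theorem Rel.exists_left (a : HG[Option N; EE ι]) :
    ∃ g : (N → I) → GLn ι, Continuous g ∧ (∀ y ∈ boundary N, g y = 1) ∧ Rel g a := by
  obtain ⟨q, hq, hS, rfl⟩ := rhg_surj a
  have hq1 : ∀ y ∈ boundary (Option N), q y = (0, 1) := fun y hy => (hS y).2 hy
  obtain ⟨F, hF, F0, Fp, Fc⟩ := lift_hty (Z := N → I) (f := fun _ => (1 : GLn (Option ι)))
    continuous_const (c := fun p => q (oc (σ p.1) p.2)) (by fun_prop) (fun p => (hS _).1)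
    (fun z => by
      simp only [unitInterval.symm_zero]
      rw [hq1 _ ((bdry_option _).2 (Or.inr (Or.inl rfl))), pE_one])
  have hFb : ∀ t, ∀ x ∈ boundary N, F (t, x) = 1 := fun t x hx => Fc x (fun t => by
    rw [hq1 _ ((bdry_option _).2 (Or.inr (Or.inr hx))),
      hq1 _ ((bdry_option _).2 (Or.inr (Or.inr hx)))]) t
  have hSt : ∀ x, F (1, x) ∈ St ι := fun x => by
    rw [mem_St', Fp]
    simp only [unitInterval.symm_one]
    exact hq1 _ ((bdry_option _).2 (Or.inl rfl))
  have hF1 : Continuous fun x => F (1, x) := by fun_prop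
  obtain ⟨K, hK, K0, K1, KS⟩ := stab_hty hF1 hSt
  let H : (Option N → I) → GLn (Option ι) := fun y =>
    F (σ (y none), fun i => y (some i)) *
      ((F (1, fun i => y (some i)))⁻¹ * K (σ (y none), fun i => y (some i)))
  have hHc : Continuous H := by
    refine Continuous.mul (by fun_prop) (Continuous.mul (Continuous.inv ?_) (by fun_prop))
    exact hF.comp (by fun_prop)
  have hKb : ∀ t, ∀ x ∈ boundary N, K (t, x) = 1 := fun t x hx => by
    rw [(KS t x).2.2 (by rw [hFb _ x hx, res_one, xs, map_one]), hFb _ x hx]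
  refine ⟨fun x => res (F (1, x)), res_cont hF1 hSt, fun y hy => ?_, H, ⟨hHc, fun x => ?_, fun x => ?_,
    fun t x hx => ?_⟩, ?_⟩
  · simp only; rw [hFb _ _ hy, res_one]
  · simp only [H, oc_none, oc_some, unitInterval.symm_zero]
    rw [mul_inv_cancel_left, K1]
  · simp only [H, oc_none, oc_some, unitInterval.symm_one]
    rw [K0, F0, inv_mul_cancel, one_mul]
  · simp only [H, oc_none, oc_some]
    rw [hFb _ _ hx, hFb _ _ hx, hKb _ _ hx]; simp
  · refine (Cl.of_loop hq hS).congr fun y => ?_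
    simp only [H]
    rw [pE_mul_St _ (mul_mem (inv_mem (hSt _)) (KS _ _).1), Fp]
    simp only [unitInterval.symm_symm, oc_eta]

theorem Rel.loop_of_null {g : (N → I) → GLn ι} {a : HG[Option N; EE ι]}
    (h : Rel g a) (hg : Hty (LS N (1 : GLn ι)) g (fun _ => 1)) :
    ∃ L : (Option N → I) → GLn (Option ι), Continuous L ∧
      (∀ y ∈ boundary (Option N), L y = 1) ∧ Cl (fun y => pE (L y)) a := by
  obtain ⟨H, hH, ha⟩ := h
  obtain ⟨K, hK, K0, K1, KS⟩ := hg
  refine ⟨fun y => H y * (xs (K (y none, fun i => y (some i))))⁻¹, ?_, fun y hy => ?_, ?_⟩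
  · refine hH.cont.mul (Continuous.inv (xs_cont.comp (hK.comp (by fun_prop))))
  · rw [← oc_eta y]
    simp only [oc_none, oc_some]
    rcases (bdry_option y).1 hy with h1 | h1 | h1
    · rw [h1, hH.H0, K0, mul_inv_cancel]
    · rw [h1, hH.H1, K1]; simp [xs]
    · rw [hH.Hb _ _ h1, KS _ _ h1]; simp [xs]
  · exact ha.congr fun y => (pE_mul_St _ (inv_mem (xs_St _))).symm

/-- Homotopic loops from equal classes. -/
theorem Rel.hty [Nonempty N] {g g' : (N → I) → GLn ι} (hg' : Continuous g')
    (hb : ∀ y ∈ boundary N, g' y = 1)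
    {a : HG[Option N; EE ι]} (h : Rel g a) (h' : Rel g' a) :
    Hty (LS N (1 : GLn ι)) g g' := by
  have h1 := (h.mul h'.inv)
  rw [inv_mul_cancel] at h1
  have h2 := Hty.mul (S := LG N (GLn ι)) h1.null_of_one (Hty.refl hg' hb)
  have e1 : (g * g'⁻¹) * g' = g := by simp
  have e2 : ((fun _ => 1 : (N → I) → GLn ι)) * g' = g' := by ext x; simp
  rw [e1, e2] at h2
  exact h2

/-- The structure of `π_{2n}(GL_n)`. -/
theorem pi_even [Nonempty N] (e : (Option N → ℝ) ≃L[ℝ] EE ι)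
    {γ : HG[Option N; EE ι]} (hγ : Cl (Lin e) γ)
    (hs : ∀ g : (N → I) → GLn ι, Continuous g → (∀ y ∈ boundary N, g y = 1) →
      Hty (LS N (1 : GLn (Option ι))) (fun y => xs (g y)) (fun _ => 1)) :
    ∃ g : (N → I) → GLn ι, Continuous g ∧ (∀ y ∈ boundary N, g y = 1) ∧
      (∀ f : (N → I) → GLn ι, Continuous f → (∀ y ∈ boundary N, f y = 1) →
        ∃ m : ℤ, Hty (LS N (1 : GLn ι)) f (g ^ m)) ∧
      ∀ m : ℤ, Hty (LS N (1 : GLn ι)) (g ^ m) (fun _ => 1) ↔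
        ∃ L : (Option N → I) → GLn (Option ι), Continuous L ∧
          (∀ y ∈ boundary (Option N), L y = 1) ∧ Cl (fun y => pE (L y)) (γ ^ m) := by
  obtain ⟨g, hg, hb, hr⟩ := Rel.exists_left (ι := ι) γ
  refine ⟨g, hg, hb, fun f hf hfb => ?_, fun m => ⟨fun h => (hr.zpow m).loop_of_null h, ?_⟩⟩
  · obtain ⟨a, ha⟩ := Rel.exists_right (hs f hf hfb)
    obtain ⟨m, rfl⟩ := gen_class e hγ a
    exact ⟨m, ha.hty (by fun_prop) (fun y hy => by simp [hb y hy]) (hr.zpow m)⟩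
  · rintro ⟨L, hL, hLb, hc⟩
    exact (hr.zpow m).hty continuous_const (fun _ _ => rfl) (Rel.of_loop hL hLb hc)

end rel

section susp

variable {ι : Type*} [Fintype ι] [DecidableEq ι] {N : Type*} [Fintype N] [DecidableEq N]

theorem qV_eq (v : EE ι × ℝ) : qV v = qV (v.1, 0) + (v.2 : ℂ) • e0 := by
  ext o; cases o <;> simp [qV, e0]; ring

theorem qV_zero : qV (0 : EE ι × ℝ) = 0 := by
  ext o; cases o <;> simp [qV]

theorem qV_eq_zero {v : EE ι × ℝ} : qV v = 0 ↔ v = 0 :=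
  ⟨fun h => by rw [← pV_qV v, h, pV_zero], fun h => by rw [h, qV_zero]⟩

/-- The convex combination of `u` and the base point. -/
noncomputable def bb (t : ℝ) (u : Option ι → ℂ) : Option ι → ℂ := (t : ℂ) • e0 + ((1 - t : ℝ) : ℂ) • u

theorem bb_zero {t : ℝ} (h0 : 0 ≤ t) (h1 : t ≤ 1) {v : EE ι × ℝ} (hv : v ≠ 0)
    (h : bb t (qV v) = 0) : 0 < t ∧ t < 1 ∧ NR v := by
  have ht1 : t ≠ 1 := by
    rintro rfl
    simp [bb, e0_ne] at h
  have ht0 : t ≠ 0 := by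
    rintro rfl
    simp [bb, qV_eq_zero, hv] at h
  refine ⟨lt_of_le_of_ne h0 ht0.symm, lt_of_le_of_ne h1 ht1, ?_⟩
  have hc : ((1 - t : ℝ) : ℂ) ≠ 0 := by exact_mod_cast sub_ne_zero.2 ht1.symm
  have h2 : v.1.1 = 0 := by
    ext i
    have := congrFun h (some i)
    simp only [bb, Pi.add_apply, Pi.smul_apply, e0, smul_eq_mul, qV, Option.elim, Pi.zero_apply] at this
    have h9 : ((1 - t : ℝ) : ℂ) * v.1.1 i = 0 := by simpa using this
    exact (mul_eq_zero.1 h9).resolve_left hc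
  have h3 := congrFun h none
  simp only [bb, Pi.add_apply, Pi.smul_apply, e0, smul_eq_mul, qV, Option.elim, Pi.zero_apply,
    Pi.single_eq_same, mul_one] at h3
  have h4 := congrArg Complex.im h3
  have h5 := congrArg Complex.re h3
  simp at h4 h5
  have h6 : 1 - t > 0 := by have := lt_of_le_of_ne h1 ht1; linarith
  refine ⟨Prod.ext h2 (h4.resolve_left (by linarith)), ?_⟩
  by_contra h7
  push Not at h7
  nlinarith [mul_pos h6 h7]

/-- The double suspension. -/
noncomputable def Psi (u : (N → I) → EE ι × ℝ) (y : Option (Option N) → I) : EE (Option ι) × ℝ :=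
  ((bb (y none) (qV (u fun i => y (some (some i)))), sin (2 * pi * y (some none))),
    cos (2 * pi * y (some none)))

theorem bdry_option2 (y : Option (Option N) → I) : y ∈ boundary (Option (Option N)) ↔
    (y none = 0 ∨ y none = 1) ∨ (y (some none) = 0 ∨ y (some none) = 1) ∨
      (fun i => y (some (some i))) ∈ boundary N := by
  rw [bdry_option, bdry_option]; tauto

theorem sin_cos_ne {v : EE (Option ι)} {θ : ℝ} {x : Option ι → ℂ} :
    (((x, sin θ), cos θ) : EE (Option ι) × ℝ) ≠ 0 := by
  intro h
  have h1 : sin θ = 0 := congrArg (fun p => p.1.2) h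
  have h2 : cos θ = 0 := congrArg (fun p => p.2) h
  have := Real.sin_sq_add_cos_sq θ
  simp [h1, h2] at this

theorem Psi_post (y : Option (Option N) → I) (v : EE ι × ℝ)
    (hv : v ∈ Adm N (EE ι) fun i => y (some (some i))) :
    (((bb (y none) (qV v), sin (2 * pi * y (some none))),
    cos (2 * pi * y (some none))) : EE (Option ι) × ℝ) ∈
      Adm (Option (Option N)) (EE (Option ι)) y := by
  refine ⟨sin_cos_ne (v := 0), ?_⟩
  rintro hy ⟨h1, h2⟩
  have hb : bb (y none) (qV v) = 0 := congrArg Prod.fst h1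
  obtain ⟨k1, k2, k3⟩ := bb_zero (y none).2.1 (y none).2.2 hv.1 hb
  rcases (bdry_option2 y).1 hy with (h | h) | (h | h) | h
  · rw [h] at k1; simp at k1
  · rw [h] at k2; simp at k2
  · rw [h] at h2; norm_num at h2
  · rw [h] at h2; norm_num at h2
  · exact hv.2 h k3

theorem bb_cont {Z : Type*} [TopologicalSpace Z] {t : Z → ℝ} {u : Z → Option ι → ℂ}
    (ht : Continuous t) (hu : Continuous u) : Continuous fun z => bb (t z) (u z) := by
  unfold bb
  have h1 : Continuous fun z => ((t z : ℝ) : ℂ) := by fun_prop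
  have h2 : Continuous fun z => ((1 - t z : ℝ) : ℂ) := by fun_prop
  exact (h1.smul continuous_const).add (h2.smul hu)

theorem Psi_hty {u u' : (N → I) → EE ι × ℝ} (h : Hty (Adm N (EE ι)) u u') :
    Hty (Adm (Option (Option N)) (EE (Option ι))) (Psi u) (Psi u') := by
  refine (h.comp (S' := fun y : Option (Option N) → I => Adm N (EE ι) fun i => y (some (some i)))
    (fun y i => y (some (some i))) (by fun_prop) (fun _ => subset_rfl)).post (fun y v =>
      (((bb (y none) (qV v), sin (2 * pi * y (some none))),
        cos (2 * pi * y (some none))) : EE (Option ι) × ℝ)) ?_ (fun y v hv => Psi_post y v hv)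
  refine ((bb_cont ?_ ?_).prodMk ?_).prodMk ?_ <;> fun_prop

theorem Psi_conc (i : N) (u u' : (N → I) → EE ι × ℝ) :
    Psi (conc i u u') = conc (some (some i)) (Psi u) (Psi u') := by
  ext1 y
  have key : ∀ c, (fun j => update y (some (some i)) c (some (some j))) =
      update (fun j => y (some (some j))) i c := by
    intro c; ext j
    by_cases h : j = i
    · subst h; simp
    · simp [h]
  simp only [conc, Psi]
  split_ifs with h
  · rw [key]; simp
  · rw [key]; simp

theorem exists_susp [Nonempty N] : ∃ φ : HG[N; EE ι] →*
    HG[Option (Option N); EE (Option ι)],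
    ∀ u a, Cl u a → Cl (Psi u) (φ a) := by
  have hex : ∀ a : HG[N; EE ι],
      ∃ b : HG[Option (Option N); EE (Option ι)], ∀ u, Cl u a → Cl (Psi u) b := by
    intro a
    obtain ⟨f, hf, hS, rfl⟩ := rhg_surj a
    have h0 := (Psi_hty (Hty.refl hf fun y => RL_sub_Adm y (hS y)))
    obtain ⟨b, hb⟩ := Cl.exists h0.cont_left h0.mem_left
    refine ⟨b, fun u hu => ?_⟩
    obtain ⟨g, hg, hS', h1, h2⟩ := hu
    exact hb.hty (Psi_hty (((rhg_eq_iff _ _ _ _).1 h2).symm.mono RL_sub_Adm |>.trans h1.symm))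
  choose φ hφ using hex
  refine ⟨MonoidHom.mk' φ fun a b => ?_, fun u a h => hφ a u h⟩
  obtain ⟨f, hf, hS, rfl⟩ := rhg_surj a
  obtain ⟨g, hg, hS', rfl⟩ := rhg_surj b
  have ha := Cl.of_loop hf hS
  have hb := Cl.of_loop hg hS'
  obtain ⟨i⟩ := ‹Nonempty N›
  have hfg : ∀ y, g (update y i 1) = f (update y i 0) := fun y => by
    rw [(hS' _).2 ⟨i, by simp⟩, (hS _).2 ⟨i, by simp⟩]
  have h1 := hφ _ _ (Cl.conc i hb ha hfg)
  have : Nonempty N := ⟨i⟩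
  have h2 := Cl.conc (some (some i)) (hφ _ _ hb) (hφ _ _ ha) (fun y => by
    have key : ∀ c, (fun j => update y (some (some i)) c (some (some j))) =
      update (fun j => y (some (some j))) i c := by
      intro c; ext j
      by_cases h : j = i
      · subst h; simp
      · simp [h]
    simp only [Psi]
    rw [key, key, hfg]; simp)
  rw [Psi_conc] at h1
  exact h1.unique h2

/-- `v ↦ qV (v, 0)` as a linear map. -/
noncomputable def qL : EE ι →L[ℝ] (Option ι → ℂ) :=
  LinearMap.toContinuousLinearMap
  { toFun := fun v => qV (v, 0)
    map_add' := fun a b => by ext o; cases o <;> simp [qV]; ring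
    map_smul' := fun a b => by ext o; cases o <;> simp [qV]; ring }

theorem susp_gen [Nonempty N] (e : (N → ℝ) ≃L[ℝ] EE ι)
    (e' : (Option (Option N) → ℝ) ≃L[ℝ] EE (Option ι))
    {γ : HG[N; EE ι]} (hγ : Cl (Lin e) γ)
    {γ' : HG[Option (Option N); EE (Option ι)]} (hγ' : Cl (Lin e') γ')
    {a : HG[Option (Option N); EE (Option ι)]} (ha : Cl (Psi (Lin e)) a) :
    a = γ' ∨ a = γ'⁻¹ := by
  let pr : (Option (Option N) → ℝ) →L[ℝ] (N → ℝ) :=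
    ContinuousLinearMap.pi fun i => proj (some (some i))
  let p0 : (Option (Option N) → ℝ) →L[ℝ] ℝ := proj none
  let p1 : (Option (Option N) → ℝ) →L[ℝ] ℝ := proj (some none)
  let A : (Option (Option N) → ℝ) →L[ℝ] (Option ι → ℂ) := qL.comp ((e : (N → ℝ) →L[ℝ] EE ι).comp pr)
  -- the explicit map
  let Φ : (Option (Option N) → ℝ) → EE (Option ι) × ℝ := fun x =>
    (((2 * x none - 1) • e0 + (1 - x none) • A (x - fun _ => 1 / 2), sin (2 * pi * x (some none))),
      cos (2 * pi * x (some none)))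
  have hΦc : Continuous Φ := by simp only [Φ]; fun_prop
  have hbx : ∀ y : Option (Option N) → I, bx 0 1 y = fun i => (y i : ℝ) := by
    intro y; ext i; simp [bx]
  have hΦ : ∀ y, Φ (bx 0 1 y) = Psi (Lin e) y := by
    intro y
    rw [hbx]
    simp only [Φ, Psi]
    refine Prod.ext (Prod.ext ?_ rfl) rfl
    simp only [Lin, bb]
    rw [qV_eq]
    have : A ((fun i => (y i : ℝ)) - fun _ => 1 / 2) = qV (e (ctr fun i => y (some (some i))), 0) := rfl
    rw [this]
    simp only [smul_add, smul_smul]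
    ext o
    simp only [Pi.add_apply, Pi.smul_apply, smul_eq_mul, Complex.real_smul]
    push_cast
    ring
  let L₀ : (Option (Option N) → ℝ) →L[ℝ] EE (Option ι) :=
    ((2 : ℝ) • p0.smulRight e0 + (1 / 2 : ℝ) • A).prod ((-(2 * pi)) • p1)
  have hA : ∀ x, ∀ c : ℝ, ∀ d : ℝ, d ≠ 0 → c • (e0 : Option ι → ℂ) + d • A x = 0 →
      c = 0 ∧ ∀ i, x (some (some i)) = 0 := by
    intro x c d hd h
    have hAx : A x = qV (e (fun i => x (some (some i))), 0) := rfl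
    rw [hAx] at h
    have h1 := congrArg Complex.re (congrFun h none)
    simp [qV, e0] at h1
    subst h1
    refine ⟨rfl, ?_⟩
    rw [zero_smul, zero_add, smul_eq_zero, qV_eq_zero] at h
    have h2 : e (fun i => x (some (some i))) = 0 := congrArg Prod.fst (h.resolve_left hd)
    have h3 := e.map_eq_zero_iff.1 h2
    exact fun i => congrFun h3 i
  have hinj : Injective L₀ := by
    rw [injective_iff_map_eq_zero]
    intro x hx
    have h1 : (2 * x none) • (e0 : Option ι → ℂ) + (1 / 2 : ℝ) • A x = 0 := by
      have := congrArg Prod.fst hx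
      simpa [L₀, p0, smul_smul] using this
    have h2 : -(2 * pi) * x (some none) = 0 := by
      have := congrArg Prod.snd hx
      simpa [L₀, p1] using this
    obtain ⟨h3, h4⟩ := hA x _ _ (by norm_num) h1
    have hpi := Real.pi_ne_zero
    ext o
    rcases o with _ | _ | i
    · simp; linarith
    · simpa [hpi] using h2
    · exact h4 i
  let L₁ := LinearMap.linearEquivOfInjective (L₀ : (Option (Option N) → ℝ) →ₗ[ℝ] EE (Option ι)) hinj
    e'.toLinearEquiv.finrank_eq
  let L : (Option (Option N) → ℝ) ≃L[ℝ] EE (Option ι) := L₁.toContinuousLinearEquiv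
  have hL : (L : (Option (Option N) → ℝ) →L[ℝ] EE (Option ι)) = L₀ := by
    ext1 x; rfl
  have hl := Hty.linearize hΦc (a := 0) (b := 1) (p := fun _ => 1 / 2) L (fun i => by norm_num)
    (fun i => by norm_num) ?_ ?_ (fun x _ _ => sin_cos_ne (v := 0)) ?_
  · have h1 : Hty (Adm _ _) (Psi (Lin e)) (Lin L) := by
      have : (fun y => Φ (bx 0 1 y)) = Psi (Lin e) := funext hΦ
      rwa [this] at hl
    exact Lin_class e' L hγ' (ha.hty h1)
  · rw [hL]
    refine HasFDerivAt.prodMk ?_ ?_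
    · have d1 : HasFDerivAt (fun x : Option (Option N) → ℝ => (2 * x none - 1) • (e0 : Option ι → ℂ))
          ((2 : ℝ) • p0.smulRight e0) (fun _ => 1 / 2) := by
        have : HasFDerivAt (fun x : Option (Option N) → ℝ => 2 * x none - 1) ((2 : ℝ) • p0)
          (fun _ => 1 / 2) := (p0.hasFDerivAt.const_mul 2).sub_const 1
        refine (this.smul_const (e0 : Option ι → ℂ)).congr_fderiv ?_
        ext1 x; simp [smul_smul]
      have d2 : HasFDerivAt (fun x : Option (Option N) → ℝ => (1 - x none)) (-p0) (fun _ => 1 / 2) :=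
        p0.hasFDerivAt.const_sub 1
      have d3 : HasFDerivAt (fun x : Option (Option N) → ℝ => A (x - fun _ => 1 / 2)) A
          (fun _ => 1 / 2) := by
        have := A.hasFDerivAt.comp (fun _ => 1 / 2 : Option (Option N) → ℝ)
          ((hasFDerivAt_id (fun _ => 1 / 2 : Option (Option N) → ℝ)).sub_const (fun _ => 1 / 2))
        simpa using this
      refine (d1.add (d2.smul d3)).congr_fderiv ?_
      ext1 x
      simp
      norm_num
    · have h1 : HasFDerivAt (fun x : Option (Option N) → ℝ => 2 * pi * x (some none))
          ((2 * pi) • p1) (fun _ => 1 / 2) := p1.hasFDerivAt.const_mul _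
      refine h1.sin.congr_fderiv ?_
      rw [show 2 * pi * (1 / 2) = pi by ring, Real.cos_pi]
      ext1 x; simp
  · refine ⟨Prod.ext ?_ ?_, ?_⟩
    · simp [Φ]
    · simp only [Φ]
      rw [show 2 * pi * (1 / 2) = pi by ring, Real.sin_pi]; rfl
    · simp only [Φ]
      rw [show 2 * pi * (1 / 2) = pi by ring, Real.cos_pi]; norm_num
  · rintro x h0 h1 ⟨h2, h3⟩
    have h4 : (2 * x none - 1) • (e0 : Option ι → ℂ) + (1 - x none) • A (x - fun _ => 1 / 2) = 0 :=
      congrArg Prod.fst h2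
    have h5 : sin (2 * pi * x (some none)) = 0 := congrArg Prod.snd h2
    have h6 := wrap_half (h0 (some none)) (h1 (some none)) h5 h3
    have h7 : (1 - x none) ≠ 0 := by
      intro h7
      have h8 : x none = 1 := by linarith
      rw [h8] at h4
      norm_num [e0_ne] at h4
    obtain ⟨h8, h9⟩ := hA _ _ _ h7 h4
    ext o
    rcases o with _ | _ | i
    · linarith
    · exact h6
    · have := h9 i
      simp only [Pi.sub_apply] at this
      linarith

end susp

/-- The standard loop in the nonzero complex numbers. -/
noncomputable def vv (θ : I) : ℂˣ :=
  Units.mk0 (Complex.exp ((2 * pi * (θ : ℝ) : ℝ) * Complex.I)) (Complex.exp_ne_zero _)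

@[fun_prop] theorem vv_cont : Continuous vv := by
  rw [Units.continuous_iff]
  constructor
  · have : Continuous fun θ : I => Complex.exp ((2 * pi * (θ : ℝ) : ℝ) * Complex.I) := by fun_prop
    exact this
  · have : Continuous fun θ : I => (Complex.exp ((2 * pi * (θ : ℝ) : ℝ) * Complex.I))⁻¹ :=
      Continuous.inv₀ (by fun_prop) (fun _ => Complex.exp_ne_zero _)
    exact this.congr fun θ => by simp [vv]

theorem vv_zero : vv 0 = 1 := by ext; simp [vv]

theorem vv_one : vv 1 = 1 := by
  ext; simp only [vv, Units.val_mk0, Set.Icc.coe_one, mul_one, val_one]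
  push_cast
  exact Complex.exp_two_pi_mul_I

theorem vv_eq (θ : I) : (vv θ : ℂ) = (cos (2 * pi * θ) : ℂ) + sin (2 * pi * θ) * Complex.I := by
  simp only [vv, Units.val_mk0]
  rw [Complex.exp_mul_I, ← Complex.ofReal_cos, ← Complex.ofReal_sin]

section blocks

variable {κ : Type*} [Fintype κ] [DecidableEq κ] {N : Type*} [Fintype N] [DecidableEq N]

/-- left block embedding -/
noncomputable abbrev eL : GLn κ →* GLn (κ ⊕ κ) := ext Embedding.inl

/-- right block embedding -/
noncomputable abbrev eR : GLn κ →* GLn (κ ⊕ κ) := ext Embedding.inr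

theorem eL_eR (a b : GLn κ) : eL a * eR b = eR b * eL a := by
  apply Units.ext
  simp only [eL, eR, val_mul, coe_ext, extM_inl, extM_inr, fromBlocks_multiply]
  simp

theorem coe_eL (a : GLn κ) : (eL a : Mat(κ ⊕ κ)) = fromBlocks a 0 0 1 := by
  simp only [eL, coe_ext, extM_inl]

theorem coe_eR (a : GLn κ) : (eR a : Mat(κ ⊕ κ)) = fromBlocks 1 0 0 a := by
  simp only [eR, coe_ext, extM_inr]

theorem mem_eL {A : GLn (κ ⊕ κ)} (h1 : ∀ i j, (A : Mat(κ ⊕ κ)) (Sum.inl i) (Sum.inr j) = 0)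
    (h2 : ∀ i j, (A : Mat(κ ⊕ κ)) (Sum.inr i) (Sum.inl j) = 0)
    (h3 : ∀ i j, (A : Mat(κ ⊕ κ)) (Sum.inr i) (Sum.inr j) = (1 : Mat(κ)) i j) :
    A ∈ (eL (κ := κ)).range := by
  have e : (A : Mat(κ ⊕ κ)) = fromBlocks (A : Mat(κ ⊕ κ)).toBlocks₁₁ 0 0 1 := by
    ext i j
    rcases i with i | i <;> rcases j with j | j
    · rfl
    · exact h1 i j
    · exact h2 i j
    · exact h3 i j
  have hd : (A : Mat(κ ⊕ κ)).toBlocks₁₁.det ≠ 0 := by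
    have := GLn_det_ne A
    rw [e, Matrix.det_fromBlocks_zero₂₁] at this
    simpa using this
  refine ⟨toGL (A : Mat(κ ⊕ κ)).toBlocks₁₁, Units.ext ?_⟩
  rw [coe_eL, coe_toGL hd, ← e]

/-- left inverse of `eL` -/
noncomputable def eLr (A : GLn (κ ⊕ κ)) : GLn κ := toGL (A : Mat(κ ⊕ κ)).toBlocks₁₁

theorem eLr_eL (a : GLn κ) : eLr (eL a) = a := by
  rw [eLr, coe_eL, Matrix.toBlocks_fromBlocks₁₁, toGL_coe]

theorem eL_eLr {A : GLn (κ ⊕ κ)} (h : A ∈ (eL (κ := κ)).range) : eL (eLr A) = A := by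
  obtain ⟨a, rfl⟩ := h
  rw [eLr_eL]

theorem eLr_cont {Z : Type*} [TopologicalSpace Z] {f : Z → GLn (κ ⊕ κ)} (hf : Continuous f)
    (h : ∀ z, f z ∈ (eL (κ := κ)).range) : Continuous fun z => eLr (f z) := by
  apply toGL_cont
  · have : Continuous fun z => (f z : Mat(κ ⊕ κ)) := coe_GLn_cont.comp hf
    refine continuous_matrix fun i j => ?_
    exact (continuous_apply_apply (Sum.inl i) (Sum.inl j)).comp this
  · intro z
    obtain ⟨a, ha⟩ := h z
    rw [← ha, coe_eL, Matrix.toBlocks_fromBlocks₁₁]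
    exact GLn_det_ne a

/-- The constraint. -/
def SW (N κ : Type*) [Fintype κ] [DecidableEq κ] (y : Option (Option N) → I) :
    Subgroup (GLn (κ ⊕ κ)) where
  carrier := {A | ((fun i => y (some i)) ∈ boundary (Option N) ∨ y none = 1 → A = 1) ∧
    (y none = 0 → A ∈ (eL (κ := κ)).range)}
  one_mem' := ⟨fun _ => rfl, fun _ => one_mem _⟩
  mul_mem' := by
    rintro a b ⟨h1, h2⟩ ⟨h3, h4⟩
    exact ⟨fun h => by rw [h1 h, h3 h, one_mul], fun h => mul_mem (h2 h) (h4 h)⟩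
  inv_mem' := by
    rintro a ⟨h1, h2⟩
    exact ⟨fun h => by rw [h1 h, inv_one], fun h => inv_mem (h2 h)⟩

/-- commutator with a left block -/
noncomputable def CC (W : GLn (κ ⊕ κ)) (Q : GLn κ) : GLn (κ ⊕ κ) := W * eL Q * W⁻¹ * (eL Q)⁻¹

theorem CC_one_left (Q : GLn κ) : CC 1 Q = 1 := by simp [CC]
theorem CC_one_right (W : GLn (κ ⊕ κ)) : CC W 1 = 1 := by simp [CC]

theorem CC_diag (a b Q : GLn κ) : CC (eL a * eR b) Q = eL (a * Q * a⁻¹ * Q⁻¹) := by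
  have h : eL a * eR b * eL Q * (eL a * eR b)⁻¹ = eL (a * Q * a⁻¹) := by
    rw [mul_inv_rev, mul_assoc (eL a), ← eL_eR Q b]
    simp only [map_mul, map_inv]; group
  rw [CC, h]; simp only [map_mul, map_inv]

theorem CC_mul (W : GLn (κ ⊕ κ)) (Q Q' : GLn κ) :
    CC W (Q * Q') = CC W Q * (eL Q * CC W Q' * (eL Q)⁻¹) := by
  simp only [CC, map_mul]; group

/-- loops in one variable -/
def SQ (κ : Type*) [Fintype κ] [DecidableEq κ] (θ : I) : Subgroup (GLn κ) where
  carrier := {A | θ = 0 ∨ θ = 1 → A = 1}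
  one_mem' := fun _ => rfl
  mul_mem' := by
    intro a b h1 h2 h
    rw [h1 h, h2 h, one_mul]
  inv_mem' := by
    intro a h1 h
    rw [h1 h, inv_one]

/-- Admissible clutching data. -/
structure IsW (W : (Option (Option N) → I) → GLn (κ ⊕ κ)) : Prop where
  cont : Continuous W
  W1 : ∀ y, (fun i => y (some (some i))) ∈ boundary N ∨ y none = 1 → W y = 1
  W0 : ∀ y, y none = 0 → ∃ a b, W y = eL a * eR b

variable {W : (Option (Option N) → I) → GLn (κ ⊕ κ)}

theorem IsW.mem (hW : IsW W) (y : Option (Option N) → I) {Q : GLn κ} (hQ : Q ∈ SQ κ (y (some none))) :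
    CC (W y) Q ∈ SW N κ y := by
  constructor
  · rintro (h | h)
    · rcases (bdry_option _).1 h with h | h | h
      · rw [hQ (Or.inl h), CC_one_right]
      · rw [hQ (Or.inr h), CC_one_right]
      · rw [hW.W1 y (Or.inl h), CC_one_left]
    · rw [hW.W1 y (Or.inr h), CC_one_left]
  · intro h
    obtain ⟨a, b, hab⟩ := hW.W0 y h
    rw [hab, CC_diag]
    exact ⟨_, rfl⟩

theorem IsW.hty (hW : IsW W) {Q Q' : I → GLn κ}
    (h : Hty (fun θ => (SQ κ θ : Set (GLn κ))) Q Q') :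
    Hty (fun y => (SW N κ y : Set (GLn (κ ⊕ κ)))) (fun y => CC (W y) (Q (y (some none))))
      (fun y => CC (W y) (Q' (y (some none)))) := by
  refine (h.comp (S' := fun y : Option (Option N) → I => (SQ κ (y (some none)) : Set (GLn κ)))
    (fun y => y (some none)) (by fun_prop) (fun _ => subset_rfl)).post (fun y Q => CC (W y) Q) ?_
      (fun y Q hQ => hW.mem y hQ)
  have := hW.cont
  unfold CC
  fun_prop

theorem IsW.mul (hW : IsW W) {Q Q' : I → GLn κ} (hQ : Continuous Q) (hQ' : Continuous Q')
    (h : ∀ θ, Q θ ∈ SQ κ θ) (h' : ∀ θ, Q' θ ∈ SQ κ θ) :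
    Hty (fun y => (SW N κ y : Set (GLn (κ ⊕ κ)))) (fun y => CC (W y) (Q (y (some none)) * Q' (y (some none))))
      ((fun y => CC (W y) (Q (y (some none)))) * fun y => CC (W y) (Q' (y (some none)))) := by
  have hc := hW.cont
  have key : Hty (fun y => (SW N κ y : Set (GLn (κ ⊕ κ)))) (fun y => CC (W y) (Q' (y (some none))))
      (fun y => eL (Q (y (some none))) * CC (W y) (Q' (y (some none))) * (eL (Q (y (some none))))⁻¹) := by
    refine ⟨fun p => eL (Q (p.1 * p.2 (some none))) * CC (W p.2) (Q' (p.2 (some none))) *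
      (eL (Q (p.1 * p.2 (some none))))⁻¹, ?_, ?_, ?_, ?_⟩
    · unfold CC; fun_prop
    · intro y; simp [h 0 (Or.inl rfl)]
    · intro y; simp
    · intro t y
      have h1 := hW.mem y (h' (y (some none)))
      constructor
      · intro h2
        simp only [h1.1 h2, mul_one, mul_inv_cancel]
      · intro h2
        obtain ⟨a, ha⟩ := h1.2 h2
        simp only [← ha]
        exact ⟨Q (t * y (some none)) * a * (Q (t * y (some none)))⁻¹, by simp only [map_mul, map_inv]⟩
  have h1 : Hty (fun y => (SW N κ y : Set (GLn (κ ⊕ κ)))) (fun y => CC (W y) (Q (y (some none))))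
    (fun y => CC (W y) (Q (y (some none)))) := hW.hty (Hty.refl hQ h)
  have h2 := h1.mul key.symm
  refine Eq.mp ?_ h2
  congr 1
  ext1 y
  rw [CC_mul]; rfl

theorem vv_SQ {Q : ℂˣ →* GLn κ} (θ : I) : Q (vv θ) ∈ SQ κ θ := by
  rintro (h | h)
  · rw [h, vv_zero, map_one]
  · rw [h, vv_one, map_one]

theorem dl_hty (i j : κ) : Hty (fun θ => (SQ κ θ : Set (GLn κ))) (fun θ => dl i (vv θ))
    (fun θ => dl j (vv θ)) := by
  have e : ∀ v, dl j v = permGL (Equiv.swap i j) * dl i v * (permGL (Equiv.swap i j))⁻¹ := by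
    intro v
    have := ext_equiv_conj (Embedding.refl κ) (Equiv.swap i j) (dl i v)
    rw [ext_refl, ext_dl] at this
    rw [← this]; simp
  obtain ⟨γ, hγ, h0, h1⟩ := GLn_path (permGL (Equiv.swap i j))
  have := Hty_conj (S := SQ κ) (f := fun θ => dl i (vv θ)) (by fun_prop) (fun θ => vv_SQ θ) γ hγ h0
    (fun t z a ha hz => by rw [ha hz]; simp)
  rw [h1] at this
  simpa only [e] using this

/-- Partial scalar matrices. -/
noncomputable def ds (s : Finset κ) (v : ℂˣ) : GLn κ :=
  toGL (diagonal fun i => if i ∈ s then (v : ℂ) else 1)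

theorem coe_ds (s : Finset κ) (v : ℂˣ) : (ds s v : Mat(κ)) =
    diagonal fun i => if i ∈ s then (v : ℂ) else 1 := by
  refine coe_toGL ?_
  rw [det_diagonal, Finset.prod_ne_zero_iff]
  intro i _
  split_ifs
  · exact v.ne_zero
  · exact one_ne_zero

theorem ds_cont (s : Finset κ) : Continuous fun θ => ds s (vv θ) := by
  apply GLn_cont
  simp only [coe_ds]
  have := continuous_val (M := ℂ)
  refine Continuous.matrix_diagonal (continuous_pi fun i => ?_)
  split_ifs <;> fun_prop

theorem ds_empty (v : ℂˣ) : ds (∅ : Finset κ) v = 1 := by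
  apply Units.ext; rw [coe_ds]; simp

theorem ds_one (s : Finset κ) : ds s 1 = 1 := by
  apply Units.ext; rw [coe_ds]; simp

theorem ds_insert {i : κ} {s : Finset κ} (h : i ∉ s) (v : ℂˣ) :
    ds (insert i s) v = dl i v * ds s v := by
  apply Units.ext
  rw [val_mul, coe_ds, coe_ds, coe_dl]
  ext a b
  rw [Matrix.mul_diagonal]
  simp only [diagonal_apply, Finset.mem_insert, Matrix.add_apply, Matrix.one_apply,
    Matrix.smul_apply, Matrix.single_apply, smul_eq_mul]
  by_cases hab : a = b
  · subst hab
    by_cases ha : a = i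
    · subst ha; simp [h]
    · simp [ha, Ne.symm ha]
  · have : ¬ (i = a ∧ i = b) := by rintro ⟨rfl, rfl⟩; exact hab rfl
    simp [hab, this]

theorem ds_SQ (s : Finset κ) (θ : I) : ds s (vv θ) ∈ SQ κ θ := by
  rintro (h | h)
  · rw [h, vv_zero, ds_one]
  · rw [h, vv_one, ds_one]

theorem IsW.power (hW : IsW W) (i₀ : κ) (s : Finset κ) :
    Hty (fun y => (SW N κ y : Set (GLn (κ ⊕ κ)))) (fun y => CC (W y) (ds s (vv (y (some none)))))
      ((fun y => CC (W y) (dl i₀ (vv (y (some none))))) ^ (s.card : ℤ)) := by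
  induction s using Finset.induction_on with
  | empty =>
    simp only [ds_empty, CC_one_right, Finset.card_empty, Nat.cast_zero, zpow_zero]
    exact Hty.refl continuous_const fun y => one_mem (SW N κ y)
  | insert i s hi ih =>
    simp only [ds_insert hi]
    refine (hW.mul (Q := fun θ => dl i (vv θ)) (Q' := fun θ => ds s (vv θ)) (by fun_prop) (ds_cont s)
      (fun θ => vv_SQ θ) (ds_SQ s)).trans ?_
    rw [Finset.card_insert_of_notMem hi, Nat.cast_succ, zpow_add_one, ← (Commute.self_zpow _ _).eq]
    exact (hW.hty (dl_hty i i₀)).mul ih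

end blocks

section pj

variable {α β : Type*} [Fintype α] [DecidableEq α] [Fintype β] [DecidableEq β]

/-- Rank one modification. -/
noncomputable def pjM (v : ℂˣ) (w r : α → ℂ) : Mat(α) := 1 + ((v : ℂ) - 1) • Matrix.vecMulVec w r

theorem pjM_det (v : ℂˣ) {w r : α → ℂ} (h : r ⬝ᵥ w = 1) : (pjM v w r).det = v := by
  rw [pjM, ← Matrix.smul_vecMulVec, Matrix.vecMulVec_eq Unit,
    Matrix.det_one_add_replicateCol_mul_replicateRow, dotProduct_smul, h]
  simp

/-- invertible version -/
noncomputable def pG (v : ℂˣ) (w r : α → ℂ) : GLn α := toGL (pjM v w r)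

theorem coe_pG (v : ℂˣ) {w r : α → ℂ} (h : r ⬝ᵥ w = 1) : (pG v w r : Mat(α)) = pjM v w r :=
  coe_toGL (by rw [pjM_det v h]; exact v.ne_zero)

theorem pG_cont {Z : Type*} [TopologicalSpace Z] {v : Z → ℂˣ} {w r : Z → α → ℂ} (hv : Continuous v)
    (hw : Continuous w) (hr : Continuous r) (h : ∀ z, r z ⬝ᵥ w z = 1) :
    Continuous fun z => pG (v z) (w z) (r z) := by
  apply toGL_cont
  · unfold pjM
    have h1 := continuous_val (M := ℂ)
    have h2 : Continuous fun z => Matrix.vecMulVec (w z) (r z) := hw.matrix_vecMulVec hr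
    have h3 : Continuous fun z => ((v z : ℂ) - 1) := by fun_prop
    exact continuous_const.add (h3.smul h2)
  · intro z; rw [pjM_det _ (h z)]; exact (v z).ne_zero

theorem pG_one {w r : α → ℂ} (h : r ⬝ᵥ w = 1) : pG 1 w r = 1 := by
  apply Units.ext; rw [coe_pG _ h]; simp [pjM]

theorem pG_single (v : ℂˣ) (i : α) : pG v (Pi.single i 1) (Pi.single i 1) = dl i v := by
  apply Units.ext
  rw [coe_pG _ (by simp), coe_dl, pjM]
  congr 2
  ext a b
  rw [Matrix.vecMulVec_apply, Matrix.single_apply, Pi.single_apply, Pi.single_apply]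
  simp only [eq_comm (a := i)]
  by_cases h1 : a = i <;> by_cases h2 : b = i <;> simp [h1, h2]

theorem pG_conj (v : ℂˣ) (i : α) (W : GLn α) : W * dl i v * W⁻¹ =
    pG v (fun a => (W : Mat(α)) a i) (fun a => ((W⁻¹ : GLn α) : Mat(α)) i a) := by
  have h : ((W⁻¹ : GLn α) : Mat(α)) * (W : Mat(α)) = 1 := by
    rw [← val_mul, inv_mul_cancel, val_one]
  have h' : (W : Mat(α)) * ((W⁻¹ : GLn α) : Mat(α)) = 1 := by
    rw [← val_mul, mul_inv_cancel, val_one]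
  apply Units.ext
  rw [coe_pG _ (by simpa [Matrix.mul_apply, dotProduct] using congrFun (congrFun h i) i),
    val_mul, val_mul, coe_dl, pjM, mul_add, add_mul, mul_one, h']
  congr 1
  rw [Matrix.mul_smul, Matrix.smul_mul]
  congr 1
  ext a b
  simp [Matrix.mul_apply, Matrix.single_apply, Matrix.vecMulVec_apply, ite_and, Finset.sum_ite_eq]

/-- The dual covector. -/
noncomputable def hd (w : α → ℂ) : α → ℂ := (star w ⬝ᵥ w)⁻¹ • star w

theorem hd_dot {w : α → ℂ} (h : w ≠ 0) : hd w ⬝ᵥ w = 1 := by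
  rw [hd, smul_dotProduct, smul_eq_mul, inv_mul_cancel₀ (dot_ne h)]

theorem hd_cont {Z : Type*} [TopologicalSpace Z] {w : Z → α → ℂ} (hw : Continuous w)
    (h : ∀ z, w z ≠ 0) : Continuous fun z => hd (w z) := by
  unfold hd
  have h1 : Continuous fun z => star (w z) ⬝ᵥ w z := hw.star.dotProduct hw
  exact (h1.inv₀ fun z => dot_ne (h z)).smul hw.star

theorem hd_single (i : α) : hd (Pi.single i 1) = Pi.single i 1 := by
  have : star (Pi.single i 1 : α → ℂ) = Pi.single i 1 := by rw [← Pi.single_star]; simp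
  rw [hd, this]; simp

theorem ext_pG (e : α ↪ β) (v : ℂˣ) {w : α → ℂ} (h : w ≠ 0) :
    ext e (pG v w (hd w)) = pG v (ind e *ᵥ w) (hd (ind e *ᵥ w)) := by
  have hr : (ind e)ᴴ = (ind e)ᵀ := by
    ext i j; simp [ind, Matrix.conjTranspose_apply, apply_ite]
  have hs : star (ind e *ᵥ w) = ind e *ᵥ star w := by
    rw [Matrix.star_mulVec, hr, Matrix.vecMul_transpose]
  have hdot : star (ind e *ᵥ w) ⬝ᵥ (ind e *ᵥ w) = star w ⬝ᵥ w := by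
    rw [hs, Matrix.dotProduct_mulVec, ← Matrix.vecMul_transpose, Matrix.vecMul_vecMul,
      ind_tr_mul e.injective, Matrix.vecMul_one]
  have hne : ind e *ᵥ w ≠ 0 := by
    intro h0
    rw [h0] at hdot
    simp at hdot
    exact dot_ne h (by simpa using hdot.symm)
  have hhd : hd (ind e *ᵥ w) = ind e *ᵥ hd w := by
    rw [hd, hdot, hs, hd, Matrix.mulVec_smul]
  apply Units.ext
  rw [coe_ext, coe_pG _ (hd_dot h), coe_pG _ (hd_dot hne), extM_apply, hhd, pjM, pjM,
    add_sub_cancel_left, Matrix.mul_smul, Matrix.smul_mul, Matrix.mul_vecMulVec, Matrix.vecMulVec_mul,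
    Matrix.vecMul_transpose]

end pj

section rot

variable {κ : Type*} [Fintype κ] [DecidableEq κ] {N : Type*} [Fintype N] [DecidableEq N]

noncomputable def cR (t : I) : ℝ := sin (pi / 2 * t)
noncomputable def sR (t : I) : ℝ := cos (pi / 2 * t)

@[fun_prop] theorem cR_cont : Continuous cR := by unfold cR; fun_prop
@[fun_prop] theorem sR_cont : Continuous sR := by unfold sR; fun_prop
theorem cR_zero : cR 0 = 0 := by simp [cR]
theorem sR_zero : sR 0 = 1 := by simp [sR]
theorem cR_one : cR 1 = 1 := by simp [cR]
theorem sR_one : sR 1 = 0 := by simp [sR]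
theorem cs_sq (t : I) : cR t ^ 2 + sR t ^ 2 = 1 := Real.sin_sq_add_cos_sq _
theorem cR_nonneg (t : I) : 0 ≤ cR t :=
  Real.sin_nonneg_of_nonneg_of_le_pi (by have := t.2.1; positivity)
    (by nlinarith [t.2.1, t.2.2, Real.pi_pos])
theorem sR_nonneg (t : I) : 0 ≤ sR t :=
  Real.cos_nonneg_of_neg_pi_div_two_le_of_le (by nlinarith [t.2.1, t.2.2, Real.pi_pos])
    (by nlinarith [t.2.1, t.2.2, Real.pi_pos])

/-- Rotation. -/
noncomputable def rot (t : I) : GLn (κ ⊕ κ) where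
  val := fromBlocks ((cR t : ℂ) • 1) (-(sR t : ℂ) • 1) ((sR t : ℂ) • 1) ((cR t : ℂ) • 1)
  inv := fromBlocks ((cR t : ℂ) • 1) ((sR t : ℂ) • 1) (-(sR t : ℂ) • 1) ((cR t : ℂ) • 1)
  val_inv := by
    have h : cR t * cR t + sR t * sR t = 1 := by rw [← cs_sq t]; ring
    have h' : sR t * sR t + cR t * cR t = 1 := by rw [← h]; ring
    rw [fromBlocks_multiply, ← Matrix.fromBlocks_one]
    congr 1 <;> simp [smul_smul, ← add_smul, h, h', mul_comm]
  inv_val := by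
    have h : cR t * cR t + sR t * sR t = 1 := by rw [← cs_sq t]; ring
    have h' : sR t * sR t + cR t * cR t = 1 := by rw [← h]; ring
    rw [fromBlocks_multiply, ← Matrix.fromBlocks_one]
    congr 1 <;> simp [smul_smul, ← add_smul, h, h', mul_comm]

theorem coe_rot (t : I) : ((rot t : GLn (κ ⊕ κ)) : Mat(κ ⊕ κ)) =
  fromBlocks ((cR t : ℂ) • 1) (-(sR t : ℂ) • 1) ((sR t : ℂ) • 1) ((cR t : ℂ) • 1) := rfl

theorem coe_rot_inv (t : I) : (((rot t)⁻¹ : GLn (κ ⊕ κ)) : Mat(κ ⊕ κ)) =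
  fromBlocks ((cR t : ℂ) • 1) ((sR t : ℂ) • 1) (-(sR t : ℂ) • 1) ((cR t : ℂ) • 1) := rfl

@[fun_prop] theorem rot_cont : Continuous (rot (κ := κ)) := by
  apply GLn_cont
  simp only [coe_rot]
  apply Continuous.matrix_fromBlocks <;> fun_prop

theorem rot_one : rot (κ := κ) 1 = 1 := by
  apply Units.ext
  rw [coe_rot, cR_one, sR_one]
  simp

theorem rot_zero (h : GLn κ) : rot 0 * eL h * (rot 0)⁻¹ = eR h := by
  rw [mul_inv_eq_iff_eq_mul]
  apply Units.ext
  rw [val_mul, val_mul, coe_rot, coe_eL, coe_eR, cR_zero, sR_zero,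
    fromBlocks_multiply, fromBlocks_multiply]
  simp

/-- The canonical nullhomotopy of `g ⊕ g⁻¹`. -/
noncomputable def Wg (g : GLn κ) (t : I) : GLn (κ ⊕ κ) := eL g * rot t * (eL g)⁻¹ * (rot t)⁻¹

theorem Wg_one (t : I) : Wg (1 : GLn κ) t = 1 := by simp [Wg]

theorem Wg_one' (g : GLn κ) : Wg g 1 = 1 := by simp [Wg, rot_one]

theorem Wg_zero (g : GLn κ) : Wg g 0 = eL g * eR g⁻¹ := by
  rw [← rot_zero, map_inv, Wg]; group

theorem IsW_Wg {g : (N → I) → GLn κ} (hg : Continuous g) (hb : ∀ y ∈ boundary N, g y = 1) :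
    IsW fun y : Option (Option N) → I => Wg (g fun i => y (some (some i))) (y none) where
  cont := by unfold Wg; fun_prop
  W1 y := by
    rintro (h | h)
    · simp only [hb _ h, Wg_one]
    · rw [h, Wg_one']
  W0 y h := by
    rw [h, Wg_zero]; exact ⟨_, _, rfl⟩

end rot

section theta

variable {ι : Type*} [Fintype ι] [DecidableEq ι] {N : Type*} [Fintype N] [DecidableEq N]

theorem Wg_col (g : GLn (Option ι)) (t : I) :
    (fun a => (Wg g t : Mat(Option ι ⊕ Option ι)) a (Sum.inl none)) =
      Sum.elim (bb (cR t ^ 2) (c0 g)) (((cR t * sR t : ℝ) : ℂ) • (c0 g⁻¹ - e0)) := by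
  have hg : (g : Mat(Option ι)) * ((g⁻¹ : GLn (Option ι)) : Mat(Option ι)) = 1 := by
    rw [← val_mul, mul_inv_cancel, val_one]
  have h1 : ((1 - cR t ^ 2 : ℝ) : ℂ) = sR t * sR t := by
    rw [← cs_sq t]; push_cast; ring
  have e : (Wg g t : Mat(Option ι ⊕ Option ι)) =
      fromBlocks (g : Mat(Option ι)) 0 0 1 *
      fromBlocks ((cR t : ℂ) • 1) (-(sR t : ℂ) • 1) ((sR t : ℂ) • 1) ((cR t : ℂ) • 1) *
      fromBlocks ((g⁻¹ : GLn (Option ι)) : Mat(Option ι)) 0 0 1 *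
      fromBlocks ((cR t : ℂ) • 1) ((sR t : ℂ) • 1) (-(sR t : ℂ) • 1) ((cR t : ℂ) • 1) := by
    rw [Wg, val_mul, val_mul, val_mul, coe_rot_inv, coe_rot, ← map_inv, coe_eL, coe_eL]
  rw [e, fromBlocks_multiply, fromBlocks_multiply, fromBlocks_multiply]
  ext a
  rcases a with a | a
  · simp only [Matrix.fromBlocks_apply₁₁, Sum.elim_inl, bb, h1, Pi.add_apply, Pi.smul_apply, c0_apply]
    simp [hg, Matrix.mul_smul, Matrix.smul_mul, smul_smul, e0, Matrix.one_apply, Pi.single_apply, pow_two]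
  · simp only [Matrix.fromBlocks_apply₂₁, Sum.elim_inr, Pi.sub_apply, Pi.smul_apply, c0_apply]
    simp [e0, Matrix.one_apply, Pi.single_apply]
    split_ifs <;> ring

/-- The embedding. -/
def em : Option (Option ι) ↪ Option ι ⊕ Option ι where
  toFun o := o.elim (Sum.inr none) Sum.inl
  inj' := by
    intro a b
    rcases a with _ | a <;> rcases b with _ | b <;> simp

theorem em_none : em (none : Option (Option ι)) = Sum.inr none := rfl
theorem em_some (i : Option ι) : em (some i) = Sum.inl i := rfl

/-- The path of vectors. -/
noncomputable def wv (g : GLn (Option ι)) (t : I) (s : ℝ) : Option ι ⊕ Option ι → ℂ :=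
  Sum.elim (bb (cR t ^ 2) (c0 g)) ((((1 - s) * (cR t * sR t) : ℝ) : ℂ) • (c0 g⁻¹ - e0) +
    ((s * -(cR t * sR t * ‖c0 g - e0‖) : ℝ) : ℂ) • e0)

/-- The final vector. -/
noncomputable def w2 (g : GLn (Option ι)) (t : I) : Option (Option ι) → ℂ := fun o =>
  o.elim ((-(cR t * sR t * ‖c0 g - e0‖) : ℝ) : ℂ) (bb (cR t ^ 2) (c0 g))

theorem ind_w2 (g : GLn (Option ι)) (t : I) : ind em *ᵥ w2 g t = wv g t 1 := by
  ext a
  rcases a with a | a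
  · simp only [Matrix.mulVec, dotProduct, ind, Fintype.sum_option (α := Option ι), of_apply, em_none, em_some]
    simp [wv, w2]
  · simp only [Matrix.mulVec, dotProduct, ind, Fintype.sum_option (α := Option ι), of_apply, em_none, em_some]
    simp [wv, w2, e0, Pi.single_apply]

theorem wv_zero (g : GLn (Option ι)) (t : I) : wv g t 0 =
    fun a => (Wg g t : Mat(Option ι ⊕ Option ι)) a (Sum.inl none) := by
  rw [Wg_col]; simp [wv]

theorem wv_ne (g : GLn (Option ι)) (t : I) {s : ℝ} (h0 : 0 ≤ s) (h1 : s ≤ 1) : wv g t s ≠ 0 := by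
  intro h
  have hb : bb (cR t ^ 2) (c0 g) = 0 := by
    ext i; exact congrFun h (Sum.inl i)
  have hq := congrArg Complex.re (congrFun h (Sum.inr none))
  simp only [wv, Sum.elim_inr, Pi.add_apply, Pi.smul_apply, Pi.sub_apply, smul_eq_mul, e0,
    Pi.single_eq_same, mul_one, Complex.add_re, Complex.re_ofReal_mul, Complex.sub_re,
    Complex.one_re, Complex.ofReal_re, Pi.zero_apply, Complex.zero_re] at hq
  have hcs := cs_sq t
  have hb' : ((cR t ^ 2 : ℝ) : ℂ) • c0 g⁻¹ + ((1 - cR t ^ 2 : ℝ) : ℂ) • e0 = 0 := by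
    have := congrArg (fun v => ((g⁻¹ : GLn (Option ι)) : Mat(Option ι)) *ᵥ v) hb
    simp only [bb, Matrix.mulVec_add, Matrix.mulVec_smul, Matrix.mulVec_zero] at this
    rw [← c0_mul, inv_mul_cancel, c0_one] at this
    exact this
  have hc : cR t ≠ 0 := by
    intro h0
    rw [h0] at hb'
    simp [e0_ne] at hb'
  have hs : sR t ≠ 0 := by
    intro h0
    rw [h0] at hcs
    have : (1 - cR t ^ 2) = 0 := by linarith
    rw [bb, this, show cR t ^ 2 = 1 by linarith] at hb
    simp [e0_ne] at hb
  have hc' := lt_of_le_of_ne (cR_nonneg t) hc.symm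
  have hs' := lt_of_le_of_ne (sR_nonneg t) hs.symm
  have hp := congrArg Complex.re (congrFun hb' none)
  have hu := congrArg Complex.re (congrFun hb none)
  simp only [Pi.add_apply, Pi.smul_apply, smul_eq_mul, e0, bb,
    Pi.single_eq_same, mul_one, Complex.add_re, Complex.re_ofReal_mul,
    Complex.one_re, Complex.ofReal_re, Pi.zero_apply, Complex.zero_re] at hp hu
  have hp' : (c0 g⁻¹ none).re < 0 := by
    by_contra hn
    push Not at hn
    have : 0 < sR t ^ 2 := by positivity
    nlinarith [mul_nonneg (sq_nonneg (cR t)) hn]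
  have hn : 0 < ‖c0 g - e0‖ := by
    rw [norm_pos_iff, sub_ne_zero]
    intro he
    rw [he] at hu
    simp [e0] at hu
  have h5 : 0 < cR t * sR t := mul_pos hc' hs'
  have h6 : 0 < cR t * sR t * ‖c0 g - e0‖ := mul_pos h5 hn
  have h7 : 0 < cR t * sR t * (1 - (c0 g⁻¹ none).re) := mul_pos h5 (by linarith)
  change (1 - s) * (cR t * sR t) * ((c0 g⁻¹ none).re - 1) + s * -(cR t * sR t * ‖c0 g - e0‖) = 0 at hq
  rcases eq_or_lt_of_le h0 with rfl | h8
  · nlinarith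
  · nlinarith [mul_pos h8 h6, mul_nonneg (sub_nonneg.2 h1) h7.le]

theorem w2_ne (g : GLn (Option ι)) (t : I) : w2 g t ≠ 0 := by
  intro h
  have := ind_w2 g t
  rw [h, Matrix.mulVec_zero] at this
  exact wv_ne g t zero_le_one le_rfl this.symm

/-- The Theta element. -/
noncomputable def Th (g : GLn (Option ι)) (t : I) (v : ℂˣ) : GLn (Option (Option ι)) :=
  pG v (w2 g t) (hd (w2 g t)) * (dl (some none) v)⁻¹

theorem ext_Th (g : GLn (Option ι)) (t : I) (v : ℂˣ) :
    ext em (Th g t v) = pG v (wv g t 1) (hd (wv g t 1)) * (dl (Sum.inl none) v)⁻¹ := by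
  rw [Th, map_mul, map_inv, ext_pG _ _ (w2_ne g t), ext_dl, ind_w2]; rfl

theorem pT_mem (y : Option (Option N) → I) {w r : Option ι ⊕ Option ι → ℂ} (h : r ⬝ᵥ w = 1)
    (h1 : (fun i => y (some (some i))) ∈ boundary N ∨ y none = 1 →
      w = Pi.single (Sum.inl none) 1 ∧ r = Pi.single (Sum.inl none) 1)
    (h0 : y none = 0 → ∀ i, w (Sum.inr i) = 0 ∧ r (Sum.inr i) = 0) :
    pG (vv (y (some none))) w r * (dl (Sum.inl none) (vv (y (some none))))⁻¹ ∈ SW N (Option ι) y := by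
  constructor
  · have key : (fun i => y (some (some i))) ∈ boundary N ∨ y none = 1 →
      pG (vv (y (some none))) w r * (dl (Sum.inl none) (vv (y (some none))))⁻¹ = 1 := by
      intro hh
      rw [(h1 hh).1, (h1 hh).2, pG_single, mul_inv_cancel]
    rintro (hh | hh)
    · rcases (bdry_option _).1 hh with hh | hh | hh
      · rw [hh, vv_zero, pG_one h, map_one, inv_one, mul_one]
      · rw [hh, vv_one, pG_one h, map_one, inv_one, mul_one]
      · exact key (Or.inl hh)
    · exact key (Or.inr hh)
  · intro hh
    refine mul_mem (mem_eL ?_ ?_ ?_) (inv_mem ⟨dl none (vv (y (some none))), ext_dl _ _ _⟩)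
    all_goals
      intro i j
      rw [coe_pG _ h]
      simp [pjM, Matrix.vecMulVec_apply, h0 hh, Matrix.one_apply]

theorem wv_cont {g : (N → I) → GLn (Option ι)} (hg : Continuous g) :
    Continuous fun p : I × (Option (Option N) → I) =>
      wv (g fun i => p.2 (some (some i))) (p.2 none) p.1 := by
  have hc0 : Continuous (c0 (ι := ι)) := by
    unfold c0
    exact (coe_GLn_cont (ι := Option ι)).matrix_mulVec continuous_const
  have hc : Continuous fun p : I × (Option (Option N) → I) => c0 (g fun i => p.2 (some (some i))) := by
    fun_prop
  have hci : Continuous fun p : I × (Option (Option N) → I) => c0 (g fun i => p.2 (some (some i)))⁻¹ := by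
    fun_prop
  refine continuous_pi fun a => ?_
  rcases a with a | a
  · simp only [wv, Sum.elim_inl]
    exact (continuous_apply a).comp (bb_cont (by fun_prop) hc)
  · simp only [wv, Sum.elim_inr]
    have h3 : Continuous fun p : I × (Option (Option N) → I) => ‖c0 (g fun i => p.2 (some (some i))) - e0‖ :=
        (hc.sub continuous_const).norm
    have h1 : Continuous fun p : I × (Option (Option N) → I) =>
      (((1 - (p.1 : ℝ)) * (cR (p.2 none) * sR (p.2 none)) : ℝ) : ℂ) := by fun_prop
    have h2 : Continuous fun p : I × (Option (Option N) → I) => ((p.1 * -(cR (p.2 none) * sR (p.2 none) *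
      ‖c0 (g fun i => p.2 (some (some i))) - e0‖) : ℝ) : ℂ) := by fun_prop
    exact (continuous_apply a).comp ((h1.smul (hci.sub continuous_const)).add (h2.smul continuous_const))

theorem wv_bd {g : GLn (Option ι)} {t : I} (h : g = 1 ∨ t = 1) (s : ℝ) :
    wv g t s = Pi.single (Sum.inl none) 1 := by
  have : wv g t s = Sum.elim e0 0 := by
    rcases h with rfl | rfl
    · simp [wv, bb, c0_one, ← add_smul]
    · simp [wv, bb, cR_one, sR_one]
  rw [this]
  ext a
  rcases a with a | a
  · simp [e0, Pi.single_apply]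
  · simp

theorem wv_t0 (g : GLn (Option ι)) (s : ℝ) (i) : wv g 0 s (Sum.inr i) = 0 := by
  simp [wv, cR_zero]

theorem hd_zero {α : Type*} [Fintype α] {w : α → ℂ} {i : α} (h : w i = 0) : hd w i = 0 := by
  simp [hd, h]

theorem CC_theta {g : (N → I) → GLn (Option ι)} (hg : Continuous g)
    (hb : ∀ y ∈ boundary N, g y = 1) :
    Hty (fun y => (SW N (Option ι) y : Set (GLn (Option ι ⊕ Option ι))))
      (fun y => CC (Wg (g fun i => y (some (some i))) (y none)) (dl none (vv (y (some none)))))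
      (fun y => ext em (Th (g fun i => y (some (some i))) (y none) (vv (y (some none))))) := by
  have hbd : ∀ y : Option (Option N) → I, (fun i => y (some (some i))) ∈ boundary N ∨ y none = 1 →
      (g fun i => y (some (some i))) = 1 ∨ y none = 1 := fun y h => h.imp_left (hb _)
  have hwc := wv_cont hg
  have hW := IsW_Wg hg hb
  have hw0 : Continuous fun y : Option (Option N) → I => wv (g fun i => y (some (some i))) (y none) 0 := by
    exact hwc.comp (f := fun y => ((0 : I), y)) (by fun_prop)
  have step2 : Hty (fun y => (SW N (Option ι) y : Set (GLn (Option ι ⊕ Option ι))))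
      (fun y => pG (vv (y (some none))) (wv (g fun i => y (some (some i))) (y none) 0)
        (hd (wv (g fun i => y (some (some i))) (y none) 0)) * (dl (Sum.inl none) (vv (y (some none))))⁻¹)
      (fun y => pG (vv (y (some none))) (wv (g fun i => y (some (some i))) (y none) 1)
        (hd (wv (g fun i => y (some (some i))) (y none) 1)) * (dl (Sum.inl none) (vv (y (some none))))⁻¹) := by
    refine ⟨fun p => pG (vv (p.2 (some none))) (wv (g fun i => p.2 (some (some i))) (p.2 none) p.1)
        (hd (wv (g fun i => p.2 (some (some i))) (p.2 none) p.1)) *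
          (dl (Sum.inl none) (vv (p.2 (some none))))⁻¹, ?_, ?_, ?_, ?_⟩
    · refine (pG_cont (by fun_prop) hwc (hd_cont hwc fun p => ?_) fun p => ?_).mul (by fun_prop)
      · exact wv_ne _ _ p.1.2.1 p.1.2.2
      · exact hd_dot (wv_ne _ _ p.1.2.1 p.1.2.2)
    · intro y; rfl
    · intro y; rfl
    · intro s y
      refine pT_mem y (hd_dot (wv_ne _ _ s.2.1 s.2.2)) (fun h => ?_) (fun h i => ?_)
      · simp only [wv_bd (hbd y h), hd_single, and_self]
      · simp only [h]
        exact ⟨wv_t0 _ _ _, hd_zero (wv_t0 _ _ _)⟩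
  simp only [ext_Th]
  refine Hty.trans ?_ step2
  let w' : (Option (Option N) → I) → Option ι ⊕ Option ι → ℂ := fun y a =>
    (((Wg (g fun i => y (some (some i))) (y none))⁻¹ : GLn (Option ι ⊕ Option ι)) :
      Mat(Option ι ⊕ Option ι)) (Sum.inl none) a
  have hw'c : Continuous w' := by
    refine continuous_pi fun a => ?_
    exact (continuous_apply_apply (Sum.inl none) a).comp (coe_GLn_cont.comp hW.cont.inv)
  have hw' : ∀ y, w' y ⬝ᵥ wv (g fun i => y (some (some i))) (y none) 0 = 1 := by
    intro y
    have h : (((Wg (g fun i => y (some (some i))) (y none))⁻¹ : GLn (Option ι ⊕ Option ι)) :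
      Mat(Option ι ⊕ Option ι)) *
      ((Wg (g fun i => y (some (some i))) (y none) : GLn (Option ι ⊕ Option ι)) :
      Mat(Option ι ⊕ Option ι)) = 1 := by
      rw [← val_mul, inv_mul_cancel, val_one]
    rw [wv_zero]
    have := congrFun (congrFun h (Sum.inl none)) (Sum.inl none)
    rw [Matrix.mul_apply, Matrix.one_apply_eq] at this
    exact this
  have hs : ∀ (s : ℂ) y, ((1 - s) • w' y + s • hd (wv (g fun i => y (some (some i))) (y none) 0)) ⬝ᵥ
      wv (g fun i => y (some (some i))) (y none) 0 = 1 := by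
    intro s y
    rw [add_dotProduct, smul_dotProduct, smul_dotProduct, hw', hd_dot (wv_ne _ _ le_rfl zero_le_one)]
    simp
  refine ⟨fun p => pG (vv (p.2 (some none))) (wv (g fun i => p.2 (some (some i))) (p.2 none) 0)
    ((1 - ((p.1 : ℝ) : ℂ)) • w' p.2 + ((p.1 : ℝ) : ℂ) • hd (wv (g fun i => p.2 (some (some i))) (p.2 none) 0)) *
          (dl (Sum.inl none) (vv (p.2 (some none))))⁻¹, ?_, ?_, ?_, ?_⟩
  · have hdc := hd_cont hw0 fun y => wv_ne _ _ le_rfl zero_le_one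
    have h1 : Continuous fun p : I × (Option (Option N) → I) => (1 - ((p.1 : ℝ) : ℂ)) := by fun_prop
    have h2 : Continuous fun p : I × (Option (Option N) → I) => ((p.1 : ℝ) : ℂ) := by fun_prop
    refine (pG_cont (by fun_prop) (hw0.comp continuous_snd)
      ((h1.smul (hw'c.comp continuous_snd)).add (h2.smul (hdc.comp continuous_snd))) fun p => hs _ _).mul
        (by fun_prop)
  · intro y
    simp only [Set.Icc.coe_zero, Complex.ofReal_zero, sub_zero, one_smul, zero_smul, add_zero]
    rw [CC, ext_dl, wv_zero]
    exact congrArg₂ (· * ·) (pG_conj _ (Sum.inl none) _).symm rfl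
  · intro y
    simp
  · intro s y
    refine pT_mem y (hs _ _) (fun h => ?_) (fun h i => ?_)
    · have h1 : w' y = Pi.single (Sum.inl none) 1 := by
        ext a
        simp only [w']
        rw [hW.W1 y h, inv_one, val_one, Matrix.one_apply, Pi.single_apply]
        simp only [eq_comm]
      simp only [wv_bd (hbd y h), hd_single, true_and, h1, ← add_smul, sub_add_cancel, one_smul]
    · have h1 : w' y (Sum.inr i) = 0 := by
        simp only [w', h, Wg_zero]
        rw [mul_inv_rev, ← map_inv, ← map_inv, val_mul, coe_eL, coe_eR, fromBlocks_multiply]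
        simp
      have h2 := hd_zero (wv_t0 (g fun i => y (some (some i))) 0 i)
      rw [← h] at h2
      refine ⟨by simp only [h]; exact wv_t0 _ _ _, ?_⟩
      simp [h1, h2]

end theta

section theta2

variable {ι : Type*} [Fintype ι] [DecidableEq ι] {N : Type*} [Fintype N] [DecidableEq N]

theorem some_em : (Embedding.some.trans em : Option ι ↪ Option ι ⊕ Option ι) =
    Embedding.inl := rfl

theorem ext_em_xs (a : GLn (Option ι)) : ext em (xs a) = eL a := by
  rw [xs, ext_trans]; rfl

theorem SW_ext {y : Option (Option N) → I} {A : GLn (Option (Option ι))}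
    (h : ext em A ∈ SW N (Option ι) y) : A ∈ SG (Option N) (Option ι) y := by
  refine ⟨fun h1 => ext_inj em ((h.1 h1).trans (map_one _).symm), fun h1 => ?_⟩
  obtain ⟨a, ha⟩ := h.2 h1
  rw [← ext_em_xs] at ha
  rw [← ext_inj em ha]
  exact xs_St a

/-- Comparison family. -/
noncomputable def FF (a : ℂ) (b : Option ι → ℂ) (r : ℝ) (v : ℂˣ) : EE (Option ι) × ℝ :=
  pV fun o => o.elim (1 + ((v : ℂ) - 1) * r) (a • b)

theorem FF_adm {y : Option (Option N) → I} {a : ℂ} {b : Option ι → ℂ} {r : ℝ} (hr : 0 ≤ r)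
    (h1 : r ≠ 0 → ((vv (y (some none)) : ℂˣ) : ℂ) = -1 → a ≠ 0) (h2 : b = 0 → r = 1)
    (h3 : y ∈ boundary (Option (Option N)) → vv (y (some none)) = 1 ∨ b ≠ 0) :
    FF a b r (vv (y (some none))) ∈ Adm (Option (Option N)) (EE (Option ι)) y := by
  set θ := 2 * pi * (y (some none) : ℝ) with hθ
  have hv := vv_eq (y (some none))
  rw [← hθ] at hv
  have hre : (FF a b r (vv (y (some none)))).2 = 1 + (cos θ - 1) * r := by
    change (1 + (((vv (y (some none)) : ℂˣ) : ℂ) - 1) * r).re = _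
    rw [hv]; generalize cos θ = c; generalize sin θ = s; simp
  have him : (FF a b r (vv (y (some none)))).1.2 = sin θ * r := by
    change (1 + (((vv (y (some none)) : ℂˣ) : ℂ) - 1) * r).im = _
    rw [hv]; generalize cos θ = c; generalize sin θ = s; simp
  have key : (FF a b r (vv (y (some none)))).1 = 0 → (FF a b r (vv (y (some none)))).2 ≤ 0 →
      ((vv (y (some none)) : ℂˣ) : ℂ) = -1 ∧ b = 0 := by
    intro k1 k2
    have k3 : a • b = 0 := congrArg Prod.fst k1
    have k4 : (FF a b r (vv (y (some none)))).1.2 = 0 := congrArg Prod.snd k1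
    rw [him] at k4
    rw [hre] at k2
    have hr0 : r ≠ 0 := by
      rintro rfl
      norm_num at k2
    have hs := (mul_eq_zero.1 k4).resolve_right hr0
    have hc := Real.sin_sq_add_cos_sq θ
    rw [hs] at hc
    have hc' : (cos θ - 1) * (cos θ + 1) = 0 := by nlinarith
    rcases mul_eq_zero.1 hc' with h | h
    · rw [h] at k2; norm_num at k2
    · have hcos : cos θ = -1 := by linarith
      have hv1 : ((vv (y (some none)) : ℂˣ) : ℂ) = -1 := by
        rw [hv, hs, hcos]; simp
      exact ⟨hv1, (smul_eq_zero.1 k3).resolve_left (h1 hr0 hv1)⟩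
  constructor
  · intro h0
    obtain ⟨k1, k2⟩ := key (by rw [h0]; rfl) (by rw [h0]; exact le_rfl)
    have k3 := h2 k2
    have : (FF a b r (vv (y (some none)))).2 = 0 := by rw [h0]; rfl
    change (1 + (((vv (y (some none)) : ℂˣ) : ℂ) - 1) * r).re = _ at this
    rw [k1, k3] at this
    norm_num at this
  · rintro hy ⟨n1, n2⟩
    obtain ⟨k1, k2⟩ := key n1 n2
    rcases h3 hy with h | h
    · rw [h] at k1
      norm_num at k1
    · exact h k2

theorem bb_bd {y : Option (Option N) → I} (hy : y ∈ boundary (Option (Option N)))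
    {c : ℝ} {g : GLn (Option ι)} (hg : (fun i => y (some (some i))) ∈ boundary N → g = 1)
    (c0' : y none = 0 → c = 0) (c1 : y none = 1 → c = 1) :
    vv (y (some none)) = 1 ∨ bb c (c0 g) ≠ 0 := by
  rcases (bdry_option2 y).1 hy with (h | h) | (h | h) | h
  · right; rw [c0' h]; simpa [bb] using c0_ne g
  · right; rw [c1 h]; simpa [bb] using e0_ne
  · left; rw [h, vv_zero]
  · left; rw [h, vv_one]
  · right
    rw [hg h, c0_one]
    have : bb c (e0 : Option ι → ℂ) = e0 := by
      rw [bb, ← add_smul]; push_cast; simp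
    rw [this]; exact e0_ne

theorem FF_cont {Z : Type*} [TopologicalSpace Z] {a : Z → ℂ} {b : Z → Option ι → ℂ} {r : Z → ℝ}
    {v : Z → ℂˣ} (ha : Continuous a) (hb : Continuous b) (hr : Continuous r) (hv : Continuous v) :
    Continuous fun z => FF (a z) (b z) (r z) (v z) := by
  have h1 := continuous_val (M := ℂ)
  have h2 : Continuous fun z => (1 + ((v z : ℂ) - 1) * r z) := by fun_prop
  have h3 : Continuous fun z => a z • b z := ha.smul hb
  have : (fun z => FF (a z) (b z) (r z) (v z)) = fun z => ((a z • b z, (1 + ((v z : ℂ) - 1) * r z).im),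
    (1 + ((v z : ℂ) - 1) * r z).re) := rfl
  rw [this]
  exact (h3.prodMk (Complex.continuous_im.comp h2)).prodMk (Complex.continuous_re.comp h2)

/-- square norm of `w2` -/
noncomputable def R2 (g : GLn (Option ι)) (t : I) : ℝ := ∑ o, normSq (w2 g t o)

noncomputable def rh (g : GLn (Option ι)) (t : I) : ℝ := -(cR t * sR t * ‖c0 g - e0‖)

theorem R2_eq (g : GLn (Option ι)) (t : I) : star (w2 g t) ⬝ᵥ w2 g t = (R2 g t : ℂ) := by
  rw [R2, dotProduct]
  push_cast
  refine Finset.sum_congr rfl fun o _ => ?_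
  rw [Complex.normSq_eq_conj_mul_self]; rfl

theorem R2_pos (g : GLn (Option ι)) (t : I) : 0 < R2 g t := by
  refine lt_of_le_of_ne (Finset.sum_nonneg fun _ _ => Complex.normSq_nonneg _) fun h => ?_
  apply dot_ne (w2_ne g t)
  rw [R2_eq, ← h]; simp

theorem R2_zero {g : GLn (Option ι)} {t : I} (h : bb (cR t ^ 2) (c0 g) = 0) : R2 g t = rh g t ^ 2 := by
  rw [R2, Fintype.sum_option (α := Option ι)]
  simp only [w2, Option.elim, h]
  simp [rh, pow_two, Complex.normSq_apply]

theorem pE_Th (g : GLn (Option ι)) (t : I) (v : ℂˣ) : pE (Th g t v) =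
    FF (((v : ℂ) - 1) * (rh g t / R2 g t : ℝ)) (bb (cR t ^ 2) (c0 g)) (rh g t ^ 2 / R2 g t) v := by
  rw [pE, Th, c0_mul, ← map_inv, FF]
  have h1 : c0 (dl (some (none : Option ι)) v⁻¹) = e0 := by
    ext o; rw [c0_apply, coe_dl]
    simp [e0, Matrix.one_apply, Pi.single_apply, Matrix.single_apply]
  congr 1
  rw [h1, coe_pG _ (hd_dot (w2_ne g t))]
  ext o
  simp only [pjM, e0, Matrix.mulVec_single_one, Matrix.col_apply, Matrix.add_apply, Matrix.smul_apply,
    Matrix.vecMulVec_apply, hd, R2_eq, Pi.smul_apply, Pi.star_apply, smul_eq_mul]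
  have h2 : star (w2 g t none) = (rh g t : ℂ) := by simp [w2, rh]
  rw [h2]
  rcases o with _ | o
  · have h3 : w2 g t none = (rh g t : ℂ) := rfl
    rw [h3]
    simp only [Matrix.one_apply_eq, Option.elim]
    push_cast
    ring
  · have h3 : w2 g t (some o) = bb (cR t ^ 2) (c0 g) o := rfl
    rw [h3]
    simp
    ring

end theta2

section theta3

variable {ι : Type*} [Fintype ι] [DecidableEq ι] {N : Type*} [Fintype N] [DecidableEq N]

theorem w2_cont : Continuous fun p : GLn (Option ι) × I => w2 p.1 p.2 := by
  refine continuous_pi fun o => ?_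
  rcases o with _ | o
  · simp only [w2, Option.elim]
    exact Complex.continuous_ofReal.comp (by fun_prop)
  · simp only [w2, Option.elim]
    exact (continuous_apply o).comp (bb_cont (by fun_prop) (by fun_prop))

theorem R2_cont : Continuous fun p : GLn (Option ι) × I => R2 p.1 p.2 := by
  unfold R2
  exact continuous_finset_sum _ fun o _ =>
    Complex.continuous_normSq.comp ((continuous_apply o).comp w2_cont)

theorem rh_cont : Continuous fun p : GLn (Option ι) × I => rh p.1 p.2 := by
  unfold rh; fun_prop

theorem rh_le (g : GLn (Option ι)) (t : I) : rh g t ≤ 0 := by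
  have := mul_nonneg (mul_nonneg (cR_nonneg t) (sR_nonneg t)) (norm_nonneg (c0 g - e0))
  unfold rh; linarith

theorem FF_hty {ρ R : (Option (Option N) → I) → ℝ} {b : (Option (Option N) → I) → Option ι → ℂ}
    (hρ : Continuous ρ) (hR : Continuous R) (hbc : Continuous b) (hl : ∀ y, ρ y ≤ 0) (hp : ∀ y, 0 < R y)
    (hz : ∀ y, b y = 0 → R y = ρ y ^ 2)
    (h3 : ∀ y ∈ boundary (Option (Option N)), vv (y (some none)) = 1 ∨ b y ≠ 0) :
    Hty (Adm (Option (Option N)) (EE (Option ι)))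
      (fun y => FF ((((vv (y (some none)) : ℂˣ) : ℂ) - 1) * (ρ y / R y : ℝ)) (b y) (ρ y ^ 2 / R y)
        (vv (y (some none)))) (fun y => FF 1 (b y) 1 (vv (y (some none)))) := by
  have hR0 : ∀ y, R y ≠ 0 := fun y => (hp y).ne'
  have hv : Continuous fun p : I × (Option (Option N) → I) => ((vv (p.2 (some none)) : ℂˣ) : ℂ) :=
    continuous_val.comp (by fun_prop)
  have hq : Continuous fun y => ρ y / R y := hρ.div hR hR0
  have hq2 : Continuous fun y => ρ y ^ 2 / R y := (hρ.pow 2).div hR hR0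
  have c1 : Continuous fun p : I × (Option (Option N) → I) =>
      ((1 - (p.1 : ℝ) : ℝ) : ℂ) * (((vv (p.2 (some none)) : ℂˣ) : ℂ) - 1) * (ρ p.2 / R p.2 : ℝ) + (p.1 : ℝ) := by
    have hq' : Continuous fun p : I × (Option (Option N) → I) => ((ρ p.2 / R p.2 : ℝ) : ℂ) :=
      Complex.continuous_ofReal.comp (hq.comp continuous_snd)
    have h1 : Continuous fun p : I × (Option (Option N) → I) => ((1 - (p.1 : ℝ) : ℝ) : ℂ) :=
      Complex.continuous_ofReal.comp (by fun_prop)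
    have h2 : Continuous fun p : I × (Option (Option N) → I) => ((p.1 : ℝ) : ℂ) :=
      Complex.continuous_ofReal.comp (by fun_prop)
    exact ((h1.mul (hv.sub continuous_const)).mul hq').add h2
  have c2 : Continuous fun p : I × (Option (Option N) → I) =>
      (1 - (p.1 : ℝ)) * (ρ p.2 ^ 2 / R p.2) + p.1 := by
    have h1 : Continuous fun p : I × (Option (Option N) → I) => ρ p.2 ^ 2 / R p.2 := hq2.comp continuous_snd
    have h2 : Continuous fun p : I × (Option (Option N) → I) => (1 - (p.1 : ℝ)) := by fun_prop
    have h3 : Continuous fun p : I × (Option (Option N) → I) => (p.1 : ℝ) := by fun_prop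
    exact (h2.mul h1).add h3
  have c3 : Continuous fun p : I × (Option (Option N) → I) => vv (p.2 (some none)) := by fun_prop
  refine ⟨_, FF_cont c1 (hbc.comp continuous_snd) c2 c3, fun y => ?_, fun y => ?_, fun s y => ?_⟩
  · simp
  · simp
  · have hs0 : (0 : ℝ) ≤ s := s.2.1
    have hs1 : (s : ℝ) ≤ 1 := s.2.2
    have hl := hl y
    have hp := hp y
    refine FF_adm ?_ ?_ ?_ (h3 y)
    · have : 0 ≤ ρ y ^ 2 / R y := by positivity
      dsimp only
      nlinarith [mul_nonneg (sub_nonneg.2 hs1) this]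
    · intro h1 h2 h3
      apply h1
      dsimp only at h2 h3 ⊢
      rw [h2] at h3
      have h4 : (1 - (s : ℝ)) * (-2) * (ρ y / R y) + s = 0 := by
        have : (((1 - (s : ℝ)) * (-2) * (ρ y / R y) + s : ℝ) : ℂ) = 0 := by
          rw [← h3]; push_cast; ring
        exact_mod_cast this
      have h5 : ρ y / R y ≤ 0 := div_nonpos_of_nonpos_of_nonneg hl hp.le
      have h6 : (s : ℝ) = 0 := by nlinarith [mul_nonneg (sub_nonneg.2 hs1) (neg_nonneg.2 h5)]
      rw [h6] at h4 ⊢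
      have h7 : ρ y / R y = 0 := by linarith
      rw [pow_two, mul_div_assoc, h7]; simp
    · intro h1
      dsimp only
      rw [← hz y h1, div_self hp.ne']; ring

theorem Th_hty {g : (N → I) → GLn (Option ι)} (hg : Continuous g)
    (hb : ∀ y ∈ boundary N, g y = 1) :
    Hty (Adm (Option (Option N)) (EE (Option ι))) (Psi fun y => pE (g y))
      (fun y => pE (Th (g fun i => y (some (some i))) (y none) (vv (y (some none))))) := by
  refine Hty.symm (Hty.trans (g := fun y => FF 1 (bb (cR (y none) ^ 2) (c0 (g fun i => y (some (some i)))))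
    1 (vv (y (some none)))) ?_ ?_)
  · have hp : Continuous fun y : Option (Option N) → I => ((g fun i => y (some (some i))), y none) := by
      fun_prop
    have := FF_hty (b := fun y => bb (cR (y none) ^ 2) (c0 (g fun i => y (some (some i)))))
      (rh_cont.comp hp) (R2_cont.comp hp) (bb_cont (by fun_prop) (by fun_prop))
      (fun y => rh_le _ _) (fun y => R2_pos _ _) (fun y hy => R2_zero hy) (fun y hy => bb_bd hy (hb _)
        (fun h => by rw [h, cR_zero]; norm_num) (fun h => by rw [h, cR_one]; norm_num))
    convert this using 1
    funext y
    exact pE_Th _ _ _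
  · refine ⟨fun p => FF 1 (bb ((1 - p.1) * cR (p.2 none) ^ 2 + p.1 * p.2 none)
      (c0 (g fun i => p.2 (some (some i))))) 1 (vv (p.2 (some none))),
      FF_cont continuous_const (bb_cont (by fun_prop) (by fun_prop)) continuous_const (by fun_prop),
      fun y => by simp, fun y => ?_, fun s y => FF_adm zero_le_one (fun _ _ => one_ne_zero) (fun _ => rfl)
      fun hy => bb_bd hy (hb _) (fun h => by simp [h, cR_zero]) (fun h => by simp [h, cR_one])⟩
    have hv := vv_eq (y (some none))
    simp only [FF, Psi, pV, one_smul, pE, qV_pV, Option.elim]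
    rw [hv]
    generalize cos _ = c
    generalize sin _ = s
    simp
    exact congrArg (bb _) (qV_pV _).symm

theorem Th_cont {g : (N → I) → GLn (Option ι)} (hg : Continuous g) :
    Continuous fun y : Option (Option N) → I =>
      Th (g fun i => y (some (some i))) (y none) (vv (y (some none))) := by
  have hp : Continuous fun y : Option (Option N) → I => ((g fun i => y (some (some i))), y none) := by
    fun_prop
  have h1 := w2_cont.comp hp
  have h2 : Continuous fun y : Option (Option N) → I => dl (some (none : Option ι)) (vv (y (some none))) := by
    fun_prop
  have h3 : Continuous fun y : Option (Option N) → I => vv (y (some none)) := by fun_prop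
  have h4 := pG_cont h3 h1 (hd_cont h1 fun _ => w2_ne _ _) (fun _ => hd_dot (w2_ne _ _))
  unfold Th
  exact h4.mul h2.inv

end theta3

section chase

variable {ι : Type} [Fintype ι] [DecidableEq ι] {N : Type*} [Fintype N] [DecidableEq N]

theorem LS_pE {f g : (N → I) → GLn (Option ι)} (h : Hty (LS N (1 : GLn (Option ι))) f g) :
    Hty (Adm N (EE ι)) (fun y => pE (f y)) (fun y => pE (g y)) :=
  h.post (fun _ A => pE A) (pE_cont.comp continuous_snd) fun y A hA =>
    RL_sub_Adm y ⟨pE_ne A, fun hy => by rw [hA hy, pE_one]⟩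

theorem chase (hN : card N + 3 ≤ 2 * (card ι + 2))
    {γ T : (Option (Option N) → I) → GLn (Option (Option ι))} (hγ : Continuous γ)
    (hγb : ∀ y ∈ boundary (Option (Option N)), γ y = 1) (hT : Continuous T)
    (K : Hty (fun y => (SW N (Option ι) y : Set (GLn (Option ι ⊕ Option ι))))
      (fun y => ext em (γ y)) (fun y => ext em (T y)))
    {a} (ha : Cl (fun y => pE (T y)) a) : Cl (fun y => pE (γ y)) a := by
  obtain ⟨K, Kc, K0, K1, KS⟩ := K
  have hr : ∀ p : I × (Option N → I), K (p.1, oc 0 p.2) ∈ (eL (κ := Option ι)).range :=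
    fun p => (KS p.1 _).2 rfl
  set h : I × (Option N → I) → GLn (Option ι) := fun p => eLr (K (p.1, oc 0 p.2)) with hh
  have hc : Continuous h := eLr_cont (by fun_prop) hr
  have hK : ∀ s (y : Option (Option N) → I), y none = 0 → eL (h (s, fun i => y (some i))) = K (s, y) := by
    intro s y hy
    rw [hh]; dsimp only
    rw [eL_eLr (hr (s, _)), ← hy, oc_eta]
  have h0 : ∀ z, h (0, z) = 1 := by
    intro z
    have : K (0, oc 0 z) = 1 := by
      rw [K0]
      dsimp only
      rw [hγb (oc 0 z) ((bdry_option _).2 (Or.inl rfl)), map_one]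
    rw [hh]; dsimp only
    rw [this, ← map_one eL, eLr_eL]
  have hb : ∀ s, ∀ z ∈ boundary (Option N), h (s, z) = 1 := by
    intro s z hz
    have : K (s, oc 0 z) = 1 := (KS s (oc 0 z)).1 (Or.inl hz)
    rw [hh]; dsimp only
    rw [this, ← map_one eL, eLr_eL]
  set V : (Option (Option N) → I) → GLn (Option (Option ι)) :=
    fun y => xs (h (σ (y none), fun i => y (some i))) with hV
  have Vc : Continuous V := by
    have : Continuous fun y : Option (Option N) → I => h (σ (y none), fun i => y (some i)) := by fun_prop
    exact xs_cont.comp this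
  have hA : Hty (LS _ (1 : GLn (Option ι ⊕ Option ι))) (fun y => ext em ((γ y)⁻¹ * T y * (V y)⁻¹)) (fun _ => 1) := by
    have hec := ext_cont (em (ι := ι))
    have hc2 : Continuous fun p : I × (Option (Option N) → I) =>
      h (p.1 * σ (p.2 none), fun i => p.2 (some i)) := by fun_prop
    refine Hty.symm ⟨fun p => (ext em (γ p.2))⁻¹ * K p * (eL (h (p.1 * σ (p.2 none), fun i => p.2 (some i))))⁻¹,
      ?_, fun y => ?_, fun y => ?_, fun s y hy => ?_⟩
    · have h1 : Continuous fun p : I × (Option (Option N) → I) => ext em (γ p.2) := by fun_prop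
      have h2 := (ext_cont (Embedding.inl : Option ι ↪ Option ι ⊕ Option ι)).comp hc2
      exact (h1.inv.mul Kc).mul h2.inv
    · simp [K0, h0]
    · simp only [K1, hV, one_mul, map_mul, map_inv, ext_em_xs]
    · have hg : ext em (γ y) = 1 := by rw [hγb y hy, map_one]
      dsimp only
      rw [hg]
      rcases (bdry_option y).1 hy with h1 | h1 | h1
      · rw [h1, unitInterval.symm_zero, mul_one, hK s y h1]; simp
      · rw [h1, unitInterval.symm_one, mul_zero, h0, (KS s y).1 (Or.inr h1)]; simp
      · rw [hb _ _ h1, (KS s y).1 (Or.inl h1)]; simp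
  have hA' := ext_null (N := Option (Option N)) (ι := Option (Option ι)) (by simp; omega)
    (card ι) (Option ι ⊕ Option ι) (by simp; omega) em
    (fun y => (γ y)⁻¹ * T y * (V y)⁻¹) ((hγ.inv.mul hT).mul Vc.inv) (fun y hy => by
      have := hA.mem_left y hy
      rw [← map_one (ext em)] at this
      exact ext_inj _ this) hA
  have hB : Hty (LS _ (1 : GLn (Option (Option ι)))) (fun y => T y * (V y)⁻¹) γ := by
    have := hA'.post (S' := LS _ (1 : GLn (Option (Option ι)))) (fun y A => γ y * A) (by fun_prop)
      (fun y A hA hy => by rw [hA hy, hγb y hy]; simp)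
    convert this using 2
    · group
    · simp
  refine Cl.hty ?_ (LS_pE hB)
  refine ha.congr fun y => ?_
  rw [pE_mul_St]
  exact inv_mem (xs_St _)

theorem SG_pow_Cl [Nonempty N] {T : (Option N → I) → GLn (Option ι)} (hT : Continuous T)
    (hTS : ∀ y, T y ∈ SG N ι y) {a : HG[Option N; EE ι]}
    (ha : Cl (fun y => pE (T y)) a) (j : ℕ) : Cl (fun y => pE ((T ^ j) y)) (a ^ j) := by
  induction j with
  | zero =>
    have : (fun y => pE ((T ^ 0) y)) = fun _ : Option N → I => ((0, 1) : EE ι × ℝ) := by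
      funext y; simp [pE_one]
    rw [this, pow_zero]
    exact Cl.one continuous_const fun _ => not_NR_base
  | succ j ih =>
    rw [pow_succ' T, pow_succ a]
    exact SG_mul_Cl hT hTS (hT.pow j) (fun y => pow_mem (hTS y) j) ha ih

/-- Main degree computation. -/
theorem degree_step [Nonempty N] (hN : card N + 3 ≤ 2 * (card ι + 2))
    {φ : HG[N; EE ι] →* HG[Option (Option N); EE (Option ι)]}
    (hφ : ∀ u a, Cl u a → Cl (Psi u) (φ a))
    {g : (N → I) → GLn (Option ι)} (hg : Continuous g) (hb : ∀ y ∈ boundary N, g y = 1)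
    {a} (ha : Cl (fun y => pE (g y)) a)
    {γ : (Option (Option N) → I) → GLn (Option (Option ι))} (hγ : Continuous γ)
    (hγb : ∀ y ∈ boundary (Option (Option N)), γ y = 1)
    (H : Hty (LS _ (1 : GLn (Option ι ⊕ Option ι))) (fun y => ext em (γ y))
      (fun y => CC (Wg (g fun i => y (some (some i))) (y none)) (ds univ (vv (y (some none)))))) :
    Cl (fun y => pE (γ y)) (φ a ^ (card ι + 1)) := by
  set T : (Option (Option N) → I) → GLn (Option (Option ι)) := fun y =>
    Th (g fun i => y (some (some i))) (y none) (vv (y (some none))) with hTd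
  have hT : Continuous T := Th_cont hg
  have hθ := CC_theta hg hb
  have hTS : ∀ y, T y ∈ SG (Option N) (Option ι) y := fun y => SW_ext (hθ.mem_right y)
  have hTC : Cl (fun y => pE (T y)) (φ a) := (hφ _ _ ha).hty (Th_hty hg hb)
  have hP := (IsW_Wg hg hb).power none univ
  have hH : Hty (fun y => (SW N (Option ι) y : Set (GLn (Option ι ⊕ Option ι)))) (fun y => ext em (γ y))
      (fun y => CC (Wg (g fun i => y (some (some i))) (y none)) (ds univ (vv (y (some none))))) := by
    obtain ⟨K, Kc, K0, K1, KS⟩ := H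
    have hS : ∀ y : Option (Option N) → I, (∀ A ∈ LS _ (1 : GLn (Option ι ⊕ Option ι)) y, A ∈ SW N (Option ι) y) := by
      intro y A hA
      refine ⟨fun h => hA ((bdry_option y).2 (by tauto)), fun h => ?_⟩
      rw [hA ((bdry_option y).2 (by tauto))]
      exact one_mem _
    exact ⟨K, Kc, K0, K1, fun s y => hS y _ (KS s y)⟩
  have h2 := (hH.trans hP).trans (hθ.zpow _)
  refine chase hN hγ hγb (T := T ^ (card ι + 1)) (hT.pow _) ?_ (SG_pow_Cl hT hTS hTC _)
  convert h2 using 1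
  funext y
  rw [Pi.pow_apply, Pi.pow_apply, map_pow, zpow_natCast, Finset.card_univ, Fintype.card_option]

end chase

section fourier

variable {X : Type*} [TopologicalSpace X] [CompactSpace X] [T2Space X]

noncomputable def cir (θ : I) : Circle := Circle.exp (2 * pi * θ)

theorem cir_cont : Continuous cir := by unfold cir; fun_prop

theorem coe_cir (θ : I) : (cir θ : ℂ) = vv θ := by
  simp [cir, vv, Circle.coe_exp]

theorem cir_surj : Function.Surjective cir := by
  intro z
  have hp : (2 * pi) ≠ 0 := by positivity
  refine ⟨⟨Int.fract (Complex.arg z / (2 * pi)), Int.fract_nonneg _, (Int.fract_lt_one _).le⟩, ?_⟩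
  have : cir ⟨Int.fract (Complex.arg z / (2 * pi)), Int.fract_nonneg _, (Int.fract_lt_one _).le⟩
    = Circle.exp (Complex.arg z) := by
    rw [cir, Circle.exp_eq_exp]
    refine ⟨-⌊Complex.arg z / (2 * pi)⌋, ?_⟩
    simp only [Int.fract]
    field_simp
    push_cast
    ring
  rw [this, Circle.exp_arg]

theorem vv_surj {z : ℂ} (hz : ‖z‖ = 1) : ∃ θ, (vv θ : ℂ) = z := by
  obtain ⟨θ, h⟩ := cir_surj ⟨z, by simpa [Submonoid.unitSphere] using hz⟩
  exact ⟨θ, by rw [← coe_cir, h]⟩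

theorem cir_eq {θ θ' : I} (h : cir θ = cir θ') : θ = θ' ∨ (θ = 0 ∧ θ' = 1) ∨ (θ = 1 ∧ θ' = 0) := by
  rw [cir, cir, Circle.exp_eq_exp] at h
  obtain ⟨m, hm⟩ := h
  have hp : (0 : ℝ) < 2 * pi := by positivity
  have h1 : (θ : ℝ) = θ' + m := by
    have : 2 * pi * (θ : ℝ) = 2 * pi * (θ' + m) := by rw [hm]; ring
    exact mul_left_cancel₀ hp.ne' this
  have a0 := θ.2.1
  have a1 := θ.2.2
  have b0 := θ'.2.1
  have b1 := θ'.2.2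
  have m1 : m ≤ 1 := by
    have : (m : ℝ) ≤ 1 := by linarith
    exact_mod_cast this
  have m2 : -1 ≤ m := by
    have : (-1 : ℝ) ≤ m := by linarith
    exact_mod_cast this
  have : m = -1 ∨ m = 0 ∨ m = 1 := by omega
  rcases this with rfl | rfl | rfl
  · right; left
    push_cast at h1
    exact ⟨Subtype.ext (by change (θ : ℝ) = 0; linarith), Subtype.ext (by change (θ' : ℝ) = 1; linarith)⟩
  · left
    exact Subtype.ext (by simpa using h1)
  · right; right
    push_cast at h1
    exact ⟨Subtype.ext (by change (θ : ℝ) = 1; linarith), Subtype.ext (by change (θ' : ℝ) = 0; linarith)⟩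

/-- monomials -/
noncomputable def mono (a : C(X, ℂ)) (k : ℤ) : C(X × Circle, ℂ) where
  toFun p := a p.1 * (p.2 : ℂ) ^ k
  continuous_toFun := (a.continuous.comp continuous_fst).mul
    ((continuous_induced_dom.comp continuous_snd).zpow₀ k fun p => Or.inl p.2.coe_ne_zero)

noncomputable def monoM (X : Type*) [TopologicalSpace X] [CompactSpace X] [T2Space X] :
    Submonoid C(X × Circle, ℂ) where
  carrier := {h | ∃ a k, h = mono a k}
  one_mem' := ⟨1, 0, by ext; simp [mono]⟩
  mul_mem' := by
    rintro _ _ ⟨a, k, rfl⟩ ⟨b, l, rfl⟩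
    refine ⟨a * b, k + l, ?_⟩
    ext p
    simp [mono, zpow_add₀]
    ring

theorem fourier_dense {h : X × I → ℂ} (hc : Continuous h) (hp : ∀ x, h (x, 0) = h (x, 1))
    {ε : ℝ} (hε : 0 < ε) : ∃ a : ℤ →₀ C(X, ℂ), ∀ x θ,
      ‖h (x, θ) - a.sum fun k c => c x * (vv θ : ℂ) ^ k‖ < ε := by
  have hq : Continuous fun p : X × I => (p.1, cir p.2) := by have := cir_cont; fun_prop
  have hs : Function.Surjective fun p : X × I => (p.1, cir p.2) := by
    rintro ⟨x, z⟩
    obtain ⟨θ, rfl⟩ := cir_surj z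
    exact ⟨(x, θ), rfl⟩
  have hQ := hq.isClosedMap.isQuotientMap hq hs
  have hfac : Function.FactorsThrough h fun p : X × I => (p.1, cir p.2) := by
    rintro ⟨x, θ⟩ ⟨x', θ'⟩ he
    obtain ⟨h1, h2⟩ := Prod.mk.inj he
    dsimp only at h1 h2
    subst h1
    rcases cir_eq h2 with rfl | ⟨rfl, rfl⟩ | ⟨rfl, rfl⟩
    · rfl
    · exact hp x
    · exact (hp x).symm
  obtain ⟨H, hH⟩ : ∃ H : C(X × Circle, ℂ), ∀ x θ, H (x, cir θ) = h (x, θ) := by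
    choose r hr using hs
    have : Continuous fun q => h (r q) := by
      rw [hQ.continuous_iff]
      convert hc using 1
      funext p
      exact hfac (hr _)
    exact ⟨⟨_, this⟩, fun x θ => hfac (hr _)⟩
  let A : StarSubalgebra ℂ C(X × Circle, ℂ) :=
    { Algebra.adjoin ℂ (monoM X : Set C(X × Circle, ℂ)) with
      star_mem' := by
        intro a ha
        change a ∈ Algebra.adjoin ℂ (monoM X : Set C(X × Circle, ℂ)) at ha
        change star a ∈ Algebra.adjoin ℂ (monoM X : Set C(X × Circle, ℂ))
        induction ha using Algebra.adjoin_induction with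
        | mem x hx =>
          obtain ⟨a, k, rfl⟩ := hx
          refine Algebra.subset_adjoin ⟨star a, -k, ?_⟩
          ext p
          simp [mono, ← Circle.coe_inv_eq_conj]
        | algebraMap r =>
          have : star (algebraMap ℂ C(X × Circle, ℂ) r) = algebraMap ℂ _ (star r) := by
            ext; simp
          rw [this]
          exact Subalgebra.algebraMap_mem _ _
        | add x y _ _ hx hy => rw [star_add]; exact add_mem hx hy
        | mul x y _ _ hx hy => rw [star_mul]; exact mul_mem hy hx }
  have hA : A.SeparatesPoints := by
    rintro ⟨x, z⟩ ⟨x', z'⟩ hne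
    by_cases hz : z = z'
    · have hx : x ≠ x' := fun h => hne (by rw [h, hz])
      obtain ⟨g, g0, g1, -⟩ := exists_continuous_zero_one_of_isClosed (isClosed_singleton (x := x))
        (isClosed_singleton (x := x')) (by simpa using hx)
      refine ⟨mono ⟨fun x => (g x : ℂ), by fun_prop⟩ 0, ⟨_, Algebra.subset_adjoin ⟨_, _, rfl⟩, rfl⟩, ?_⟩
      have e0 : g x = 0 := g0 rfl
      have e1 : g x' = 1 := g1 rfl
      simp [mono, e0, e1]
    · refine ⟨mono 1 1, ⟨_, Algebra.subset_adjoin ⟨_, _, rfl⟩, rfl⟩, ?_⟩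
      simp only [mono, ContinuousMap.coe_mk, ContinuousMap.one_apply, one_mul, zpow_one]
      exact fun h => hz (Circle.ext h)
  have htop := ContinuousMap.starSubalgebra_topologicalClosure_eq_top_of_separatesPoints A hA
  have hmem : H ∈ closure (A : Set C(X × Circle, ℂ)) := by
    have : H ∈ A.topologicalClosure := by rw [htop]; trivial
    exact this
  obtain ⟨P, hP, hd⟩ := Metric.mem_closure_iff.1 hmem ε hε
  have hP' : P ∈ Submodule.span ℂ (monoM X : Set C(X × Circle, ℂ)) := by
    have h1 : P ∈ Subalgebra.toSubmodule (Algebra.adjoin ℂ (monoM X : Set C(X × Circle, ℂ))) := hP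
    rw [Algebra.adjoin_eq_span, Submonoid.closure_eq] at h1
    exact h1
  have hrep : ∃ a : ℤ →₀ C(X, ℂ), ∀ x z, P (x, z) = a.sum fun k c => c x * (z : ℂ) ^ k := by
    clear hd hP
    induction hP' using Submodule.span_induction with
    | mem x hx =>
      obtain ⟨a, k, rfl⟩ := hx
      refine ⟨Finsupp.single k a, fun x z => ?_⟩
      rw [Finsupp.sum_single_index (by simp)]
      simp [mono]
    | zero => exact ⟨0, by simp⟩
    | add x y _ _ hx hy =>
      obtain ⟨a, ha⟩ := hx
      obtain ⟨b, hb⟩ := hy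
      refine ⟨a + b, fun x z => ?_⟩
      rw [Finsupp.sum_add_index' (by simp) (by intros; simp [add_mul]), ← ha, ← hb]; rfl
    | smul r x _ hx =>
      obtain ⟨a, ha⟩ := hx
      refine ⟨r • a, fun x z => ?_⟩
      rw [Finsupp.sum_smul_index' (by intro i; simp)]
      change r * _ = _
      rw [ha, Finsupp.sum, Finsupp.sum, Finset.mul_sum]
      refine Finset.sum_congr rfl fun k _ => ?_
      simp [mul_assoc]
  obtain ⟨a, ha⟩ := hrep
  refine ⟨a, fun x θ => ?_⟩
  rw [← hH, ← coe_cir, ← ha, ← dist_eq_norm]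
  exact lt_of_le_of_lt (ContinuousMap.dist_apply_le_dist _) hd

end fourier

section NN

variable {X : Type*} [TopologicalSpace X] {ι κ : Type*} [Fintype ι] [DecidableEq ι]
  [Fintype κ] [DecidableEq κ]

def SX (B : Set X) (G : Type*) [One G] (p : X × I) : Set G :=
  {A | p.1 ∈ B ∨ p.2 = 0 ∨ p.2 = 1 → A = 1}

noncomputable def NN (b0 : X) (G : X × I → GLn ι) (p : X × I) : GLn ι :=
  (G (p.1, 0))⁻¹ * G p * ((G (b0, 0))⁻¹ * G (b0, p.2))⁻¹

theorem NN_hty {B : Set X} {b0 : X} (K : I × X × I → Mat(ι)) (hK : Continuous K)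
    (hd : ∀ s x θ, (K (s, x, θ)).det ≠ 0) (h1 : ∀ s x, K (s, x, 1) = K (s, x, 0))
    (hB : ∀ s, ∀ x ∈ B, ∀ θ, K (s, x, θ) = K (s, b0, θ)) :
    Hty (SX B (GLn ι)) (NN b0 fun p => toGL (K (0, p))) (NN b0 fun p => toGL (K (1, p))) := by
  have hT : Continuous fun p => toGL (K p) := toGL_cont hK fun p => hd _ _ _
  refine ⟨fun q => NN b0 (fun p => toGL (K (q.1, p))) q.2, ?_, fun _ => rfl, fun _ => rfl, ?_⟩
  · unfold NN
    have c1 : Continuous fun q : I × X × I => toGL (K (q.1, q.2.1, 0)) :=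
      hT.comp (by fun_prop : Continuous fun q : I × X × I => (q.1, q.2.1, (0 : I)))
    have c2 : Continuous fun q : I × X × I => toGL (K (q.1, b0, 0)) :=
      hT.comp (by fun_prop : Continuous fun q : I × X × I => (q.1, b0, (0 : I)))
    have c3 : Continuous fun q : I × X × I => toGL (K (q.1, b0, q.2.2)) :=
      hT.comp (by fun_prop : Continuous fun q : I × X × I => (q.1, b0, q.2.2))
    exact (c1.inv.mul hT).mul (c2.inv.mul c3).inv
  · rintro s ⟨x, θ⟩ h
    simp only [NN]
    rcases h with h | h | h
    · dsimp only at h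
      simp [hB s x h]
    · dsimp only at h
      subst h
      simp
    · dsimp only at h
      subst h
      simp [h1]

theorem NN_left {b0 : X} (C : X → GLn ι) (G : X × I → GLn ι) :
    NN b0 (fun p => C p.1 * G p) = NN b0 G := by
  funext p
  simp [NN, mul_assoc]

theorem NN_ext {b0 : X} (e : ι ↪ κ) (G : X × I → GLn ι) :
    NN b0 (fun p => ext e (G p)) = fun p => ext e (NN b0 G p) := by
  funext p
  simp [NN]

theorem exists_eps {Y : Type*} [TopologicalSpace Y] [CompactSpace Y] {f : Y → GLn ι}
    (hf : Continuous f) : ∃ ε > 0, ∀ y, ∀ D : Mat(ι), (∀ i j, ‖D i j‖ < ε) →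
      ((f y : Mat(ι)) + D).det ≠ 0 := by
  have hc : Continuous fun q : Y × (ι → ι → ℂ) =>
      ((f q.1 : Mat(ι)) + Matrix.of q.2).det := by
    have h1 : Continuous fun q : Y × (ι → ι → ℂ) => (f q.1 : Mat(ι)) :=
      continuous_val.comp (hf.comp continuous_fst)
    have h2 : Continuous fun q : Y × (ι → ι → ℂ) => Matrix.of q.2 := continuous_snd
    exact (h1.add h2).matrix_det
  have ho : IsOpen {q : Y × (ι → ι → ℂ) | ((f q.1 : Mat(ι)) + Matrix.of q.2).det ≠ 0} :=
    isOpen_ne_fun hc continuous_const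
  obtain ⟨u, v, hu, hv, su, sv, huv⟩ := generalized_tube_lemma (isCompact_univ (X := Y))
    (isCompact_singleton (x := (0 : ι → ι → ℂ))) ho (by
      rintro ⟨y, D⟩ ⟨-, hD⟩
      have : D = 0 := hD
      subst this
      simpa using GLn_det_ne (f y))
  obtain ⟨ε, hε, hb⟩ := Metric.isOpen_iff.1 hv 0 (sv rfl)
  refine ⟨ε, hε, fun y D hD => ?_⟩
  have : (y, (fun i j => D i j)) ∈ u ×ˢ v := by
    refine ⟨su trivial, hb ?_⟩
    rw [Metric.mem_ball, dist_pi_lt_iff hε]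
    intro i
    rw [dist_pi_lt_iff hε]
    intro j
    simpa using hD i j
  exact huv this

theorem sum_shift (a : ℤ → ℂ) (z : ℂ) (hz : z ≠ 0) (m : ℕ) :
    ∑ j ∈ range (2 * m + 1), z ^ j * a ((j : ℤ) - m) =
      z ^ m * ∑ k ∈ Finset.Icc (-(m : ℤ)) m, a k * z ^ k := by
  rw [Finset.mul_sum]
  refine Finset.sum_bij' (fun j _ => (j : ℤ) - m) (fun k _ => (k + m).toNat) ?_ ?_ ?_ ?_ ?_
  · intro j hj
    simp at hj ⊢
    omega
  · intro k hk
    simp at hk ⊢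
    omega
  · intro j hj; simp
  · intro k hk
    simp at hk ⊢
    omega
  · intro j hj
    rw [zpow_sub₀ hz]
    field_simp
    simp
    ring

theorem vv_norm (θ : I) : ‖(vv θ : ℂ)‖ = 1 := by
  rw [← coe_cir]; exact mem_sphere_zero_iff_norm.1 (cir θ).2

theorem laurent [CompactSpace X] [T2Space X] {B : Set X} (hBc : IsClosed B) {b0 : X} (hb0 : b0 ∈ B)
    {f : X × I → GLn ι} (hf : Continuous f) (hfS : ∀ p, f p ∈ SX B (GLn ι) p) :
    ∃ (n : ℕ) (a : ℕ → X → Mat(ι)), (∀ k, Continuous (a k)) ∧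
      (∀ k, ∀ x ∈ B, a k x = a k b0) ∧
      (∀ x, ∀ z : ℂ, ‖z‖ = 1 → (∑ k ∈ range (n + 1), z ^ k • a k x).det ≠ 0) ∧
      Hty (SX B (GLn ι)) f
        (NN b0 fun p => toGL (∑ k ∈ range (n + 1), (vv p.2 : ℂ) ^ k • a k p.1)) := by
  obtain ⟨ε, hε, hdet⟩ := exists_eps hf
  have hfM : Continuous fun p => (f p : Mat(ι)) := continuous_val.comp hf
  have hu : ∀ i j, Continuous fun p => ((f p : Mat(ι)) - 1) i j := fun i j =>
    (hfM.sub continuous_const).matrix_elem i j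
  have f0 : ∀ x, f (x, 0) = 1 := fun x => hfS (x, 0) (Or.inr (Or.inl rfl))
  have f1 : ∀ x, f (x, 1) = 1 := fun x => hfS (x, 1) (Or.inr (Or.inr rfl))
  have fB : ∀ x ∈ B, ∀ θ, f (x, θ) = 1 := fun x hx θ => hfS (x, θ) (Or.inl hx)
  have hF : ∀ i j, ∃ c : ℤ →₀ C(X, ℂ), ∀ x θ, ‖((f (x, θ) : Mat(ι)) - 1) i j -
      c.sum fun k c => c x * (vv θ : ℂ) ^ k‖ < ε := fun i j =>
    fourier_dense (hu i j) (fun x => by rw [f0, f1]) hε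
  choose c hc using hF
  let C : Set X := ⋃ i, ⋃ j, Prod.fst '' {p : X × I | ε ≤ ‖((f p : Mat(ι)) - 1) i j‖}
  have hC : IsClosed C := by
    refine isClosed_iUnion_of_finite fun i => isClosed_iUnion_of_finite fun j => ?_
    exact isClosedMap_fst_of_compactSpace _ (isClosed_le continuous_const (hu i j).norm)
  have hCB : Disjoint B C := by
    rw [Set.disjoint_left]
    intro x hx hxC
    simp only [C, Set.mem_iUnion, Set.mem_image] at hxC
    obtain ⟨i, j, ⟨x', θ⟩, h, rfl⟩ := hxC
    dsimp only at hx
    simp only [Set.mem_setOf_eq, fB x' hx] at h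
    simp at h
    linarith
  obtain ⟨χ, χ0, χ1, χm⟩ := exists_continuous_zero_one_of_isClosed hBc hC hCB
  obtain ⟨m, hm⟩ : ∃ m : ℕ, ∀ i j, (c i j).support ⊆ Finset.Icc (-(m : ℤ)) m := by
    have h : ∀ i j, ∃ m : ℕ, (c i j).support ⊆ Finset.Icc (-(m : ℤ)) m := by
      intro i j
      refine ⟨(c i j).support.sup Int.natAbs, fun k hk => ?_⟩
      have := Finset.le_sup (f := Int.natAbs) hk
      rw [Finset.mem_Icc]
      omega
    choose m hm using h
    refine ⟨univ.sup fun i => univ.sup fun j => m i j, fun i j => (hm i j).trans ?_⟩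
    have h1 : m i j ≤ univ.sup fun j => m i j := Finset.le_sup (f := fun j => m i j) (Finset.mem_univ j)
    have h2 : (univ.sup fun j => m i j) ≤ univ.sup fun i => univ.sup fun j => m i j :=
      Finset.le_sup (f := fun i => univ.sup fun j => m i j) (Finset.mem_univ i)
    refine Finset.Icc_subset_Icc ?_ ?_ <;> omega
  let a : ℕ → X → Mat(ι) := fun k x => Matrix.of fun i j =>
    (if k = m then (1 : Mat(ι)) i j else 0) + (χ x : ℂ) * c i j ((k : ℤ) - m) x
  let p : X × I → Mat(ι) := fun q => Matrix.of fun i j => (1 : Mat(ι)) i j +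
    (χ q.1 : ℂ) * (c i j).sum fun k c => c q.1 * (vv q.2 : ℂ) ^ k
  have hap : ∀ x θ, ∑ k ∈ range (2 * m + 1), (vv θ : ℂ) ^ k • a k x =
      (vv θ : ℂ) ^ m • p (x, θ) := by
    intro x θ
    ext i j
    rw [Matrix.sum_apply]
    simp only [a, p, Matrix.smul_apply, of_apply, smul_eq_mul, mul_add, Finset.sum_add_distrib]
    congr 1
    · rw [Finset.sum_eq_single m]
      · simp
      · intro b _ hb; simp [hb]
      · intro h; simp at h; omega
    · have := sum_shift (fun k => (χ x : ℂ) * c i j k x) (vv θ) (vv θ).ne_zero m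
      rw [this, Finsupp.sum_of_support_subset _ (hm i j) _ (by simp), Finset.mul_sum, Finset.mul_sum,
        Finset.mul_sum]
      exact Finset.sum_congr rfl fun k _ => by ring
  have hpf : ∀ x θ i j, ‖(p (x, θ) - f (x, θ)) i j‖ < ε := by
    intro x θ i j
    have e : (p (x, θ) - f (x, θ)) i j = -((1 - χ x : ℝ) • (((f (x, θ) : Mat(ι)) - 1) i j) +
      (χ x : ℝ) • (((f (x, θ) : Mat(ι)) - 1) i j -
        (c i j).sum fun k c => c x * (vv θ : ℂ) ^ k)) := by
      simp only [p, Matrix.sub_apply, of_apply, Complex.real_smul]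
      push_cast
      ring
    rw [e, norm_neg]
    by_cases hx : x ∈ C
    · have : χ x = 1 := χ1 hx
      rw [this]
      simpa using hc i j x θ
    · have h1 : ‖((f (x, θ) : Mat(ι)) - 1) i j‖ < ε := by
        by_contra hcon
        exact hx (Set.mem_iUnion.2 ⟨i, Set.mem_iUnion.2 ⟨j, (x, θ), not_lt.1 hcon, rfl⟩⟩)
      have := convex_ball (0 : ℂ) ε (mem_ball_zero_iff.2 h1) (mem_ball_zero_iff.2 (hc i j x θ))
        (sub_nonneg.2 (χm x).2) (χm x).1 (by ring)
      exact mem_ball_zero_iff.1 this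
  have hvc : Continuous fun q : X × I => (vv q.2 : ℂ) :=
    continuous_val.comp (vv_cont.comp continuous_snd)
  have hχ : Continuous fun x => (χ x : ℂ) := Complex.continuous_ofReal.comp χ.continuous
  have ha : ∀ k, Continuous (a k) := by
    intro k
    refine continuous_matrix fun i j => ?_
    exact continuous_const.add (hχ.mul (c i j _).continuous)
  have hpB : ∀ x ∈ B, ∀ θ, p (x, θ) = 1 := by
    intro x hx θ
    have : χ x = 0 := χ0 hx
    ext i j
    simp [p, this]
  have hpc : Continuous p := by
    refine continuous_matrix fun i j => ?_
    refine continuous_const.add ((hχ.comp continuous_fst).mul ?_)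
    refine continuous_finset_sum _ fun k _ => ?_
    exact ((c i j k).continuous.comp continuous_fst).mul (hvc.zpow₀ k fun q => Or.inl (vv q.2).ne_zero)
  have hd : ∀ (s : I) x θ, ((vv θ : ℂ) ^ m • ((f (x, θ) : Mat(ι)) +
      ((s : ℝ) : ℂ) • (p (x, θ) - f (x, θ)))).det ≠ 0 := by
    intro s x θ
    rw [Matrix.det_smul]
    refine mul_ne_zero (pow_ne_zero _ (pow_ne_zero _ (vv θ).ne_zero)) (hdet _ _ fun i j => ?_)
    rw [Matrix.smul_apply, smul_eq_mul, norm_mul]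
    refine lt_of_le_of_lt ?_ (hpf x θ i j)
    refine mul_le_of_le_one_left (norm_nonneg _) ?_
    rw [Complex.norm_real, Real.norm_eq_abs, abs_of_nonneg s.2.1]
    exact s.2.2
  refine ⟨2 * m, a, ha, ?_, ?_, ?_⟩
  · intro k x hx
    have h0 : χ x = 0 := χ0 hx
    have h1 : χ b0 = 0 := χ0 hb0
    ext i j
    simp [a, h0, h1]
  · intro x z hz
    obtain ⟨θ, rfl⟩ := vv_surj hz
    rw [hap]
    have := hd 1 x θ
    simpa using this
  · have := NN_hty (B := B) (b0 := b0) (fun q : I × X × I => (vv q.2.2 : ℂ) ^ m • ((f q.2 : Mat(ι)) +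
      ((q.1 : ℝ) : ℂ) • (p q.2 - (f q.2 : Mat(ι))))) ?_ hd ?_ ?_
    · convert this using 1
      · funext ⟨x, θ⟩
        have e : ∀ x θ, toGL ((vv θ : ℂ) ^ m • ((f (x, θ) : Mat(ι)) + (((0 : I) : ℝ) : ℂ) • (p (x, θ) - (f (x, θ) : Mat(ι))))) =
            toGL ((vv θ : ℂ) ^ m • (1 : Mat(ι))) * f (x, θ) := by
          intro x θ
          apply Units.ext
          rw [val_mul, coe_toGL (hd 0 x θ), coe_toGL (by
            rw [Matrix.det_smul]
            simp)]
          simp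
        simp only [NN]
        rw [e, e, e, e, f0, f0, fB b0 hb0]
        have e1 : toGL ((vv (0 : I) : ℂ) ^ m • (1 : Mat(ι))) = 1 := by
          rw [vv_zero]
          apply Units.ext
          rw [coe_toGL (by simp)]
          simp
        rw [e1]
        set Q := toGL ((vv θ : ℂ) ^ m • (1 : Mat(ι))) with hQ
        have hcom : Q * f (x, θ) = f (x, θ) * Q := by
          apply Units.ext
          rw [val_mul, val_mul, hQ, coe_toGL (by
            rw [Matrix.det_smul]
            simp)]
          simp
        simp [hcom]
      · congr 1
        funext ⟨x, θ⟩
        rw [hap]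
        simp
    · have h1 : Continuous fun q : I × X × I => (vv q.2.2 : ℂ) ^ m := (hvc.comp continuous_snd).pow m
      have h2 : Continuous fun q : I × X × I => (((q.1 : I) : ℝ) : ℂ) :=
        Complex.continuous_ofReal.comp (continuous_subtype_val.comp continuous_fst)
      have h3 : Continuous fun q : I × X × I => p q.2 - (f q.2 : Mat(ι)) := (hpc.sub hfM).comp continuous_snd
      have h4 := h2.smul h3
      have h5 : Continuous fun q : I × X × I => (f q.2 : Mat(ι)) := hfM.comp continuous_snd
      exact h1.smul (h5.add h4)
    · intro s x
      have hv : vv 1 = vv 0 := by rw [vv_one, vv_zero]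
      have hp : p (x, 1) = p (x, 0) := by simp only [p, hv]
      simp only [f0, f1, hp, hv]
    · intro s x hx θ
      simp only [fB x hx, fB b0 hb0, hpB x hx, hpB b0 hb0]

end NN

section lin

variable {X : Type*} [TopologicalSpace X]

theorem toGL_ext {ι κ : Type*} [Fintype ι] [DecidableEq ι] [Fintype κ] [DecidableEq κ]
    (e : ι ↪ κ) {A : Mat(ι)} (h : A.det ≠ 0) : ext e (toGL A) = toGL (extM e A) := by
  apply Units.ext
  rw [coe_ext, coe_toGL h, coe_toGL (by rwa [extM_det])]

theorem linearize {B : Set X} {b0 : X} (n : ℕ) : ∀ (ι : Type) [Fintype ι] [DecidableEq ι]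
    (a : ℕ → X → Mat(ι)) (_ : ∀ k, Continuous (a k)) (_ : ∀ k, ∀ x ∈ B, a k x = a k b0)
    (_ : ∀ x, ∀ z : ℂ, ‖z‖ = 1 → (∑ k ∈ range (n + 2), z ^ k • a k x).det ≠ 0),
    ∃ (κ : Type) (_ : Fintype κ) (_ : DecidableEq κ) (e : ι ↪ κ) (α β : X → Mat(κ)),
      Continuous α ∧ Continuous β ∧ (∀ x ∈ B, α x = α b0) ∧ (∀ x ∈ B, β x = β b0) ∧
      (∀ x, ∀ z : ℂ, ‖z‖ = 1 → (β x + z • α x).det ≠ 0) ∧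
      Hty (SX B (GLn κ)) (fun p => ext e ((NN b0 fun p => toGL
        (∑ k ∈ range (n + 2), (vv p.2 : ℂ) ^ k • a k p.1)) p))
        (NN b0 fun p => toGL (β p.1 + (vv p.2 : ℂ) • α p.1)) := by
  have hv : vv 1 = vv 0 := by rw [vv_one, vv_zero]
  induction n with
  | zero =>
    intro ι _ _ a ha hB hd
    have e : ∀ x (z : ℂ), ∑ k ∈ range (0 + 2), z ^ k • a k x = a 0 x + z • a 1 x := by
      intro x z; simp [Finset.sum_range_succ]
    simp only [e] at hd ⊢
    refine ⟨ι, inferInstance, inferInstance, Embedding.refl ι, a 1, a 0, ha 1, ha 0,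
      hB 1, hB 0, hd, ?_⟩
    simp only [ext_refl]
    refine NN_hty (B := B) (b0 := b0) (fun q : I × X × I => a 0 q.2.1 + (vv q.2.2 : ℂ) • a 1 q.2.1)
      ?_ ?_ ?_ ?_
    · have h0 := ha 0
      have h1 := ha 1
      have h2 : Continuous fun q : I × X × I => (vv q.2.2 : ℂ) :=
        continuous_val.comp (vv_cont.comp (by fun_prop))
      have h3 : Continuous fun q : I × X × I => a 1 q.2.1 := h1.comp (by fun_prop)
      have h4 : Continuous fun q : I × X × I => a 0 q.2.1 := h0.comp (by fun_prop)
      exact h4.add (h2.smul h3)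
    · intro s x θ; exact hd x _ (vv_norm θ)
    · intro s x; simp only [hv]
    · intro s x hx θ; simp only [hB _ x hx]
  | succ n ih =>
    intro ι _ _ a ha hB hd
    let q' : X → ℂ → Mat(ι) := fun x z => ∑ k ∈ range (n + 2), z ^ k • a (k + 1) x
    have hq : ∀ x z, ∑ k ∈ range (n + 1 + 2), z ^ k • a k x = a 0 x + z • q' x z := by
      intro x z
      rw [Finset.sum_range_succ', Finset.smul_sum]
      simp only [pow_succ', mul_smul, pow_zero, one_smul]
      rw [add_comm]
    let A : ℕ → X → Mat(ι ⊕ ι) := fun k x =>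
      fromBlocks (if k = 0 then 1 else 0) (if k = 1 then -1 else 0) (a (k + 1) x)
        (if k = 0 then a 0 x else 0)
    have hA : ∀ x z, ∑ k ∈ range (n + 2), z ^ k • A k x =
        fromBlocks 1 (-z • (1 : Mat(ι))) (q' x z) (a 0 x) := by
      intro x z
      ext i j
      rw [Matrix.sum_apply]
      rcases i with i | i <;> rcases j with j | j
      · simp only [A, Matrix.smul_apply, Matrix.fromBlocks_apply₁₁]
        rw [Finset.sum_eq_single 0]
        · simp
        · intro b _ hb; simp [hb]
        · intro h; simp at h
      · simp only [A, Matrix.smul_apply, Matrix.fromBlocks_apply₁₂]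
        rw [Finset.sum_eq_single 1]
        · simp
        · intro b _ hb; simp [hb]
        · intro h; simp at h
      · simp only [A, q', Matrix.smul_apply, Matrix.fromBlocks_apply₂₁, Matrix.sum_apply]
      · simp only [A, Matrix.smul_apply, Matrix.fromBlocks_apply₂₂]
        rw [Finset.sum_eq_single 0]
        · simp
        · intro b _ hb; simp [hb]
        · intro h; simp at h
    have hAc : ∀ k, Continuous (A k) := by
      intro k
      refine Continuous.matrix_fromBlocks continuous_const continuous_const (ha _) ?_
      split_ifs
      · exact ha 0
      · exact continuous_const
    have hAB : ∀ k, ∀ x ∈ B, A k x = A k b0 := by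
      intro k x hx
      simp only [A, hB _ x hx]
    let K : ℂ → X → ℂ → Mat(ι ⊕ ι) := fun s x z =>
      fromBlocks 1 0 (s • q' x z) 1 * (fromBlocks 1 0 0 (a 0 x + z • q' x z) *
        fromBlocks 1 (-(s * z) • (1 : Mat(ι))) 0 1)
    have K1 : ∀ x z, K 1 x z = fromBlocks 1 (-z • (1 : Mat(ι))) (q' x z) (a 0 x) := by
      intro x z
      simp [K, fromBlocks_multiply]
    have K0 : ∀ x z, K 0 x z = fromBlocks 1 0 0 (a 0 x + z • q' x z) := by
      intro x z
      simp [K, fromBlocks_multiply]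
    have Kd : ∀ s x z, (K s x z).det = (a 0 x + z • q' x z).det := by
      intro s x z
      simp only [K, Matrix.det_mul, Matrix.det_fromBlocks_zero₁₂, Matrix.det_fromBlocks_zero₂₁]
      simp
    have hd' : ∀ x, ∀ z : ℂ, ‖z‖ = 1 → (∑ k ∈ range (n + 2), z ^ k • A k x).det ≠ 0 := by
      intro x z hz
      rw [hA, ← K1, Kd, ← hq]
      exact hd x z hz
    obtain ⟨κ, _, _, e, α, β, hα, hβ, hαB, hβB, hdet, H⟩ := ih (ι ⊕ ι) A hAc hAB hd'
    refine ⟨κ, inferInstance, inferInstance, (Embedding.inr : ι ↪ ι ⊕ ι).trans e, α, β,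
      hα, hβ, hαB, hβB, hdet, Hty.trans ?_ H⟩
    have hqc : Continuous fun p : X × ℂ => q' p.1 p.2 := by
      refine continuous_finset_sum _ fun k _ => ?_
      have h1 : Continuous fun p : X × ℂ => p.2 ^ k := by fun_prop
      have h2 : Continuous fun p : X × ℂ => a (k + 1) p.1 := (ha _).comp continuous_fst
      exact h1.smul h2
    have hKc : Continuous fun p : ℂ × X × ℂ => K p.1 p.2.1 p.2.2 := by
      have c1 : Continuous fun p : ℂ × X × ℂ => q' p.2.1 p.2.2 := hqc.comp continuous_snd
      have c2 : Continuous fun p : ℂ × X × ℂ => p.1 := continuous_fst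
      have c3 : Continuous fun p : ℂ × X × ℂ => p.2.2 := by fun_prop
      have c4 : Continuous fun p : ℂ × X × ℂ => a 0 p.2.1 := (ha 0).comp (by fun_prop)
      have c5 : Continuous fun p : ℂ × X × ℂ => (-(p.1 * p.2.2)) • (1 : Mat(ι)) :=
        (c2.mul c3).neg.smul continuous_const
      exact (Continuous.matrix_fromBlocks continuous_const continuous_const (c2.smul c1)
        continuous_const).mul ((Continuous.matrix_fromBlocks continuous_const continuous_const
        continuous_const (c4.add (c3.smul c1))).mul (Continuous.matrix_fromBlocks continuous_const
        c5 continuous_const continuous_const))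
    have hKB : ∀ s, ∀ x ∈ B, ∀ z, K s x z = K s b0 z := by
      intro s x hx z
      simp only [K, q', hB _ x hx]
    clear_value K
    have hphi : Continuous fun q : I × X × I => ((((q.1 : I) : ℝ) : ℂ), q.2.1, (vv q.2.2 : ℂ)) := by
      have h2 : Continuous fun q : I × X × I => (vv q.2.2 : ℂ) :=
        continuous_val.comp (vv_cont.comp (by fun_prop))
      have h1 : Continuous fun q : I × X × I => (((q.1 : I) : ℝ) : ℂ) :=
        Complex.continuous_ofReal.comp (continuous_subtype_val.comp continuous_fst)
      have h3 : Continuous fun q : I × X × I => q.2.1 := by fun_prop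
      exact h1.prodMk (h3.prodMk h2)
    have hHom := NN_hty (B := B) (b0 := b0) (fun q : I × X × I => K ((q.1 : ℝ) : ℂ) q.2.1 (vv q.2.2))
      (hKc.comp hphi)
      (fun s x θ => by rw [Kd, ← hq]; exact hd x _ (vv_norm θ))
      (fun s x => by simp only [hv]) (fun s x hx θ => hKB _ x hx _)
    have := hHom.post (S' := SX B (GLn κ)) (fun _ A => ext e A) ((ext_cont e).comp continuous_snd) (by
      intro z m hm h
      rw [hm h, map_one])
    simp only [hA, ← K1]
    convert this using 1
    · funext p
      rw [← ext_trans]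
      congr 1
      have := congrFun (NN_ext (b0 := b0) (Embedding.inr : ι ↪ ι ⊕ ι) (fun p : X × I =>
        toGL (∑ k ∈ range (n + 1 + 2), (vv p.2 : ℂ) ^ k • a k p.1))) p
      rw [← this]
      congr 1
      funext p
      rw [toGL_ext _ (hd _ _ (vv_norm _)), extM_inr, hq]
      simp [K0]
    · simp

end lin

section riesz

variable {κ : Type*} [Fintype κ] [DecidableEq κ]

theorem common_eig {M A : Mat(κ)} (h : M * A = A * M) (hd : M.det = 0) :
    ∃ (v : κ → ℂ) (a : ℂ), v ≠ 0 ∧ M *ᵥ v = 0 ∧ A *ᵥ v = a • v := by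
  obtain ⟨w, hw, hMw⟩ := Matrix.exists_mulVec_eq_zero_iff.2 hd
  let W := LinearMap.ker (Matrix.toLin' M)
  have hst : ∀ x ∈ W, Matrix.toLin' A x ∈ W := by
    intro x hx
    rw [LinearMap.mem_ker, Matrix.toLin'_apply] at hx ⊢
    rw [Matrix.toLin'_apply, mulVec_mulVec, h, ← mulVec_mulVec, hx, Matrix.mulVec_zero]
  have : Nontrivial W := by
    refine ⟨⟨⟨w, by simpa [W] using hMw⟩, 0, fun h => hw (congrArg Subtype.val h)⟩⟩
  obtain ⟨a, ha⟩ := Module.End.exists_eigenvalue ((Matrix.toLin' A).restrict hst)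
  obtain ⟨v, hv⟩ := ha.exists_hasEigenvector
  refine ⟨v, a, fun h => hv.2 (Subtype.ext h), ?_, ?_⟩
  · have := v.2
    rwa [LinearMap.mem_ker, Matrix.toLin'_apply] at this
  · have := congrArg Subtype.val hv.apply_eq_smul
    simpa using this

noncomputable def ee (θ : ℝ) : ℂ := Complex.exp ((2 * pi * θ : ℝ) * Complex.I)

theorem ee_cont : Continuous ee := by unfold ee; fun_prop

theorem ee_ne (θ : ℝ) : ee θ ≠ 0 := Complex.exp_ne_zero _

theorem ee_norm (θ : ℝ) : ‖ee θ‖ = 1 := Complex.norm_exp_ofReal_mul_I _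

theorem ee_int {k : ℤ} (hk : k ≠ 0) : ∫ θ in (0 : ℝ)..1, ee θ ^ k = 0 := by
  have h : ∀ θ : ℝ, ee θ ^ k = Complex.exp ((2 * pi * k * Complex.I) * θ) := by
    intro θ
    rw [ee, ← Complex.exp_int_mul]
    congr 1
    push_cast
    ring
  simp only [h]
  rw [integral_exp_mul_complex (by
    have : (pi : ℂ) ≠ 0 := by exact_mod_cast Real.pi_ne_zero
    simp [hk])]
  have : Complex.exp (2 * pi * k * Complex.I * (1 : ℝ)) = 1 := by
    rw [Complex.exp_eq_one_iff]
    exact ⟨k, by push_cast; ring⟩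
  rw [this]
  simp

noncomputable def mint (F : ℝ → Mat(κ)) : Mat(κ) :=
  Matrix.of fun i j => ∫ θ in (0 : ℝ)..1, F θ i j

theorem cont_entry {F : ℝ → Mat(κ)} (hF : Continuous F) (i j : κ) :
    Continuous fun θ => F θ i j := hF.matrix_elem i j

theorem mint_mul_left (M : Mat(κ)) {F : ℝ → Mat(κ)} (hF : Continuous F) :
    mint (fun θ => M * F θ) = M * mint F := by
  ext i j
  simp only [mint, of_apply, Matrix.mul_apply]
  rw [intervalIntegral.integral_finset_sum (f := fun k θ => M i k * F θ k j) fun k _ =>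
    (continuous_const.mul (cont_entry hF k j)).intervalIntegrable _ _]
  simp only [intervalIntegral.integral_const_mul]

theorem mint_mul_right (M : Mat(κ)) {F : ℝ → Mat(κ)} (hF : Continuous F) :
    mint (fun θ => F θ * M) = mint F * M := by
  ext i j
  simp only [mint, of_apply, Matrix.mul_apply]
  rw [intervalIntegral.integral_finset_sum (f := fun k θ => F θ i k * M k j) fun k _ =>
    ((cont_entry hF i k).mul continuous_const).intervalIntegrable _ _]
  simp only [intervalIntegral.integral_mul_const]

theorem mint_add {F G : ℝ → Mat(κ)} (hF : Continuous F) (hG : Continuous G) :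
    mint (fun θ => F θ + G θ) = mint F + mint G := by
  ext i j
  simp only [mint, of_apply, Matrix.add_apply]
  rw [intervalIntegral.integral_add ((cont_entry hF i j).intervalIntegrable _ _)
    ((cont_entry hG i j).intervalIntegrable _ _)]

theorem mint_mulVec {F : ℝ → Mat(κ)} (hF : Continuous F) (v : κ → ℂ) (g : ℝ → ℂ)
    (h : ∀ θ, F θ *ᵥ v = g θ • v) : mint F *ᵥ v = (∫ θ in (0 : ℝ)..1, g θ) • v := by
  ext i
  have h' : ∀ θ, ∑ j, F θ i j * v j = g θ * v i := fun θ => congrFun (h θ) i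
  simp only [Matrix.mulVec, dotProduct, mint, of_apply, Pi.smul_apply, smul_eq_mul]
  rw [← intervalIntegral.integral_mul_const]
  simp only [← h']
  rw [intervalIntegral.integral_finset_sum (f := fun k θ => F θ i k * v k) fun k _ =>
    ((cont_entry hF i k).mul continuous_const).intervalIntegrable _ _]
  simp only [intervalIntegral.integral_mul_const]

def Good (α : Mat(κ)) : Prop := ∀ z : ℂ, ‖z‖ = 1 → (1 - α + z • α).det ≠ 0

noncomputable def rk (α : Mat(κ)) (k : ℤ) : Mat(κ) :=
  mint fun θ => ee θ ^ (-k) • (1 - α + ee θ • α)⁻¹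

theorem inv_cont {Z : Type*} [TopologicalSpace Z] {F : Z → Mat(κ)} (hF : Continuous F)
    (hd : ∀ z, (F z).det ≠ 0) : Continuous fun z => (F z)⁻¹ := by
  have h := toGL_cont hF hd
  have h2 : Continuous fun z => (((toGL (F z))⁻¹ : GLn κ) : Mat(κ)) :=
    continuous_val.comp h.inv
  convert h2 using 1
  funext z
  rw [Matrix.coe_units_inv, coe_toGL (hd z)]

theorem rk_cont {X : Type*} [TopologicalSpace X] {α : X → Mat(κ)} (hα : Continuous α)
    (hg : ∀ x, Good (α x)) (k : ℤ) :
    Continuous fun p : X × ℝ => ee p.2 ^ (-k) • (1 - α p.1 + ee p.2 • α p.1)⁻¹ := by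
  have c1 : Continuous fun p : X × ℝ => ee p.2 := ee_cont.comp continuous_snd
  have c2 : Continuous fun p : X × ℝ => α p.1 := hα.comp continuous_fst
  have c3 : Continuous fun p : X × ℝ => ee p.2 ^ (-k) := c1.zpow₀ _ fun p => Or.inl (ee_ne _)
  have c4 : Continuous fun p : X × ℝ => (1 - α p.1 + ee p.2 • α p.1) :=
    (continuous_const.sub c2).add (c1.smul c2)
  exact c3.smul (inv_cont c4 fun p => hg _ _ (ee_norm _))

theorem rk_cont' {X : Type*} [TopologicalSpace X] {α : X → Mat(κ)} (hα : Continuous α)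
    (hg : ∀ x, Good (α x)) (k : ℤ) : Continuous fun x => rk (α x) k := by
  refine continuous_matrix fun i j => ?_
  exact intervalIntegral.continuous_parametric_intervalIntegral_of_continuous'
    (f := fun x θ => (ee θ ^ (-k) • (1 - α x + ee θ • α x)⁻¹) i j)
    ((rk_cont hα hg k).matrix_elem i j) 0 1

variable {α : Mat(κ)}

theorem rk_cont1 (hα : Good α) (k : ℤ) :
    Continuous fun θ : ℝ => ee θ ^ (-k) • (1 - α + ee θ • α)⁻¹ :=
  (rk_cont (X := Unit) (α := fun _ => α) continuous_const (fun _ => hα) k).comp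
    (by fun_prop : Continuous fun θ : ℝ => ((), θ))

theorem rk_rec (hα : Good α) (k : ℤ) :
    (1 - α) * rk α k + α * rk α (k - 1) = if k = 0 then 1 else 0 := by
  have c1 : Continuous fun θ : ℝ => (1 - α) * (ee θ ^ (-k) • (1 - α + ee θ • α)⁻¹) :=
    continuous_const.mul (rk_cont1 hα k)
  have c2 : Continuous fun θ : ℝ => α * (ee θ ^ (-(k - 1)) • (1 - α + ee θ • α)⁻¹) :=
    continuous_const.mul (rk_cont1 hα (k - 1))
  rw [rk, rk, ← mint_mul_left _ (rk_cont1 hα k), ← mint_mul_left _ (rk_cont1 hα (k - 1)),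
    ← mint_add c1 c2]
  have h : ∀ θ, (1 - α) * (ee θ ^ (-k) • (1 - α + ee θ • α)⁻¹) +
      α * (ee θ ^ (-(k - 1)) • (1 - α + ee θ • α)⁻¹) = ee θ ^ (-k) • (1 : Mat(κ)) := by
    intro θ
    have e : -(k - 1) = -k + 1 := by ring
    rw [e, zpow_add₀ (ee_ne θ), zpow_one, mul_smul, Matrix.mul_smul, Matrix.mul_smul, ← smul_add]
    congr 1
    have := Matrix.mul_nonsing_inv (1 - α + ee θ • α) (isUnit_iff_ne_zero.2 (hα _ (ee_norm θ)))
    rw [Matrix.mul_smul, ← Matrix.smul_mul, ← add_mul, this]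
  simp only [h]
  ext i j
  simp only [mint, of_apply, Matrix.smul_apply, smul_eq_mul, intervalIntegral.integral_mul_const]
  split_ifs with hk
  · simp [hk]
  · rw [ee_int (by omega)]; simp

theorem rk_comm (hα : Good α) (k : ℤ) : α * rk α k = rk α k * α := by
  rw [rk, ← mint_mul_left _ (rk_cont1 hα k), ← mint_mul_right _ (rk_cont1 hα k)]
  congr 1
  funext θ
  rw [Matrix.mul_smul, Matrix.smul_mul]
  congr 1
  have hu := isUnit_iff_ne_zero.2 (hα _ (ee_norm θ))
  set R := 1 - α + ee θ • α with hR
  have hc : R * α = α * R := by rw [hR]; simp [add_mul, mul_add, sub_mul, mul_sub]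
  calc α * R⁻¹ = R⁻¹ * (R * α) * R⁻¹ := by
        rw [← mul_assoc, Matrix.nonsing_inv_mul _ hu, one_mul]
    _ = R⁻¹ * α := by rw [hc, mul_assoc, mul_assoc, Matrix.mul_nonsing_inv _ hu, mul_one]

theorem rk_step (hα : Good α) {j k : ℤ} (hj : j ≠ 0) (hk : k ≠ 0) :
    α * rk α j * rk α (k - 1) = α * rk α (j - 1) * rk α k := by
  have h1 := rk_rec hα j
  have h2 := rk_rec hα k
  rw [if_neg hj] at h1
  rw [if_neg hk] at h2
  have h1' : α * rk α (j - 1) = -((1 - α) * rk α j) := by rw [← sub_eq_zero]; rw [← h1]; abel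
  have h2' : α * rk α (k - 1) = -((1 - α) * rk α k) := by rw [← sub_eq_zero]; rw [← h2]; abel
  rw [h1', rk_comm hα, mul_assoc, h2', mul_neg, ← mul_assoc, neg_mul]
  congr 2
  rw [mul_sub, sub_mul, rk_comm hα]
  simp

theorem rk_lim (i j : κ) : Filter.Tendsto (fun k : ℤ => rk α k i j) Filter.cofinite (nhds 0) := by
  have h := (Real.tendsto_integral_exp_smul_cocompact
    (Set.indicator (Set.Ioc (0 : ℝ) 1) fun θ => (1 - α + ee θ • α)⁻¹ i j)).comp Int.tendsto_coe_cofinite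
  refine h.congr fun k => ?_
  simp only [Function.comp, rk, mint, of_apply]
  rw [intervalIntegral.integral_of_le zero_le_one, ← MeasureTheory.integral_indicator measurableSet_Ioc]
  congr 1
  funext θ
  by_cases hθ : θ ∈ Set.Ioc (0 : ℝ) 1
  · rw [Set.indicator_of_mem hθ, Set.indicator_of_mem hθ, Matrix.smul_apply, Circle.smul_def,
      Real.fourierChar_apply]
    congr 1
    rw [ee, ← Complex.exp_int_mul]
    congr 1
    push_cast
    ring
  · rw [Set.indicator_of_notMem hθ, Set.indicator_of_notMem hθ, smul_zero]

theorem rk_zero (hα : Good α) : α * rk α (-1) * rk α 0 = 0 := by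
  have h : ∀ m : ℕ, α * rk α (-1 - m) * rk α m = α * rk α (-1) * rk α 0 := by
    intro m
    induction m with
    | zero => simp
    | succ m ih =>
      rw [← ih]
      have := rk_step hα (j := -1 - m) (k := m + 1) (by omega) (by omega)
      rw [add_sub_cancel_right] at this
      rw [this]
      push_cast
      rw [sub_sub]
  have t1 : Filter.Tendsto (fun m : ℕ => rk α (-1 - m)) Filter.atTop (nhds 0) := by
    refine tendsto_pi_nhds.2 fun i => tendsto_pi_nhds.2 fun j => ?_
    refine (rk_lim i j).comp ?_
    rw [← Nat.cofinite_eq_atTop]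
    exact Injective.tendsto_cofinite fun a b h => by simpa using h
  have t2 : Filter.Tendsto (fun m : ℕ => rk α m) Filter.atTop (nhds 0) := by
    refine tendsto_pi_nhds.2 fun i => tendsto_pi_nhds.2 fun j => ?_
    refine (rk_lim i j).comp ?_
    rw [← Nat.cofinite_eq_atTop]
    exact Injective.tendsto_cofinite fun a b h => by simpa using h
  have t3 := (t1.const_mul α).mul t2
  simp only [h, mul_zero] at t3
  exact tendsto_nhds_unique tendsto_const_nhds t3

noncomputable def Pr (α : Mat(κ)) : Mat(κ) := α * rk α (-1)

theorem Pr_idem (hα : Good α) : Pr α * Pr α = Pr α := by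
  have h := rk_rec hα 0
  rw [if_pos rfl, zero_sub] at h
  have h1 : Pr α = 1 - (1 - α) * rk α 0 := by
    rw [Pr, eq_sub_iff_add_eq, add_comm]; exact h
  have h2 : Pr α * ((1 - α) * rk α 0) = 0 := by
    have hc : rk α (-1) * (1 - α) = (1 - α) * rk α (-1) := by
      rw [mul_sub, sub_mul, rk_comm hα]; simp
    have e : Pr α * (1 - α) = (1 - α) * (α * rk α (-1)) := by
      rw [Pr, mul_assoc, hc, ← mul_assoc, ← mul_assoc]
      congr 1
      rw [mul_sub, sub_mul]; simp
    rw [← mul_assoc, e, mul_assoc, rk_zero hα, mul_zero]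
  nth_rewrite 2 [h1]
  rw [mul_sub, h2, mul_one, sub_zero]

theorem Pr_comm (hα : Good α) : Pr α * α = α * Pr α := by
  rw [Pr, mul_assoc, ← rk_comm hα]

theorem re_half {w b : ℂ} (h0 : b + w ≠ 0) : ((w / (b + w)).re - 1 / 2) * (2 * normSq (b + w)) =
    normSq w - normSq b := by
  have : normSq (b + w) ≠ 0 := by simpa using h0
  rw [Complex.div_re]
  field_simp
  simp [Complex.normSq_apply]
  ring

theorem Pr_eig (hα : Good α) {v : κ → ℂ} (hv : v ≠ 0) {a : ℂ} (h : α *ᵥ v = a • v) :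
    ∃ l : ℂ, Pr α *ᵥ v = l • v ∧ ((l = 1 ∧ 1 / 2 < a.re) ∨ (l = 0 ∧ a.re < 1 / 2)) := by
  have hz : ∀ z : ℂ, ‖z‖ = 1 → 1 - a + z * a ≠ 0 := by
    intro z hz h0
    refine hα z hz (Matrix.exists_mulVec_eq_zero_iff.1 ⟨v, hv, ?_⟩)
    rw [Matrix.add_mulVec, Matrix.sub_mulVec, Matrix.one_mulVec, Matrix.smul_mulVec, h]
    have : v - a • v + z • a • v = (1 - a + z * a) • v := by rw [add_smul, sub_smul, mul_smul, one_smul]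
    rw [this, h0, zero_smul]
  have hP : Pr α = mint fun θ => α * (ee θ ^ (-(-1 : ℤ)) • (1 - α + ee θ • α)⁻¹) := by
    rw [mint_mul_left _ (rk_cont1 hα (-1)), Pr, rk]
  have hgc : Continuous fun θ : ℝ => ee θ * a / (1 - a + ee θ * a) :=
    (ee_cont.mul continuous_const).div (continuous_const.add (ee_cont.mul continuous_const))
      fun θ => hz _ (ee_norm θ)
  have hl := mint_mulVec (F := fun θ => α * (ee θ ^ (-(-1 : ℤ)) • (1 - α + ee θ • α)⁻¹))
    (continuous_const.mul (rk_cont1 hα (-1))) v (fun θ => ee θ * a / (1 - a + ee θ * a)) (by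
      intro θ
      have hu := isUnit_iff_ne_zero.2 (hα _ (ee_norm θ))
      have h1 : (1 - α + ee θ • α)⁻¹ *ᵥ v = (1 - a + ee θ * a)⁻¹ • v := by
        have h2 : (1 - α + ee θ • α) *ᵥ v = (1 - a + ee θ * a) • v := by
          rw [Matrix.add_mulVec, Matrix.sub_mulVec, Matrix.one_mulVec, Matrix.smul_mulVec, h,
            add_smul, sub_smul, mul_smul, one_smul]
        have h3 : (1 - α + ee θ • α)⁻¹ *ᵥ ((1 - α + ee θ • α) *ᵥ v) = v := by
          rw [mulVec_mulVec, Matrix.nonsing_inv_mul _ hu, Matrix.one_mulVec]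
        rw [h2, Matrix.mulVec_smul] at h3
        rw [eq_inv_smul_iff₀ (hz _ (ee_norm θ)), h3]
      rw [← mulVec_mulVec, Matrix.smul_mulVec, h1, Matrix.mulVec_smul, Matrix.mulVec_smul, h]
      simp only [neg_neg, zpow_one, smul_smul]
      congr 1
      rw [div_eq_mul_inv]; ring)
  rw [← hP] at hl
  set l := ∫ θ in (0 : ℝ)..1, ee θ * a / (1 - a + ee θ * a) with hldef
  refine ⟨l, hl, ?_⟩
  have hl01 : l = 0 ∨ l = 1 := by
    have h1 : Pr α *ᵥ (Pr α *ᵥ v) = Pr α *ᵥ v := by rw [mulVec_mulVec, Pr_idem hα]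
    rw [hl, Matrix.mulVec_smul, hl, smul_smul, ← sub_eq_zero, ← sub_smul] at h1
    rcases smul_eq_zero.1 h1 with h2 | h2
    · have : l * (l - 1) = 0 := by rw [← h2]; ring
      rcases mul_eq_zero.1 this with h3 | h3
      · exact Or.inl h3
      · exact Or.inr (sub_eq_zero.1 h3)
    · exact absurd h2 hv
  have hre : l.re - 1 / 2 = ∫ θ in (0 : ℝ)..1, ((ee θ * a / (1 - a + ee θ * a)).re - 1 / 2) := by
    have hc : Continuous fun θ : ℝ => (ee θ * a / (1 - a + ee θ * a)).re := Complex.continuous_re.comp hgc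
    rw [intervalIntegral.integral_sub (hc.intervalIntegrable _ _)
      (continuous_const.intervalIntegrable _ _)]
    have := Complex.reCLM.intervalIntegral_comp_comm (hgc.intervalIntegrable (μ := MeasureTheory.volume) 0 1)
    simp only [Complex.reCLM_apply] at this
    rw [this]
    simp
    norm_num
    rw [hldef]
  have hsq : ∀ θ : ℝ, normSq (ee θ * a) - normSq (1 - a) = 2 * (a.re - 1 / 2) := by
    intro θ
    rw [Complex.normSq_mul, Complex.normSq_eq_norm_sq (ee θ), ee_norm]
    simp [Complex.normSq_apply]
    ring
  have hk : ∀ θ : ℝ, ((ee θ * a / (1 - a + ee θ * a)).re - 1 / 2) *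
      normSq (1 - a + ee θ * a) = a.re - 1 / 2 := by
    intro θ
    have := re_half (hz _ (ee_norm θ))
    rw [hsq] at this
    linarith
  have hpos : ∀ θ : ℝ, 0 < normSq (1 - a + ee θ * a) := fun θ =>
    Complex.normSq_pos.2 (hz _ (ee_norm θ))
  have hgc' : Continuous fun θ : ℝ => (ee θ * a / (1 - a + ee θ * a)).re - 1 / 2 :=
    (Complex.continuous_re.comp hgc).sub continuous_const
  rcases lt_trichotomy a.re (1 / 2) with hr | hr | hr
  · right
    refine ⟨?_, hr⟩
    have : 0 < ∫ θ in (0 : ℝ)..1, -((ee θ * a / (1 - a + ee θ * a)).re - 1 / 2) := by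
      refine intervalIntegral.intervalIntegral_pos_of_pos (hgc'.neg.intervalIntegrable _ _) (fun θ => ?_) one_pos
      by_contra hcon
      have := hk θ
      have h5 := hpos θ
      nlinarith
    rw [intervalIntegral.integral_neg, ← hre] at this
    rcases hl01 with h1 | h1
    · exact h1
    · rw [h1] at this; norm_num at this
  · exfalso
    have ha : a ≠ 0 := by rintro rfl; norm_num at hr
    refine hz (-(1 - a) / a) ?_ (by field_simp; ring)
    rw [norm_div, norm_neg, div_eq_one_iff_eq (by simpa using ha)]
    rw [← sq_eq_sq₀ (norm_nonneg _) (norm_nonneg _), ← Complex.normSq_eq_norm_sq, ← Complex.normSq_eq_norm_sq]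
    simp [Complex.normSq_apply]
    nlinarith
  · left
    refine ⟨?_, hr⟩
    have : 0 < ∫ θ in (0 : ℝ)..1, ((ee θ * a / (1 - a + ee θ * a)).re - 1 / 2) := by
      refine intervalIntegral.intervalIntegral_pos_of_pos (hgc'.intervalIntegrable _ _) (fun θ => ?_) one_pos
      by_contra hcon
      have := hk θ
      have h5 := hpos θ
      nlinarith
    rw [← hre] at this
    rcases hl01 with h1 | h1
    · rw [h1] at this; norm_num at this
    · exact h1

theorem Pr_line (hα : Good α) (s : I) :
    Good (α + ((s : ℝ) : ℂ) • (Pr α - α)) := by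
  intro z hz hd
  set μ := α + ((s : ℝ) : ℂ) • (Pr α - α) with hμ
  have hc : μ * α = α * μ := by
    rw [hμ]
    simp [add_mul, mul_add, sub_mul, mul_sub, Pr_comm hα]
  obtain ⟨v, a, hv, h0, ha⟩ := common_eig (M := 1 - μ + z • μ) (A := α) (by
    simp [add_mul, mul_add, sub_mul, mul_sub, hc]) hd
  obtain ⟨l, hl, hcase⟩ := Pr_eig hα hv ha
  have hμv : μ *ᵥ v = (a + (s : ℝ) * (l - a)) • v := by
    rw [hμ, Matrix.add_mulVec, Matrix.smul_mulVec, Matrix.sub_mulVec, hl, ha]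
    rw [← sub_smul, smul_smul, ← add_smul]
  set m := a + (s : ℝ) * (l - a) with hm
  have h1 : (1 - m + z * m) • v = 0 := by
    rw [← h0, Matrix.add_mulVec, Matrix.sub_mulVec, Matrix.one_mulVec, Matrix.smul_mulVec, hμv,
      add_smul, sub_smul, mul_smul, one_smul]
  have h2 : 1 - m + z * m = 0 := (smul_eq_zero.1 h1).resolve_right hv
  have h3 : normSq (1 - m) = normSq m := by
    have : 1 - m = -(z * m) := by rw [← add_eq_zero_iff_eq_neg]; exact h2
    rw [this, Complex.normSq_neg, Complex.normSq_mul, Complex.normSq_eq_norm_sq z, hz]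
    simp
  have h4 : m.re = 1 / 2 := by
    simp [Complex.normSq_apply] at h3
    linarith
  have h5 : m.re = a.re + (s : ℝ) * (l.re - a.re) := by rw [hm]; simp
  have s0 := s.2.1
  have s1 := s.2.2
  rcases hcase with ⟨rfl, h⟩ | ⟨rfl, h⟩
  · simp only [Complex.one_re] at h5
    have hp := mul_nonneg (sub_nonneg.2 s1) (sub_nonneg.2 h.le)
    have : (s : ℝ) = 0 := by nlinarith
    rw [this] at h5
    linarith
  · simp only [Complex.zero_re] at h5
    have hp := mul_nonneg (sub_nonneg.2 s1) (sub_nonneg.2 h.le)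
    have : (s : ℝ) = 0 := by nlinarith
    rw [this] at h5
    linarith

end riesz

theorem idem_mul {κ : Type*} [Fintype κ] [DecidableEq κ] {P : Mat(κ)} (h : P * P = P)
    (z w : ℂ) : (1 - P + z • P) * (1 - P + w • P) = 1 - P + (z * w) • P := by
  have h1 : (1 - P) * P = 0 := by rw [sub_mul, one_mul, h, sub_self]
  have h2 : P * (1 - P) = 0 := by rw [mul_sub, mul_one, h, sub_self]
  have h3 : (1 - P) * (1 - P) = 1 - P := by rw [mul_sub, mul_one, h1, sub_zero]
  simp only [add_mul, mul_add, smul_mul_assoc, mul_smul_comm, h1, h2, h3, h, smul_zero, add_zero,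
    zero_add, smul_smul, mul_comm w z]

theorem idem_det {κ : Type*} [Fintype κ] [DecidableEq κ] {P : Mat(κ)} (h : P * P = P)
    {z : ℂ} (hz : z ≠ 0) : (1 - P + z • P).det ≠ 0 := by
  intro h0
  have := congrArg Matrix.det (idem_mul h z z⁻¹)
  rw [Matrix.det_mul, h0, mul_inv_cancel₀ hz] at this
  simp at this

theorem pencil_proj {X : Type*} [TopologicalSpace X] {κ : Type*} [Fintype κ] [DecidableEq κ]
    {B : Set X} {b0 : X} {α β : X → Mat(κ)} (hα : Continuous α) (hβ : Continuous β)
    (hαB : ∀ x ∈ B, α x = α b0) (hβB : ∀ x ∈ B, β x = β b0)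
    (hd : ∀ x, ∀ z : ℂ, ‖z‖ = 1 → (β x + z • α x).det ≠ 0) :
    ∃ P : X → Mat(κ), Continuous P ∧ (∀ x, P x * P x = P x) ∧ (∀ x ∈ B, P x = P b0) ∧
      Hty (SX B (GLn κ)) (NN b0 fun p => toGL (β p.1 + (vv p.2 : ℂ) • α p.1))
        (NN b0 fun p => toGL (1 - P p.1 + (vv p.2 : ℂ) • P p.1)) := by
  have hC : ∀ x, (β x + α x).det ≠ 0 := fun x => by simpa using hd x 1 (by simp)
  set a : X → Mat(κ) := fun x => (β x + α x)⁻¹ * α x with ha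
  have hac : Continuous a := (inv_cont (hβ.add hα) hC).mul hα
  have key : ∀ x (z : ℂ), β x + z • α x = (β x + α x) * (1 - a x + z • a x) := by
    intro x z
    have : (β x + α x) * a x = α x := by
      rw [ha]; dsimp only
      rw [Matrix.mul_nonsing_inv_cancel_left _ _ (isUnit_iff_ne_zero.2 (hC x))]
    rw [mul_add, mul_sub, mul_one, mul_smul_comm, this, add_sub_cancel_right]
  have hg : ∀ x, Good (a x) := by
    intro x z hz h0
    apply hd x z hz
    rw [key, Matrix.det_mul, h0, mul_zero]
  have haB : ∀ x ∈ B, a x = a b0 := fun x hx => by simp only [ha, hαB x hx, hβB x hx]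
  clear_value a
  refine ⟨fun x => Pr (a x), hac.mul (rk_cont' hac hg (-1)), fun x => Pr_idem (hg x),
    fun x hx => by dsimp only; rw [haB x hx], ?_⟩
  have e1 : (fun p : X × I => toGL (β p.1 + (vv p.2 : ℂ) • α p.1)) = fun p =>
      toGL (β p.1 + α p.1) * toGL (1 - a p.1 + (vv p.2 : ℂ) • a p.1) := by
    funext p
    apply Units.ext
    rw [val_mul, coe_toGL (hd _ _ (vv_norm _)), coe_toGL (hC _),
      coe_toGL (hg _ _ (vv_norm _)), key]
  rw [e1, NN_left (fun x => toGL (β x + α x))]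
  have hPc : Continuous fun x => Pr (a x) := hac.mul (rk_cont' hac hg (-1))
  have hmu : Continuous fun q : I × X × I =>
      a q.2.1 + (((q.1 : ℝ) : ℂ)) • (Pr (a q.2.1) - a q.2.1) := by
    have h1 : Continuous fun q : I × X × I => ((q.1 : ℝ) : ℂ) := by fun_prop
    have h2 : Continuous fun q : I × X × I => Pr (a q.2.1) - a q.2.1 :=
      (hPc.sub hac).comp (by fun_prop : Continuous fun q : I × X × I => q.2.1)
    exact (hac.comp (by fun_prop)).add (h1.smul h2)
  have hK : Continuous fun q : I × X × I =>
      1 - (a q.2.1 + (((q.1 : ℝ) : ℂ)) • (Pr (a q.2.1) - a q.2.1)) +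
        (vv q.2.2 : ℂ) • (a q.2.1 + (((q.1 : ℝ) : ℂ)) • (Pr (a q.2.1) - a q.2.1)) := by
    have h1 : Continuous fun q : I × X × I => (vv q.2.2 : ℂ) :=
      continuous_val.comp (vv_cont.comp (by fun_prop))
    exact (continuous_const.sub hmu).add (h1.smul hmu)
  have := NN_hty (B := B) (b0 := b0) _ hK
    (fun s x θ => Pr_line (hg x) s _ (vv_norm θ)) (fun s x => by simp [vv_one, vv_zero])
    (fun s x hx θ => by simp only [haB x hx])
  simpa using this

/-- the swap matrix attached to an idempotent -/
theorem idem_swap {κ : Type*} [Fintype κ] [DecidableEq κ] {P : Mat(κ)} (h : P * P = P) :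
    ∃ U : GLn (κ ⊕ κ), ∀ v : ℂˣ, ∀ w : GLn κ, ∃ Q R : GLn κ, (Q : Mat(κ)) =
      1 - P + (v : ℂ) • P ∧ U * (eL Q * eR R) * U⁻¹ = eL (ds univ v) := by
  have h1 : (1 - P) * P = 0 := by rw [sub_mul, one_mul, h, sub_self]
  have h2 : P * (1 - P) = 0 := by rw [mul_sub, mul_one, h, sub_self]
  have h3 : (1 - P) * (1 - P) = 1 - P := by rw [mul_sub, mul_one, h1, sub_zero]
  have hUU : fromBlocks P (1 - P) (1 - P) P * fromBlocks P (1 - P) (1 - P) P =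
      1 := by
    rw [fromBlocks_multiply, h, h1, h2, h3, ← Matrix.fromBlocks_one]
    simp
  refine ⟨⟨_, _, hUU, hUU⟩, fun v w => ?_⟩
  have hQ := idem_det h v.ne_zero
  have hR := idem_det h3 v.ne_zero
  refine ⟨toGL _, toGL (1 - (1 - P) + (v : ℂ) • (1 - P)), coe_toGL hQ, ?_⟩
  rw [mul_inv_eq_iff_eq_mul]
  apply Units.ext
  simp only [val_mul, coe_eL, coe_eR, coe_toGL hQ, coe_toGL hR, coe_ds]
  have hD : (diagonal fun i : κ => if i ∈ univ then (v : ℂ) else 1) =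
      (v : ℂ) • (1 : Mat(κ)) := by
    rw [Matrix.smul_one_eq_diagonal]; simp
  rw [hD]
  simp only [fromBlocks_multiply, mul_zero, zero_mul, mul_one, one_mul, add_zero, zero_add,
    mul_add, mul_smul_comm, smul_mul_assoc, h, h1, h2, h3, sub_sub_cancel, smul_zero]

theorem bott_surj0 {M : Type} [Fintype M] [DecidableEq M] [Nonempty M] {ι : Type} [Fintype ι]
    [DecidableEq ι] {f : (M → I) × I → GLn ι} (hf : Continuous f)
    (hS : ∀ p, f p ∈ SX (boundary M) (GLn ι) p) :
    ∃ (κ : Type) (_ : Fintype κ) (_ : DecidableEq κ) (e : ι ↪ κ) (W : (M → I) → GLn (κ ⊕ κ)),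
      Continuous W ∧
      (∀ x ∈ boundary M, ∀ v, W x * eL (ds univ v) = eL (ds univ v) * W x) ∧
      Hty (SX (boundary M) (GLn (κ ⊕ κ)))
        (fun p => ext (e.trans Embedding.inl) (f p))
        (fun p => CC (W p.1) (ds univ (vv p.2))) := by
  have hb0 : (0 : M → I) ∈ boundary M := ⟨Classical.arbitrary M, Or.inl rfl⟩
  have hBc : IsClosed (boundary M) := by
    have : boundary M = ⋃ i, {y : M → I | y i = 0 ∨ y i = 1} := by
      ext y; simp [boundary]
    rw [this]
    exact isClosed_iUnion_of_finite fun i =>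
      (isClosed_eq (continuous_apply i) continuous_const).union
        (isClosed_eq (continuous_apply i) continuous_const)
  obtain ⟨n, a, ha, haB, had, H1⟩ := laurent hBc hb0 hf hS
  have hsum : ∀ x (z : ℂ), ∑ k ∈ range (n + 2), z ^ k • (if k ≤ n then a k x else 0) =
      ∑ k ∈ range (n + 1), z ^ k • a k x := by
    intro x z
    rw [Finset.sum_range_succ, if_neg (by omega), smul_zero, add_zero]
    refine Finset.sum_congr rfl fun k hk => ?_
    rw [if_pos (by have := Finset.mem_range.1 hk; omega)]
  obtain ⟨κ, i1, i2, e, α, β, hα, hβ, hαB, hβB, hd, H2⟩ := linearize (B := boundary M) (b0 := 0) n ι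
    (fun k x => if k ≤ n then a k x else 0)
    (fun k => by by_cases h : k ≤ n <;> simp [h, ha, continuous_const])
    (fun k x hx => by rw [haB k x hx])
    (fun x z hz => by rw [hsum]; exact had x z hz)
  simp only [hsum] at H2
  obtain ⟨P, hP, hPP, hPB, H3⟩ := pencil_proj hα hβ hαB hβB hd
  have H4 : Hty (SX (boundary M) (GLn κ)) (fun p => ext e (f p))
      (NN 0 fun p => toGL (1 - P p.1 + (vv p.2 : ℂ) • P p.1)) := by
    refine ((H1.post (S' := SX (boundary M) (GLn κ)) (fun _ A => ext e A)
      ((ext_cont e).comp continuous_snd) ?_).trans H2).trans H3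
    intro z m hm hz
    rw [hm hz, map_one]
  obtain ⟨Γ, hΓ, hΓ0, hΓR, -⟩ := telescope (X := M → I) (κ := κ)
    (Y := {A : Mat(κ) // A * A = A})
    (fun u v => v.1 * u.1 + (1 - v.1) * (1 - u.1)) (by fun_prop)
    (fun y => by simp only [mul_sub, sub_mul, mul_one, one_mul, y.2]; abel)
    (fun A u v => (A : Mat(κ)) * u.1 = v.1 * A)
    (fun y => by simp)
    (fun a b u v w h1 h2 => by
      rw [val_mul, mul_assoc, h1, ← mul_assoc, h2, mul_assoc])
    (fun u v h => by
      rw [coe_toGL h]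
      simp only [add_mul, mul_add, sub_mul, mul_sub, mul_assoc, one_mul, mul_one, u.2, ← mul_assoc v.1 v.1, v.2]
      abel)
    (fun q => ⟨P (fun i => q.1 * q.2 i), hPP _⟩)
    ((hP.comp (by fun_prop)).subtype_mk _)
  have hW : ∀ x, (Γ (1, x) : Mat(κ)) * P 0 = P x * Γ (1, x) := by
    intro x
    have := hΓR 1 x
    dsimp only at this
    have z0 : (fun i => (0 : I) * x i) = 0 := by funext i; exact zero_mul _
    have z1 : (fun i => (1 : I) * x i) = x := by funext i; exact one_mul _
    rwa [z0, z1] at this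
  obtain ⟨U, hU⟩ := idem_swap (hPP 0)
  refine ⟨κ, i1, i2, e, fun x => U * eL (Γ (1, x)) * U⁻¹, ?_, ?_, ?_⟩
  · have h1 : Continuous fun x => eL (Γ (1, x)) := (ext_cont _).comp (hΓ.comp (by fun_prop))
    exact (continuous_const.mul h1).mul continuous_const
  · intro x hx v
    obtain ⟨Q, R, hQ, hQR⟩ := hU v 1
    rw [← hQR]
    have h1 : Γ (1, x) * Q = Q * Γ (1, x) := by
      apply Units.ext
      have h2 := hW x
      rw [hPB x hx] at h2
      rw [val_mul, val_mul, hQ]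
      simp only [mul_add, add_mul, mul_sub, sub_mul, mul_one, one_mul, mul_smul_comm,
        smul_mul_assoc, h2]
    have h2 : eL (Γ (1, x)) * (eL Q * eR R) = (eL Q * eR R) * eL (Γ (1, x)) := by
      rw [← mul_assoc, ← map_mul, h1, mul_assoc, ← eL_eR, ← mul_assoc, ← map_mul]
    calc _ = U * (eL (Γ (1, x)) * (eL Q * eR R)) * U⁻¹ := by group
      _ = _ := by rw [h2]; group
  · obtain ⟨γ, hγ, hγ0, hγ1⟩ := GLn_path U
    have H5 := H4.post (S' := SX (boundary M) (GLn (κ ⊕ κ)))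
      (fun _ A => ext Embedding.inl A) ((ext_cont _).comp continuous_snd)
      (fun z m hm hz => by rw [hm hz, map_one])
    simp only [ext_trans] at H5
    refine H5.trans ?_
    refine ⟨fun q => γ q.1 * ext Embedding.inl (NN 0 (fun p => toGL (1 - P p.1 + (vv p.2 : ℂ) • P p.1)) q.2) *
      (γ q.1)⁻¹, ?_, ?_, ?_, ?_⟩
    · have h1 : Continuous fun q : I × (M → I) × I => γ q.1 := hγ.comp continuous_fst
      have h2 := H5.cont_right.comp (continuous_snd : Continuous (Prod.snd : I × (M → I) × I → _))
      exact (h1.mul h2).mul h1.inv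
    · intro z; simp [hγ0]
    · rintro ⟨x, θ⟩
      dsimp only
      rw [hγ1]
      obtain ⟨Q, R, hQ, hQR⟩ := hU (vv θ) 1
      have e0 : toGL (1 - P x + (vv 0 : ℂ) • P x) = 1 := by
        apply Units.ext; rw [coe_toGL (idem_det (hPP _) (vv 0).ne_zero)]; simp [vv_zero]
      have e00 : toGL (1 - P 0 + (vv 0 : ℂ) • P 0) = 1 := by
        apply Units.ext; rw [coe_toGL (idem_det (hPP _) (vv 0).ne_zero)]; simp [vv_zero]
      have e1 : toGL (1 - P 0 + (vv θ : ℂ) • P 0) = Q := by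
        apply Units.ext; rw [coe_toGL (idem_det (hPP _) (vv θ).ne_zero), hQ]
      have e2 : toGL (1 - P x + (vv θ : ℂ) • P x) = Γ (1, x) * Q * (Γ (1, x))⁻¹ := by
        rw [eq_mul_inv_iff_mul_eq]
        apply Units.ext
        rw [val_mul, val_mul, coe_toGL (idem_det (hPP _) (vv θ).ne_zero), hQ]
        simp only [mul_add, add_mul, mul_sub, sub_mul, mul_one, one_mul, mul_smul_comm,
          smul_mul_assoc, hW x]
      have e3 : NN 0 (fun p : (M → I) × I => toGL (1 - P p.1 + (vv p.2 : ℂ) • P p.1)) (x, θ) =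
          Γ (1, x) * Q * (Γ (1, x))⁻¹ * Q⁻¹ := by
        simp only [NN, e0, e00, e1, e2]; group
      rw [e3]
      have e4 : eL (Γ (1, x) * Q * (Γ (1, x))⁻¹ * Q⁻¹) =
          eL (Γ (1, x)) * (eL Q * eR R) * (eL (Γ (1, x)))⁻¹ * (eL Q * eR R)⁻¹ := by
        have c1 : eR R * (eL (Γ (1, x)))⁻¹ * (eR R)⁻¹ = (eL (Γ (1, x)))⁻¹ := by
          rw [mul_inv_eq_iff_eq_mul, ← map_inv, eL_eR]
        rw [map_mul, map_mul, map_mul, map_inv, map_inv]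
        calc _ = eL (Γ (1, x)) * eL Q * (eR R * (eL (Γ (1, x)))⁻¹ * (eR R)⁻¹) * (eL Q)⁻¹ := by
              rw [c1]
          _ = _ := by group
      show U * eL _ * U⁻¹ = _
      rw [e4, CC, ← hQR]
      group
    · intro t z hz
      show γ t * _ * _ = 1
      rw [H5.mem_right z hz]; simp
section
variable {κ : Type*} [Fintype κ] [DecidableEq κ]

theorem coe_ds_univ (v : ℂˣ) : ((ds univ v : GLn κ) : Mat(κ)) = (v : ℂ) • 1 := by
  rw [coe_ds, Matrix.smul_one_eq_diagonal]; simp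

theorem ds_univ_comm (v : ℂˣ) (A : GLn κ) : A * ds univ v = ds univ v * A := by
  apply Units.ext
  rw [val_mul, val_mul, coe_ds_univ]
  simp

/-- block diagonal matrices, as a centralizer -/
noncomputable def HB (κ : Type*) [Fintype κ] [DecidableEq κ] : Subgroup (GLn (κ ⊕ κ)) :=
  Subgroup.centralizer (Set.range fun v : ℂˣ => eL (ds (univ : Finset κ) v))

theorem mem_HB {A : GLn (κ ⊕ κ)} : A ∈ HB κ ↔
    ∀ v : ℂˣ, A * eL (ds univ v) = eL (ds univ v) * A := by
  rw [HB, Subgroup.mem_centralizer_iff]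
  simp only [Set.forall_mem_range]
  exact forall_congr' fun v => eq_comm

theorem HB_diag (a b : GLn κ) : eL a * eR b ∈ HB κ := by
  rw [mem_HB]
  intro v
  rw [mul_assoc, ← eL_eR, ← mul_assoc, ← map_mul, ds_univ_comm, map_mul, mul_assoc]

theorem HB_split {Z : Type*} [TopologicalSpace Z] {f : Z → GLn (κ ⊕ κ)} (hf : Continuous f)
    (h : ∀ z, f z ∈ HB κ) : ∃ f1 f2 : Z → GLn κ, Continuous f1 ∧ Continuous f2 ∧
      (∀ z, f z = eL (f1 z) * eR (f2 z)) ∧ ∀ z, f z = 1 → f1 z = 1 ∧ f2 z = 1 := by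
  have hu : ∀ z, (f z : Mat(κ ⊕ κ)) =
      fromBlocks (f z : Mat(κ ⊕ κ)).toBlocks₁₁ 0 0
        (f z : Mat(κ ⊕ κ)).toBlocks₂₂ := by
    intro z
    have h1 := congrArg (fun A : GLn (κ ⊕ κ) => (A : Mat(κ ⊕ κ)))
      (mem_HB.1 (h z) (Units.mk0 2 two_ne_zero))
    rw [val_mul, val_mul, coe_eL, coe_ds_univ,
      ← Matrix.fromBlocks_toBlocks (f z : Mat(κ ⊕ κ))] at h1
    rw [fromBlocks_multiply, fromBlocks_multiply, Matrix.fromBlocks_inj] at h1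
    obtain ⟨-, h2, h3, -⟩ := h1
    have two : ∀ A : Mat(κ), A = (2 : ℂ) • A → A = 0 := by
      intro A hA
      rw [two_smul] at hA
      exact left_eq_add.1 hA
    conv_lhs => rw [← Matrix.fromBlocks_toBlocks (f z : Mat(κ ⊕ κ))]
    have h2' := two (f z : Mat(κ ⊕ κ)).toBlocks₁₂ (by simpa using h2)
    have h3' := two (f z : Mat(κ ⊕ κ)).toBlocks₂₁ (by simpa using h3.symm)
    rw [h2', h3']
  have hd : ∀ z, (f z : Mat(κ ⊕ κ)).toBlocks₁₁.det ≠ 0 ∧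
      (f z : Mat(κ ⊕ κ)).toBlocks₂₂.det ≠ 0 := by
    intro z
    have h1 := GLn_det_ne (f z)
    rw [hu z, Matrix.det_fromBlocks_zero₂₁] at h1
    exact ⟨left_ne_zero_of_mul h1, right_ne_zero_of_mul h1⟩
  have hc : Continuous fun z => (f z : Mat(κ ⊕ κ)) := continuous_val.comp hf
  refine ⟨fun z => toGL (f z : Mat(κ ⊕ κ)).toBlocks₁₁,
    fun z => toGL (f z : Mat(κ ⊕ κ)).toBlocks₂₂,
    toGL_cont (continuous_matrix fun i j => hc.matrix_elem _ _) fun z => (hd z).1,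
    toGL_cont (continuous_matrix fun i j => hc.matrix_elem _ _) fun z => (hd z).2, ?_, ?_⟩
  · intro z
    apply Units.ext
    rw [val_mul, coe_eL, coe_eR, coe_toGL (hd z).1, coe_toGL (hd z).2,
      fromBlocks_multiply]
    simpa using hu z
  · intro z hz
    constructor
    · apply Units.ext
      rw [coe_toGL (hd z).1, hz, val_one, ← Matrix.fromBlocks_one, Matrix.toBlocks_fromBlocks₁₁]; rfl
    · apply Units.ext
      rw [coe_toGL (hd z).2, hz, val_one, ← Matrix.fromBlocks_one, Matrix.toBlocks_fromBlocks₂₂]; rfl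

theorem CC_HB (V h : GLn (κ ⊕ κ)) (hh : h ∈ HB κ) (v : ℂˣ) :
    CC (V * h) (ds univ v) = CC V (ds univ v) := by
  have h1 : h * eL (ds univ v) * h⁻¹ = eL (ds univ v) := by
    rw [mem_HB.1 hh, mul_inv_cancel_right]
  rw [CC, CC]
  calc _ = V * (h * eL (ds univ v) * h⁻¹) * V⁻¹ * (eL (ds univ v))⁻¹ := by group
    _ = _ := by rw [h1]

theorem CC_mul_left (V V' : GLn (κ ⊕ κ)) (Q : GLn κ) :
    CC (V * V') Q = V * CC V' Q * V⁻¹ * CC V Q := by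
  simp only [CC]; group

variable {N : Type*}

/-- the face set `J` -/
def JJ (N : Type*) : Set (Option N → I) :=
  {x | (fun i => x (some i)) ∈ boundary N ∨ x none = 1}

theorem bdry_JJ {x : Option N → I} (h : x ∈ boundary (Option N)) :
    x ∈ JJ N ∨ x none = 0 := by
  obtain ⟨i | i, hi⟩ := h
  · exact hi.elim Or.inr fun h => Or.inl (Or.inr h)
  · exact Or.inl (Or.inl ⟨i, hi⟩)

/-- relative loops -/
noncomputable def SV (N κ : Type*) [Fintype κ] [DecidableEq κ] (x : Option N → I) :
    Subgroup (GLn (κ ⊕ κ)) where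
  carrier := {A | (x ∈ JJ N → A = 1) ∧ (x none = 0 → A ∈ HB κ)}
  mul_mem' := fun {a b} ha hb => ⟨fun h => by rw [ha.1 h, hb.1 h, one_mul],
    fun h => mul_mem (ha.2 h) (hb.2 h)⟩
  one_mem' := ⟨fun _ => rfl, fun _ => one_mem _⟩
  inv_mem' := fun {a} ha => ⟨fun h => by rw [ha.1 h, inv_one], fun h => inv_mem (ha.2 h)⟩

/-- the base coordinates of a point of the big cube -/
def xc (y : Option (Option N) → I) : Option N → I := fun o => y (o.map some)

theorem xc_cont : Continuous (xc : (Option (Option N) → I) → Option N → I) :=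
  continuous_pi fun o => continuous_apply _

/-- the loop attached to a relative loop -/
noncomputable def CL (V : (Option N → I) → GLn (κ ⊕ κ)) (y : Option (Option N) → I) : GLn (κ ⊕ κ) :=
  CC (V (xc y)) (ds univ (vv (y (some none))))

theorem CC_mem {y : Option (Option N) → I} {A : GLn (κ ⊕ κ)} (hA : A ∈ SV N κ (xc y)) :
    CC A (ds univ (vv (y (some none)))) ∈ LS (Option (Option N)) (1 : GLn (κ ⊕ κ)) y := by
  intro hy
  have key : xc y ∈ boundary (Option N) ∨ y (some none) = 0 ∨ y (some none) = 1 := by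
    obtain ⟨o, ho⟩ := hy
    rcases o with _ | _ | i
    · exact Or.inl ⟨none, ho⟩
    · exact Or.inr ho
    · exact Or.inl ⟨some i, ho⟩
  rcases key with h | h
  · rcases bdry_JJ h with h | h
    · rw [hA.1 h, CC_one_left]
    · have := CC_HB 1 A (hA.2 h) (vv (y (some none)))
      rwa [one_mul, CC_one_left] at this
  · have : vv (y (some none)) = 1 := by rcases h with h | h <;> rw [h] <;> simp [vv_one, vv_zero]
    rw [this, ds_one, CC_one_right]

theorem CL_hty {V V' : (Option N → I) → GLn (κ ⊕ κ)}
    (H : Hty (fun x => (SV N κ x : Set (GLn (κ ⊕ κ)))) V V') :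
    Hty (LS (Option (Option N)) (1 : GLn (κ ⊕ κ))) (CL V) (CL V') := by
  refine (H.comp (S' := fun y => (SV N κ (xc y) : Set (GLn (κ ⊕ κ)))) xc xc_cont fun _ => subset_rfl).post
    (fun y A => CC A (ds univ (vv (y (some none))))) ?_ fun y A hA => CC_mem hA
  have h1 : Continuous fun p : (Option (Option N) → I) × GLn (κ ⊕ κ) =>
      (eL (ds (univ : Finset κ) (vv (p.1 (some none)))) : GLn (κ ⊕ κ)) :=
    (ext_cont _).comp ((ds_cont _).comp (by fun_prop))
  have h2 : Continuous fun p : (Option (Option N) → I) × GLn (κ ⊕ κ) => p.2 := continuous_snd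
  exact ((h2.mul h1).mul h2.inv).mul h1.inv

theorem CL_refl {V : (Option N → I) → GLn (κ ⊕ κ)} (hV : Continuous V) (hS : ∀ x, V x ∈ SV N κ x) :
    Hty (LS (Option (Option N)) (1 : GLn (κ ⊕ κ))) (CL V) (CL V) := CL_hty (Hty.refl hV hS)

theorem conj_fun {Q G : Type*} [TopologicalSpace G] [Group G] [IsTopologicalGroup G]
    {L V : (Q → I) → G} (hL : Continuous L) (hb : ∀ y, L y ∈ LS Q (1 : G) y) (hV : Continuous V)
    (h1 : V 1 = 1) : Hty (LS Q (1 : G)) L (fun y => V y * L y * (V y)⁻¹) := by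
  refine ⟨fun q => V (fun i => lerp q.1 1 (q.2 i)) * L q.2 * (V fun i => lerp q.1 1 (q.2 i))⁻¹,
    ?_, ?_, ?_, ?_⟩
  · have hc : Continuous fun q : I × (Q → I) => V (fun i => lerp q.1 1 (q.2 i)) :=
      hV.comp (continuous_pi fun i => lerp_continuous continuous_fst continuous_const (by fun_prop))
    exact (hc.mul (hL.comp continuous_snd)).mul hc.inv
  · intro z
    have : (fun i => lerp 0 1 (z i)) = (1 : Q → I) := by
      funext i; apply Subtype.ext; simp [coe_lerp]
    dsimp only
    rw [this, h1]; simp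
  · intro z
    have : (fun i => lerp 1 1 (z i)) = z := by
      funext i; apply Subtype.ext; simp [coe_lerp]
    dsimp only
    rw [this]
  · intro t z hz
    show _ * _ * _ = _
    rw [hb z hz]; simp

theorem CL_mul {V V' : (Option N → I) → GLn (κ ⊕ κ)} (hV : Continuous V)
    (hS : ∀ x, V x ∈ SV N κ x) (hV' : Continuous V') (hS' : ∀ x, V' x ∈ SV N κ x) :
    Hty (LS (Option (Option N)) (1 : GLn (κ ⊕ κ))) (CL (V * V')) (CL V' * CL V) := by
  have e : CL (V * V') = (fun y => V (xc y) * CL V' y * (V (xc y))⁻¹) * CL V := by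
    funext y
    simp only [CL, Pi.mul_apply, CC_mul_left]
  rw [e, ← LG_eq]
  have h1 := CL_refl hV' hS'
  have h2 := conj_fun h1.cont_left h1.mem_left (hV.comp xc_cont) ((hS _).1 (Or.inr rfl))
  rw [← LG_eq] at h2
  have h3 := CL_refl hV hS
  rw [← LG_eq] at h3
  exact h2.symm.mul h3

theorem CL_one : CL (1 : (Option N → I) → GLn (κ ⊕ κ)) = 1 := by
  funext y; simp [CL, CC_one_left]

theorem SV_zpow {V : (Option N → I) → GLn (κ ⊕ κ)} (hV : Continuous V)
    (hS : ∀ x, V x ∈ SV N κ x) (m : ℤ) :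
    Continuous (V ^ m) ∧ ∀ x, (V ^ m) x ∈ SV N κ x := ⟨hV.zpow m, fun x => zpow_mem (hS x) m⟩

theorem CL_zpow {V : (Option N → I) → GLn (κ ⊕ κ)} (hV : Continuous V)
    (hS : ∀ x, V x ∈ SV N κ x) (m : ℤ) :
    Hty (LS (Option (Option N)) (1 : GLn (κ ⊕ κ))) (CL (V ^ m)) (CL V ^ m) := by
  have hr := CL_refl hV hS
  have hm := fun m => SV_zpow hV hS m
  induction m using Int.induction_on with
  | zero => rw [zpow_zero, zpow_zero, CL_one]; exact Hty.refl continuous_const fun _ _ => rfl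
  | succ i ih =>
    have h := CL_mul (hm i).1 (hm i).2 hV hS
    rw [zpow_add_one, add_comm (i : ℤ) 1, zpow_add, zpow_one]
    refine h.trans ?_
    rw [← LG_eq] at *
    exact hr.mul ih
  | pred i ih =>
    have h := CL_mul (hm (-i - 1)).1 (hm (-i - 1)).2 hV hS
    rw [← zpow_add_one, sub_add_cancel] at h
    have e : CL V ^ (-(i : ℤ) - 1) = (CL V)⁻¹ * CL V ^ (-(i : ℤ)) := by
      rw [sub_eq_neg_add, zpow_add, zpow_neg_one]
    rw [e]
    rw [← LG_eq] at *
    have h2 := hr.inv.mul (h.symm.trans ih)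
    rwa [inv_mul_cancel_left] at h2
end

/-- the retraction onto `J` -/
noncomputable def mr {N : Type*} [Fintype N] (x : Option N → I) : ℝ :=
  max ‖fun i => 2 * (x (some i) : ℝ) - 1‖ (((x none : ℝ) + 1) / 2)

theorem mr_pos {N : Type*} [Fintype N] (x : Option N → I) : 0 < mr x :=
  lt_max_of_lt_right (by have := (x none).2.1; linarith)

theorem mr_cont {N : Type*} [Fintype N] : Continuous (mr : (Option N → I) → ℝ) := by
  unfold mr; fun_prop

noncomputable def rJ {N : Type*} [Fintype N] (x : Option N → I) : Option N → I
  | none => projIcc 0 1 zero_le_one (((x none : ℝ) + 1) / mr x - 1)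
  | some i => projIcc 0 1 zero_le_one (((2 * (x (some i) : ℝ) - 1) / mr x + 1) / 2)

theorem rJ_cont {N : Type*} [Fintype N] : Continuous (rJ : (Option N → I) → Option N → I) := by
  have h := (mr_cont (N := N))
  have h0 : ∀ x : Option N → I, mr x ≠ 0 := fun x => (mr_pos x).ne'
  refine continuous_pi fun o => ?_
  cases o with
  | none =>
    refine continuous_projIcc.comp ?_
    exact ((by fun_prop : Continuous fun x : Option N → I => (x none : ℝ) + 1).div h h0).sub continuous_const
  | some i =>
    refine continuous_projIcc.comp ?_
    exact (((by fun_prop : Continuous fun x : Option N → I => 2 * (x (some i) : ℝ) - 1).div h h0).add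
      continuous_const).div_const 2

theorem rJ_mem {N : Type*} [Fintype N] (x : Option N → I) : rJ x ∈ JJ N := by
  have hp := mr_pos x
  rcases max_choice ‖fun i => 2 * (x (some i) : ℝ) - 1‖ (((x none : ℝ) + 1) / 2) with h | h
  · left
    have h' : mr x = _ := h
    obtain ⟨i, hi⟩ : ∃ i, |2 * (x (some i) : ℝ) - 1| = mr x := by
      by_contra hc
      push Not at hc
      have : ‖fun i => 2 * (x (some i) : ℝ) - 1‖ < mr x := by
        rw [pi_norm_lt_iff hp]
        intro i
        exact lt_of_le_of_ne ((norm_le_pi_norm (fun i => 2 * (x (some i) : ℝ) - 1) i).trans h'.ge) (hc i)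
      exact absurd h' this.ne'
    refine ⟨i, ?_⟩
    rcases abs_choice (2 * (x (some i) : ℝ) - 1) with h2 | h2 <;> rw [h2] at hi
    · right
      show projIcc 0 1 zero_le_one _ = _
      rw [hi, div_self hp.ne']
      exact Set.projIcc_of_right_le _ (by norm_num)
    · left
      show projIcc 0 1 zero_le_one _ = _
      rw [← neg_neg (2 * (x (some i) : ℝ) - 1), hi, neg_div, div_self hp.ne']
      exact Set.projIcc_of_le_left _ (by norm_num)
  · right
    have h' : mr x = _ := h
    show projIcc 0 1 zero_le_one _ = _
    have h3 : ((x none : ℝ) + 1) / mr x = 2 := by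
      rw [div_eq_iff hp.ne', h']; ring
    rw [h3]
    exact Set.projIcc_of_right_le _ (by norm_num)

theorem rJ_id {N : Type*} [Fintype N] {x : Option N → I} (hx : x ∈ JJ N) : rJ x = x := by
  have hu : ∀ i, ‖2 * (x (some i) : ℝ) - 1‖ ≤ 1 := fun i => by
    rw [Real.norm_eq_abs, abs_le]
    have h1 := (x (some i)).2.1
    have h2 := (x (some i)).2.2
    constructor <;> linarith
  have hm : mr x = 1 := by
    apply le_antisymm
    · exact max_le ((pi_norm_le_iff_of_nonneg zero_le_one).2 hu)
        (by have := (x none).2.2; linarith)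
    · rcases hx with ⟨i, hi⟩ | h
      · refine le_max_of_le_left (le_trans ?_ (norm_le_pi_norm (fun i => 2 * (x (some i) : ℝ) - 1) i))
        dsimp only at hi ⊢
        rcases hi with hi | hi <;> rw [hi] <;> norm_num
      · refine le_max_of_le_right ?_
        rw [h]; norm_num
  funext o
  cases o with
  | none =>
    show projIcc 0 1 zero_le_one _ = _
    rw [hm, div_one, add_sub_cancel_right]
    exact Set.projIcc_val _ _
  | some i =>
    show projIcc 0 1 zero_le_one _ = _
    rw [hm, div_one, sub_add_cancel, mul_div_cancel_left₀ _ (two_ne_zero)]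
    exact Set.projIcc_val _ _
section
variable {N : Type*} [Fintype N] [DecidableEq N] {κ : Type} [Fintype κ] [DecidableEq κ]

theorem ext_surj' {ι : Type*} [Fintype ι] [DecidableEq ι] (hN : card N ≤ 2 * card ι)
    (e : ι ↪ κ) {f : (N → I) → GLn κ} (hf : Continuous f) (hb : ∀ y ∈ boundary N, f y = 1) :
    ∃ g : (N → I) → GLn ι, Continuous g ∧ (∀ y ∈ boundary N, g y = 1) ∧
      Hty (LS N (1 : GLn κ)) f (fun y => ext e (g y)) :=
  ext_surj hN (card κ - card ι) κ
    (by have := Fintype.card_le_of_embedding e; omega) e f hf hb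

theorem ext_null' {ι : Type*} [Fintype ι] [DecidableEq ι] (hN : card N + 1 ≤ 2 * card ι)
    (e : ι ↪ κ) {g : (N → I) → GLn ι} (hg : Continuous g) (hb : ∀ y ∈ boundary N, g y = 1)
    (h : Hty (LS N (1 : GLn κ)) (fun y => ext e (g y)) (fun _ => 1)) :
    Hty (LS N (1 : GLn ι)) g (fun _ => 1) :=
  ext_null hN (card κ - card ι) κ
    (by have := Fintype.card_le_of_embedding e; omega) e g hg hb h

theorem JJ_bdry {x : Option N → I} (h : x ∈ JJ N) : x ∈ boundary (Option N) := by
  rcases h with ⟨i, hi⟩ | h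
  · exact ⟨some i, hi⟩
  · exact ⟨none, Or.inr h⟩

theorem LS_SV (x : Option N → I) : LS (Option N) (1 : GLn (κ ⊕ κ)) x ⊆ (SV N κ x : Set (GLn (κ ⊕ κ))) :=
  fun A hA => ⟨fun h => hA (JJ_bdry h), fun h => by
    rw [show A = 1 from hA ⟨none, Or.inl h⟩]; exact one_mem _⟩

theorem CL_same (hN : card N + 1 ≤ 2 * card κ) {V V' : (Option N → I) → GLn (κ ⊕ κ)}
    (hV : Continuous V) (hS : ∀ x, V x ∈ SV N κ x) (hV' : Continuous V') (hS' : ∀ x, V' x ∈ SV N κ x)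
    (h : ∀ x, x none = 0 → V x = V' x) :
    Hty (LS (Option (Option N)) (1 : GLn (κ ⊕ κ))) (CL V) (CL V') := by
  obtain ⟨w, hw, hwb, H⟩ := ext_surj' (N := Option N) (ι := κ) (by simpa using hN)
    Embedding.inl (f := V * V'⁻¹) (hV.mul hV'.inv) (by
      intro y hy
      rcases bdry_JJ hy with h1 | h1
      · simp [(hS y).1 h1, (hS' y).1 h1]
      · simp [h y h1])
  have h1 := (H.mono LS_SV).mul (Hty.refl hV' hS')
  rw [inv_mul_cancel_right] at h1
  refine (CL_hty h1).trans ?_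
  have e : CL ((fun y => ext Embedding.inl (w y)) * V') =
      fun y => eL (w (xc y)) * CL V' y * (eL (w (xc y)))⁻¹ := by
    funext y
    have h3 := CC_HB 1 (eL (w (xc y)) * eR 1) (HB_diag _ _) (vv (y (some none)))
    rw [one_mul, CC_one_left, map_one, mul_one] at h3
    show CC (eL (w (xc y)) * V' (xc y)) _ = _
    rw [CC_mul_left, h3, mul_one]; rfl
  rw [e]
  have h2 := CL_refl hV' hS'
  refine (conj_fun (V := fun y => eL (w (xc y))) h2.cont_left h2.mem_left
    ((ext_cont _).comp (hw.comp xc_cont)) ?_).symm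
  rw [hwb _ ⟨none, Or.inr rfl⟩, map_one]

theorem inv_mul_null {G : Type*} [TopologicalSpace G] [Group G] [IsTopologicalGroup G]
    {a b : (N → I) → G} (h : Hty (LS N (1 : G)) a b) : Hty (LS N (1 : G)) (a⁻¹ * b) 1 := by
  have h2 := Hty.refl h.cont_right h.mem_right
  rw [← LG_eq] at *
  have := h.inv.mul h2
  rwa [inv_mul_cancel] at this

theorem normalize {W : (Option N → I) → GLn (κ ⊕ κ)} (hW : Continuous W)
    (hb : ∀ x ∈ boundary (Option N), W x ∈ HB κ) :
    ∃ V, Continuous V ∧ (∀ x, V x ∈ SV N κ x) ∧ CL V = CL W := by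
  have hJ : ∀ x, (W (rJ x))⁻¹ ∈ HB κ := fun x => inv_mem (hb _ (JJ_bdry (rJ_mem x)))
  refine ⟨fun x => W x * (W (rJ x))⁻¹, hW.mul (hW.comp rJ_cont).inv, fun x => ⟨?_, ?_⟩, ?_⟩
  · intro h; dsimp only; rw [rJ_id h, mul_inv_cancel]
  · intro h; exact mul_mem (hb x ⟨none, Or.inl h⟩) (hJ x)
  · funext y; exact CC_HB _ _ (hJ _) _

theorem Wg_SV {G : (N → I) → GLn κ} (hG : Continuous G) (hb : ∀ y ∈ boundary N, G y = 1) :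
    Continuous (fun x : Option N → I => Wg (G fun i => x (some i)) (x none)) ∧
    ∀ x : Option N → I, Wg (G fun i => x (some i)) (x none) ∈ SV N κ x := by
  refine ⟨?_, fun x => ⟨?_, ?_⟩⟩
  · unfold Wg; fun_prop
  · rintro (h | h)
    · rw [hb _ h, Wg_one]
    · rw [h, Wg_one']
  · intro h; rw [h, Wg_zero]; exact HB_diag _ _

theorem SV_class (hN : card N + 1 ≤ 2 * card κ) {V : (Option N → I) → GLn (κ ⊕ κ)}
    (hV : Continuous V) (hS : ∀ x, V x ∈ SV N κ x) {G : (N → I) → GLn κ} (hG : Continuous G)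
    (hGb : ∀ y ∈ boundary N, G y = 1)
    (hgen : ∀ f : (N → I) → GLn κ, Continuous f → (∀ y ∈ boundary N, f y = 1) →
      ∃ m : ℤ, Hty (LS N (1 : GLn κ)) f (G ^ m)) :
    ∃ m : ℤ, Hty (LS (Option (Option N)) (1 : GLn (κ ⊕ κ))) (CL V)
      (CL (fun x : Option N → I => Wg (G fun i => x (some i)) (x none)) ^ m) := by
  have hoc : Continuous fun q : I × (N → I) => oc q.1 q.2 := continuous_pi fun o => by
    cases o with
    | none => exact continuous_fst
    | some i => exact (continuous_apply i).comp continuous_snd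
  have hoc0 : Continuous fun x : N → I => oc 0 x := hoc.comp (Continuous.prodMk_right 0)
  obtain ⟨f1, f2, hf1, hf2, hf, hf1b⟩ := HB_split (hV.comp hoc0) (fun x => (hS _).2 rfl)
  dsimp only [Function.comp] at hf hf1b
  have hb : ∀ x ∈ boundary N, f1 x = 1 ∧ f2 x = 1 := fun x hx =>
    hf1b x ((hS _).1 (Or.inl hx))
  have H1 : Hty (LS N (1 : GLn (κ ⊕ κ))) (fun x => eL (f1 x) * eR (f2 x)) (fun _ => 1) :=
    ⟨fun q => V (oc q.1 q.2), hV.comp hoc, fun z => hf z, fun z => (hS _).1 (Or.inr rfl),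
      fun t z hz => (hS _).1 (Or.inl hz)⟩
  have H2 := ext_any hf2 (fun y hy => (hb y hy).2) (Embedding.inl : κ ↪ κ ⊕ κ)
    Embedding.inr
  have H3 : Hty (LS N (1 : GLn (κ ⊕ κ))) (fun x => eL (f1 x)) (fun x => eL (f1 x)) :=
    Hty.refl ((ext_cont _).comp hf1) (fun y hy => by
      show eL (f1 y) = 1
      rw [(hb y hy).1, map_one])
  have H4 : Hty (LS N (1 : GLn (κ ⊕ κ))) (fun x => ext Embedding.inl ((f1 * f2) x))
      (fun _ => 1) := by
    refine Hty.trans ?_ H1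
    rw [← LG_eq] at H2 H3 ⊢
    have := H3.mul H2
    convert this using 1
    · funext x
      exact map_mul _ _ _
    · rfl
  have H5 := ext_null' hN _ (hf1.mul hf2) (fun y hy => by simp [hb y hy]) H4
  obtain ⟨m, H6⟩ := hgen f1 hf1 fun y hy => (hb y hy).1
  have H7 : Hty (LS N (1 : GLn κ)) f2 (G ^ (-m)) := by
    rw [← LG_eq] at H5 H6 ⊢
    have h1 := H6.inv.mul H5
    rw [inv_mul_cancel_left] at h1
    rw [zpow_neg]
    convert h1 using 1
    funext x; simp
  obtain ⟨K1, hK1, K10, K11, K1b⟩ := inv_mul_null H6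
  obtain ⟨K2, hK2, K20, K21, K2b⟩ := inv_mul_null H7
  have hY := Wg_SV hG hGb
  set Y := fun x : Option N → I => Wg (G fun i => x (some i)) (x none) with hYd
  have hYm := SV_zpow hY.1 hY.2 m
  refine ⟨m, Hty.trans ?_ (CL_zpow hY.1 hY.2 m)⟩
  set h : (Option N → I) → GLn (κ ⊕ κ) := fun x =>
    eL (K1 (x none, fun i => x (some i))) * eR (K2 (x none, fun i => x (some i))) with hh
  have hhH : ∀ x, h x ∈ HB κ := fun x => HB_diag _ _
  have e1 : CL V = CL (V * h) := by
    funext y; exact (CC_HB _ _ (hhH _) _).symm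
  rw [e1]
  have hhc : Continuous h := by
    have hs : Continuous fun x : Option N → I => (x none, fun i => x (some i)) := by fun_prop
    exact ((ext_cont _).comp (hK1.comp hs)).mul ((ext_cont _).comp (hK2.comp hs))
  refine CL_same hN (hV.mul hhc) (fun x => mul_mem (hS x) ⟨?_, fun _ => hhH x⟩) hYm.1 hYm.2 ?_
  · intro hx
    have k1 : K1 (x none, fun i => x (some i)) = 1 := by
      rcases hx with hx | hx
      · exact K1b _ _ hx
      · rw [hx, K11]; rfl
    have k2 : K2 (x none, fun i => x (some i)) = 1 := by
      rcases hx with hx | hx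
      · exact K2b _ _ hx
      · rw [hx, K21]; rfl
    simp only [hh, k1, k2, map_one, one_mul]
  · intro x hx
    have hxo : x = oc 0 (fun i => x (some i)) := by rw [← hx, oc_eta]
    rw [Pi.mul_apply, Pi.pow_apply]
    simp only [hh, hYd, hx, K10, K20, Wg_zero]
    rw [hxo, hf]
    simp only [Pi.mul_apply, Pi.inv_apply, Pi.pow_apply]
    have hc : ∀ a b c d : GLn κ, eL a * eR b * (eL c * eR d) = eL (a * c) * eR (b * d) := by
      intro a b c d
      rw [map_mul, map_mul, mul_assoc, ← mul_assoc (eR b), ← eL_eR c b]; group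
    rw [hc, (show Commute _ _ from eL_eR _ _).mul_zpow, ← map_zpow, ← map_zpow]
    simp only [oc, Option.elim_some, mul_inv_cancel_left, inv_zpow, zpow_neg]

end

theorem conj_ext {ι κ : Type*} [Fintype ι] [DecidableEq ι] [Fintype κ] [DecidableEq κ] (e : ι ↪ κ)
    {M0 : GLn ι} {M : GLn κ} (h1 : (M : Mat(κ)) * ind e = ind e * (M0 : Mat(ι)))
    (h2 : (ind e)ᵀ * (M : Mat(κ)) = (M0 : Mat(ι)) * (ind e)ᵀ) (A : GLn ι) :
    M * ext e A * M⁻¹ = ext e (M0 * A * M0⁻¹) := by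
  rw [mul_inv_eq_iff_eq_mul]
  apply Units.ext
  simp only [val_mul, coe_ext, extM_apply, mul_add, add_mul, mul_one, one_mul]
  congr 1
  have h3 : ((M0⁻¹ : GLn ι) : Mat(ι)) * (M0 : Mat(ι)) = 1 := by
    rw [← val_mul, inv_mul_cancel, val_one]
  calc _ = ((M : Mat(κ)) * ind e) * ((A : Mat(ι)) - 1) * (ind e)ᵀ := by
        simp only [Matrix.mul_assoc]
    _ = ind e * ((M0 : Mat(ι)) * ((A : Mat(ι)) - 1) * ((M0⁻¹ : GLn ι) : Mat(ι)) * (M0 : Mat(ι))) * (ind e)ᵀ := by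
        rw [h1, Matrix.mul_assoc _ _ (M0 : Mat(ι)), h3, mul_one]; simp only [Matrix.mul_assoc]
    _ = ind e * ((M0 : Mat(ι)) * ((A : Mat(ι)) - 1) * ((M0⁻¹ : GLn ι) : Mat(ι))) * ((ind e)ᵀ * (M : Mat(κ))) := by
        rw [h2]; simp only [Matrix.mul_assoc]
    _ = _ := by
        have : (M0 : Mat(ι)) * ((M0⁻¹ : GLn ι) : Mat(ι)) = 1 := by
          rw [← val_mul, mul_inv_cancel, val_one]
        rw [Matrix.mul_sub, Matrix.sub_mul, mul_one, this]
        simp only [Matrix.mul_assoc]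

section
variable {ι κ : Type*} [Fintype ι] [DecidableEq ι] [Fintype κ] [DecidableEq κ] (e : ι ↪ κ)

theorem ind_sum : ind (e.sumMap e) = fromBlocks (ind e) 0 0 (ind e) := by
  ext (i | i) (j | j) <;> simp [ind]

theorem eL_ext (g : GLn ι) : eL (ext e g) = ext (e.sumMap e) (eL g) := by
  show ext _ (ext _ _) = ext _ (ext _ _)
  rw [ext_trans, ext_trans]; rfl

theorem Wg_ext (g : GLn ι) (t : I) : Wg (ext e g) t = ext (e.sumMap e) (Wg g t) := by
  have h := conj_ext (e.sumMap e) (M0 := rot t) (M := rot t)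
    (by rw [coe_rot, coe_rot, ind_sum]; simp [fromBlocks_multiply])
    (by rw [coe_rot, coe_rot, ind_sum]; simp [fromBlocks_multiply, Matrix.fromBlocks_transpose])
    (eL g⁻¹)
  rw [Wg, Wg, eL_ext, mul_assoc, mul_assoc, ← map_inv (ext _), ← map_inv eL, ← mul_assoc (rot t), h,
    ← map_mul, map_inv eL]
  simp only [mul_assoc]

theorem CC_ext (A : GLn (ι ⊕ ι)) (v : ℂˣ) : CC (ext (e.sumMap e) A) (ds univ v) =
    ext (e.sumMap e) (CC A (ds univ v)) := by
  have h := conj_ext (e.sumMap e) (M0 := eL (ds univ v)) (M := eL (ds univ v))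
    (by rw [coe_eL, coe_eL, ind_sum, coe_ds_univ, coe_ds_univ]; simp [fromBlocks_multiply])
    (by rw [coe_eL, coe_eL, ind_sum, coe_ds_univ, coe_ds_univ]
        simp [fromBlocks_multiply, Matrix.fromBlocks_transpose]) A⁻¹
  rw [CC, CC, mul_assoc, mul_assoc, ← map_inv (ext _), ← mul_assoc (eL _), h, ← map_mul]
  simp only [mul_assoc]
end

theorem bott_gen {N : Type} [Fintype N] [DecidableEq N] {κ₀ ι : Type} [Fintype κ₀] [DecidableEq κ₀]
    [Fintype ι] [DecidableEq ι] (hN : card N ≤ 2 * card κ₀)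
    {g : (N → I) → GLn κ₀} (hg : Continuous g) (hgb : ∀ y ∈ boundary N, g y = 1)
    (hgen : ∀ f : (N → I) → GLn κ₀, Continuous f → (∀ y ∈ boundary N, f y = 1) →
      ∃ m : ℤ, Hty (LS N (1 : GLn κ₀)) f (g ^ m))
    {f : (Option (Option N) → I) → GLn ι} (hf : Continuous f)
    (hfb : ∀ y ∈ boundary (Option (Option N)), f y = 1) :
    ∃ (κ : Type) (_ : Fintype κ) (_ : DecidableEq κ) (e : κ₀ ↪ κ) (e' : ι ↪ κ ⊕ κ) (m : ℤ),
      Hty (LS (Option (Option N)) (1 : GLn (κ ⊕ κ))) (fun y => ext e' (f y))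
        ((fun y => ext (e.sumMap e) (CC (Wg (g fun i => y (some (some i))) (y none))
          (ds univ (vv (y (some none)))))) ^ m) := by
  let j : (Option N → I) × I → Option (Option N) → I := fun p o => match o with
      | none => p.1 none
      | some none => p.2
      | some (some i) => p.1 (some i)
  have hj : Continuous j := continuous_pi fun o => by
    rcases o with _ | _ | i
    · exact (continuous_apply _).comp continuous_fst
    · exact continuous_snd
    · exact (continuous_apply _).comp continuous_fst
  have hj2 : ∀ y, j (xc y, y (some none)) = y := fun y => by
    funext o; rcases o with _ | _ | i <;> rfl
  let i1 : ι ↪ ι ⊕ Option κ₀ := Embedding.inl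
  obtain ⟨κ, h1, h2, e, W, hW, hWb, H⟩ := bott_surj0 (M := Option N) (f := fun p => ext i1 (f (j p)))
    ((ext_cont _).comp (hf.comp hj)) (by
      intro p hp
      show ext i1 (f (j p)) = 1
      rw [hfb _ ?_, map_one]
      rcases hp with ⟨o, ho⟩ | hp
      · cases o with
        | none => exact ⟨none, ho⟩
        | some i => exact ⟨some (some i), ho⟩
      · exact ⟨some none, hp⟩)
  let e₀ : κ₀ ↪ κ := (Embedding.some.trans Embedding.inr).trans e
  have hc : card N + 1 ≤ 2 * card κ := by
    have := Fintype.card_le_of_embedding e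
    rw [Fintype.card_sum, Fintype.card_option] at this
    omega
  obtain ⟨V, hV, hVS, hVW⟩ := normalize hW (fun x hx => mem_HB.2 (hWb x hx))
  have hGb : ∀ y ∈ boundary N, ext e₀ (g y) = 1 := fun y hy => by rw [hgb y hy, map_one]
  obtain ⟨m, Hm⟩ := SV_class hc hV hVS (G := fun x => ext e₀ (g x)) ((ext_cont _).comp hg) hGb (by
      intro u hu hub
      obtain ⟨u', hu', hub', Hu⟩ := ext_surj' hN e₀ hu hub
      obtain ⟨m, Hm⟩ := hgen u' hu' hub'
      refine ⟨m, Hu.trans ?_⟩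
      convert Hm.ext e₀ using 1
      funext y
      exact (map_zpow _ _ _).symm)
  refine ⟨κ, h1, h2, e₀, (i1.trans e).trans Embedding.inl, m, ?_⟩
  have H2 := H.comp (S' := LS (Option (Option N)) (1 : GLn (κ ⊕ κ)))
    (fun y => (xc y, y (some none))) (xc_cont.prodMk (continuous_apply _)) (by
      intro y A hA hy
      apply hA
      obtain ⟨o, ho⟩ := hy
      rcases o with _ | _ | i
      · exact Or.inl ⟨none, ho⟩
      · exact Or.inr ho
      · exact Or.inl ⟨some i, ho⟩)
  have e1 : (fun y => CC (W (xc y)) (ds univ (vv (y (some none))))) = CL V := hVW.symm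
  simp only [hj2, ext_trans] at H2
  rw [e1] at H2
  refine H2.trans ?_
  convert Hm using 2
  funext y
  show _ = CC (Wg (ext e₀ _) _) _
  rw [Wg_ext, CC_ext]
  rfl
section
variable {N : Type} [Fintype N] [DecidableEq N] {ι κ : Type} [Fintype ι] [DecidableEq ι]
  [Fintype κ] [DecidableEq κ]

/-- Loops of shape `N` in the general linear group. -/
structure IsL {G : Type*} [TopologicalSpace G] [One G] (f : (N → I) → G) : Prop where
  c : Continuous f
  b : ∀ y ∈ boundary N, f y = 1

section TopGroup
variable {G : Type*} [TopologicalSpace G] [Group G] [IsTopologicalGroup G]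

theorem IsL.mul {f g : (N → I) → G} (hf : IsL f) (hg : IsL g) : IsL (f * g) :=
  ⟨hf.c.mul hg.c, fun y hy => by simp [hf.b y hy, hg.b y hy]⟩

theorem IsL.inv {f : (N → I) → G} (hf : IsL f) : IsL f⁻¹ :=
  ⟨hf.c.inv, fun y hy => by simp [hf.b y hy]⟩

theorem IsL.zpow {f : (N → I) → G} (hf : IsL f) (m : ℤ) : IsL (f ^ m) :=
  ⟨hf.c.zpow m, fun y hy => by simp [hf.b y hy]⟩

theorem IsL.one : IsL (1 : (N → I) → G) :=
  ⟨continuous_const, fun _ _ => rfl⟩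

theorem IsL.ext (e : ι ↪ κ) {f : (N → I) → GLn ι} (hf : IsL f) : IsL fun y => ext e (f y) :=
  ⟨(ext_cont e).comp hf.c, fun y hy => by simp [hf.b y hy]⟩

theorem Hty.isL_left {f g : (N → I) → G} (h : Hty (LS N (1 : G)) f g) : IsL f := ⟨h.cont_left, h.mem_left⟩

theorem IsL.refl {f : (N → I) → G} (h : IsL f) : Hty (LS N (1 : G)) f f := Hty.refl h.c h.b

theorem Hty.lmul {f g f' g' : (N → I) → G} (h : Hty (LS N (1 : G)) f g) (h' : Hty (LS N (1 : G)) f' g') :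
    Hty (LS N (1 : G)) (f * f') (g * g') := by
  rw [← LG_eq] at *; exact h.mul h'

theorem Hty.lzpow {f g : (N → I) → G} (h : Hty (LS N (1 : G)) f g) (m : ℤ) :
    Hty (LS N (1 : G)) (f ^ m) (g ^ m) := by
  rw [← LG_eq] at *; exact h.zpow m

theorem Hty.of_inv_mul {f g : (N → I) → G} (hf : IsL f) (h : Hty (LS N (1 : G)) (f⁻¹ * g) 1) :
    Hty (LS N (1 : G)) f g := by
  have := (hf.refl.lmul h).symm
  simpa using this

end TopGroup

/-- `π_N(GL_ι)` is generated by one loop, whose order is `d`. -/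
def Cyc (N ι : Type) [Fintype ι] [DecidableEq ι] (d : ℕ) : Prop :=
  ∃ g : (N → I) → GLn ι, IsL g ∧ (∀ f : (N → I) → GLn ι, IsL f → ∃ m : ℤ,
    Hty (LS N (1 : GLn ι)) f (g ^ m)) ∧ ∀ m : ℤ, Hty (LS N (1 : GLn ι)) (g ^ m) 1 ↔ (d : ℤ) ∣ m

/-- All loops of shape `N` in `GL_ι` are null-homotopic. -/
def Nul (N ι : Type) [Fintype ι] [DecidableEq ι] : Prop :=
  ∀ f : (N → I) → GLn ι, IsL f → Hty (LS N (1 : GLn ι)) f 1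

theorem IsL.re {N' : Type} {G : Type*} [TopologicalSpace G] [One G] (q : N ≃ N')
    {f : (N → I) → G} (h : IsL f) : IsL fun y : N' → I => f fun i => y (q i) :=
  ⟨h.c.comp (by fun_prop), fun y ⟨i, hi⟩ => h.b _ ⟨q.symm i, by simpa using hi⟩⟩

theorem Hty.re {N' : Type} {G : Type*} [TopologicalSpace G] [One G] (q : N ≃ N')
    {f g : (N → I) → G} (h : Hty (LS N (1 : G)) f g) :
    Hty (LS N' (1 : G)) (fun y => f fun i => y (q i)) (fun y => g fun i => y (q i)) :=
  h.comp (fun (y : N' → I) i => y (q i)) (by fun_prop)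
    fun y a ha ⟨i, hi⟩ => ha ⟨q.symm i, by simpa using hi⟩

theorem Nul.re {N' : Type} [Fintype N'] [DecidableEq N'] (q : N ≃ N') (h : Nul N ι) : Nul N' ι := by
  intro f hf
  have := (h _ (hf.re q.symm)).re q
  simp only [Equiv.apply_symm_apply] at this
  exact this

theorem Cyc.re {N' : Type} [Fintype N'] [DecidableEq N'] (q : N ≃ N') {d : ℕ} (h : Cyc N ι d) :
    Cyc N' ι d := by
  obtain ⟨g, hg, h1, h2⟩ := h
  refine ⟨_, hg.re q, fun f hf => ?_, fun m => ?_⟩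
  · obtain ⟨m, hm⟩ := h1 _ (hf.re q.symm)
    have := hm.re q
    simp only [Equiv.apply_symm_apply] at this
    exact ⟨m, this⟩
  · rw [← h2]
    refine ⟨fun h => ?_, fun h => h.re q⟩
    have := h.re q.symm
    simp only [Pi.pow_apply, Equiv.symm_apply_apply] at this
    exact this

theorem Cyc.ext {d : ℕ} (e : ι ↪ κ)
    (hs : ∀ f : (N → I) → GLn κ, IsL f → ∃ g : (N → I) → GLn ι, IsL g ∧
      Hty (LS N (1 : GLn κ)) f (fun y => ext e (g y)))
    (hn : ∀ g : (N → I) → GLn ι, IsL g → Hty (LS N (1 : GLn κ)) (fun y => ext e (g y)) 1 →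
      Hty (LS N (1 : GLn ι)) g 1) (h : Cyc N ι d) : Cyc N κ d := by
  obtain ⟨g, hg, h1, h2⟩ := h
  have key : ∀ m : ℤ, (fun y => BottSU.ext e (g y)) ^ m = fun y => BottSU.ext e ((g ^ m) y) := by
    intro m; ext1 y; simp
  refine ⟨_, hg.ext e, fun f hf => ?_, fun m => ?_⟩
  · obtain ⟨f', hf', hh⟩ := hs f hf
    obtain ⟨m, hm⟩ := h1 _ hf'
    exact ⟨m, key m ▸ hh.trans (hm.ext e)⟩
  · rw [← h2, key]
    refine ⟨hn _ (hg.zpow m), fun h => ?_⟩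
    have := h.ext e
    simp only [Pi.one_apply, map_one] at this
    exact this

theorem Cyc.equiv {d : ℕ} (q : ι ≃ κ) (h : Cyc N ι d) : Cyc N κ d := by
  refine h.ext q.toEmbedding (fun f hf => ⟨_, hf.ext q.symm.toEmbedding, ?_⟩) fun g hg h => ?_
  · simp only [ext_symm_apply]; exact hf.refl
  · have := h.ext q.symm.toEmbedding
    have k := ext_symm_apply q.symm
    rw [Equiv.symm_symm] at k
    simp only [Pi.one_apply, map_one, k] at this
    exact this

theorem Cyc.stab {d : ℕ} (hN : card N + 1 ≤ 2 * card ι) (e : ι ↪ κ) (h : Cyc N ι d) :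
    Cyc N κ d := by
  refine h.ext e (fun f hf => ?_) fun g hg h => ext_null' hN e hg.c hg.b h
  obtain ⟨g, a, b, c⟩ := ext_surj' (by omega) e hf.c hf.b
  exact ⟨g, ⟨a, b⟩, c⟩

theorem even_null (j : ℕ) : ∃ (N : Type) (_ : Fintype N) (_ : DecidableEq N),
    card N = 2 * j ∧ ∀ (ι : Type) [Fintype ι] [DecidableEq ι], 2 * j + 1 ≤ 2 * card ι →
      Nul N ι := by
  induction j with
  | zero =>
    refine ⟨Empty, inferInstance, inferInstance, rfl, fun ι _ _ _ f hf => ?_⟩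
    obtain ⟨γ, h, h0, h1⟩ := GLn_path (f default)
    refine Hty.symm ⟨fun p => γ p.1, by fun_prop, fun y => h0, fun y => ?_, fun t y ⟨i, _⟩ => i.elim⟩
    rw [Subsingleton.elim y default]; exact h1
  | succ j ih =>
    obtain ⟨N, _, _, hc, h⟩ := ih
    refine ⟨Option (Option N), inferInstance, inferInstance, by simp [hc]; ring, fun ι _ _ hi f hf => ?_⟩
    obtain ⟨κ, _, _, e, e', m, H⟩ := bott_gen (N := N) (κ₀ := Fin (j + 1)) (g := 1) (by simp; omega)
      continuous_const (fun _ _ => rfl) (fun f a b => ⟨0, h _ (by simp [hc]) f ⟨a, b⟩⟩) hf.c hf.b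
    refine ext_null' (by simp [hc]; omega) e' hf.c hf.b ?_
    simp only [Pi.one_apply, Wg_one, CC_one_left, map_one] at H
    convert H using 1
    ext1 y; simp

theorem Nul.fin {j n : ℕ} (h : j + 1 ≤ n) : Nul (Fin (2 * j)) (Fin n) := by
  obtain ⟨N, _, _, hc, h⟩ := even_null j
  exact (h (Fin n) (by simp; omega)).re (Fintype.equivFinOfCardEq hc)

theorem pE_mul_Cl [Nonempty N] {f g : (N → I) → GLn (Option ι)} (hf : IsL f) (hg : IsL g)
    {a b : HG[N; EE ι]} (ha : Cl (fun y => pE (f y)) a)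
    (hb : Cl (fun y => pE (g y)) b) : Cl (fun y => pE ((f * g) y)) (a * b) := by
  obtain ⟨i⟩ := ‹Nonempty N›
  have h := (eckmann_hilton (S := LG N (GLn (Option ι))) i (fun y h0 h1 c => LG_update i y h0 h1 c)
    (fun y h => LG_bot y ⟨i, h⟩) hf.c hf.b hg.c hg.b).2
  rw [LG_eq] at h
  refine Cl.hty ?_ (LS_pE h).symm
  refine (hb.conc i ha fun y => ?_).congr fun y => (conc_comp i pE g f y).symm
  rw [hf.b _ ⟨i, by simp⟩, hg.b _ ⟨i, by simp⟩]

theorem pE_ex [Nonempty N] {f : (N → I) → GLn (Option ι)} (hf : IsL f) :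
    ∃ a, Cl (fun y => pE (f y)) a :=
  Cl.exists (LS_pE hf.refl).cont_left (LS_pE hf.refl).mem_left

theorem pE_zpow_Cl [Nonempty N] {f : (N → I) → GLn (Option ι)} (hf : IsL f)
    {a : HG[N; EE ι]} (ha : Cl (fun y => pE (f y)) a) (m : ℤ) :
    Cl (fun y => pE ((f ^ m) y)) (a ^ m) := by
  choose! c hc using fun (f : (N → I) → GLn (Option ι)) (h : IsL f) => pE_ex h
  have mul : ∀ m k : ℤ, c (f ^ (m + k)) = c (f ^ m) * c (f ^ k) := fun m k => by
    have := pE_mul_Cl (hf.zpow m) (hf.zpow k) (hc _ (hf.zpow m)) (hc _ (hf.zpow k))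
    rw [← zpow_add] at this
    exact (hc _ (hf.zpow _)).unique this
  let φ : Multiplicative ℤ →* HG[N; EE ι] :=
    MonoidHom.mk' (fun m => c (f ^ m.toAdd)) fun m k => mul _ _
  have : c (f ^ m) = a ^ m := by
    have := map_zpow φ (Multiplicative.ofAdd 1) m
    simp only [φ, MonoidHom.mk'_apply, toAdd_zpow, toAdd_ofAdd, smul_eq_mul, mul_one, zpow_one] at this
    rw [this, (hc f hf).unique ha]
  exact this ▸ hc _ (hf.zpow m)

end

section
variable {N : Type} [Fintype N] [DecidableEq N] {ι : Type} [Fintype ι] [DecidableEq ι]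

/-- `π_N(GL_{ι+1})` is generated by one loop, of degree `±|ι|!` on the sphere. -/
def OddP (N ι : Type) [Fintype N] [DecidableEq N] [Nonempty N] [Fintype ι] [DecidableEq ι] : Prop :=
  ∃ g : (N → I) → GLn (Option ι), IsL g ∧ (∀ f : (N → I) → GLn (Option ι), IsL f → ∃ m : ℤ,
    Hty (LS N (1 : GLn (Option ι))) f (g ^ m)) ∧ ∀ (e : (N → ℝ) ≃L[ℝ] EE ι)
    (γ : HG[N; EE ι]), Cl (Lin e) γ → ∃ ε : ℤˣ,
      Cl (fun y => pE (g y)) (γ ^ (ε * (card ι).factorial : ℤ))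

theorem exists_lin (hN : card N = 2 * card ι + 1) :
    ∃ (e : (N → ℝ) ≃L[ℝ] EE ι) (γ : HG[N; EE ι]), Cl (Lin e) γ := by
  let e : (N → ℝ) ≃L[ℝ] EE ι := ContinuousLinearEquiv.ofFinrankEq (by
    rw [finrank_EE, Module.finrank_fintype_fun_eq_card, hN])
  refine ⟨e, Cl.exists ?_ (Lin_adm e e.continuous fun x h => by simpa using h)⟩
  unfold Lin ctr
  have := e.continuous
  fun_prop

theorem OddP.step [Nonempty N] (hN : card N = 2 * card ι + 1) (h : OddP N ι) :
    OddP (Option (Option N)) (Option ι) := by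
  obtain ⟨g, hg, h1, h2⟩ := h
  have hW := CL_refl (Wg_SV hg.c hg.b).1 (Wg_SV hg.c hg.b).2
  have hc : card (Option (Option N)) = 2 * card ι + 3 := by simp [hN]
  have hc' : card (Option (Option ι)) = card ι + 2 := by simp
  obtain ⟨γ, hγ, hγb, H⟩ := ext_surj' (by omega) em hW.cont_left hW.mem_left
  refine ⟨γ, ⟨hγ, hγb⟩, fun f hf => ?_, fun e' γ' hγ' => ?_⟩
  · obtain ⟨κ, _, _, e, e', m, K⟩ := bott_gen (by simp; omega) hg.c hg.b
      (fun f a b => h1 f ⟨a, b⟩) hf.c hf.b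
    refine ⟨m, Hty.of_inv_mul hf ?_⟩
    have hL : IsL (f⁻¹ * γ ^ m) := hf.inv.mul (IsL.zpow ⟨hγ, hγb⟩ m)
    refine ext_null' (by omega) e' hL.c hL.b ?_
    have K2 : Hty (LS (Option (Option N)) (1 : GLn (κ ⊕ κ))) (fun y => ext e' (f y))
        ((fun y => ext e' (γ y)) ^ m) := by
      refine K.trans (Hty.lzpow ?_ m)
      refine (H.ext (e.sumMap e)).trans ?_
      simp only [ext_trans]
      exact ext_any hγ hγb _ _
    convert inv_mul_null K2 using 1
    · ext1 y; simp [map_mul]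
    · rfl
  · obtain ⟨φ, hφ⟩ := exists_susp (N := N) (ι := ι)
    obtain ⟨e, c, hcl⟩ := exists_lin hN
    obtain ⟨ε, hε⟩ := h2 e c hcl
    have D := degree_step (by omega) hφ hg.c hg.b hε hγ hγb H.symm
    obtain ⟨δ, hδ⟩ : ∃ δ : ℤˣ, φ c = γ' ^ (δ : ℤ) := by
      rcases susp_gen e e' hcl hγ' (hφ _ _ hcl) with h | h
      · exact ⟨1, by simp [h]⟩
      · exact ⟨-1, by simp [h]⟩
    refine ⟨δ * ε, ?_⟩
    convert D using 1
    rw [map_zpow, hδ, ← zpow_mul, ← zpow_natCast, ← zpow_mul, Fintype.card_option, Nat.factorial_succ]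
    congr 1
    push_cast
    ring

theorem OddP.base : OddP (Option Empty) Empty := by
  obtain ⟨e, c, hcl⟩ := exists_lin (N := Option Empty) (ι := Empty) (by simp)
  let F : EE Empty × ℝ → GLn (Option Empty) := fun v => toGL (Matrix.of fun _ _ => qV v none)
  have hq : Continuous (qV : EE Empty × ℝ → Option Empty → ℂ) := by
    refine continuous_pi fun i => ?_
    rw [Subsingleton.elim i none]
    show Continuous fun v : EE Empty × ℝ => (v.2 : ℂ) + (v.1.2 : ℂ) * Complex.I
    fun_prop
  have dF : ∀ v : EE Empty × ℝ, v ≠ 0 →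
      (Matrix.of fun (_ _ : Option Empty) => qV v none).det ≠ 0 := fun v hv h => hv <| by
    rw [Matrix.det_unique] at h
    rw [← pV_qV v, pV_eq_zero]
    ext1 i
    rw [Subsingleton.elim i none]
    exact h
  have Fp : ∀ A : GLn (Option Empty), F (pE A) = A := fun A => by
    apply Units.ext
    show ((toGL _ : GLn (Option Empty)) : Mat(Option Empty)) = _
    rw [coe_toGL (dF _ (pE_ne A))]
    ext i j
    rw [Subsingleton.elim i none, Subsingleton.elim j none]
    simp [pE, qV_pV, c0_apply]
  have pF : ∀ v : EE Empty × ℝ, v ≠ 0 → pE (F v) = v := fun v hv => by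
    have : c0 (F v) = qV v := by
      ext1 i
      rw [c0_apply, Subsingleton.elim i none]
      show ((toGL _ : GLn (Option Empty)) : Mat(Option Empty)) _ _ = _
      rw [coe_toGL (dF _ hv)]; rfl
    rw [pE, this, pV_qV]
  have F1 : F (0, 1) = 1 := by rw [← pE_one, Fp]
  have FH : ∀ {u v}, Hty (RL (Option Empty) (EE Empty)) u v →
      Hty (LS (Option Empty) (1 : GLn (Option Empty))) (fun y => F (u y)) fun y => F (v y) := by
    rintro u v ⟨H, hc, h0, h1, hs⟩
    refine ⟨fun p => F (H p), ?_, fun y => congrArg F (h0 y), fun y => congrArg F (h1 y), fun t y hy => ?_⟩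
    · exact toGL_cont (continuous_matrix fun _ _ => ((continuous_apply none).comp (hq.comp hc)))
        fun p => dF _ (hs _ _).1
    · show F _ = 1
      rw [(hs t y).2 hy, F1]
  obtain ⟨u, hu, hS, rfl⟩ := rhg_surj c
  have hL := (FH (Hty.refl hu hS)).isL_left
  have hgc : Cl (fun y => pE (F (u y))) (rhg u hu hS) :=
    (Cl.of_loop hu hS).congr fun y => (pF _ (hS y).1).symm
  have pR : ∀ {f : (Option Empty → I) → GLn (Option Empty)}, IsL f →
      Continuous (fun y => pE (f y)) ∧ ∀ y, pE (f y) ∈ RL _ _ y := fun {f} hf =>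
    ⟨(LS_pE hf.refl).cont_left, pE_RL fun y hy => by rw [hf.b y hy]; exact one_mem _⟩
  refine ⟨_, hL, fun f hf => ?_, fun e' γ hγ => ?_⟩
  · obtain ⟨a, b⟩ := pR hf
    obtain ⟨m, hm⟩ := gen_class e hcl (rhg _ a b)
    refine ⟨m, ?_⟩
    obtain ⟨a', b'⟩ := pR (hL.zpow m)
    have : rhg _ a b = rhg _ a' b' :=
      hm.trans ((pE_zpow_Cl hL hgc m).unique (Cl.of_loop a' b'))
    have := FH ((rhg_eq_iff a b a' b').1 this)
    simp only [Fp] at this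
    exact this
  · rcases Lin_class e' e hγ hcl with h | h
    · exact ⟨1, by simpa [← h] using hgc⟩
    · exact ⟨-1, by simpa [← h] using hgc⟩

theorem odd_all (k : ℕ) : ∃ (N ι : Type) (_ : Fintype N) (_ : DecidableEq N) (_ : Fintype ι)
    (_ : DecidableEq ι), card N = 2 * k ∧ card ι = k ∧ OddP (Option N) ι := by
  induction k with
  | zero => exact ⟨Empty, Empty, inferInstance, inferInstance, inferInstance, inferInstance, rfl, rfl,
      OddP.base⟩
  | succ k ih =>
    obtain ⟨N, ι, _, _, _, _, h1, h2, h⟩ := ih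
    exact ⟨Option (Option N), Option ι, inferInstance, inferInstance, inferInstance, inferInstance,
      by simp [h1]; ring, by simp [h2], h.step (by simp [h1, h2])⟩

theorem OddP.order [Nonempty N] (hN : card N = 2 * card ι + 1) (h : OddP N ι) :
    Cyc N (Option ι) 0 := by
  obtain ⟨g, hg, h1, h2⟩ := h
  obtain ⟨e, c, hcl⟩ := exists_lin hN
  obtain ⟨ε, hε⟩ := h2 e c hcl
  refine ⟨g, hg, h1, fun m => ⟨fun H => ?_, fun H => ?_⟩⟩
  · have k := (pE_zpow_Cl hg hε m).hty (LS_pE H)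
    have k0 := pE_zpow_Cl hg hε 0
    simp only [zpow_zero] at k0
    have := k.unique k0
    rw [← zpow_mul] at this
    have := gen_order e hcl this
    simp only [mul_eq_zero, Units.ne_zero, false_or, Nat.cast_eq_zero, Nat.factorial_ne_zero] at this
    simp [this]
  · rw [Nat.cast_zero, zero_dvd_iff] at H
    rw [H, zpow_zero]
    exact IsL.one.refl

theorem cyc_odd {i n : ℕ} (h1 : 1 ≤ i) (h : i ≤ n) : Cyc (Fin (2 * i - 1)) (Fin n) 0 := by
  obtain ⟨k, rfl⟩ : ∃ k, i = k + 1 := ⟨i - 1, by omega⟩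
  obtain ⟨N, ι, _, _, _, _, h1, h2, H⟩ := odd_all k
  have hN : card (Option N) = 2 * (k + 1) - 1 := by simp [h1]; omega
  obtain ⟨e⟩ : Nonempty (Option ι ↪ Fin n) :=
    Embedding.nonempty_of_card_le (by simp [h2]; omega)
  exact ((H.order (by simp [h1, h2])).stab (by simp [h1, h2]; omega) e).re
    (Fintype.equivFinOfCardEq hN)

theorem cyc_even {n : ℕ} (hn : 1 ≤ n) : Cyc (Fin (2 * n)) (Fin n) n.factorial := by
  obtain ⟨N, ι, _, _, _, _, h1, h2, g, hg, g1, g2⟩ := odd_all n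
  haveI : Nonempty N := Fintype.card_pos_iff.1 (by omega)
  obtain ⟨e, c, hcl⟩ := exists_lin (N := Option N) (ι := ι) (by simp [h1, h2])
  obtain ⟨ε, hε⟩ := g2 e c hcl
  obtain ⟨N', _, _, hc, hnul⟩ := even_null n
  have hnul' : Nul N (Option ι) :=
    (hnul (Option ι) (by simp [h2])).re (Fintype.equivOfCardEq (hc.trans h1.symm))
  obtain ⟨f, hf, hfb, f1, f2⟩ := pi_even e hcl fun g hg hb =>
    hnul' _ (IsL.ext Embedding.some ⟨hg, hb⟩)
  have C : Cyc N ι n.factorial := by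
    refine ⟨f, ⟨hf, hfb⟩, fun u hu => f1 u hu.c hu.b, fun m => (f2 m).trans ?_⟩
    constructor
    · rintro ⟨L, hL, hLb, hLc⟩
      obtain ⟨k, hk⟩ := g1 L ⟨hL, hLb⟩
      have := (pE_zpow_Cl hg hε k).unique (hLc.hty (LS_pE hk))
      rw [← zpow_mul, ← mul_inv_eq_one, ← zpow_neg, ← zpow_add] at this
      have := gen_order e hcl this
      rw [h2] at this
      exact ⟨ε * k, by linear_combination -this⟩
    · rintro ⟨k, rfl⟩
      refine ⟨g ^ (ε * k : ℤ), (hg.zpow _).c, (hg.zpow _).b, ?_⟩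
      convert pE_zpow_Cl hg hε (ε * k) using 1
      rw [← zpow_mul, h2]
      congr 1
      have : (ε : ℤ) * ε = 1 := by rw [← val_mul, Int.units_mul_self]; rfl
      linear_combination -(n.factorial * k : ℤ) * this
  exact (C.re (Fintype.equivFinOfCardEq h1)).equiv (Fintype.equivFinOfCardEq h2)

end

section
variable {N : Type} [Fintype N] [DecidableEq N] {n : ℕ} [NeZero n]

theorem det_cont : Continuous (GeneralLinearGroup.det : GLn (Fin n) → ℂˣ) := by
  refine Units.continuous_iff.2 ⟨?_, ?_⟩
  · exact Continuous.matrix_det continuous_val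
  · exact Continuous.matrix_det Units.continuous_coe_inv

theorem IsL.incl {f : (N → I) → SU n} (hf : IsL f) : IsL fun y => inclSU n (f y) :=
  ⟨(inclSU_cont n).comp hf.c, fun y hy => by simp [hf.b y hy]⟩

theorem Hty.incl {f g : (N → I) → SU n} (h : Hty (LS N (1 : SU n)) f g) :
    Hty (LS N (1 : GLn (Fin n))) (fun y => inclSU n (f y)) (fun y => inclSU n (g y)) := by
  refine h.post (fun _ => inclSU n) ((inclSU_cont n).comp continuous_snd) fun y a ha hy => ?_
  rw [ha hy, map_one]

theorem SU_null {f : (N → I) → SU n}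
    (h : Hty (LS N (1 : GLn (Fin n))) (fun y => inclSU n (f y)) 1) : Hty (LS N (1 : SU n)) f 1 := by
  refine SU_hty (g := 1) ?_
  simp only [Pi.one_apply, map_one]
  exact h

theorem Nul.SU (h : Nul N (Fin n)) : Subsingleton (HomotopyGroup N (SU n) 1) :=
  subsingleton_hg fun f hf hb => SU_null (h _ (IsL.incl ⟨hf, hb⟩))

theorem Cyc.SU [Nontrivial N] {d : ℕ} (h : Cyc N (Fin n) d) :
    Nonempty (HomotopyGroup N (SU n) 1 ≃* Multiplicative (ZMod d)) := by
  obtain ⟨g, hg, h1, h2⟩ := h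
  obtain ⟨u, hu, hub, H⟩ := SU_lift hg.c hg.b
    (pi_units_C (det_cont.comp hg.c) fun y hy => by simp [hg.b y hy])
  have key : ∀ m : ℤ, Hty (LS N (1 : GLn (Fin n))) (g ^ m) (fun y => inclSU n ((u ^ m) y)) := by
    intro m
    convert H.lzpow m using 1
    ext1 y; simp
  refine mulEquiv_zmod d u hu hub (fun f hf hb => ?_) fun m => ?_
  · obtain ⟨m, hm⟩ := h1 _ (IsL.incl ⟨hf, hb⟩)
    exact ⟨m, SU_hty (hm.trans (key m))⟩
  · rw [← h2]
    refine ⟨fun h => (key m).trans ?_, fun h => SU_null ((key m).symm.trans h)⟩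
    have := h.incl
    simp only [Pi.one_apply, map_one] at this
    exact this

theorem pi_one_SU : Subsingleton (HomotopyGroup (Fin 1) (SU n) 1) := by
  refine subsingleton_hg fun f hf hb => SU_null ?_
  have hL := IsL.incl ⟨hf, hb⟩
  let e : Fin 1 ↪ Fin n := ⟨fun _ => 0, fun i j _ => Subsingleton.elim i j⟩
  obtain ⟨g, hg, hgb, H⟩ := ext_surj' (by simp) e hL.c hL.b
  refine H.trans ?_
  have K := H.post (S' := LS (Fin 1) (1 : GLn (Fin n)))
    (fun _ A => dl 0 (GeneralLinearGroup.det A)) ((dl_cont 0).comp (det_cont.comp continuous_snd))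
    fun y a ha hy => by rw [ha hy, map_one, map_one]
  have k1 : ∀ A : SU n, GeneralLinearGroup.det (inclSU n A) = 1 := fun A =>
    Units.ext (inclSU_det A)
  have k2 : ∀ A : GLn (Fin 1), dl 0 (GeneralLinearGroup.det A) = A := fun A => by
    ext i j
    rw [Subsingleton.elim i 0, Subsingleton.elim j 0, coe_dl]
    simp
  simp only [k1, map_one, det_ext] at K
  refine Hty.symm ?_
  convert K using 1
  · rfl
  ext1 y
  rw [← show e 0 = 0 from rfl, ← ext_dl, k2]

end

end BottSU

/-- **Theorem (Bott).** For `n ≥ 2` the homotopy groups of `SU(n)` satisfy: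
`π_k` is trivial for `k = 0, 1, 2`; `π_{2i-1} ≅ ℤ` for `2 ≤ i ≤ n`;
`π_{2i}` is trivial for `2 ≤ i ≤ n - 1`; and `π_{2n} ≅ ℤ/n!ℤ`. -/
theorem homotopyGroups_SU (n : ℕ) (hn : 2 ≤ n) :
    Subsingleton (HomotopyGroup (Fin 0) (SU n) 1) ∧
    Subsingleton (HomotopyGroup (Fin 1) (SU n) 1) ∧
    Subsingleton (HomotopyGroup (Fin 2) (SU n) 1) ∧
    (∀ i : ℕ, ∀ _hi : 2 ≤ i, ∀ _hin : i ≤ n,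
      haveI : Nonempty (Fin (2 * i - 1)) := ⟨⟨0, by omega⟩⟩
      Nonempty (HomotopyGroup (Fin (2 * i - 1)) (SU n) 1 ≃* Multiplicative ℤ)) ∧
    (∀ i : ℕ, 2 ≤ i → i ≤ n - 1 →
      Subsingleton (HomotopyGroup (Fin (2 * i)) (SU n) 1)) ∧
    (haveI : Nonempty (Fin (2 * n)) := ⟨⟨0, by omega⟩⟩
     Nonempty (HomotopyGroup (Fin (2 * n)) (SU n) 1
        ≃* Multiplicative (ZMod n.factorial))) := by
  haveI : NeZero n := ⟨by omega⟩
  refine ⟨(BottSU.Nul.fin (j := 0) (by omega)).SU, BottSU.pi_one_SU,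
    (BottSU.Nul.fin (j := 1) (by omega)).SU, fun i hi hin => ?_,
    fun i hi hin => (BottSU.Nul.fin (by omega)).SU, ?_⟩
  · haveI : Nontrivial (Fin (2 * i - 1)) := Fin.nontrivial_iff_two_le.2 (by omega)
    exact (BottSU.cyc_odd (by omega) hin).SU
  · haveI : Nontrivial (Fin (2 * n)) := Fin.nontrivial_iff_two_le.2 (by omega)
    exact (BottSU.cyc_even (by omega)).SU
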